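/- Let α∈ℤ∖{0,1} and let 1<p₁,p₂≤∞ and 2/3<p₃<∞ satisfy 1/p₁+1/p₂=1/p₃. There exists a constant C=C(α,p₁,p₂)>0 such that for all finitely supported sequences a,b on ℤ, ‖H_α(a,b)‖_{ℓ^{p₃}(ℤ)} ≤ C‖a‖_{ℓ^{p₁}(ℤ)}‖b‖_{ℓ^{p₂}(ℤ)}. -/

import Mathlib

open MeasureTheory Complex SchwartzMap Filter
open scoped FourierTransform ENNReal NNReal Real

/-- The distribution function of an `ℝ≥0∞`-valued function. -/
noncomputable def distFn {X : Type*} [MeasurableSpace X] (μ : Measure X)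
    (f : X → ℝ≥0∞) (t : ℝ) : ℝ≥0∞ :=
  μ {x | ENNReal.ofReal t < f x}

/-- The Lorentz `L^{p,q}` quasinorm, defined via the distribution function. -/
noncomputable def lorentzNorm {X : Type*} [MeasurableSpace X] (μ : Measure X)
    (p q : ℝ≥0∞) (f : X → ℝ≥0∞) : ℝ≥0∞ :=
  if q = ∞ then ⨆ t ∈ Set.Ioi (0 : ℝ), ENNReal.ofReal t * distFn μ f t ^ (1 / p.toReal)
  else (q * ∫⁻ t in Set.Ioi (0 : ℝ),
      ENNReal.ofReal (t ^ (q.toReal - 1)) * distFn μ f t ^ (q.toReal / p.toReal)) ^ (1 / q.toReal)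

/-- The Lorentz `L^{p,q}` quasinorm of a complex-valued function. -/
noncomputable def lorentzNormC {X : Type*} [MeasurableSpace X] (μ : Measure X)
    (p q : ℝ≥0∞) (f : X → ℂ) : ℝ≥0∞ :=
  lorentzNorm μ p q fun x => (‖f x‖₊ : ℝ≥0∞)

/-- A function is locally bounded if it is bounded on every compact set. -/
def LocallyBounded (m : ℝ × ℝ → ℂ) : Prop :=
  ∀ K : Set (ℝ × ℝ), IsCompact K → ∃ C : ℝ, ∀ z ∈ K, ‖m z‖ ≤ C

/-- The bilinear multiplier operator `C_m`. -/
noncomputable def Cm (m : ℝ × ℝ → ℂ) (f g : 𝓢(ℝ, ℂ)) (x : ℝ) : ℂ :=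
  ∫ ξ : ℝ, ∫ η : ℝ, 𝓕 (f : ℝ → ℂ) ξ * 𝓕 (g : ℝ → ℂ) η * m (ξ, η) *
    Complex.exp (2 * Real.pi * Complex.I * (x : ℂ) * ((ξ : ℂ) + (η : ℂ)))

/-- The trigonometric polynomial with coefficients `a`. -/
noncomputable def trigP (a : ℤ → ℂ) (ξ : ℝ) : ℂ :=
  ∑ᶠ k : ℤ, a k * Complex.exp (-(2 * Real.pi) * Complex.I * (k : ℂ) * (ξ : ℂ))

/-- The discrete bilinear operator `D_{m̃_{t,p}}`. -/
noncomputable def Dop (m : ℝ × ℝ → ℂ) (t p : ℝ) (a b : ℤ → ℂ) (n : ℤ) : ℂ :=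
  ((t ^ (1 / p) : ℝ) : ℂ) *
    ∫ ξ in Set.Icc (-(1/2) : ℝ) (1/2), ∫ η in Set.Icc (-(1/2) : ℝ) (1/2),
      trigP a ξ * trigP b η * m (t * ξ, t * η) *
        Complex.exp (2 * Real.pi * Complex.I * (n : ℂ) * ((ξ : ℂ) + (η : ℂ)))

/-- `InER R f` : `f` is (a representative of) a tempered distribution of exponential type,
i.e. a continuous function of polynomial growth whose distributional Fourier transform is
supported in `[-R, R]`. -/
def InER (R : ℝ) (f : ℝ → ℂ) : Prop :=
  Continuous f ∧ (∃ (C : ℝ) (k : ℕ), ∀ x : ℝ, ‖f x‖ ≤ C * (1 + |x|) ^ k) ∧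
  ∀ φ : 𝓢(ℝ, ℂ), Disjoint (tsupport (φ : ℝ → ℂ)) (Set.Icc (-R) R) →
    ∫ x : ℝ, f x * 𝓕 (φ : ℝ → ℂ) x = 0

/-- The discrete bilinear Hilbert transform. -/
noncomputable def bhtZ (α : ℤ) (a b : ℤ → ℂ) (n : ℤ) : ℂ :=
  ((Real.pi : ℂ))⁻¹ * ∑ᶠ (k : ℤ) (_ : k ≠ 0), a (n - k) * b (n - α * k) * (k : ℂ)⁻¹

/-- `sinc x = sin (π x) / (π x)`, with `sinc 0 = 1`. -/
noncomputable def mySinc (x : ℝ) : ℝ :=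
  if x = 0 then 1 else Real.sin (Real.pi * x) / (Real.pi * x)


namespace BHT

/-- A tile: scale, position, frequency label. -/
abbrev Tile := ℕ × ℤ × ℤ

/-- normalized distance from a tile -/
noncomputable def del (P : Tile) (x : ℤ) : ℝ := 1 + |(x : ℝ) / 2 ^ P.1 - P.2.1|

/-- x lies in the triple of the r-th ancestor of the interval of P -/
def near (P : Tile) (r : ℕ) (x : ℤ) : Prop := |x / 2 ^ (P.1 + r) - P.2.1 / 2 ^ r| ≤ 1

instance (P : Tile) (r : ℕ) (x : ℤ) : Decidable (near P r x) := by unfold near; infer_instance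

lemma one_le_del (P : Tile) (x : ℤ) : 1 ≤ del P x := by
  unfold del; linarith [abs_nonneg ((x : ℝ) / 2 ^ P.1 - P.2.1)]

lemma del_pos (P : Tile) (x : ℤ) : 0 < del P x := lt_of_lt_of_le one_pos (one_le_del P x)

lemma Zbasic : ∃ C : ℝ, 1 ≤ C ∧ ∀ (X : Finset ℤ) (y : ℝ),
    ∑ x ∈ X, ((1 + |(x : ℝ) - y|) ^ 2)⁻¹ ≤ C := by
  have hs : Summable (fun z : ℤ => ((1 + |(z : ℝ)|) ^ 2)⁻¹) := by
    have h1 : Summable (fun n : ℕ => ((1 + (n : ℝ)) ^ 2)⁻¹) := by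
      have := (summable_nat_add_iff 1).2 (Real.summable_nat_pow_inv.2 (by norm_num : 1 < 2))
      refine this.congr (fun n => ?_)
      push_cast; ring_nf
    refine Summable.of_nat_of_neg (h1.congr fun n => ?_) (h1.congr fun n => ?_)
    · simp
    · simp
  refine ⟨1 + 4 * ∑' z : ℤ, ((1 + |(z : ℝ)|) ^ 2)⁻¹, ?_, ?_⟩
  · have : 0 ≤ ∑' z : ℤ, ((1 + |(z : ℝ)|) ^ 2)⁻¹ := tsum_nonneg fun z => by positivity
    linarith
  · intro X y
    have h2 : ∀ x : ℤ, ((1 + |(x : ℝ) - y|) ^ 2)⁻¹ ≤ 4 * ((1 + |((x - ⌊y⌋ : ℤ) : ℝ)|) ^ 2)⁻¹ := by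
      intro x
      have h3 : 1 + |((x - ⌊y⌋ : ℤ) : ℝ)| ≤ 2 * (1 + |(x : ℝ) - y|) := by
        have h4 : |((x - ⌊y⌋ : ℤ) : ℝ)| ≤ |(x : ℝ) - y| + 1 := by
          have h5 : ((x - ⌊y⌋ : ℤ) : ℝ) = ((x : ℝ) - y) + (y - ⌊y⌋) := by push_cast; ring
          rw [h5]
          refine (abs_add_le _ _).trans ?_
          have : |y - ⌊y⌋| ≤ 1 := by
            rw [abs_of_nonneg (by linarith [Int.floor_le y])]; linarith [Int.lt_floor_add_one y]
          linarith
        linarith [abs_nonneg ((x : ℝ) - y)]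
      have : (4 : ℝ) * ((1 + |((x - ⌊y⌋ : ℤ) : ℝ)|) ^ 2)⁻¹ = (((1 + |((x - ⌊y⌋ : ℤ) : ℝ)|) / 2) ^ 2)⁻¹ := by
        rw [div_pow, inv_div]; ring
      rw [this]
      gcongr
      linarith
    calc _ ≤ ∑ x ∈ X, 4 * ((1 + |((x - ⌊y⌋ : ℤ) : ℝ)|) ^ 2)⁻¹ := Finset.sum_le_sum fun x _ => h2 x
      _ = 4 * ∑ x ∈ X, ((1 + |((x - ⌊y⌋ : ℤ) : ℝ)|) ^ 2)⁻¹ := by rw [Finset.mul_sum]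
      _ = 4 * ∑ x ∈ X.map ⟨fun x => x - ⌊y⌋, fun a b h => by simpa using h⟩, ((1 + |(x : ℝ)|) ^ 2)⁻¹ := by
          rw [Finset.sum_map]; rfl
      _ ≤ 4 * ∑' z : ℤ, ((1 + |(z : ℝ)|) ^ 2)⁻¹ := by
          gcongr
          exact hs.sum_le_tsum _ (fun z _ => by positivity)
      _ ≤ _ := by linarith

/-- the dyadic interval as a finset -/
noncomputable def dyad (j : ℕ) (n : ℤ) : Finset ℤ := Finset.Ico (n * 2 ^ j) ((n + 1) * 2 ^ j)

lemma mem_dyad {j : ℕ} {n x : ℤ} : x ∈ dyad j n ↔ x / 2 ^ j = n := by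
  have h : (0 : ℤ) < 2 ^ j := by positivity
  unfold dyad
  rw [Finset.mem_Ico]
  constructor
  · rintro ⟨h1, h2⟩
    apply le_antisymm
    · exact Int.lt_add_one_iff.1 (Int.ediv_lt_of_lt_mul h h2)
    · exact (Int.le_ediv_iff_mul_le h).2 h1
  · rintro rfl
    exact ⟨Int.ediv_mul_le _ h.ne', Int.lt_ediv_add_one_mul_self x h⟩

lemma card_dyad (j : ℕ) (n : ℤ) : (dyad j n).card = 2 ^ j := by
  unfold dyad
  rw [Int.card_Ico]
  have : (n + 1) * 2 ^ j - n * 2 ^ j = ((2 ^ j : ℕ) : ℤ) := by push_cast; ring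
  rw [this, Int.toNat_natCast]

lemma ediv_bounds (x : ℤ) (j : ℕ) : ((x / 2 ^ j : ℤ) : ℝ) ≤ (x : ℝ) / 2 ^ j ∧
    (x : ℝ) / 2 ^ j < ((x / 2 ^ j : ℤ) : ℝ) + 1 := by
  have h : (0 : ℤ) < 2 ^ j := by positivity
  have h1 := Int.ediv_mul_le x h.ne'
  have h2 := Int.lt_ediv_add_one_mul_self x h
  have hr : (0 : ℝ) < 2 ^ j := by positivity
  constructor
  · rw [le_div_iff₀ hr]; exact_mod_cast h1
  · rw [div_lt_iff₀ hr]; exact_mod_cast h2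

lemma ediv_real_bounds (x : ℤ) (j r : ℕ) : ((x / 2 ^ (j + r) : ℤ) : ℝ) * 2 ^ r ≤ (x : ℝ) / 2 ^ j ∧
    (x : ℝ) / 2 ^ j < (((x / 2 ^ (j + r) : ℤ) : ℝ) + 1) * 2 ^ r := by
  obtain ⟨h1, h2⟩ := ediv_bounds x (j + r)
  have hr : (0 : ℝ) < 2 ^ r := by positivity
  have e : (x : ℝ) / 2 ^ j = (x : ℝ) / 2 ^ (j + r) * 2 ^ r := by
    rw [pow_add]; field_simp
  rw [e]
  exact ⟨by gcongr, by gcongr⟩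

lemma L1 : ∃ C : ℝ, 1 ≤ C ∧ ∀ (X : Finset ℤ) (j : ℕ) (y : ℝ),
    ∑ x ∈ X, ((1 + |(x : ℝ) / 2 ^ j - y|) ^ 2)⁻¹ ≤ C * 2 ^ j := by
  obtain ⟨C, hC, h⟩ := Zbasic
  refine ⟨4 * C, by linarith, fun X j y => ?_⟩
  have h1 : ∀ x : ℤ, ((1 + |(x : ℝ) / 2 ^ j - y|) ^ 2)⁻¹ ≤ 4 * ((1 + |((x / 2 ^ j : ℤ) : ℝ) - y|) ^ 2)⁻¹ := by
    intro x
    obtain ⟨h2, h3⟩ := ediv_bounds x j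
    have h4 : |((x / 2 ^ j : ℤ) : ℝ) - y| ≤ |(x : ℝ) / 2 ^ j - y| + 1 := by
      rw [abs_le]
      constructor
      · linarith [neg_abs_le ((x : ℝ) / 2 ^ j - y)]
      · linarith [le_abs_self ((x : ℝ) / 2 ^ j - y)]
    have : (4 : ℝ) * ((1 + |((x / 2 ^ j : ℤ) : ℝ) - y|) ^ 2)⁻¹ = (((1 + |((x / 2 ^ j : ℤ) : ℝ) - y|) / 2) ^ 2)⁻¹ := by
      rw [div_pow, inv_div]; ring
    rw [this]
    gcongr
    linarith [abs_nonneg ((x : ℝ) / 2 ^ j - y)]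
  calc _ ≤ ∑ x ∈ X, 4 * ((1 + |((x / 2 ^ j : ℤ) : ℝ) - y|) ^ 2)⁻¹ := Finset.sum_le_sum fun x _ => h1 x
    _ = ∑ n ∈ X.image (fun x : ℤ => x / (2:ℤ) ^ j), ∑ x ∈ X with x / 2 ^ j = n,
          4 * ((1 + |((x / 2 ^ j : ℤ) : ℝ) - y|) ^ 2)⁻¹ :=
        (Finset.sum_fiberwise_of_maps_to (fun x hx => Finset.mem_image_of_mem _ hx) _).symm
    _ ≤ ∑ n ∈ X.image (fun x : ℤ => x / (2:ℤ) ^ j), 2 ^ j * (4 * ((1 + |(n : ℝ) - y|) ^ 2)⁻¹) := by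
        refine Finset.sum_le_sum fun n _ => ?_
        have : ∑ x ∈ X with x / 2 ^ j = n, 4 * ((1 + |((x / 2 ^ j : ℤ) : ℝ) - y|) ^ 2)⁻¹ =
            ∑ x ∈ X with x / 2 ^ j = n, 4 * ((1 + |(n : ℝ) - y|) ^ 2)⁻¹ :=
          Finset.sum_congr rfl fun x hx => by rw [(Finset.mem_filter.1 hx).2]
        rw [this, Finset.sum_const, nsmul_eq_mul]
        gcongr
        have h6 : (X.filter (fun x => x / 2 ^ j = n)).card ≤ 2 ^ j := by
          rw [← card_dyad j n]
          exact Finset.card_le_card fun x hx => mem_dyad.2 (Finset.mem_filter.1 hx).2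
        exact_mod_cast h6
    _ = 4 * 2 ^ j * ∑ n ∈ X.image (fun x : ℤ => x / (2:ℤ) ^ j), ((1 + |(n : ℝ) - y|) ^ 2)⁻¹ := by
        rw [Finset.mul_sum]; exact Finset.sum_congr rfl fun n _ => by ring
    _ ≤ 4 * 2 ^ j * C := by gcongr; exact h _ _
    _ = _ := by ring

lemma not_near {P : Tile} {r : ℕ} {x : ℤ} (h : ¬ near P r x) :
    (2 : ℝ) ^ r ≤ |(x : ℝ) / 2 ^ P.1 - P.2.1| := by
  unfold near at h
  obtain ⟨h1, h2⟩ := ediv_real_bounds x P.1 r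
  have h3 := ediv_real_bounds P.2.1 0 r
  simp only [zero_add, pow_zero, div_one] at h3
  obtain ⟨h3, h4⟩ := h3
  set u := x / 2 ^ (P.1 + r)
  set v := P.2.1 / 2 ^ r
  have hr : (0 : ℝ) < 2 ^ r := by positivity
  rcases le_or_gt v u with hvu | hvu
  · rw [abs_of_nonneg (by omega)] at h
    have : v + 2 ≤ u := by omega
    have : (v : ℝ) + 2 ≤ u := by exact_mod_cast this
    refine le_trans ?_ (le_abs_self _)
    nlinarith
  · rw [abs_of_neg (by omega)] at h
    have : u + 2 ≤ v := by omega
    have : (u : ℝ) + 2 ≤ v := by exact_mod_cast this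
    refine le_trans ?_ (neg_le_abs _)
    nlinarith

lemma near_mono {P : Tile} {r s : ℕ} {x : ℤ} (hrs : r ≤ s) (h : near P r x) : near P s x := by
  obtain ⟨t, rfl⟩ := Nat.exists_eq_add_of_le hrs
  unfold near at *
  have e1 : x / 2 ^ (P.1 + (r + t)) = (x / 2 ^ (P.1 + r)) / 2 ^ t := by
    rw [Int.ediv_ediv_of_nonneg (by positivity), ← pow_add]; ring_nf
  have e2 : P.2.1 / 2 ^ (r + t) = (P.2.1 / 2 ^ r) / 2 ^ t := by
    rw [Int.ediv_ediv_of_nonneg (by positivity), ← pow_add]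
  rw [e1, e2]
  set u := x / 2 ^ (P.1 + r)
  set v := P.2.1 / 2 ^ r
  have hp : (0 : ℤ) < 2 ^ t := by positivity
  rw [abs_le] at *
  have a1 : v / 2 ^ t ≤ u / 2 ^ t + 1 := by
    calc v / 2 ^ t ≤ (u + 1 * 2 ^ t) / 2 ^ t := Int.ediv_le_ediv hp (by nlinarith [h.1])
      _ = _ := by rw [Int.add_mul_ediv_right _ _ hp.ne']
  have a2 : u / 2 ^ t ≤ v / 2 ^ t + 1 := by
    calc u / 2 ^ t ≤ (v + 1 * 2 ^ t) / 2 ^ t := Int.ediv_le_ediv hp (by nlinarith [h.2])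
      _ = _ := by rw [Int.add_mul_ediv_right _ _ hp.ne']
  constructor <;> linarith

lemma exists_near (P : Tile) (S : Finset ℤ) : ∃ R : ℕ, ∀ x ∈ S, near P R x := by
  induction S using Finset.induction_on with
  | empty => exact ⟨0, by simp⟩
  | insert a S ha ih =>
    obtain ⟨R, hR⟩ := ih
    obtain ⟨r, hr⟩ := pow_unbounded_of_one_lt (|(a : ℝ) / 2 ^ P.1 - P.2.1|) (by norm_num : (1 : ℝ) < 2)
    refine ⟨max R r, fun x hx => ?_⟩
    rcases Finset.mem_insert.1 hx with rfl | hx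
    · by_contra h
      have h1 : ¬ near P r x := fun h2 => h (near_mono (le_max_right _ _) h2)
      exact absurd (not_near h1) (not_le.2 hr)
    · exact near_mono (le_max_left _ _) (hR x hx)

lemma geom_half (r0 R : ℕ) (N : ℕ) (hN : 1 ≤ N) :
    ∑ r ∈ Finset.Ico r0 R, ((2 : ℝ) ^ (r * N))⁻¹ ≤ 2 * ((2 : ℝ) ^ (r0 * N))⁻¹ := by
  have key : ∀ k : ℕ, ∑ r ∈ Finset.Ico r0 (r0 + k), ((2 : ℝ) ^ (r * N))⁻¹ ≤
      2 * ((2 : ℝ) ^ (r0 * N))⁻¹ - 2 * ((2 : ℝ) ^ ((r0 + k) * N))⁻¹ := by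
    intro k
    induction k with
    | zero => simp
    | succ k ih =>
      rw [← add_assoc, Finset.sum_Ico_succ_top (by omega)]
      have h1 : ((2 : ℝ) ^ ((r0 + k + 1) * N))⁻¹ ≤ ((2 : ℝ) ^ ((r0 + k) * N))⁻¹ / 2 := by
        rw [add_mul (r0 + k) 1 N, pow_add, mul_inv, one_mul, div_eq_mul_inv]
        gcongr
        calc (2 : ℝ) = 2 ^ 1 := by norm_num
          _ ≤ 2 ^ N := pow_le_pow_right₀ (by norm_num) hN
      linarith
  rcases le_or_gt r0 R with h | h
  · obtain ⟨k, rfl⟩ := Nat.exists_eq_add_of_le h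
    have h1 := key k
    have : (0 : ℝ) ≤ ((2 : ℝ) ^ ((r0 + k) * N))⁻¹ := by positivity
    linarith
  · rw [Finset.Ico_eq_empty (by omega)]; simp

/-- Annuli lemma. -/
lemma L2 (N : ℕ) (hN : 2 ≤ N) (P : Tile) (S : Finset ℤ) (lam : ℝ) (hlam : 0 ≤ lam)
    (hS : ∀ r, ((S.filter (near P r)).card : ℝ) ≤ lam * 2 ^ (P.1 + r)) (r0 : ℕ)
    (hr0 : ∀ x ∈ S, ∀ r < r0, ¬ near P r x) :
    ∑ x ∈ S, (del P x ^ N)⁻¹ ≤ 2 ^ (N + 1) * lam * 2 ^ P.1 * ((2 : ℝ) ^ (r0 * (N - 1)))⁻¹ := by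
  obtain ⟨R, hR⟩ := exists_near P S
  have h1 : ∀ x ∈ S, (del P x ^ N)⁻¹ ≤ ∑ r ∈ Finset.Ico r0 (R + 1),
      if near P r x then 2 ^ N * ((2 : ℝ) ^ (r * N))⁻¹ else 0 := by
    intro x hx
    have hex : ∃ r, near P r x := ⟨R, hR x hx⟩
    classical
    set r := Nat.find hex with hr
    have hnr : near P r x := Nat.find_spec hex
    have hrR : r ≤ R := Nat.find_min' hex (hR x hx)
    have hr0' : r0 ≤ r := by
      by_contra hc
      exact hr0 x hx r (not_le.1 hc) hnr
    have h2 : (del P x ^ N)⁻¹ ≤ 2 ^ N * ((2 : ℝ) ^ (r * N))⁻¹ := by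
      rcases Nat.eq_zero_or_pos r with h0 | h0
      · rw [h0]
        have : (1 : ℝ) ≤ 2 ^ N := one_le_pow₀ (by norm_num)
        have h3 : (del P x ^ N)⁻¹ ≤ 1 := inv_le_one_of_one_le₀ (one_le_pow₀ (one_le_del P x))
        simp only [zero_mul, pow_zero, inv_one, mul_one]; linarith
      · have h3 : ¬ near P (r - 1) x := Nat.find_min hex (by omega)
        have h4 := not_near h3
        have h5 : (2 : ℝ) ^ r / 2 ≤ del P x := by
          unfold del
          have : (2 : ℝ) ^ r = 2 ^ (r - 1) * 2 := by rw [← pow_succ]; congr 1; omega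
          rw [this]; linarith
        calc (del P x ^ N)⁻¹ ≤ (((2 : ℝ) ^ r / 2) ^ N)⁻¹ := by gcongr
          _ = _ := by rw [div_pow, inv_div, pow_mul, div_eq_mul_inv]
    refine h2.trans ?_
    have := Finset.single_le_sum (f := fun r => if near P r x then 2 ^ N * ((2 : ℝ) ^ (r * N))⁻¹ else 0)
      (fun i _ => by positivity) (Finset.mem_Ico.2 ⟨hr0', by omega⟩ : r ∈ Finset.Ico r0 (R + 1))
    simpa [hnr] using this
  calc _ ≤ ∑ x ∈ S, ∑ r ∈ Finset.Ico r0 (R + 1),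
      (if near P r x then 2 ^ N * ((2 : ℝ) ^ (r * N))⁻¹ else 0) := Finset.sum_le_sum h1
    _ = ∑ r ∈ Finset.Ico r0 (R + 1), ∑ x ∈ S,
      (if near P r x then 2 ^ N * ((2 : ℝ) ^ (r * N))⁻¹ else 0) := Finset.sum_comm
    _ ≤ ∑ r ∈ Finset.Ico r0 (R + 1), (2 ^ N * lam * 2 ^ P.1) * ((2 : ℝ) ^ (r * (N - 1)))⁻¹ := by
      refine Finset.sum_le_sum fun r _ => ?_
      rw [← Finset.sum_filter, Finset.sum_const, nsmul_eq_mul]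
      calc _ ≤ lam * 2 ^ (P.1 + r) * (2 ^ N * ((2 : ℝ) ^ (r * N))⁻¹) := by gcongr; exact hS r
        _ = _ := by
          have : (2 : ℝ) ^ (r * N) = 2 ^ (r * (N - 1)) * 2 ^ r := by
            rw [← pow_add]; congr 1
            obtain ⟨k, rfl⟩ : ∃ k, N = k + 1 := ⟨N - 1, by omega⟩
            simp; ring
          rw [this, mul_inv, pow_add]
          field_simp
    _ = (2 ^ N * lam * 2 ^ P.1) * ∑ r ∈ Finset.Ico r0 (R + 1), ((2 : ℝ) ^ (r * (N - 1)))⁻¹ := by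
      rw [Finset.mul_sum]
    _ ≤ (2 ^ N * lam * 2 ^ P.1) * (2 * ((2 : ℝ) ^ (r0 * (N - 1)))⁻¹) := by
      gcongr; exact geom_half _ _ _ (by omega)
    _ = _ := by rw [pow_succ]; ring

end BHT

namespace BHT

/-- the Hilbert space of square summable sequences -/
noncomputable abbrev H := lp (fun _ : ℤ => ℂ) 2

/-- character -/
noncomputable def ee (x : ℝ) : ℂ := Complex.exp ((2 * π * x : ℝ) * I)

lemma norm_ee (x : ℝ) : ‖ee x‖ = 1 := Complex.norm_exp_ofReal_mul_I _

lemma ee_add (x y : ℝ) : ee (x + y) = ee x * ee y := by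
  unfold ee; rw [← Complex.exp_add]; congr 1; push_cast; ring

lemma ee_zero : ee 0 = 1 := by simp [ee]

lemma norm_ee_sub_one (x : ℝ) : ‖ee x - 1‖ ≤ 2 * π * |x| := by
  unfold ee
  have := Real.norm_exp_I_mul_ofReal_sub_one_le (x := 2 * π * x)
  rw [mul_comm I] at this
  refine this.trans ?_
  rw [Real.norm_eq_abs, abs_mul, abs_of_pos (by positivity)]

/-- packet conditions -/
structure Pk (N : ℕ) (φ : Tile → H) (l : Tile → ℝ) (T : Finset Tile) : Prop where
  bd : ∀ P ∈ T, ∀ x : ℤ, ‖φ P x‖ ≤ ((2 : ℝ) ^ P.1)⁻¹ * (del P x ^ N)⁻¹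
  df : ∀ P ∈ T, ∀ x : ℤ, ‖φ P (x + 1) * ee (-(l P / 2 ^ P.1 * (x + 1 : ℤ))) -
    φ P x * ee (-(l P / 2 ^ P.1 * x))‖ ≤ ((2 : ℝ) ^ P.1)⁻¹ * ((2 : ℝ) ^ P.1)⁻¹ * (del P x ^ N)⁻¹
  orth : ∀ P ∈ T, ∀ Q ∈ T, ((2 : ℝ) ^ P.1)⁻¹ + ((2 : ℝ) ^ Q.1)⁻¹ < |l P / 2 ^ P.1 - l Q / 2 ^ Q.1| →
    inner ℂ (φ P) (φ Q) = 0

lemma Pk.mono {N : ℕ} {φ : Tile → H} {l : Tile → ℝ} {T T' : Finset Tile} (h : Pk N φ l T)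
    (hT : T' ⊆ T) : Pk N φ l T' :=
  ⟨fun P hP => h.bd P (hT hP), fun P hP => h.df P (hT hP), fun P hP Q hQ => h.orth P (hT hP) Q (hT hQ)⟩

lemma norm_inner_le_of_sum {f g : H} {B : ℝ} (h : ∀ X : Finset ℤ, ∑ x ∈ X, ‖f x‖ * ‖g x‖ ≤ B) :
    ‖inner ℂ f g‖ ≤ B := by
  have h1 := Tendsto.norm (show Tendsto _ _ _ from lp.hasSum_inner (𝕜 := ℂ) f g)
  refine le_of_tendsto h1 (Eventually.of_forall fun X => ?_)
  refine (norm_sum_le _ _).trans (le_trans (Finset.sum_le_sum fun x _ => ?_) (h X))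
  exact norm_inner_le_norm _ _

lemma norm_inner_le_of_support {f g : H} {S : Finset ℤ} (h : ∀ x, ‖g x‖ ≤ if x ∈ S then 1 else 0) :
    ‖inner ℂ f g‖ ≤ ∑ x ∈ S, ‖f x‖ := by
  apply norm_inner_le_of_sum
  intro X
  calc ∑ x ∈ X, ‖f x‖ * ‖g x‖ ≤ ∑ x ∈ X, if x ∈ S then ‖f x‖ else 0 := by
        refine Finset.sum_le_sum fun x _ => ?_
        refine (mul_le_mul_of_nonneg_left (h x) (norm_nonneg _)).trans ?_
        split_ifs <;> simp
    _ = ∑ x ∈ X.filter (· ∈ S), ‖f x‖ := by rw [Finset.sum_filter]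
    _ ≤ ∑ x ∈ S, ‖f x‖ := Finset.sum_le_sum_of_subset_of_nonneg
        (fun x hx => (Finset.mem_filter.1 hx).2) (fun _ _ _ => norm_nonneg _)

lemma norm_sq_le_card {g : H} {S : Finset ℤ} (h : ∀ x, ‖g x‖ ≤ if x ∈ S then 1 else 0) :
    ‖g‖ ^ 2 ≤ S.card := by
  have h1 : ‖inner ℂ g g‖ ≤ ∑ x ∈ S, ‖g x‖ := norm_inner_le_of_support h
  rw [inner_self_eq_norm_sq_to_K] at h1
  have h2 : ‖((‖g‖ : ℂ)) ^ 2‖ = ‖g‖ ^ 2 := by simp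
  have h3 : ‖g‖ ^ 2 ≤ ∑ x ∈ S, ‖g x‖ := by rw [← h2]; exact h1
  refine h3.trans ?_
  calc ∑ x ∈ S, ‖g x‖ ≤ ∑ x ∈ S, (1 : ℝ) := Finset.sum_le_sum fun x hx => by
        have := h x; simpa [hx] using this
    _ = _ := by simp

lemma sum_norm_sq_le (g : H) (X : Finset ℤ) : ∑ x ∈ X, ‖g x‖ ^ 2 ≤ ‖g‖ ^ 2 := by
  have := lp.sum_rpow_le_norm_rpow (p := 2) (by norm_num) g X
  simpa using this

lemma sum_norm_le (g : H) (X : Finset ℤ) : ∑ x ∈ X, ‖g x‖ ≤ Real.sqrt X.card * ‖g‖ := by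
  have h := Finset.sum_mul_sq_le_sq_mul_sq X (fun _ => (1 : ℝ)) (fun x => ‖g x‖)
  simp only [one_mul, one_pow, Finset.sum_const, nsmul_eq_mul, mul_one] at h
  have h2 := h.trans (mul_le_mul_of_nonneg_left (sum_norm_sq_le g X) (Nat.cast_nonneg _))
  have h3 : (X.card : ℝ) * ‖g‖ ^ 2 = (Real.sqrt X.card * ‖g‖) ^ 2 := by
    rw [mul_pow, Real.sq_sqrt (Nat.cast_nonneg _)]
  rw [h3] at h2
  exact le_of_sq_le_sq h2 (by positivity)

/-- coefficient square sum -/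
noncomputable def SS (φ : Tile → H) (f : H) (T : Finset Tile) : ℝ :=
  ∑ P ∈ T, 2 ^ P.1 * ‖inner ℂ (φ P) f‖ ^ 2

/-- the synthesized function -/
noncomputable def GG (φ : Tile → H) (f : H) (T : Finset Tile) : H :=
  ∑ P ∈ T, ((2 : ℂ) ^ P.1 * inner ℂ (φ P) f) • φ P

/-- the double sum of interactions -/
noncomputable def BB (φ : Tile → H) (f : H) (T : Finset Tile) : ℝ :=
  ∑ P ∈ T, ∑ Q ∈ T, ‖inner ℂ (φ P) f‖ * ‖inner ℂ (φ Q) f‖ * (2 ^ P.1 * 2 ^ Q.1 * ‖inner ℂ (φ P) (φ Q)‖)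

lemma SS_nonneg (φ : Tile → H) (f : H) (T : Finset Tile) : 0 ≤ SS φ f T :=
  Finset.sum_nonneg fun _ _ => by positivity

lemma SS_eq (φ : Tile → H) (f : H) (T : Finset Tile) : SS φ f T = ‖inner ℂ (GG φ f T) f‖ := by
  have h : inner ℂ (GG φ f T) f = ((SS φ f T : ℝ) : ℂ) := by
    unfold GG SS
    rw [sum_inner, Complex.ofReal_sum]
    refine Finset.sum_congr rfl fun P _ => ?_
    rw [inner_smul_left]
    push_cast
    rw [map_mul, mul_assoc, Complex.conj_mul', map_pow, show (starRingEnd ℂ) 2 = 2 from Complex.conj_ofNat 2]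
  rw [h, Complex.norm_real, Real.norm_of_nonneg (SS_nonneg _ _ _)]

lemma GG_norm (φ : Tile → H) (f : H) (T : Finset Tile) : ‖GG φ f T‖ ^ 2 ≤ BB φ f T := by
  have h1 : ‖inner ℂ (GG φ f T) (GG φ f T)‖ = ‖GG φ f T‖ ^ 2 := by
    rw [inner_self_eq_norm_sq_to_K]; simp
  rw [← h1]
  unfold GG BB
  rw [sum_inner]
  refine (norm_sum_le _ _).trans (Finset.sum_le_sum fun P _ => ?_)
  rw [inner_sum]
  refine (norm_sum_le _ _).trans (Finset.sum_le_sum fun Q _ => ?_)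
  rw [inner_smul_left, inner_smul_right]
  simp only [norm_mul, RCLike.norm_conj, norm_pow]
  apply le_of_eq
  simp
  ring

lemma bessel {φ : Tile → H} {f : H} {T : Finset Tile} {K : ℝ} (hK : 0 ≤ K) (hB : BB φ f T ≤ K * SS φ f T) :
    SS φ f T ≤ K * ‖f‖ ^ 2 := by
  have h0 := SS_nonneg φ f T
  rcases h0.eq_or_lt with h | h
  · rw [← h]; positivity
  · have h1 := (GG_norm φ f T).trans hB
    have h2 : SS φ f T ≤ ‖GG φ f T‖ * ‖f‖ := by
      conv_lhs => rw [SS_eq]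
      exact norm_inner_le_norm _ _
    have h3 : SS φ f T ^ 2 ≤ (K * SS φ f T) * ‖f‖ ^ 2 := by
      calc SS φ f T ^ 2 ≤ (‖GG φ f T‖ * ‖f‖) ^ 2 := by gcongr
        _ = ‖GG φ f T‖ ^ 2 * ‖f‖ ^ 2 := by ring
        _ ≤ _ := by gcongr
    nlinarith

lemma IP : ∃ K : ℝ, 1 ≤ K ∧ ∀ (N : ℕ) (_ : 6 ≤ N) (φ : Tile → H) (l : Tile → ℝ) (T : Finset Tile)
    (_ : Pk N φ l T), ∀ P ∈ T, ∀ Q ∈ T, Q.1 ≤ P.1 →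
    2 ^ P.1 * 2 ^ Q.1 * ‖inner ℂ (φ P) (φ Q)‖ ≤ K * ∑ x ∈ dyad Q.1 Q.2.1, (del P x ^ 4)⁻¹ := by
  obtain ⟨C, hC1, hC⟩ := L1
  refine ⟨C * 16, by linarith, fun N hN φ l T h P hP Q hQ hPQ => ?_⟩
  set c : ℤ := Q.2.1 * 2 ^ Q.1 with hc
  have h2P : (0 : ℝ) < 2 ^ P.1 := by positivity
  have h2Q : (0 : ℝ) < 2 ^ Q.1 := by positivity
  have hle : (2 : ℝ) ^ Q.1 ≤ 2 ^ P.1 := pow_le_pow_right₀ (by norm_num) hPQ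
  have hdel : ∀ x, del P c ≤ del P x * del Q x := by
    intro x
    unfold del
    have h1 : |((c : ℤ) : ℝ) / 2 ^ P.1 - P.2.1| ≤ |(x : ℝ) / 2 ^ P.1 - P.2.1| + |(x : ℝ) / 2 ^ Q.1 - Q.2.1| := by
      have e1 : ((c : ℤ) : ℝ) / 2 ^ P.1 - P.2.1 = ((x : ℝ) / 2 ^ P.1 - P.2.1) - ((x : ℝ) / 2 ^ Q.1 - Q.2.1) * (2 ^ Q.1 / 2 ^ P.1) := by
        rw [hc]; push_cast; field_simp; ring
      rw [e1]
      rw [sub_eq_add_neg _ (((x : ℝ) / 2 ^ Q.1 - Q.2.1) * (2 ^ Q.1 / 2 ^ P.1))]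
      refine (abs_add_le _ _).trans ?_
      rw [abs_neg]
      refine add_le_add le_rfl ?_
      rw [abs_mul, abs_of_pos (by positivity : (0 : ℝ) < 2 ^ Q.1 / 2 ^ P.1)]
      exact mul_le_of_le_one_right (abs_nonneg _) ((div_le_one h2P).2 hle)
    nlinarith [abs_nonneg ((x : ℝ) / 2 ^ P.1 - P.2.1), abs_nonneg ((x : ℝ) / 2 ^ Q.1 - Q.2.1)]
  have h1 : ‖inner ℂ (φ P) (φ Q)‖ ≤ (2 ^ P.1 : ℝ)⁻¹ * C * (del P c ^ 4)⁻¹ := by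
    apply norm_inner_le_of_sum
    intro X
    calc ∑ x ∈ X, ‖φ P x‖ * ‖φ Q x‖ ≤ ∑ x ∈ X, ((2 ^ P.1 : ℝ)⁻¹ * (2 ^ Q.1 : ℝ)⁻¹ * (del P c ^ 4)⁻¹) * (del Q x ^ 2)⁻¹ := by
          refine Finset.sum_le_sum fun x _ => ?_
          calc ‖φ P x‖ * ‖φ Q x‖ ≤ ((2 ^ P.1 : ℝ)⁻¹ * (del P x ^ N)⁻¹) * ((2 ^ Q.1 : ℝ)⁻¹ * (del Q x ^ N)⁻¹) := by
                gcongr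
                · have := del_pos P x; positivity
                · exact h.bd P hP x
                · exact h.bd Q hQ x
            _ ≤ ((2 ^ P.1 : ℝ)⁻¹ * (del P x ^ 4)⁻¹) * ((2 ^ Q.1 : ℝ)⁻¹ * (del Q x ^ 6)⁻¹) := by
                have a1 := one_le_del P x
                have a2 := one_le_del Q x
                have a3 := del_pos P x
                have a4 := del_pos Q x
                gcongr <;> first | assumption | omega
            _ = ((2 ^ P.1 : ℝ)⁻¹ * (2 ^ Q.1 : ℝ)⁻¹ * ((del P x * del Q x) ^ 4)⁻¹) * (del Q x ^ 2)⁻¹ := by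
                have a3 := del_pos P x
                have a4 := del_pos Q x
                field_simp
            _ ≤ _ := by
                have a3 := del_pos P c
                gcongr
                exact hdel x
      _ = ((2 ^ P.1 : ℝ)⁻¹ * (2 ^ Q.1 : ℝ)⁻¹ * (del P c ^ 4)⁻¹) * ∑ x ∈ X, (del Q x ^ 2)⁻¹ := by rw [Finset.mul_sum]
      _ ≤ ((2 ^ P.1 : ℝ)⁻¹ * (2 ^ Q.1 : ℝ)⁻¹ * (del P c ^ 4)⁻¹) * (C * 2 ^ Q.1) := by
          have a3 := del_pos P c
          gcongr; exact hC X Q.1 Q.2.1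
      _ = _ := by field_simp
  have h3 : ∀ x ∈ dyad Q.1 Q.2.1, (del P c ^ 4)⁻¹ ≤ 16 * (del P x ^ 4)⁻¹ := by
    intro x hx
    have h4 : del P x ≤ 2 * del P c := by
      have hx' := mem_dyad.1 hx
      obtain ⟨h5, h6⟩ := ediv_bounds x Q.1
      rw [hx'] at h5 h6
      unfold del
      have e1 : (x : ℝ) / 2 ^ P.1 - P.2.1 = (((c : ℤ) : ℝ) / 2 ^ P.1 - P.2.1) + ((x : ℝ) / 2 ^ Q.1 - Q.2.1) * (2 ^ Q.1 / 2 ^ P.1) := by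
        rw [hc]; push_cast; field_simp; ring
      have e2 : |((x : ℝ) / 2 ^ Q.1 - Q.2.1) * (2 ^ Q.1 / 2 ^ P.1)| ≤ 1 := by
        rw [abs_mul, abs_of_pos (by positivity : (0 : ℝ) < 2 ^ Q.1 / 2 ^ P.1)]
        have : |(x : ℝ) / 2 ^ Q.1 - Q.2.1| ≤ 1 := by rw [abs_of_nonneg (by linarith)]; linarith
        exact mul_le_one₀ this (by positivity) ((div_le_one h2P).2 hle)
      rw [e1]
      have := abs_add_le (((c : ℤ) : ℝ) / 2 ^ P.1 - P.2.1) (((x : ℝ) / 2 ^ Q.1 - Q.2.1) * (2 ^ Q.1 / 2 ^ P.1))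
      have := abs_nonneg (((c : ℤ) : ℝ) / 2 ^ P.1 - P.2.1)
      linarith
    have a3 := del_pos P c
    have a4 := del_pos P x
    calc (del P c ^ 4)⁻¹ = 16 * ((2 * del P c) ^ 4)⁻¹ := by field_simp; norm_num
      _ ≤ _ := by gcongr
  have h4 : (2 : ℝ) ^ Q.1 * (del P c ^ 4)⁻¹ ≤ 16 * ∑ x ∈ dyad Q.1 Q.2.1, (del P x ^ 4)⁻¹ := by
    have := Finset.sum_le_sum h3
    rw [Finset.sum_const, card_dyad, nsmul_eq_mul, ← Finset.mul_sum] at this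
    exact_mod_cast this
  calc 2 ^ P.1 * 2 ^ Q.1 * ‖inner ℂ (φ P) (φ Q)‖ ≤ 2 ^ P.1 * 2 ^ Q.1 * ((2 ^ P.1 : ℝ)⁻¹ * C * (del P c ^ 4)⁻¹) := by gcongr
    _ = C * (2 ^ Q.1 * (del P c ^ 4)⁻¹) := by field_simp
    _ ≤ C * (16 * ∑ x ∈ dyad Q.1 Q.2.1, (del P x ^ 4)⁻¹) := by gcongr
    _ = _ := by ring

end BHT

namespace BHT

lemma inv_pow_del_le {P : Tile} {x : ℤ} {a b : ℕ} (h : a ≤ b) : (del P x ^ b)⁻¹ ≤ (del P x ^ a)⁻¹ := by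
  have a1 := one_le_del P x
  have a3 := del_pos P x
  gcongr

lemma diag : ∃ K : ℝ, 1 ≤ K ∧ ∀ (N : ℕ) (_ : 6 ≤ N) (φ : Tile → H) (l : Tile → ℝ) (T : Finset Tile)
    (_ : Pk N φ l T) (_ : ∀ P ∈ T, ∀ Q ∈ T, P.1 = Q.1 → inner ℂ (φ P) (φ Q) ≠ 0 → P.2.2 = Q.2.2) (f : H),
    ∑ P ∈ T, ∑ Q ∈ T with Q.1 = P.1, ‖inner ℂ (φ P) f‖ * ‖inner ℂ (φ Q) f‖ *
      (2 ^ P.1 * 2 ^ Q.1 * ‖inner ℂ (φ P) (φ Q)‖) ≤ K * SS φ f T := by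
  obtain ⟨C, hC1, hC⟩ := L1
  obtain ⟨K, hK1, hK⟩ := IP
  refine ⟨K * C, by nlinarith, fun N hN φ l T h hs f => ?_⟩
  set b : Tile → Tile → ℝ := fun P Q => 2 ^ P.1 * 2 ^ Q.1 * ‖inner ℂ (φ P) (φ Q)‖ with hb
  set a : Tile → ℝ := fun P => ‖inner ℂ (φ P) f‖ with ha
  have hbs : ∀ P Q, b P Q = b Q P := fun P Q => by
    simp only [hb]; rw [norm_inner_symm]; ring
  have hb0 : ∀ P Q, 0 ≤ b P Q := fun P Q => by simp only [hb]; positivity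
  have hrow : ∀ P ∈ T, ∑ Q ∈ T with Q.1 = P.1, b P Q ≤ K * C * 2 ^ P.1 := by
    intro P hP
    classical
    set F := T.filter (fun Q => Q.1 = P.1 ∧ inner ℂ (φ P) (φ Q) ≠ 0) with hF
    have e1 : ∑ Q ∈ T with Q.1 = P.1, b P Q = ∑ Q ∈ F, b P Q := by
      symm
      apply Finset.sum_subset
      · intro Q hQ
        simp only [hF, Finset.mem_filter] at hQ ⊢
        exact ⟨hQ.1, hQ.2.1⟩
      · intro Q hQ hQ2
        simp only [hF, Finset.mem_filter, not_and, not_not] at hQ hQ2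
        simp only [hb]
        rw [hQ2 hQ.1 hQ.2]; simp
    rw [e1]
    calc ∑ Q ∈ F, b P Q ≤ ∑ Q ∈ F, K * ∑ x ∈ dyad Q.1 Q.2.1, (del P x ^ 4)⁻¹ := by
          refine Finset.sum_le_sum fun Q hQ => ?_
          simp only [hF, Finset.mem_filter] at hQ
          exact hK N hN φ l T h P hP Q hQ.1 hQ.2.1.le
      _ = K * ∑ x ∈ F.biUnion (fun Q => dyad Q.1 Q.2.1), (del P x ^ 4)⁻¹ := by
          rw [Finset.sum_biUnion, Finset.mul_sum]
          intro Q hQ R hR hQR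
          simp only [hF, Finset.coe_filter, Set.mem_ofPred_eq] at hQ hR
          refine Finset.disjoint_left.2 fun x hx hx2 => hQR ?_
          rw [mem_dyad] at hx hx2
          have l1 := hs P hP Q hQ.1 hQ.2.1.symm hQ.2.2
          have l2 := hs P hP R hR.1 hR.2.1.symm hR.2.2
          refine Prod.ext (hQ.2.1.trans hR.2.1.symm) (Prod.ext ?_ (l1.symm.trans l2))
          rw [← hx, ← hx2, hQ.2.1, hR.2.1]
      _ ≤ K * ∑ x ∈ F.biUnion (fun Q => dyad Q.1 Q.2.1), (del P x ^ 2)⁻¹ := by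
          exact mul_le_mul_of_nonneg_left (Finset.sum_le_sum fun x _ => inv_pow_del_le (by norm_num)) (by linarith)
      _ ≤ K * (C * 2 ^ P.1) := by gcongr; exact hC _ P.1 P.2.1
      _ = _ := by ring
  have hsym : ∑ P ∈ T, ∑ Q ∈ T with Q.1 = P.1, a Q ^ 2 * b P Q = ∑ P ∈ T, ∑ Q ∈ T with Q.1 = P.1, a P ^ 2 * b P Q := by
    simp only [Finset.sum_filter]
    rw [Finset.sum_comm]
    refine Finset.sum_congr rfl fun P _ => Finset.sum_congr rfl fun Q _ => ?_
    rw [hbs]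
    by_cases hh : P.1 = Q.1
    · rw [if_pos hh, if_pos hh.symm]
    · rw [if_neg hh, if_neg (Ne.symm hh)]
  calc _ ≤ ∑ P ∈ T, ∑ Q ∈ T with Q.1 = P.1, (a P ^ 2 * b P Q / 2 + a Q ^ 2 * b P Q / 2) := by
        refine Finset.sum_le_sum fun P _ => Finset.sum_le_sum fun Q _ => ?_
        have := hb0 P Q
        change a P * a Q * b P Q ≤ _
        nlinarith [mul_nonneg (sq_nonneg (a P - a Q)) this]
    _ = ∑ P ∈ T, ∑ Q ∈ T with Q.1 = P.1, a P ^ 2 * b P Q := by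
        simp only [Finset.sum_add_distrib, ← Finset.sum_div]
        rw [hsym]; ring
    _ ≤ ∑ P ∈ T, a P ^ 2 * (K * C * 2 ^ P.1) := by
        refine Finset.sum_le_sum fun P hP => ?_
        rw [← Finset.mul_sum]
        gcongr
        exact hrow P hP
    _ = _ := by
        unfold SS; rw [Finset.mul_sum]
        exact Finset.sum_congr rfl fun P _ => by simp only [ha]; ring

lemma coef_le {N : ℕ} (hN : 2 ≤ N) {φ : Tile → H} {P : Tile}
    (hbd : ∀ x : ℤ, ‖φ P x‖ ≤ ((2 : ℝ) ^ P.1)⁻¹ * (del P x ^ N)⁻¹) {S : Finset ℤ} {lam : ℝ} (hlam : 0 ≤ lam)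
    (hS : ∀ r, ((S.filter (near P r)).card : ℝ) ≤ lam * 2 ^ (P.1 + r)) (r0 : ℕ)
    (hr0 : ∀ x ∈ S, ∀ r < r0, ¬ near P r x) {f : H} (hf : ∀ x, ‖f x‖ ≤ if x ∈ S then 1 else 0) :
    ‖inner ℂ (φ P) f‖ ≤ 2 ^ (N + 1) * lam * ((2 : ℝ) ^ (r0 * (N - 1)))⁻¹ := by
  calc _ ≤ ∑ x ∈ S, ‖φ P x‖ := norm_inner_le_of_support hf
    _ ≤ ∑ x ∈ S, ((2 : ℝ) ^ P.1)⁻¹ * (del P x ^ N)⁻¹ := Finset.sum_le_sum fun x _ => hbd x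
    _ = ((2 : ℝ) ^ P.1)⁻¹ * ∑ x ∈ S, (del P x ^ N)⁻¹ := by rw [Finset.mul_sum]
    _ ≤ ((2 : ℝ) ^ P.1)⁻¹ * (2 ^ (N + 1) * lam * 2 ^ P.1 * ((2 : ℝ) ^ (r0 * (N - 1)))⁻¹) := by
        gcongr; exact L2 N hN P S lam hlam hS r0 hr0
    _ = _ := by field_simp

/-- lacunary trees -/
structure LTree (φ : Tile → H) (l : Tile → ℝ) (T : Finset Tile) (J : ℕ) (M : ℤ) (θ C2 : ℝ) : Prop where
  top : ∀ P ∈ T, P.1 ≤ J ∧ P.2.1 / 2 ^ (J - P.1) = M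
  freq : ∀ P ∈ T, |l P - 2 ^ P.1 * θ| ≤ C2
  lab : ∀ P ∈ T, ∀ Q ∈ T, P.1 = Q.1 → P.2.2 = Q.2.2
  orth : ∀ P ∈ T, ∀ Q ∈ T, P.1 ≠ Q.1 → inner ℂ (φ P) (φ Q) = 0

lemma tree_sum_del : ∃ C : ℝ, 1 ≤ C ∧ ∀ (T : Finset Tile)
    (_ : ∀ P ∈ T, ∀ Q ∈ T, P.1 = Q.1 → P.2.2 = Q.2.2) (g : ℕ → ℝ) (_ : ∀ j, 0 ≤ g j) (x : ℤ),
    ∑ P ∈ T, g P.1 * (del P x ^ 2)⁻¹ ≤ C * ∑ j ∈ T.image Prod.fst, g j := by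
  obtain ⟨C, hC1, hC⟩ := Zbasic
  refine ⟨C, hC1, fun T hT g hg x => ?_⟩
  rw [← Finset.sum_fiberwise_of_maps_to (g := Prod.fst) (t := T.image Prod.fst) (fun P hP => Finset.mem_image_of_mem _ hP),
    Finset.mul_sum]
  refine Finset.sum_le_sum fun j _ => ?_
  calc ∑ P ∈ T with P.1 = j, g P.1 * (del P x ^ 2)⁻¹
      = ∑ P ∈ T with P.1 = j, g j * ((1 + |((P.2.1 : ℤ) : ℝ) - (x : ℝ) / 2 ^ j|) ^ 2)⁻¹ := by
        refine Finset.sum_congr rfl fun P hP => ?_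
        have := (Finset.mem_filter.1 hP).2
        unfold del
        rw [this, abs_sub_comm]
    _ = ∑ n ∈ (T.filter (fun P => P.1 = j)).image (fun P => P.2.1), g j * ((1 + |((n : ℤ) : ℝ) - (x : ℝ) / 2 ^ j|) ^ 2)⁻¹ := by
        rw [Finset.sum_image]
        intro P hP Q hQ hPQ
        simp only [Finset.coe_filter, Set.mem_ofPred_eq] at hP hQ
        exact Prod.ext (hP.2.trans hQ.2.symm) (Prod.ext hPQ (hT P hP.1 Q hQ.1 (hP.2.trans hQ.2.symm)))
    _ = g j * ∑ n ∈ (T.filter (fun P => P.1 = j)).image (fun P => P.2.1), ((1 + |((n : ℤ) : ℝ) - (x : ℝ) / 2 ^ j|) ^ 2)⁻¹ := by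
        rw [Finset.mul_sum]
    _ ≤ g j * C := by gcongr; exact hg j; exact hC _ _
    _ = _ := mul_comm _ _

lemma sum_two_sided (X : Finset ℕ) (r : ℕ) :
    ∑ j ∈ X, ((2 : ℝ) ^ (r - j) * (2 : ℝ) ^ (j - r))⁻¹ ≤ 4 := by
  have h1 : ∀ j ∈ X, ((2 : ℝ) ^ (r - j) * (2 : ℝ) ^ (j - r))⁻¹ ≤
      (if j ≤ r then ((2 : ℝ) ^ (r - j))⁻¹ else 0) + (if r ≤ j then ((2 : ℝ) ^ (j - r))⁻¹ else 0) := by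
    intro j _
    rcases le_total j r with h | h
    · rw [if_pos h, Nat.sub_eq_zero_of_le h]
      have : (0 : ℝ) ≤ (if r ≤ j then ((2 : ℝ) ^ 0)⁻¹ else 0) := by positivity
      simp only [pow_zero, mul_one] at *
      linarith
    · rw [if_pos h, Nat.sub_eq_zero_of_le h]
      have : (0 : ℝ) ≤ (if j ≤ r then ((2 : ℝ) ^ 0)⁻¹ else 0) := by positivity
      simp only [pow_zero, one_mul] at *
      linarith
  refine (Finset.sum_le_sum h1).trans ?_
  rw [Finset.sum_add_distrib, ← Finset.sum_filter, ← Finset.sum_filter]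
  have key : ∀ Y : Finset ℕ, ∑ k ∈ Y, ((2 : ℝ) ^ k)⁻¹ ≤ 2 := by
    intro Y
    have := Summable.sum_le_tsum Y (f := fun k : ℕ => ((1 : ℝ) / 2) ^ k) (fun k _ => by positivity) summable_geometric_two
    rw [tsum_geometric_two] at this
    simpa using this
  have k1 : ∑ j ∈ X with j ≤ r, ((2 : ℝ) ^ (r - j))⁻¹ ≤ 2 := by
    have := key ((X.filter (· ≤ r)).image (fun j => r - j))
    rwa [Finset.sum_image] at this
    intro a ha b hb hab
    simp only [Finset.coe_filter, Set.mem_ofPred_eq] at ha hb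
    simp only at hab; omega
  have k2 : ∑ j ∈ X with r ≤ j, ((2 : ℝ) ^ (j - r))⁻¹ ≤ 2 := by
    have := key ((X.filter (r ≤ ·)).image (fun j => j - r))
    rwa [Finset.sum_image] at this
    intro a ha b hb hab
    simp only [Finset.coe_filter, Set.mem_ofPred_eq] at ha hb
    simp only at hab; omega
  linarith

lemma near_iff {P : Tile} {r : ℕ} {x : ℤ} (h : P.1 ≤ r) : near P (r - P.1) x ↔ |x / 2 ^ r - P.2.1 / 2 ^ (r - P.1)| ≤ 1 := by
  unfold near; rw [Nat.add_sub_cancel' h]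

lemma GG_apply (φ : Tile → H) (f : H) (T : Finset Tile) (x : ℤ) :
    GG φ f T x = ∑ P ∈ T, ((2 : ℂ) ^ P.1 * inner ℂ (φ P) f) * φ P x := by
  unfold GG
  rw [lp.coeFn_sum, Finset.sum_apply]
  rfl

/-- one-step oscillation -/
lemma step (N : ℕ) (hN : 6 ≤ N) (C2 : ℝ) (hC2 : 0 ≤ C2) : ∃ K : ℝ, 0 < K ∧ ∀ (φ : Tile → H) (l : Tile → ℝ) (T : Finset Tile)
    (J : ℕ) (M : ℤ) (θ : ℝ) (f : H) (A : ℝ), 0 ≤ A → Pk N φ l T → LTree φ l T J M θ C2 →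
    (∀ P ∈ T, ‖inner ℂ (φ P) f‖ ≤ A) → ∀ (r : ℕ) (y : ℤ), (∀ P ∈ T, P.1 ≤ r → ¬ near P (r - P.1) y) →
    ‖GG φ f T (y + 1) * ee (-(θ * (y + 1 : ℤ))) - GG φ f T y * ee (-(θ * y))‖ ≤ K * A * (2 ^ r)⁻¹ := by
  obtain ⟨C, hC1, hC⟩ := tree_sum_del
  refine ⟨(1 + 2 * π * C2) * (4 * C), by positivity, fun φ l T J M θ f A hA hpk ht hA2 r y hy => ?_⟩
  rw [GG_apply, GG_apply, Finset.sum_mul, Finset.sum_mul, ← Finset.sum_sub_distrib]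
  have h1 : ∀ P ∈ T, ‖(2 : ℂ) ^ P.1 * inner ℂ (φ P) f * φ P (y + 1) * ee (-(θ * (y + 1 : ℤ))) -
      (2 : ℂ) ^ P.1 * inner ℂ (φ P) f * φ P y * ee (-(θ * y))‖ ≤
      ((1 + 2 * π * C2) * A * (2 ^ r)⁻¹) * (((2 : ℝ) ^ (r - P.1) * (2 : ℝ) ^ (P.1 - r))⁻¹ * (del P y ^ 2)⁻¹) := by
    intro P hP
    set c := (l P - 2 ^ P.1 * θ) / 2 ^ P.1 with hc
    have h2P : (0 : ℝ) < 2 ^ P.1 := by positivity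
    have hE : ∀ z : ℤ, ee (-(θ * z)) = ee (-(l P / 2 ^ P.1 * z)) * ee (c * z) := by
      intro z; rw [← ee_add]; congr 1; rw [hc]; field_simp; ring
    have hd := hpk.df P hP y
    have hb := hpk.bd P hP y
    have hc' : |c| ≤ C2 * ((2 : ℝ) ^ P.1)⁻¹ := by
      rw [hc, abs_div, abs_of_pos h2P, div_eq_mul_inv]
      gcongr; exact ht.freq P hP
    have hee : ‖ee (c * (y + 1 : ℤ)) - ee (c * y)‖ ≤ 2 * π * (C2 * ((2 : ℝ) ^ P.1)⁻¹) := by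
      have : ee (c * (y + 1 : ℤ)) - ee (c * y) = ee (c * y) * (ee c - 1) := by
        have e : c * ((y + 1 : ℤ) : ℝ) = c * y + c := by push_cast; ring
        rw [e, ee_add]; ring
      rw [this, norm_mul, norm_ee, one_mul]
      exact (norm_ee_sub_one c).trans (by gcongr)
    have e1 : (2 : ℂ) ^ P.1 * inner ℂ (φ P) f * φ P (y + 1) * ee (-(θ * (y + 1 : ℤ))) -
      (2 : ℂ) ^ P.1 * inner ℂ (φ P) f * φ P y * ee (-(θ * y)) = ((2 : ℂ) ^ P.1 * inner ℂ (φ P) f) *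
      ((φ P (y + 1) * ee (-(l P / 2 ^ P.1 * (y + 1 : ℤ))) - φ P y * ee (-(l P / 2 ^ P.1 * y))) * ee (c * (y + 1 : ℤ))
       + φ P y * ee (-(l P / 2 ^ P.1 * y)) * (ee (c * (y + 1 : ℤ)) - ee (c * y))) := by
      rw [hE, hE]; ring
    rw [e1, norm_mul, norm_mul]
    have n2 : ‖(2 : ℂ) ^ P.1‖ = 2 ^ P.1 := by simp
    rw [n2]
    have e2 : ‖(φ P (y + 1) * ee (-(l P / 2 ^ P.1 * (y + 1 : ℤ))) - φ P y * ee (-(l P / 2 ^ P.1 * y))) * ee (c * (y + 1 : ℤ))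
       + φ P y * ee (-(l P / 2 ^ P.1 * y)) * (ee (c * (y + 1 : ℤ)) - ee (c * y))‖ ≤
       (1 + 2 * π * C2) * (((2 : ℝ) ^ P.1)⁻¹ * ((2 : ℝ) ^ P.1)⁻¹ * (del P y ^ N)⁻¹) := by
      refine (norm_add_le _ _).trans ?_
      rw [norm_mul, norm_mul, norm_mul, norm_ee, norm_ee, mul_one, mul_one]
      have : ‖φ P y‖ * ‖ee (c * (y + 1 : ℤ)) - ee (c * y)‖ ≤ (((2 : ℝ) ^ P.1)⁻¹ * (del P y ^ N)⁻¹) * (2 * π * (C2 * ((2 : ℝ) ^ P.1)⁻¹)) := by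
        have := del_pos P y
        gcongr
      linarith
    have key : ((2 : ℝ) ^ P.1)⁻¹ * (del P y ^ N)⁻¹ ≤ (2 ^ r)⁻¹ * (((2 : ℝ) ^ (r - P.1) * (2 : ℝ) ^ (P.1 - r))⁻¹ * (del P y ^ 2)⁻¹) := by
      have a1 := one_le_del P y
      have a3 := del_pos P y
      rcases le_total P.1 r with h | h
      · have h4 := not_near (hy P hP h)
        have h5 : (2 : ℝ) ^ (r - P.1) ≤ del P y := by unfold del; linarith
        have h6 : ((2 : ℝ) ^ (r - P.1)) ^ 2 * del P y ^ 2 ≤ del P y ^ N := by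
          calc _ ≤ del P y ^ 2 * del P y ^ 2 := by gcongr
            _ = del P y ^ 4 := by ring
            _ ≤ _ := pow_le_pow_right₀ a1 (by omega)
        rw [Nat.sub_eq_zero_of_le h]
        have e : (2 : ℝ) ^ r = 2 ^ P.1 * 2 ^ (r - P.1) := by rw [← pow_add]; congr 1; omega
        rw [e]
        calc _ ≤ ((2 : ℝ) ^ P.1)⁻¹ * (((2 : ℝ) ^ (r - P.1)) ^ 2 * del P y ^ 2)⁻¹ := by gcongr
          _ = _ := by field_simp
      · rw [Nat.sub_eq_zero_of_le h]
        have e : (2 : ℝ) ^ P.1 = 2 ^ r * 2 ^ (P.1 - r) := by rw [← pow_add]; congr 1; omega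
        rw [e]
        calc _ ≤ ((2 : ℝ) ^ r * 2 ^ (P.1 - r))⁻¹ * (del P y ^ 2)⁻¹ := by gcongr; omega
          _ = _ := by field_simp
    calc _ ≤ 2 ^ P.1 * A * ((1 + 2 * π * C2) * (((2 : ℝ) ^ P.1)⁻¹ * ((2 : ℝ) ^ P.1)⁻¹ * (del P y ^ N)⁻¹)) := by
          gcongr; exact hA2 P hP
      _ = (1 + 2 * π * C2) * A * (((2 : ℝ) ^ P.1)⁻¹ * (del P y ^ N)⁻¹) := by field_simp
      _ ≤ (1 + 2 * π * C2) * A * ((2 ^ r)⁻¹ * (((2 : ℝ) ^ (r - P.1) * (2 : ℝ) ^ (P.1 - r))⁻¹ * (del P y ^ 2)⁻¹)) := by gcongr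
      _ = _ := by ring
  refine (norm_sum_le _ _).trans ((Finset.sum_le_sum h1).trans ?_)
  rw [← Finset.mul_sum]
  have h2 := hC T ht.lab (fun j => ((2 : ℝ) ^ (r - j) * (2 : ℝ) ^ (j - r))⁻¹) (fun j => by positivity) y
  have h3 := sum_two_sided (T.image Prod.fst) r
  calc _ ≤ ((1 + 2 * π * C2) * A * (2 ^ r)⁻¹) * (C * 4) := by
        gcongr
        exact h2.trans (by gcongr)
    _ = _ := by ring

end BHT

namespace BHT

lemma ediv_between {x y z : ℤ} {r : ℕ} (hxy : x ≤ y) (hyz : y ≤ z) (h : x / 2 ^ r = z / 2 ^ r) :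
    y / 2 ^ r = x / 2 ^ r := by
  have hp : (0 : ℤ) < 2 ^ r := by positivity
  have h1 := Int.ediv_le_ediv hp hxy
  have h2 := Int.ediv_le_ediv hp hyz
  omega

lemma osc (N : ℕ) (hN : 6 ≤ N) (C2 : ℝ) (hC2 : 0 ≤ C2) : ∃ K : ℝ, 0 < K ∧ ∀ (φ : Tile → H) (l : Tile → ℝ) (T : Finset Tile)
    (J : ℕ) (M : ℤ) (θ : ℝ) (f : H) (A : ℝ), 0 ≤ A → Pk N φ l T → LTree φ l T J M θ C2 →
    (∀ P ∈ T, ‖inner ℂ (φ P) f‖ ≤ A) → ∀ (r : ℕ) (x z : ℤ), (∀ P ∈ T, P.1 ≤ r → ¬ near P (r - P.1) x) →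
    z / 2 ^ r = x / 2 ^ r →
    ‖GG φ f T x‖ ≤ ‖GG φ f T z‖ + K * A := by
  obtain ⟨K, hK, h⟩ := step N hN C2 hC2
  refine ⟨K, hK, fun φ l T J M θ f A hA hpk ht hA2 r x z hx hz => ?_⟩
  set F : ℤ → ℂ := fun y => GG φ f T y * ee (-(θ * y)) with hF
  have hFn : ∀ y, ‖F y‖ = ‖GG φ f T y‖ := fun y => by simp only [hF]; rw [norm_mul, norm_ee, mul_one]
  have hstep : ∀ y : ℤ, y / 2 ^ r = x / 2 ^ r → ‖F (y + 1) - F y‖ ≤ K * A * (2 ^ r)⁻¹ := by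
    intro y hy
    refine h φ l T J M θ f A hA hpk ht hA2 r y fun P hP hPr hn => hx P hP hPr ?_
    rw [near_iff hPr] at hn ⊢
    rwa [← hy]
  have htel : ∀ (k : ℕ) (y : ℤ), y / 2 ^ r = x / 2 ^ r → (y + k) / 2 ^ r = x / 2 ^ r →
      ‖F (y + k) - F y‖ ≤ k * (K * A * (2 ^ r)⁻¹) := by
    intro k
    induction k with
    | zero => intro y _ _; simp
    | succ k ih =>
      intro y h1 h2
      have h3 : (y + k) / 2 ^ r = x / 2 ^ r := by
        rw [← h1]
        refine ediv_between (z := y + ((k + 1 : ℕ) : ℤ)) ?_ ?_ (h1.trans h2.symm) <;> push_cast <;> omega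
      have h4 := ih y h1 h3
      have h5 := hstep _ h3
      have e : F (y + ((k + 1 : ℕ) : ℤ)) - F y = (F (y + k + 1) - F (y + k)) + (F (y + k) - F y) := by
        rw [show y + ((k + 1 : ℕ) : ℤ) = y + k + 1 by push_cast; ring]; ring
      rw [e]
      refine (norm_add_le _ _).trans ?_
      push_cast; linarith
  have hmain : ∀ u v : ℤ, u ≤ v → u / 2 ^ r = x / 2 ^ r → v / 2 ^ r = x / 2 ^ r → ‖F v - F u‖ ≤ K * A := by
    intro u v huv hu hv
    obtain ⟨k, rfl⟩ := Int.exists_add_of_le huv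
    have h1 := htel k u hu hv
    have hk : (k : ℝ) ≤ 2 ^ r := by
      have b1 := (ediv_bounds u r).1
      have b2 := (ediv_bounds (u + k) r).2
      rw [hu] at b1
      rw [hv] at b2
      have hp : (0 : ℝ) < 2 ^ r := by positivity
      rw [le_div_iff₀ hp] at b1
      rw [div_lt_iff₀ hp] at b2
      push_cast at b2
      linarith
    refine h1.trans ?_
    calc (k : ℝ) * (K * A * (2 ^ r)⁻¹) ≤ 2 ^ r * (K * A * (2 ^ r)⁻¹) := by gcongr
      _ = K * A := by field_simp
  have hfin : ‖F x - F z‖ ≤ K * A := by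
    rcases le_total z x with h1 | h1
    · exact hmain z x h1 hz rfl
    · rw [norm_sub_rev]; exact hmain x z h1 rfl hz
  rw [← hFn, ← hFn]
  have := norm_sub_norm_le (F x) (F z)
  linarith

lemma tree_card {T : Finset Tile} {J : ℕ} {M : ℤ} (htop : ∀ P ∈ T, P.1 ≤ J ∧ P.2.1 / 2 ^ (J - P.1) = M)
    (hlab : ∀ P ∈ T, ∀ Q ∈ T, P.1 = Q.1 → P.2.2 = Q.2.2) (j : ℕ) :
    (T.filter (fun P => P.1 = j)).card ≤ 2 ^ (J - j) := by
  rw [← card_dyad (J - j) M]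
  refine Finset.card_le_card_of_injOn (fun P => P.2.1) ?_ ?_
  · intro P hP
    simp only [Finset.coe_filter, Set.mem_ofPred_eq] at hP
    simp only [Finset.mem_coe]
    rw [mem_dyad, ← (htop P hP.1).2, hP.2]
  · intro P hP Q hQ hPQ
    simp only [Finset.coe_filter, Set.mem_ofPred_eq] at hP hQ
    exact Prod.ext (hP.2.trans hQ.2.symm) (Prod.ext hPQ (hlab P hP.1 Q hQ.1 (hP.2.trans hQ.2.symm)))

lemma tree_sum_scale {T : Finset Tile} {J : ℕ} {M : ℤ} (htop : ∀ P ∈ T, P.1 ≤ J ∧ P.2.1 / 2 ^ (J - P.1) = M)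
    (hlab : ∀ P ∈ T, ∀ Q ∈ T, P.1 = Q.1 → P.2.2 = Q.2.2) :
    ∑ P ∈ T, (2 : ℝ) ^ P.1 * ((2 : ℝ) ^ (J - P.1))⁻¹ ≤ 2 * 2 ^ J := by
  rw [← Finset.sum_fiberwise_of_maps_to (g := Prod.fst) (t := Finset.range (J + 1))
    (fun P hP => Finset.mem_range.2 (by have := (htop P hP).1; omega))]
  calc _ ≤ ∑ j ∈ Finset.range (J + 1), (2 : ℝ) ^ J * ((2 : ℝ) ^ (J - j))⁻¹ := by
        refine Finset.sum_le_sum fun j hj => ?_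
        have hj' : j ≤ J := by have := Finset.mem_range.1 hj; omega
        have e : ∑ P ∈ T with P.1 = j, (2 : ℝ) ^ P.1 * ((2 : ℝ) ^ (J - P.1))⁻¹ =
            ∑ P ∈ T with P.1 = j, (2 : ℝ) ^ j * ((2 : ℝ) ^ (J - j))⁻¹ :=
          Finset.sum_congr rfl fun P hP => by rw [(Finset.mem_filter.1 hP).2]
        rw [e, Finset.sum_const, nsmul_eq_mul]
        have h1 : ((T.filter (fun P => P.1 = j)).card : ℝ) ≤ 2 ^ (J - j) := by exact_mod_cast tree_card htop hlab j
        have e2 : (2 : ℝ) ^ J = 2 ^ (J - j) * 2 ^ j := by rw [← pow_add]; congr 1; omega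
        rw [e2]
        calc _ ≤ (2 : ℝ) ^ (J - j) * (2 ^ j * ((2 : ℝ) ^ (J - j))⁻¹) := by gcongr
          _ = _ := by ring
    _ = 2 ^ J * ∑ j ∈ Finset.range (J + 1), ((2 : ℝ) ^ j)⁻¹ := by
        rw [← Finset.mul_sum]
        congr 1
        have := Finset.sum_range_reflect (fun j => ((2 : ℝ) ^ j)⁻¹) (J + 1)
        simpa using this
    _ ≤ 2 ^ J * 2 := by
        gcongr
        have := geom_half 0 (J + 1) 1 le_rfl
        simpa using this
    _ = _ := by ring

lemma quad_solve {S A B : ℝ} (hS : 0 ≤ S) (h : S ≤ A * Real.sqrt S + B) : S ≤ A ^ 2 + 2 * B := by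
  have h1 := Real.sq_sqrt hS
  nlinarith [sq_nonneg (A - Real.sqrt S)]

lemma treeD (N : ℕ) (hN : 6 ≤ N) (C2 : ℝ) (hC2 : 0 ≤ C2) : ∃ K : ℝ, 0 < K ∧ ∀ (φ : Tile → H) (l : Tile → ℝ) (T : Finset Tile)
    (J : ℕ) (M : ℤ) (θ : ℝ) (f : H) (S : Finset ℤ) (lam : ℝ), 0 ≤ lam → Pk N φ l T → LTree φ l T J M θ C2 →
    (∀ x, ‖f x‖ ≤ if x ∈ S then 1 else 0) →
    (∀ P ∈ T, ∀ r, ((S.filter (near P r)).card : ℝ) ≤ lam * 2 ^ (P.1 + r)) →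
    SS φ f T ≤ K * lam ^ 2 * 2 ^ J := by
  obtain ⟨K1, hK1, hosc⟩ := osc N hN C2 hC2
  obtain ⟨K2, hK2, hdiag⟩ := diag
  set c : ℝ := 2 ^ (N + 1) with hc
  refine ⟨12 * K2 + 2 * (K1 * c + 2 * (c * c)), by positivity, fun φ l T J M θ f S lam hlam hpk ht hf hS => ?_⟩
  rcases T.eq_empty_or_nonempty with rfl | ⟨P0, hP0⟩
  · have : SS φ f ∅ = 0 := by simp [SS]
    rw [this]; positivity
  have hcoef : ∀ P ∈ T, ‖inner ℂ (φ P) f‖ ≤ c * lam := by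
    intro P hP
    have := coef_le (by omega) (hpk.bd P hP) hlam (hS P hP) 0 (fun _ _ r hr => absurd hr (Nat.not_lt_zero r)) hf
    simpa using this
  -- BB bound
  have hBB : BB φ f T ≤ K2 * SS φ f T := by
    refine le_trans (le_of_eq ?_) (hdiag N hN φ l T hpk (fun P hP Q hQ h _ => ht.lab P hP Q hQ h) f)
    unfold BB
    refine Finset.sum_congr rfl fun P hP => ?_
    symm
    apply Finset.sum_subset (Finset.filter_subset _ _)
    intro Q hQ hQ2
    simp only [Finset.mem_filter, not_and] at hQ2
    rw [ht.orth P hP Q hQ (fun h => hQ2 hQ h.symm)]; simp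
  have hG : ‖GG φ f T‖ ≤ Real.sqrt (K2 * SS φ f T) := Real.le_sqrt_of_sq_le ((GG_norm φ f T).trans hBB)
  set G := GG φ f T with hGdef
  have h1 : SS φ f T ≤ ∑ x ∈ S, ‖G x‖ := by
    rw [SS_eq]; exact norm_inner_le_of_support hf
  -- conditions
  set cond : ℕ → ℤ → Prop := fun r x => ∃ P ∈ T, P.1 ≤ r ∧ near P (r - P.1) x with hcond
  have cond_mono : ∀ {r s x}, r ≤ s → cond r x → cond s x := by
    rintro r s x hrs ⟨P, hP, hPr, hn⟩
    exact ⟨P, hP, by omega, near_mono (by omega) hn⟩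
  have cond_congr : ∀ {r x z}, z / 2 ^ r = x / 2 ^ r → cond r x → cond r z := by
    rintro r x z hz ⟨P, hP, hPr, hn⟩
    refine ⟨P, hP, hPr, ?_⟩
    rw [near_iff hPr] at hn ⊢
    rwa [hz]
  have cond_congr' : ∀ {r s : ℕ} {x z : ℤ}, r ≤ s → z / 2 ^ r = x / 2 ^ r → z / 2 ^ s = x / 2 ^ s := by
    intro r s x z hrs h
    obtain ⟨t, rfl⟩ := Nat.exists_eq_add_of_le hrs
    rw [pow_add, ← Int.ediv_ediv_of_nonneg (by positivity), ← Int.ediv_ediv_of_nonneg (by positivity), h]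
  have condJ : ∀ x, cond J x ↔ |x / 2 ^ J - M| ≤ 1 := by
    intro x
    constructor
    · rintro ⟨P, hP, hPr, hn⟩
      rw [near_iff hPr, (ht.top P hP).2] at hn; exact hn
    · intro h
      refine ⟨P0, hP0, (ht.top P0 hP0).1, ?_⟩
      rw [near_iff (ht.top P0 hP0).1, (ht.top P0 hP0).2]; exact h
  set ρ : ℤ → ℕ := fun x => sInf {r | cond r x} with hρ
  set X := S.filter (fun x => |x / 2 ^ J - M| ≤ 1) with hX
  set Y := S.filter (fun x => ¬ |x / 2 ^ J - M| ≤ 1) with hY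
  set W : Finset ℤ := Finset.Ico ((M - 1) * 2 ^ J) ((M + 2) * 2 ^ J) with hW
  have hWc : (W.card : ℝ) = 3 * 2 ^ J := by
    rw [hW, Int.card_Ico]
    have : (M + 2) * 2 ^ J - (M - 1) * 2 ^ J = ((3 * 2 ^ J : ℕ) : ℤ) := by push_cast; ring
    rw [this, Int.toNat_natCast]; push_cast; ring
  have hWm : ∀ x, |x / 2 ^ J - M| ≤ 1 → x ∈ W := by
    intro x hx
    have hp : (0 : ℤ) < 2 ^ J := by positivity
    rw [abs_le] at hx
    have a1 := Int.ediv_mul_le x hp.ne'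
    have a2 := Int.lt_ediv_add_one_mul_self x hp
    rw [hW, Finset.mem_Ico]
    constructor <;> nlinarith
  have hXcard : (X.card : ℝ) ≤ lam * 2 ^ J := by
    have h := hS P0 hP0 (J - P0.1)
    rw [Nat.add_sub_cancel' (ht.top P0 hP0).1] at h
    refine le_trans ?_ h
    have : X = S.filter (near P0 (J - P0.1)) := by
      rw [hX]
      refine Finset.filter_congr fun x _ => ?_
      rw [near_iff (ht.top P0 hP0).1, (ht.top P0 hP0).2]
    rw [this]
  -- far part
  have hfar : ∑ x ∈ Y, ‖G x‖ ≤ 2 * (c * c) * lam ^ 2 * 2 ^ J := by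
    calc ∑ x ∈ Y, ‖G x‖ ≤ ∑ x ∈ Y, ∑ P ∈ T, c * lam * (del P x ^ N)⁻¹ := by
          refine Finset.sum_le_sum fun x _ => ?_
          rw [hGdef, GG_apply]
          refine (norm_sum_le _ _).trans (Finset.sum_le_sum fun P hP => ?_)
          rw [norm_mul, norm_mul]
          have n2 : ‖(2 : ℂ) ^ P.1‖ = 2 ^ P.1 := by simp
          rw [n2]
          calc _ ≤ 2 ^ P.1 * (c * lam) * (((2 : ℝ) ^ P.1)⁻¹ * (del P x ^ N)⁻¹) := by
                gcongr
                · exact hcoef P hP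
                · exact hpk.bd P hP x
            _ = _ := by field_simp
      _ = c * lam * ∑ P ∈ T, ∑ x ∈ Y, (del P x ^ N)⁻¹ := by
          rw [Finset.sum_comm, Finset.mul_sum]
          exact Finset.sum_congr rfl fun P _ => by rw [Finset.mul_sum]
      _ ≤ c * lam * ∑ P ∈ T, c * lam * ((2 : ℝ) ^ P.1 * ((2 : ℝ) ^ (J - P.1))⁻¹) := by
          gcongr with P hP
          have hYS : ∀ r, ((Y.filter (near P r)).card : ℝ) ≤ lam * 2 ^ (P.1 + r) := fun r =>
            le_trans (by exact_mod_cast Finset.card_le_card (Finset.filter_subset_filter _ (Finset.filter_subset _ _))) (hS P hP r)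
          have := L2 N (by omega) P Y lam hlam hYS (J - P.1) (by
            intro x hx r hr hn
            have hx2 := (Finset.mem_filter.1 hx).2
            apply hx2
            have := near_mono hr.le hn
            rw [near_iff (ht.top P hP).1, (ht.top P hP).2] at this
            exact this)
          refine this.trans ?_
          rw [← hc, mul_assoc (c * lam)]
          gcongr
          · norm_num
          · exact Nat.le_mul_of_pos_right _ (by omega)
      _ = c * lam * (c * lam * ∑ P ∈ T, ((2 : ℝ) ^ P.1 * ((2 : ℝ) ^ (J - P.1))⁻¹)) := by rw [← Finset.mul_sum]
      _ ≤ c * lam * (c * lam * (2 * 2 ^ J)) := by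
          gcongr; exact tree_sum_scale ht.top ht.lab
      _ = _ := by ring
  -- near part
  have hρspec : ∀ x, |x / 2 ^ J - M| ≤ 1 → cond (ρ x) x ∧ ρ x ≤ J := by
    intro x hx
    have hJ : J ∈ {r | cond r x} := (condJ x).2 hx
    exact ⟨Nat.sInf_mem (s := {r | cond r x}) ⟨J, hJ⟩, Nat.sInf_le hJ⟩
  have hρmin : ∀ x r, r < ρ x → ¬ cond r x := fun x r hr h => Nat.notMem_of_lt_sInf hr h
  have hρeq : ∀ x z, |x / 2 ^ J - M| ≤ 1 → z / 2 ^ (ρ x - 1) = x / 2 ^ (ρ x - 1) → ρ z = ρ x := by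
    intro x z hx hz
    obtain ⟨hs, hsJ⟩ := hρspec x hx
    rcases Nat.eq_zero_or_pos (ρ x) with h0 | h0
    · rw [h0] at hz
      simp only [zero_le, Nat.sub_eq_zero_of_le, pow_zero, Int.ediv_one] at hz
      rw [hz]
    · have hz1 : cond (ρ x) z := cond_congr (cond_congr' (s := ρ x) (by omega) hz) hs
      have hz2 : ρ z ≤ ρ x := Nat.sInf_le hz1
      by_contra hne
      have hz3 : cond (ρ z) z := Nat.sInf_mem (s := {r | cond r z}) ⟨ρ x, hz1⟩
      have hz4 : cond (ρ x - 1) z := cond_mono (by omega) hz3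
      exact hρmin x (ρ x - 1) (by omega) (cond_congr hz.symm hz4)
  have hnear1 : ∀ x ∈ X, ‖G x‖ ≤ (∑ z ∈ W with z / 2 ^ (ρ x - 1) = x / 2 ^ (ρ x - 1), ((2 : ℝ) ^ (ρ x - 1))⁻¹ * ‖G z‖) + K1 * (c * lam) := by
    intro x hx
    have hx2 := (Finset.mem_filter.1 hx).2
    obtain ⟨hs, hsJ⟩ := hρspec x hx2
    set r := ρ x - 1 with hr
    have hWd : W.filter (fun z => z / 2 ^ r = x / 2 ^ r) = dyad r (x / 2 ^ r) := by
      ext z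
      rw [Finset.mem_filter, mem_dyad]
      constructor
      · exact fun h => h.2
      · intro h
        refine ⟨hWm z ?_, h⟩
        rwa [cond_congr' (s := J) (by omega) h]
    rw [hWd]
    have hz : ∀ z ∈ dyad r (x / 2 ^ r), ‖G x‖ ≤ ‖G z‖ + K1 * (c * lam) := by
      intro z hz
      rw [mem_dyad] at hz
      rcases Nat.eq_zero_or_pos (ρ x) with h0 | h0
      · have : r = 0 := by omega
        rw [this] at hz
        simp only [pow_zero, Int.ediv_one] at hz
        rw [hz]
        have : 0 ≤ K1 * (c * lam) := by positivity
        linarith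
      · refine hosc φ l T J M θ f (c * lam) (by positivity) hpk ht hcoef r x z ?_ hz
        intro P hP hPr hn
        exact hρmin x r (by omega) ⟨P, hP, hPr, hn⟩
    have hsum := Finset.sum_le_sum hz
    rw [Finset.sum_const, Finset.sum_add_distrib, Finset.sum_const, card_dyad, nsmul_eq_mul, nsmul_eq_mul] at hsum
    push_cast at hsum
    have hp : (0 : ℝ) < 2 ^ r := by positivity
    rw [← Finset.mul_sum]
    have e : ‖G x‖ = ((2 : ℝ) ^ r)⁻¹ * (2 ^ r * ‖G x‖) := by field_simp
    rw [e]
    calc _ ≤ ((2 : ℝ) ^ r)⁻¹ * (∑ i ∈ dyad r (x / 2 ^ r), ‖G i‖ + 2 ^ r * (K1 * (c * lam))) := by gcongr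
      _ = _ := by field_simp
  have hnear2 : ∀ z ∈ W, ∑ x ∈ X with z / 2 ^ (ρ x - 1) = x / 2 ^ (ρ x - 1), ((2 : ℝ) ^ (ρ x - 1))⁻¹ ≤ 2 * lam := by
    intro z _
    rcases (X.filter (fun x => z / 2 ^ (ρ x - 1) = x / 2 ^ (ρ x - 1))).eq_empty_or_nonempty with he | ⟨x0, hx0⟩
    · rw [he]; simp; exact hlam
    simp only [hX, Finset.mem_filter] at hx0
    have hz0 : ρ z = ρ x0 := hρeq x0 z hx0.1.2 hx0.2
    obtain ⟨⟨P, hP, hPr, hn⟩, hsJ⟩ := hρspec x0 hx0.1.2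
    have hnz : near P (ρ z - P.1) z := by
      rw [hz0]; rw [near_iff hPr] at hn ⊢
      rwa [cond_congr' (s := ρ x0) (by omega) hx0.2]
    rw [← hz0] at hPr
    have hsub : ∀ x ∈ X.filter (fun x => z / 2 ^ (ρ x - 1) = x / 2 ^ (ρ x - 1)), ρ x = ρ z ∧ near P (ρ z - P.1) x ∧ x ∈ S := by
      intro x hx
      simp only [hX, Finset.mem_filter] at hx
      have h1 := hρeq x z hx.1.2 hx.2
      refine ⟨h1.symm, ?_, hx.1.1⟩
      rw [near_iff hPr] at hnz ⊢
      have := cond_congr' (s := ρ z) (by omega) hx.2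
      rwa [← this]
    calc _ = ∑ x ∈ X with z / 2 ^ (ρ x - 1) = x / 2 ^ (ρ x - 1), ((2 : ℝ) ^ (ρ z - 1))⁻¹ :=
          Finset.sum_congr rfl fun x hx => by rw [(hsub x hx).1]
      _ = ((X.filter (fun x => z / 2 ^ (ρ x - 1) = x / 2 ^ (ρ x - 1))).card : ℝ) * ((2 : ℝ) ^ (ρ z - 1))⁻¹ := by
          rw [Finset.sum_const, nsmul_eq_mul]
      _ ≤ (lam * 2 ^ (ρ z)) * ((2 : ℝ) ^ (ρ z - 1))⁻¹ := by
          gcongr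
          have h2 := hS P hP (ρ z - P.1)
          rw [Nat.add_sub_cancel' hPr] at h2
          refine le_trans ?_ h2
          exact_mod_cast Finset.card_le_card fun x hx => Finset.mem_filter.2 ⟨(hsub x hx).2.2, (hsub x hx).2.1⟩
      _ ≤ (lam * (2 * 2 ^ (ρ z - 1))) * ((2 : ℝ) ^ (ρ z - 1))⁻¹ := by
          gcongr
          rw [← pow_succ']
          exact pow_le_pow_right₀ (by norm_num) (by omega)
      _ = _ := by field_simp
  have hnear : ∑ x ∈ X, ‖G x‖ ≤ 2 * lam * (Real.sqrt (3 * 2 ^ J) * ‖G‖) + K1 * c * lam ^ 2 * 2 ^ J := by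
    calc ∑ x ∈ X, ‖G x‖ ≤ ∑ x ∈ X, ((∑ z ∈ W with z / 2 ^ (ρ x - 1) = x / 2 ^ (ρ x - 1), ((2 : ℝ) ^ (ρ x - 1))⁻¹ * ‖G z‖) + K1 * (c * lam)) :=
          Finset.sum_le_sum hnear1
      _ = (∑ z ∈ W, (∑ x ∈ X with z / 2 ^ (ρ x - 1) = x / 2 ^ (ρ x - 1), ((2 : ℝ) ^ (ρ x - 1))⁻¹) * ‖G z‖) + X.card * (K1 * (c * lam)) := by
          rw [Finset.sum_add_distrib, Finset.sum_const, nsmul_eq_mul]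
          congr 1
          simp only [Finset.sum_filter, Finset.sum_mul]
          rw [Finset.sum_comm]
          refine Finset.sum_congr rfl fun z _ => Finset.sum_congr rfl fun x _ => ?_
          split_ifs <;> simp
      _ ≤ (∑ z ∈ W, (2 * lam) * ‖G z‖) + (lam * 2 ^ J) * (K1 * (c * lam)) := by
          gcongr with z hz
          exact hnear2 z hz
      _ ≤ _ := by
          rw [← Finset.mul_sum]
          have := sum_norm_le G W
          rw [hWc] at this
          have h2 : 2 * lam * ∑ z ∈ W, ‖G z‖ ≤ 2 * lam * (Real.sqrt (3 * 2 ^ J) * ‖G‖) := by gcongr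
          linarith
  have hsplit : ∑ x ∈ S, ‖G x‖ = ∑ x ∈ X, ‖G x‖ + ∑ x ∈ Y, ‖G x‖ := by
    rw [hX, hY, Finset.sum_filter_add_sum_filter_not]
  have hSS0 := SS_nonneg φ f T
  have hfinal : SS φ f T ≤ (2 * lam * Real.sqrt (3 * 2 ^ J) * Real.sqrt K2) * Real.sqrt (SS φ f T) +
      (K1 * c * lam ^ 2 * 2 ^ J + 2 * (c * c) * lam ^ 2 * 2 ^ J) := by
    have e1 : Real.sqrt (K2 * SS φ f T) = Real.sqrt K2 * Real.sqrt (SS φ f T) := Real.sqrt_mul (by linarith) _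
    rw [e1] at hG
    have : 2 * lam * (Real.sqrt (3 * 2 ^ J) * ‖G‖) ≤ 2 * lam * (Real.sqrt (3 * 2 ^ J) * (Real.sqrt K2 * Real.sqrt (SS φ f T))) := by gcongr
    linarith
  have := quad_solve hSS0 hfinal
  refine this.trans (le_of_eq ?_)
  rw [mul_pow, mul_pow, Real.sq_sqrt (by positivity), Real.sq_sqrt (by linarith)]
  ring

end BHT

namespace BHT

/-- spatial containment in a top interval -/
def inTop (J : ℕ) (M : ℤ) (P : Tile) : Prop := P.1 ≤ J ∧ P.2.1 / 2 ^ (J - P.1) = M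

lemma SS_mono {φ : Tile → H} {f : H} {T T' : Finset Tile} (h : T ⊆ T') : SS φ f T ≤ SS φ f T' :=
  Finset.sum_le_sum_of_subset_of_nonneg h fun _ _ _ => by positivity

open Classical in
lemma greedy (φ : Tile → H) (f : H) (l : Tile → ℝ) (R : Tile → ℝ → Prop) (ε σ η C0 : ℝ) (hη : 0 < η) :
    ∀ (c : ℕ) (PP : Finset Tile), PP.card ≤ c → (∀ P ∈ PP, ∀ θ, R P θ → ε * θ ≤ C0) →
    ∃ (n : ℕ) (J : ℕ → ℕ) (M : ℕ → ℤ) (θ : ℕ → ℝ) (T : ℕ → Finset Tile) (PP' : Finset Tile),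
      (∀ s < n, T s ⊆ PP ∧ ∀ P ∈ T s, inTop (J s) (M s) P ∧ R P (θ s)) ∧
      (∀ s < n, σ ^ 2 * 2 ^ J s < SS φ f (T s)) ∧
      (∀ s t, s < t → t < n → (∀ Q ∈ T t, Q ∉ T s ∧ ¬ (inTop (J s) (M s) Q ∧ |l Q - 2 ^ Q.1 * θ s| ≤ 3)) ∧
        ε * θ t < ε * θ s + η) ∧
      PP' ⊆ PP ∧
      (∀ J M θ, SS φ f (PP'.filter fun P => inTop J M P ∧ R P θ) ≤ σ ^ 2 * 2 ^ J) ∧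
      (∀ P ∈ PP, P ∉ PP' → ∃ s < n, inTop (J s) (M s) P ∧ (R P (θ s) ∨ |l P - 2 ^ P.1 * θ s| ≤ 3)) := by
  intro c
  induction c with
  | zero =>
    intro PP hc _
    have : PP = ∅ := Finset.card_eq_zero.1 (by omega)
    subst this
    refine ⟨0, fun _ => 0, fun _ => 0, fun _ => 0, fun _ => ∅, ∅, by simp, by simp, by simp, by simp, ?_, by simp⟩
    intro J M θ
    simp [SS]
    positivity
  | succ c ih =>
    intro PP hc hC0
    by_cases hgood : ∀ J M θ, SS φ f (PP.filter fun P => inTop J M P ∧ R P θ) ≤ σ ^ 2 * 2 ^ J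
    · refine ⟨0, fun _ => 0, fun _ => 0, fun _ => 0, fun _ => ∅, PP, by simp, by simp, by simp, by simp, hgood, ?_⟩
      intro P h1 h2; exact absurd h1 h2
    push Not at hgood
    set B : Set ℝ := {u | ∃ J M θ, σ ^ 2 * 2 ^ J < SS φ f (PP.filter fun P => inTop J M P ∧ R P θ) ∧ u = ε * θ} with hB
    have hBne : B.Nonempty := by
      obtain ⟨J, M, θ, h⟩ := hgood
      exact ⟨_, J, M, θ, h, rfl⟩
    have hBb : BddAbove B := by
      refine ⟨C0, ?_⟩
      rintro u ⟨J, M, θ, h, rfl⟩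
      have h0 : 0 < SS φ f (PP.filter fun P => inTop J M P ∧ R P θ) := lt_of_le_of_lt (by positivity) h
      have hne : (PP.filter fun P => inTop J M P ∧ R P θ).Nonempty := by
        by_contra hne
        rw [Finset.not_nonempty_iff_eq_empty] at hne
        rw [hne] at h0
        simp [SS] at h0
      obtain ⟨P, hP⟩ := hne
      rw [Finset.mem_filter] at hP
      exact hC0 P hP.1 θ hP.2.2
    obtain ⟨u, ⟨J0, M0, θ0, hbad, rfl⟩, hu⟩ := exists_lt_of_lt_csSup hBne (show sSup B - η < sSup B by linarith)
    set T0 := PP.filter fun P => inTop J0 M0 P ∧ R P θ0 with hT0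
    set PP1 := PP.filter fun P => ¬ (inTop J0 M0 P ∧ (R P θ0 ∨ |l P - 2 ^ P.1 * θ0| ≤ 3)) with hPP1
    have hT0ne : T0.Nonempty := by
      by_contra hne
      rw [Finset.not_nonempty_iff_eq_empty] at hne
      rw [hne] at hbad
      simp only [SS, Finset.sum_empty] at hbad
      have : 0 ≤ σ ^ 2 * 2 ^ J0 := by positivity
      linarith
    have hcard : PP1.card ≤ c := by
      have : PP1 ⊂ PP := by
        refine Finset.filter_ssubset.2 ?_
        obtain ⟨P, hP⟩ := hT0ne
        rw [hT0, Finset.mem_filter] at hP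
        exact ⟨P, hP.1, fun h => h ⟨hP.2.1, Or.inl hP.2.2⟩⟩
      have := Finset.card_lt_card this
      omega
    have hsub : PP1 ⊆ PP := Finset.filter_subset _ _
    obtain ⟨n, J, M, θ, T, PP', h1, h2, h3, h4, h5, h6⟩ := ih PP1 hcard (fun P hP => hC0 P (hsub hP))
    refine ⟨n + 1, fun s => Nat.casesOn s J0 J, fun s => Nat.casesOn s M0 M, fun s => Nat.casesOn s θ0 θ,
      fun s => Nat.casesOn s T0 T, PP', ?_, ?_, ?_, h4.trans hsub, h5, ?_⟩
    · intro s hs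
      rcases s with _ | s
      · exact ⟨Finset.filter_subset _ _, fun P hP => (Finset.mem_filter.1 hP).2⟩
      · exact ⟨(h1 s (by omega)).1.trans hsub, (h1 s (by omega)).2⟩
    · intro s hs
      rcases s with _ | s
      · exact hbad
      · exact h2 s (by omega)
    · intro s t hst ht
      rcases t with _ | t
      · omega
      rcases s with _ | s
      · refine ⟨?_, ?_⟩
        · intro Q hQ
          have hQ1 := (h1 t (by omega)).1 hQ
          rw [hPP1, Finset.mem_filter] at hQ1
          refine ⟨fun h => ?_, fun h => hQ1.2 ⟨h.1, Or.inr h.2⟩⟩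
          have := (Finset.mem_filter.1 h).2
          exact hQ1.2 ⟨this.1, Or.inl this.2⟩
        · have hmem : ε * θ t ∈ B := by
            refine ⟨J t, M t, θ t, lt_of_lt_of_le (h2 t (by omega)) (SS_mono ?_), rfl⟩
            intro P hP
            rw [Finset.mem_filter]
            exact ⟨hsub ((h1 t (by omega)).1 hP), (h1 t (by omega)).2 P hP⟩
          have := le_csSup hBb hmem
          show ε * θ t < ε * θ0 + η
          linarith
      · exact h3 s t (by omega) (by omega)
    · intro P hP hP'
      by_cases hP1 : P ∈ PP1
      · obtain ⟨s, hs, h⟩ := h6 P hP1 hP'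
        exact ⟨s + 1, by omega, h⟩
      · refine ⟨0, by omega, ?_⟩
        by_contra h
        exact hP1 (Finset.mem_filter.2 ⟨hP, h⟩)

/-- off-tree mass -/
lemma off_tree : ∃ C : ℝ, 1 ≤ C ∧ ∀ (T : Finset Tile) (J : ℕ) (M : ℤ) (X : Finset ℤ),
    (∀ P ∈ T, inTop J M P) → (∀ P ∈ T, ∀ Q ∈ T, P.1 = Q.1 → P.2.2 = Q.2.2) →
    (∀ x ∈ X, x / 2 ^ J ≠ M) → ∑ P ∈ T, ∑ x ∈ X, (del P x ^ 4)⁻¹ ≤ C * 2 ^ J := by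
  obtain ⟨C, hC1, hC⟩ := L1
  obtain ⟨C', hC1', hC'⟩ := tree_sum_del
  refine ⟨C' * (4 * C), by nlinarith, fun T J M X htop hlab hX => ?_⟩
  set g : ℤ → ℕ → ℝ := fun x j => ((1 + |(x : ℝ) / 2 ^ j - M * 2 ^ J / 2 ^ j|) ^ 2)⁻¹ +
    ((1 + |(x : ℝ) / 2 ^ j - (M + 1) * 2 ^ J / 2 ^ j|) ^ 2)⁻¹ with hg
  have hg0 : ∀ x j, 0 ≤ g x j := fun x j => by simp only [hg]; positivity
  have hb : ∀ P ∈ T, ∀ x ∈ X, (del P x ^ 4)⁻¹ ≤ g x P.1 * (del P x ^ 2)⁻¹ := by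
    intro P hP x hx
    have hd := del_pos P x
    have e : (del P x ^ 4)⁻¹ = (del P x ^ 2)⁻¹ * (del P x ^ 2)⁻¹ := by
      rw [← mul_inv]; congr 1; ring
    rw [e]
    refine mul_le_mul_of_nonneg_right ?_ (by positivity)
    obtain ⟨ht1, ht2⟩ := htop P hP
    obtain ⟨r, hr⟩ := Nat.exists_eq_add_of_le ht1
    rw [hr, Nat.add_sub_cancel_left] at ht2
    have hp : (0 : ℤ) < 2 ^ r := by positivity
    have hn1 : M * 2 ^ r ≤ P.2.1 := by rw [← ht2]; exact Int.ediv_mul_le _ hp.ne'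
    have hn2 : P.2.1 + 1 ≤ (M + 1) * 2 ^ r := by
      rw [← ht2]; have := Int.lt_ediv_add_one_mul_self P.2.1 hp; omega
    have hn1' : (M : ℝ) * 2 ^ r ≤ P.2.1 := by exact_mod_cast hn1
    have hn2' : (P.2.1 : ℝ) + 1 ≤ (M + 1) * 2 ^ r := by exact_mod_cast hn2
    have hpJ : (0 : ℤ) < 2 ^ J := by positivity
    have h2 : (0 : ℝ) < 2 ^ P.1 := by positivity
    have eJ : (2 : ℝ) ^ J / 2 ^ P.1 = 2 ^ r := by rw [hr, pow_add]; field_simp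
    simp only [hg]
    rw [mul_div_assoc, mul_div_assoc, eJ]
    rcases lt_or_gt_of_ne (hX x hx) with h | h
    · have h3 : x < M * 2 ^ J := (Int.ediv_lt_iff_lt_mul hpJ).1 h
      have h3' : (x : ℝ) < M * 2 ^ J := by exact_mod_cast h3
      have h4 : (x : ℝ) / 2 ^ P.1 < M * 2 ^ r := by
        rw [← eJ, ← mul_div_assoc]; exact div_lt_div_of_pos_right h3' h2
      have : ((del P x) ^ 2)⁻¹ ≤ ((1 + |(x : ℝ) / 2 ^ P.1 - M * 2 ^ r|) ^ 2)⁻¹ := by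
        apply inv_anti₀ (by positivity)
        apply pow_le_pow_left₀ (by positivity)
        unfold del
        rw [abs_of_neg (by linarith), abs_of_neg (by linarith)]
        linarith
      refine this.trans (le_add_of_nonneg_right (by positivity))
    · have h3 : (M + 1) * 2 ^ J ≤ x := (Int.le_ediv_iff_mul_le hpJ).1 h
      have h3' : ((M : ℝ) + 1) * 2 ^ J ≤ x := by exact_mod_cast h3
      have h4 : ((M : ℝ) + 1) * 2 ^ r ≤ (x : ℝ) / 2 ^ P.1 := by
        rw [← eJ, ← mul_div_assoc]; exact div_le_div_of_nonneg_right h3' h2.le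
      have : ((del P x) ^ 2)⁻¹ ≤ ((1 + |(x : ℝ) / 2 ^ P.1 - (M + 1) * 2 ^ r|) ^ 2)⁻¹ := by
        apply inv_anti₀ (by positivity)
        apply pow_le_pow_left₀ (by positivity)
        unfold del
        rw [abs_of_nonneg (by linarith), abs_of_nonneg (by linarith)]
        linarith
      refine this.trans (le_add_of_nonneg_left (by positivity))
  calc ∑ P ∈ T, ∑ x ∈ X, (del P x ^ 4)⁻¹ = ∑ x ∈ X, ∑ P ∈ T, (del P x ^ 4)⁻¹ := Finset.sum_comm
    _ ≤ ∑ x ∈ X, ∑ P ∈ T, g x P.1 * (del P x ^ 2)⁻¹ :=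
        Finset.sum_le_sum fun x hx => Finset.sum_le_sum fun P hP => hb P hP x hx
    _ ≤ ∑ x ∈ X, C' * ∑ j ∈ T.image Prod.fst, g x j := Finset.sum_le_sum fun x _ => hC' T hlab (g x) (hg0 x) x
    _ = C' * ∑ j ∈ T.image Prod.fst, ∑ x ∈ X, g x j := by rw [← Finset.mul_sum, Finset.sum_comm]
    _ ≤ C' * ∑ j ∈ T.image Prod.fst, (2 * C) * 2 ^ j := by
        gcongr with j _
        simp only [hg]
        rw [Finset.sum_add_distrib]
        have := hC X j (M * 2 ^ J / 2 ^ j)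
        have := hC X j ((M + 1) * 2 ^ J / 2 ^ j)
        linarith
    _ ≤ C' * ∑ j ∈ Finset.range (J + 1), (2 * C) * 2 ^ j := by
        gcongr
        intro j hj
        obtain ⟨P, hP, rfl⟩ := Finset.mem_image.1 hj
        exact Finset.mem_range.2 (by have := (htop P hP).1; omega)
    _ ≤ _ := by
        rw [← Finset.mul_sum]
        have := geom_sum_eq (show (2 : ℝ) ≠ 1 by norm_num) (J + 1)
        rw [this]
        have e : ((2 : ℝ) ^ (J + 1) - 1) / (2 - 1) ≤ 2 * 2 ^ J := by rw [pow_succ]; linarith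
        calc C' * (2 * C * (((2 : ℝ) ^ (J + 1) - 1) / (2 - 1))) ≤ C' * (2 * C * (2 * 2 ^ J)) := by gcongr
          _ = _ := by ring

end BHT

namespace BHT

lemma inTop_dyad {J : ℕ} {M : ℤ} {P : Tile} (h : inTop J M P) {x : ℤ} (hx : x ∈ dyad P.1 P.2.1) : x / 2 ^ J = M := by
  rw [mem_dyad] at hx
  rw [← h.2, ← hx, Int.ediv_ediv_of_nonneg (by positivity), ← pow_add, Nat.add_sub_cancel' h.1]

lemma not_inTop_dyad {J : ℕ} {M : ℤ} {P : Tile} (hJ : P.1 ≤ J) (h : ¬ inTop J M P) {x : ℤ} (hx : x ∈ dyad P.1 P.2.1) :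
    x / 2 ^ J ≠ M := by
  intro h1
  apply h
  refine ⟨hJ, ?_⟩
  rw [mem_dyad] at hx
  rw [← hx, Int.ediv_ediv_of_nonneg (by positivity), ← pow_add, Nat.add_sub_cancel' hJ, h1]

/-- key numeric lemma -/
lemma key_num {ε C2 lP lQ θs θt p q : ℝ} (hε : ε = 1 ∨ ε = -1) (hP : ε * (lP - p * θs) ≤ C2) (hP4 : 4 ≤ ε * (lP - p * θs))
    (hQ : 4 ≤ ε * (lQ - q * θt)) (hp : 0 < p) (hq : 0 < q) (hC : C2 * q ≤ p)
    (hd : |lP / p - lQ / q| ≤ 3 / 2 * q⁻¹) : ε * θt + q⁻¹ ≤ ε * θs ∧ |lQ - q * θs| ≤ 3 := by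
  have h1 : C2 / p ≤ q⁻¹ := by
    rw [div_le_iff₀ hp, inv_mul_eq_div, le_div_iff₀ hq]; exact hC
  obtain ⟨a1, a2⟩ := abs_le.1 hd
  have hqi : 0 < q⁻¹ := inv_pos.2 hq
  have e1 : (lP - p * θs) = p * (lP / p - θs) := by field_simp
  have e2 : (lQ - q * θt) = q * (lQ / q - θt) := by field_simp
  have e3 : (lQ - q * θs) = q * (lQ / q - θs) := by field_simp
  have hPs : ε * (lP / p - θs) ≤ C2 / p := by rw [le_div_iff₀ hp]; rw [e1] at hP; linarith
  have hPs0 : 0 ≤ ε * (lP / p - θs) := by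
    have : 0 ≤ p * (ε * (lP / p - θs)) := by rw [e1] at hP4; linarith
    exact nonneg_of_mul_nonneg_right this hp
  have hQt : 4 * q⁻¹ ≤ ε * (lQ / q - θt) := by
    rw [← div_eq_mul_inv, div_le_iff₀ hq]; rw [e2] at hQ; linarith
  have h3 : |lQ / q - θs| ≤ 3 * q⁻¹ := by
    rw [abs_le]
    rcases hε with rfl | rfl <;> constructor <;> linarith
  constructor
  · rcases hε with rfl | rfl <;> linarith
  · rw [e3, abs_mul, abs_of_pos hq]
    calc q * |lQ / q - θs| ≤ q * (3 * q⁻¹) := by gcongr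
      _ = 3 := by field_simp

open Classical in
lemma select : ∃ K : ℝ, 1 ≤ K ∧ ∀ (N : ℕ) (_ : 6 ≤ N) (φ : Tile → H) (l : Tile → ℝ) (R : Tile → ℝ → Prop) (ε C2 : ℝ)
    (PP : Finset Tile) (f : H) (σ : ℝ), Pk N φ l PP → (ε = 1 ∨ ε = -1) → 8 ≤ C2 → 0 < σ →
    (∀ P ∈ PP, ∀ θ, R P θ → 4 ≤ ε * (l P - 2 ^ P.1 * θ) ∧ ε * (l P - 2 ^ P.1 * θ) ≤ C2) →
    (∀ P ∈ PP, ∀ Q ∈ PP, Q.1 < P.1 → C2 * 2 ^ Q.1 ≤ 2 ^ P.1) →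
    (∀ P ∈ PP, ∀ Q ∈ PP, P.1 = Q.1 → |l P - l Q| ≤ 6 → P.2.2 = Q.2.2) →
    (∀ P ∈ PP, ∀ Q ∈ PP, P.1 = Q.1 → ∀ θ, R P θ → R Q θ → P.2.2 = Q.2.2) →
    (∀ P ∈ PP, ‖inner ℂ (φ P) f‖ ≤ 2 * σ) →
    ∃ (n : ℕ) (J : ℕ → ℕ) (M : ℕ → ℤ) (θ : ℕ → ℝ) (PP' : Finset Tile),
      PP' ⊆ PP ∧ σ ^ 2 * (∑ s ∈ Finset.range n, (2 : ℝ) ^ J s) ≤ K * ‖f‖ ^ 2 ∧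
      (∀ J M θ, SS φ f (PP'.filter fun P => inTop J M P ∧ R P θ) ≤ σ ^ 2 * 2 ^ J) ∧
      (∀ P ∈ PP, P ∉ PP' → ∃ s < n, inTop (J s) (M s) P ∧ (R P (θ s) ∨ |l P - 2 ^ P.1 * θ s| ≤ 3)) := by
  obtain ⟨K1, hK1, hIP⟩ := IP
  obtain ⟨K2, hK2, hdiag⟩ := diag
  obtain ⟨C, hC1, hoff⟩ := off_tree
  refine ⟨K2 + 8 * K1 * C, by nlinarith, fun N hN φ l R ε C2 PP f σ hpk hε hC2 hσ hR hsc hlab hRlab ha => ?_⟩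
  set Jm := PP.sup Prod.fst with hJm
  have hJm' : ∀ P ∈ PP, P.1 ≤ Jm := fun P hP => Finset.le_sup (f := Prod.fst) hP
  set η : ℝ := ((2 : ℝ) ^ Jm)⁻¹ with hη
  have hηpos : 0 < η := by positivity
  obtain ⟨C0, hC0⟩ : ∃ C0, ∀ P ∈ PP, ∀ θ, R P θ → ε * θ ≤ C0 := by
    refine ⟨∑ P ∈ PP, |l P|, fun P hP θ h => ?_⟩
    have h1 := (hR P hP θ h).1
    have h2 : |l P| ≤ ∑ P ∈ PP, |l P| := Finset.single_le_sum (f := fun P => |l P|) (fun _ _ => abs_nonneg _) hP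
    refine le_trans ?_ h2
    have h3 : ε * l P ≤ |l P| := by
      rcases hε with rfl | rfl
      · rw [one_mul]; exact le_abs_self _
      · have := neg_abs_le (l P); linarith
    have h4 : (1 : ℝ) ≤ 2 ^ P.1 := one_le_pow₀ (by norm_num)
    have h5 : 2 ^ P.1 * (ε * θ) ≤ |l P| := by linarith
    rcases le_or_gt (ε * θ) 0 with h6 | h6
    · exact h6.trans (abs_nonneg _)
    · nlinarith
  obtain ⟨n, J, M, θ, T, PP', h1, h2, h3, h4, h5, h6⟩ := greedy φ f l R ε σ η C0 hηpos _ PP le_rfl hC0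
  refine ⟨n, J, M, θ, PP', h4, ?_, h5, h6⟩
  have hdisj : ∀ s < n, ∀ t < n, ∀ Q, Q ∈ T s → Q ∈ T t → s = t := by
    intro s hs t ht Q hQs hQt
    rcases lt_trichotomy s t with h | h | h
    · exact absurd hQs ((h3 s t h ht).1 Q hQt).1
    · exact h
    · exact absurd hQt ((h3 t s h hs).1 Q hQs).1
  -- key
  have key : ∀ s < n, ∀ t < n, ∀ P ∈ T s, ∀ Q ∈ T t, Q.1 < P.1 →
      |l P / 2 ^ P.1 - l Q / 2 ^ Q.1| ≤ 3 / 2 * ((2 : ℝ) ^ Q.1)⁻¹ → ∀ x ∈ dyad Q.1 Q.2.1, x / 2 ^ J s ≠ M s := by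
    intro s hs t ht P hP Q hQ hPQ hd
    have hPm := (h1 s hs).1 hP
    have hQm := (h1 t ht).1 hQ
    obtain ⟨hPt, hPR⟩ := (h1 s hs).2 P hP
    obtain ⟨hQt, hQR⟩ := (h1 t ht).2 Q hQ
    obtain ⟨k1, k2⟩ := key_num hε (hR P hPm _ hPR).2 (hR P hPm _ hPR).1 (hR Q hQm _ hQR).1 (by positivity) (by positivity)
      (hsc P hPm Q hQm hPQ) hd
    have hηQ : η ≤ ((2 : ℝ) ^ Q.1)⁻¹ := by
      apply inv_anti₀ (by positivity)
      exact pow_le_pow_right₀ (by norm_num) (hJm' Q hQm)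
    have hst : s < t := by
      rcases lt_trichotomy s t with h | h | h
      · exact h
      · subst h; linarith
      · have := (h3 t s h hs).2; linarith
    intro x hx
    refine not_inTop_dyad (by have := hPt.1; omega) (fun h => ?_) hx
    exact ((h3 s t hst ht).1 Q hQ).2 ⟨h, k2⟩
  set U : Finset Tile := (Finset.range n).biUnion T with hU
  have hUPP : U ⊆ PP := by
    intro P hP
    rw [hU, Finset.mem_biUnion] at hP
    obtain ⟨s, hs, hP⟩ := hP
    exact (h1 s (Finset.mem_range.1 hs)).1 hP
  have hpd : Set.PairwiseDisjoint (↑(Finset.range n)) T := by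
    intro s hs t ht hst
    rw [Function.onFun, Finset.disjoint_left]
    intro Q hQs hQt
    exact hst (hdisj s (by simpa using hs) t (by simpa using ht) Q hQs hQt)
  have hsumU : ∀ g : Tile → ℝ, ∑ P ∈ U, g P = ∑ s ∈ Finset.range n, ∑ P ∈ T s, g P := fun g => Finset.sum_biUnion hpd
  have hσS : σ ^ 2 * (∑ s ∈ Finset.range n, (2 : ℝ) ^ J s) ≤ SS φ f U := by
    unfold SS
    rw [hsumU, Finset.mul_sum]
    exact Finset.sum_le_sum fun s hs => (h2 s (Finset.mem_range.1 hs)).le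
  refine hσS.trans (bessel (by nlinarith) ?_)
  have hpkU := hpk.mono hUPP
  have hclose : ∀ P ∈ U, ∀ Q ∈ U, inner ℂ (φ P) (φ Q) ≠ 0 →
      |l P / 2 ^ P.1 - l Q / 2 ^ Q.1| ≤ ((2 : ℝ) ^ P.1)⁻¹ + ((2 : ℝ) ^ Q.1)⁻¹ := by
    intro P hP Q hQ h
    by_contra hc
    exact h (hpkU.orth P hP Q hQ (not_le.1 hc))
  have hsc8 : ∀ P ∈ PP, ∀ Q ∈ PP, Q.1 < P.1 → 8 * ((2 : ℝ) ^ P.1)⁻¹ ≤ ((2 : ℝ) ^ Q.1)⁻¹ := by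
    intro P hP Q hQ h
    have := hsc P hP Q hQ h
    rw [← div_eq_mul_inv, div_le_iff₀ (by positivity), inv_mul_eq_div, le_div_iff₀ (by positivity)]
    refine le_trans ?_ this
    gcongr
  have hdiagU := hdiag N hN φ l U hpkU (fun P hP Q hQ hPQ h => by
    refine hlab P (hUPP hP) Q (hUPP hQ) hPQ ?_
    have h7 := hclose P hP Q hQ h
    rw [hPQ, ← sub_div, abs_div, abs_of_pos (by positivity : (0 : ℝ) < 2 ^ Q.1), div_le_iff₀ (by positivity)] at h7
    refine h7.trans ?_
    rw [add_mul, inv_mul_cancel₀ (by positivity)]; norm_num) f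
  set b : Tile → Tile → ℝ := fun P Q => ‖inner ℂ (φ P) f‖ * ‖inner ℂ (φ Q) f‖ *
      (2 ^ P.1 * 2 ^ Q.1 * ‖inner ℂ (φ P) (φ Q)‖) with hb
  have hbsymm : ∀ P Q, b P Q = b Q P := by
    intro P Q; simp only [hb]; rw [norm_inner_symm (𝕜 := ℂ) (φ P) (φ Q)]; ring
  have hb0 : ∀ P Q, 0 ≤ b P Q := fun P Q => by simp only [hb]; positivity
  -- lower part
  have hlow : ∑ P ∈ U, ∑ Q ∈ U with Q.1 < P.1, b P Q ≤ (4 * K1 * C) * SS φ f U := by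
    have hP1 : ∀ s < n, ∑ P ∈ T s, ∑ Q ∈ U with Q.1 < P.1, b P Q ≤ 4 * K1 * C * (σ ^ 2 * 2 ^ J s) := by
      intro s hs
      set X : Finset ℤ := (U.biUnion fun Q => dyad Q.1 Q.2.1).filter (fun x => x / 2 ^ J s ≠ M s) with hX
      have hP2 : ∀ P ∈ T s, ∑ Q ∈ U with Q.1 < P.1, b P Q ≤ 4 * σ ^ 2 * K1 * ∑ x ∈ X, (del P x ^ 4)⁻¹ := by
        intro P hP
        have hPU : P ∈ U := Finset.mem_biUnion.2 ⟨s, Finset.mem_range.2 hs, hP⟩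
        have hPm := hUPP hPU
        set V := U.filter (fun Q => Q.1 < P.1 ∧ inner ℂ (φ P) (φ Q) ≠ 0) with hV
        have hVc : ∀ Q ∈ V, |l P / 2 ^ P.1 - l Q / 2 ^ Q.1| ≤ 9 / 8 * ((2 : ℝ) ^ Q.1)⁻¹ := by
          intro Q hQ
          obtain ⟨q1, q2, q3⟩ := Finset.mem_filter.1 hQ
          have := hclose P hPU Q q1 q3
          have := hsc8 P hPm Q (hUPP q1) q2
          linarith
        have hVd : Set.PairwiseDisjoint (↑V) (fun Q : Tile => dyad Q.1 Q.2.1) := by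
          have hlt : ∀ Q ∈ V, ∀ Q' ∈ V, Q.1 < Q'.1 → Disjoint (dyad Q.1 Q.2.1) (dyad Q'.1 Q'.2.1) := by
            intro Q hQ Q' hQ' hlt
            have c1 := hVc Q hQ
            have c2 := hVc Q' hQ'
            obtain ⟨q1, -⟩ := Finset.mem_filter.1 hQ
            obtain ⟨q1', -⟩ := Finset.mem_filter.1 hQ'
            have c3 := hsc8 Q' (hUPP q1') Q (hUPP q1) hlt
            obtain ⟨t, ht, hQt⟩ := Finset.mem_biUnion.1 q1
            obtain ⟨t', ht', hQt'⟩ := Finset.mem_biUnion.1 q1'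
            rw [Finset.mem_range] at ht ht'
            have hd : |l Q' / 2 ^ Q'.1 - l Q / 2 ^ Q.1| ≤ 3 / 2 * ((2 : ℝ) ^ Q.1)⁻¹ := by
              rw [abs_le] at c1 c2 ⊢
              constructor <;> linarith
            have hk := key t' ht' t ht Q' hQt' Q hQt hlt hd
            rw [Finset.disjoint_left]
            intro x hx hx'
            exact hk x hx (inTop_dyad ((h1 t' ht').2 Q' hQt').1 hx')
          intro Q hQ Q' hQ' hne
          rw [Finset.mem_coe] at hQ hQ'
          rw [Function.onFun]
          rcases lt_trichotomy Q.1 Q'.1 with h | h | h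
          · exact hlt Q hQ Q' hQ' h
          · have c1 := hVc Q hQ
            have c2 := hVc Q' hQ'
            obtain ⟨q1, -⟩ := Finset.mem_filter.1 hQ
            obtain ⟨q1', -⟩ := Finset.mem_filter.1 hQ'
            have hl : Q.2.2 = Q'.2.2 := by
              refine hlab Q (hUPP q1) Q' (hUPP q1') h ?_
              rw [← h] at c2
              have hp : (0 : ℝ) < 2 ^ Q.1 := by positivity
              have hd : |l Q / 2 ^ Q.1 - l Q' / 2 ^ Q.1| ≤ 6 * ((2 : ℝ) ^ Q.1)⁻¹ := by
                have : 0 < ((2 : ℝ) ^ Q.1)⁻¹ := by positivity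
                rw [abs_le] at c1 c2 ⊢
                constructor <;> linarith
              rw [← sub_div, abs_div, abs_of_pos hp, div_le_iff₀ hp, mul_assoc, inv_mul_cancel₀ hp.ne', mul_one] at hd
              exact hd
            rw [Finset.disjoint_left]
            intro x hx hx'
            rw [mem_dyad] at hx hx'
            apply hne
            refine Prod.ext h (Prod.ext ?_ hl)
            rw [← hx, ← hx', h]
          · exact (hlt Q' hQ' Q hQ h).symm
        calc ∑ Q ∈ U with Q.1 < P.1, b P Q = ∑ Q ∈ V, b P Q := by
              symm
              refine Finset.sum_subset (fun Q hQ => ?_) ?_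
              · obtain ⟨q1, q2, q3⟩ := Finset.mem_filter.1 hQ
                exact Finset.mem_filter.2 ⟨q1, q2⟩
              · intro Q hQ hQ'
                obtain ⟨q1, q2⟩ := Finset.mem_filter.1 hQ
                have : inner ℂ (φ P) (φ Q) = 0 := by
                  by_contra h
                  exact hQ' (Finset.mem_filter.2 ⟨q1, q2, h⟩)
                simp only [hb, this, norm_zero, mul_zero]
          _ ≤ ∑ Q ∈ V, 4 * σ ^ 2 * K1 * ∑ x ∈ dyad Q.1 Q.2.1, (del P x ^ 4)⁻¹ := by
              refine Finset.sum_le_sum fun Q hQ => ?_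
              obtain ⟨q1, q2, q3⟩ := Finset.mem_filter.1 hQ
              have i1 := hIP N hN φ l U hpkU P hPU Q q1 q2.le
              have i2 := ha P hPm
              have i3 := ha Q (hUPP q1)
              calc b P Q ≤ (2 * σ) * (2 * σ) * (K1 * ∑ x ∈ dyad Q.1 Q.2.1, (del P x ^ 4)⁻¹) := by
                    simp only [hb]; gcongr
                _ = _ := by ring
          _ = 4 * σ ^ 2 * K1 * ∑ x ∈ V.biUnion (fun Q => dyad Q.1 Q.2.1), (del P x ^ 4)⁻¹ := by
              rw [← Finset.mul_sum, Finset.sum_biUnion hVd]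
          _ ≤ _ := by
              refine mul_le_mul_of_nonneg_left ?_ (by positivity)
              refine Finset.sum_le_sum_of_subset_of_nonneg ?_ (fun x _ _ => by have := del_pos P x; positivity)
              intro x hx
              obtain ⟨Q, hQ, hx⟩ := Finset.mem_biUnion.1 hx
              have c1 := hVc Q hQ
              obtain ⟨q1, q2, q3⟩ := Finset.mem_filter.1 hQ
              refine Finset.mem_filter.2 ⟨Finset.mem_biUnion.2 ⟨Q, q1, hx⟩, ?_⟩
              obtain ⟨t, ht, hQt⟩ := Finset.mem_biUnion.1 q1
              rw [Finset.mem_range] at ht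
              refine key s hs t ht P hP Q hQt q2 (c1.trans ?_) x hx
              exact mul_le_mul_of_nonneg_right (by norm_num) (by positivity)
      calc _ ≤ ∑ P ∈ T s, 4 * σ ^ 2 * K1 * ∑ x ∈ X, (del P x ^ 4)⁻¹ := Finset.sum_le_sum hP2
        _ = 4 * σ ^ 2 * K1 * ∑ P ∈ T s, ∑ x ∈ X, (del P x ^ 4)⁻¹ := by rw [Finset.mul_sum]
        _ ≤ 4 * σ ^ 2 * K1 * (C * 2 ^ J s) := by
            refine mul_le_mul_of_nonneg_left ?_ (by positivity)
            refine hoff (T s) (J s) (M s) X (fun P hP => ((h1 s hs).2 P hP).1) ?_ (fun x hx => (Finset.mem_filter.1 hx).2)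
            intro P hP Q hQ hPQ
            exact hRlab P ((h1 s hs).1 hP) Q ((h1 s hs).1 hQ) hPQ (θ s) ((h1 s hs).2 P hP).2 ((h1 s hs).2 Q hQ).2
        _ = _ := by ring
    rw [hsumU]
    calc _ ≤ ∑ s ∈ Finset.range n, 4 * K1 * C * (σ ^ 2 * 2 ^ J s) :=
          Finset.sum_le_sum fun s hs => hP1 s (Finset.mem_range.1 hs)
      _ = 4 * K1 * C * (σ ^ 2 * ∑ s ∈ Finset.range n, (2 : ℝ) ^ J s) := by rw [← Finset.mul_sum, ← Finset.mul_sum]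
      _ ≤ _ := by gcongr
  have hup : ∑ P ∈ U, ∑ Q ∈ U with P.1 < Q.1, b P Q = ∑ P ∈ U, ∑ Q ∈ U with Q.1 < P.1, b P Q := by
    simp only [Finset.sum_filter]
    rw [Finset.sum_comm]
    simp only [hbsymm]
  have hsplit : BB φ f U = ∑ P ∈ U, ∑ Q ∈ U with Q.1 = P.1, b P Q + ∑ P ∈ U, ∑ Q ∈ U with Q.1 < P.1, b P Q +
      ∑ P ∈ U, ∑ Q ∈ U with P.1 < Q.1, b P Q := by
    unfold BB
    rw [← Finset.sum_add_distrib, ← Finset.sum_add_distrib]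
    refine Finset.sum_congr rfl fun P _ => ?_
    simp only [Finset.sum_filter]
    rw [← Finset.sum_add_distrib, ← Finset.sum_add_distrib]
    refine Finset.sum_congr rfl fun Q _ => ?_
    rcases lt_trichotomy Q.1 P.1 with h | h | h
    · simp [h, h.ne, h.not_gt, hb]
    · simp [h, hb]
    · simp [h, h.ne', h.not_gt, hb]
  rw [hsplit, hup]
  calc _ ≤ K2 * SS φ f U + 4 * K1 * C * SS φ f U + 4 * K1 * C * SS φ f U := add_le_add (add_le_add hdiagU hlow) hlow
    _ = _ := by ring

end BHT

namespace BHT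

/-- membership in a `k`-tree -/
def kt (d : Fin 3 → ℝ) (l : Fin 3 → Tile → ℝ) (k : Fin 3) (J : ℕ) (M : ℤ) (θ : ℝ) (P : Tile) : Prop :=
  inTop J M P ∧ |l k P - 2 ^ P.1 * (d k * θ)| ≤ 3

/-- model data -/
structure Model (d : Fin 3 → ℝ) (C2 : ℝ) (N : ℕ) (φ : Fin 3 → Tile → H) (l : Fin 3 → Tile → ℝ)
    (ε : Fin 3 → Fin 3 → ℝ) (PP : Finset Tile) : Prop where
  pk : ∀ i, Pk N (φ i) (l i) PP
  dne : ∀ i, d i ≠ 0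
  eps : ∀ i k, ε i k = 1 ∨ ε i k = -1
  C2le : 8 ≤ C2
  lac : ∀ i k, i ≠ k → ∀ P ∈ PP, ∀ θ : ℝ, |l k P - 2 ^ P.1 * (d k * θ)| ≤ 3 →
    4 ≤ ε i k * (l i P - 2 ^ P.1 * (d i * θ)) ∧ ε i k * (l i P - 2 ^ P.1 * (d i * θ)) ≤ C2
  sc : ∀ P ∈ PP, ∀ Q ∈ PP, Q.1 < P.1 → C2 * 2 ^ Q.1 ≤ 2 ^ P.1
  lab : ∀ i, ∀ P ∈ PP, ∀ Q ∈ PP, P.1 = Q.1 → |l i P - l i Q| ≤ 6 → P.2.2 = Q.2.2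

lemma Model.mono {d : Fin 3 → ℝ} {C2 : ℝ} {N : ℕ} {φ : Fin 3 → Tile → H} {l : Fin 3 → Tile → ℝ}
    {ε : Fin 3 → Fin 3 → ℝ} {PP PP' : Finset Tile} (h : Model d C2 N φ l ε PP) (hs : PP' ⊆ PP) :
    Model d C2 N φ l ε PP' :=
  ⟨fun i => (h.pk i).mono hs, h.dne, h.eps, h.C2le, fun i k hik P hP => h.lac i k hik P (hs hP),
    fun P hP Q hQ => h.sc P (hs hP) Q (hs hQ), fun i P hP Q hQ => h.lab i P (hs hP) Q (hs hQ)⟩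

open Classical in
/-- size bound -/
def SizeLE (d : Fin 3 → ℝ) (φ : Fin 3 → Tile → H) (l : Fin 3 → Tile → ℝ) (f : Fin 3 → H) (i : Fin 3) (σ : ℝ)
    (PP : Finset Tile) : Prop :=
  ∀ k, k ≠ i → ∀ J M θ, SS (φ i) (f i) (PP.filter (kt d l k J M θ)) ≤ σ ^ 2 * 2 ^ J

lemma SizeLE.mono {d : Fin 3 → ℝ} {φ : Fin 3 → Tile → H} {l : Fin 3 → Tile → ℝ} {f : Fin 3 → H} {i : Fin 3} {σ : ℝ}
    {PP PP' : Finset Tile} (h : SizeLE d φ l f i σ PP) (hs : PP' ⊆ PP) : SizeLE d φ l f i σ PP' := by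
  classical
  intro k hk J M θ
  refine le_trans (SS_mono ?_) (h k hk J M θ)
  exact Finset.filter_subset_filter _ hs

/-- the trilinear model form -/
noncomputable def Lam (φ : Fin 3 → Tile → H) (f : Fin 3 → H) (PP : Finset Tile) : ℝ :=
  ∑ P ∈ PP, 2 ^ P.1 * ∏ i, ‖inner ℂ (φ i P) (f i)‖

lemma Lam_nonneg (φ : Fin 3 → Tile → H) (f : Fin 3 → H) (PP : Finset Tile) : 0 ≤ Lam φ f PP :=
  Finset.sum_nonneg fun _ _ => by positivity

lemma Lam_mono {φ : Fin 3 → Tile → H} {f : Fin 3 → H} {T T' : Finset Tile} (h : T ⊆ T') : Lam φ f T ≤ Lam φ f T' :=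
  Finset.sum_le_sum_of_subset_of_nonneg h fun _ _ _ => by positivity

section
variable {d : Fin 3 → ℝ} {C2 : ℝ} {N : ℕ} {φ : Fin 3 → Tile → H} {l : Fin 3 → Tile → ℝ}
    {ε : Fin 3 → Fin 3 → ℝ} {PP : Finset Tile} {f : Fin 3 → H}

lemma Model.ltree (h : Model d C2 N φ l ε PP) {T : Finset Tile} (hT : T ⊆ PP) {i k : Fin 3} (hik : i ≠ k) {J : ℕ} {M : ℤ}
    {θ : ℝ} (hk : ∀ P ∈ T, kt d l k J M θ P) : LTree (φ i) (l i) T J M (d i * θ) C2 := by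
  have hC := h.C2le
  have hor : ∀ P ∈ T, ∀ Q ∈ T, Q.1 < P.1 → inner ℂ (φ i P) (φ i Q) = 0 := by
    intro P hP Q hQ hPQ
    apply (h.pk i).orth P (hT hP) Q (hT hQ)
    have h1 := (h.lac i k hik P (hT hP) θ (hk P hP).2).2
    have h2 := (h.lac i k hik Q (hT hQ) θ (hk Q hQ).2).1
    have h3 := h.sc P (hT hP) Q (hT hQ) hPQ
    set p : ℝ := 2 ^ P.1
    set q : ℝ := 2 ^ Q.1
    have hp : 0 < p := by positivity
    have hq : 0 < q := by positivity
    have h4 : C2 / p ≤ q⁻¹ := by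
      rw [div_le_iff₀ hp, inv_mul_eq_div, le_div_iff₀ hq]; exact h3
    have h5 : 8 * p⁻¹ ≤ q⁻¹ := by
      rw [← div_eq_mul_inv]; refine le_trans ?_ h4; gcongr
    have e1 : l i P - p * (d i * θ) = p * (l i P / p - d i * θ) := by field_simp
    have e2 : l i Q - q * (d i * θ) = q * (l i Q / q - d i * θ) := by field_simp
    have h1' : ε i k * (l i P / p - d i * θ) ≤ C2 / p := by rw [le_div_iff₀ hp]; rw [e1] at h1; linarith
    have h2' : 4 * q⁻¹ ≤ ε i k * (l i Q / q - d i * θ) := by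
      rw [← div_eq_mul_inv, div_le_iff₀ hq]; rw [e2] at h2; linarith
    have hqi : 0 < q⁻¹ := by positivity
    rcases h.eps i k with he | he <;> rw [he] at h1' h2'
    · rw [lt_abs]; right; linarith
    · rw [lt_abs]; left; linarith
  refine ⟨fun P hP => (hk P hP).1, ?_, ?_, ?_⟩
  · intro P hP
    obtain ⟨h1, h2⟩ := h.lac i k hik P (hT hP) θ (hk P hP).2
    rw [abs_le]
    rcases h.eps i k with he | he <;> rw [he] at h1 h2 <;> constructor <;> linarith
  · intro P hP Q hQ hPQ
    refine h.lab k P (hT hP) Q (hT hQ) hPQ ?_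
    have h1 := abs_le.1 (hk P hP).2
    have h2 := abs_le.1 (hk Q hQ).2
    rw [hPQ] at h1
    rw [abs_le]; constructor <;> linarith
  · intro P hP Q hQ hPQ
    rcases lt_or_gt_of_ne hPQ with h1 | h1
    · have := hor Q hQ P hP h1
      rw [← inner_conj_symm, this, map_zero]
    · exact hor P hP Q hQ h1

lemma kt_self (h : ∀ i, d i ≠ 0) (k : Fin 3) (P : Tile) : ∃ θ, kt d l k P.1 P.2.1 θ P := by
  refine ⟨l k P / (2 ^ P.1 * d k), ⟨le_rfl, by simp⟩, ?_⟩
  have : l k P - 2 ^ P.1 * (d k * (l k P / (2 ^ P.1 * d k))) = 0 := by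
    have := h k
    field_simp
    ring
  rw [this]; norm_num

lemma SizeLE.single {i : Fin 3} {σ : ℝ} (h : SizeLE d φ l f i σ PP) (hd : ∀ i, d i ≠ 0) (hσ : 0 ≤ σ) {P : Tile}
    (hP : P ∈ PP) : ‖inner ℂ (φ i P) (f i)‖ ≤ σ := by
  classical
  obtain ⟨θ, hθ⟩ := kt_self (l := l) hd (i + 1) P
  have hne : i + 1 ≠ i := by fin_cases i <;> decide
  have h1 := h (i + 1) hne P.1 P.2.1 θ
  have h2 : 2 ^ P.1 * ‖inner ℂ (φ i P) (f i)‖ ^ 2 ≤ SS (φ i) (f i) (PP.filter (kt d l (i + 1) P.1 P.2.1 θ)) := by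
    unfold SS
    exact Finset.single_le_sum (f := fun P : Tile => (2 : ℝ) ^ P.1 * ‖inner ℂ (φ i P) (f i)‖ ^ 2)
      (fun _ _ => by positivity) (Finset.mem_filter.2 ⟨hP, hθ⟩)
  have hp : (0 : ℝ) < 2 ^ P.1 := by positivity
  have h3 : ‖inner ℂ (φ i P) (f i)‖ ^ 2 ≤ σ ^ 2 := by
    have h4 := h2.trans h1
    rw [mul_comm] at h4
    exact le_of_mul_le_mul_right h4 hp
  exact le_of_sq_le_sq h3 hσ

lemma tree_est (hd : ∀ i, d i ≠ 0) {σ : Fin 3 → ℝ} (hσ : ∀ i, 0 ≤ σ i) (h : ∀ i, SizeLE d φ l f i (σ i) PP)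
    {T : Finset Tile} (hT : T ⊆ PP) {k : Fin 3} {J : ℕ} {M : ℤ} {θ : ℝ} (hk : ∀ P ∈ T, kt d l k J M θ P) :
    Lam φ f T ≤ (∏ i, σ i) * 2 ^ J := by
  classical
  have hprod : ∀ g : Fin 3 → ℝ, ∏ i, g i = g k * (g (k + 1) * g (k + 2)) := by
    intro g; rw [Fin.prod_univ_three]
    fin_cases k
    · simp; ring
    · show _ = g 1 * (g 2 * g 0); ring
    · show _ = g 2 * (g 0 * g 1); ring
  set a : Fin 3 → Tile → ℝ := fun i P => ‖inner ℂ (φ i P) (f i)‖ with ha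
  have ha0 : ∀ i P, 0 ≤ a i P := fun i P => norm_nonneg _
  have hS : ∀ i, k ≠ i → ∑ P ∈ T, (2 : ℝ) ^ P.1 * a i P ^ 2 ≤ σ i ^ 2 * 2 ^ J := by
    intro i hi
    refine le_trans ?_ (h i k hi J M θ)
    refine SS_mono fun P hP => Finset.mem_filter.2 ⟨hT hP, hk P hP⟩
  have hS1 := hS (k + 1) (by fin_cases k <;> decide)
  have hS2 := hS (k + 2) (by fin_cases k <;> decide)
  have hcs : ∑ P ∈ T, (2 : ℝ) ^ P.1 * (a (k + 1) P * a (k + 2) P) ≤ (σ (k + 1) * σ (k + 2)) * 2 ^ J := by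
    have h1 := Finset.sum_mul_sq_le_sq_mul_sq T (fun P => Real.sqrt (2 ^ P.1) * a (k + 1) P) (fun P => Real.sqrt (2 ^ P.1) * a (k + 2) P)
    have e : ∀ P : Tile, Real.sqrt (2 ^ P.1) * Real.sqrt (2 ^ P.1) = 2 ^ P.1 := fun P => Real.mul_self_sqrt (by positivity)
    have e1 : ∀ P : Tile, Real.sqrt (2 ^ P.1) * a (k + 1) P * (Real.sqrt (2 ^ P.1) * a (k + 2) P) = 2 ^ P.1 * (a (k + 1) P * a (k + 2) P) := by
      intro P; linear_combination (a (k + 1) P * a (k + 2) P) * e P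
    have e2 : ∀ (i : Fin 3) (P : Tile), (Real.sqrt (2 ^ P.1) * a i P) ^ 2 = 2 ^ P.1 * a i P ^ 2 := by
      intro i P; linear_combination (a i P ^ 2) * e P
    simp only [e1, e2] at h1
    refine le_of_sq_le_sq (h1.trans ?_) (by have := hσ (k + 1); have := hσ (k + 2); positivity)
    calc _ ≤ (σ (k + 1) ^ 2 * 2 ^ J) * (σ (k + 2) ^ 2 * 2 ^ J) := by
          gcongr
      _ = _ := by ring
  unfold Lam
  calc _ ≤ ∑ P ∈ T, σ k * ((2 : ℝ) ^ P.1 * (a (k + 1) P * a (k + 2) P)) := by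
        refine Finset.sum_le_sum fun P hP => ?_
        rw [hprod]
        have h1 : a k P ≤ σ k := (h k).single hd (hσ k) (hT hP)
        have h2 : 0 ≤ (2 : ℝ) ^ P.1 * (a (k + 1) P * a (k + 2) P) := by have := ha0 (k + 1) P; have := ha0 (k + 2) P; positivity
        calc _ = a k P * ((2 : ℝ) ^ P.1 * (a (k + 1) P * a (k + 2) P)) := by ring
          _ ≤ _ := by gcongr
    _ = σ k * ∑ P ∈ T, ((2 : ℝ) ^ P.1 * (a (k + 1) P * a (k + 2) P)) := by rw [Finset.mul_sum]
    _ ≤ σ k * ((σ (k + 1) * σ (k + 2)) * 2 ^ J) := by gcongr; exact hσ k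
    _ = _ := by rw [hprod]; ring

end

open Classical in
lemma size_step1 : ∃ K : ℝ, 1 ≤ K ∧ ∀ (d : Fin 3 → ℝ) (C2 : ℝ) (N : ℕ) (φ : Fin 3 → Tile → H) (l : Fin 3 → Tile → ℝ)
    (ε : Fin 3 → Fin 3 → ℝ) (PP : Finset Tile) (f : Fin 3 → H) (σ : Fin 3 → ℝ) (i k : Fin 3) (τ : ℝ),
    6 ≤ N → Model d C2 N φ l ε PP → (∀ i, 0 ≤ σ i) → (∀ i, SizeLE d φ l f i (σ i) PP) → 0 < τ → σ i ≤ 2 * τ → k ≠ i →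
    ∃ PP' ⊆ PP, (∀ J M θ, SS (φ i) (f i) (PP'.filter (kt d l k J M θ)) ≤ τ ^ 2 * 2 ^ J) ∧
      Lam φ f PP ≤ Lam φ f PP' + K * (∏ i, σ i) * (‖f i‖ ^ 2 / τ ^ 2) := by
  obtain ⟨K, hK, h⟩ := select
  refine ⟨2 * K, by linarith, fun d C2 N φ l ε PP f σ i k τ hN hm hσ hs hτ hστ hki => ?_⟩
  have hdi := hm.dne i
  have hmul : ∀ θ : ℝ, d i * (θ / d i) = θ := fun θ => by field_simp
  obtain ⟨n, J, M, θ, PP', h1, h2, h3, h4⟩ := h N hN (φ i) (l i) (fun P θ => |l k P - 2 ^ P.1 * (d k * (θ / d i))| ≤ 3)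
    (ε i k) C2 PP (f i) τ (hm.pk i) (hm.eps i k) hm.C2le hτ
    (fun P hP θ hθ => by have := hm.lac i k hki.symm P hP _ hθ; rwa [hmul] at this) hm.sc (hm.lab i)
    (fun P hP Q hQ hPQ θ hθ hθ' => by
      refine hm.lab k P hP Q hQ hPQ ?_
      rw [hPQ] at hθ
      rw [abs_le] at hθ hθ' ⊢
      constructor <;> linarith)
    (fun P hP => ((hs i).single hm.dne (hσ i) hP).trans hστ)
  refine ⟨PP', h1, ?_, ?_⟩
  · intro J M θ
    have := h3 J M (d i * θ)
    rw [show d i * θ / d i = θ by field_simp] at this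
    convert this using 2
    ext P; simp only [Finset.mem_filter, kt]
  · have hcov : Lam φ f (PP \ PP') ≤ ∑ s ∈ Finset.range n, (Lam φ f (PP.filter (kt d l k (J s) (M s) (θ s / d i))) +
        Lam φ f (PP.filter (kt d l i (J s) (M s) (θ s / d i)))) := by
      set g : Tile → ℝ := fun P => 2 ^ P.1 * ∏ i, ‖inner ℂ (φ i P) (f i)‖ with hg
      have hg0 : ∀ P, 0 ≤ g P := fun P => by simp only [hg]; positivity
      have e : ∀ T : Finset Tile, Lam φ f T = ∑ P ∈ T, g P := fun T => rfl
      have hs' : ∀ s ∈ Finset.range n, (∑ P ∈ PP, ((if kt d l k (J s) (M s) (θ s / d i) P then g P else 0) +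
        (if kt d l i (J s) (M s) (θ s / d i) P then g P else 0))) = (Lam φ f (PP.filter (kt d l k (J s) (M s) (θ s / d i))) +
        Lam φ f (PP.filter (kt d l i (J s) (M s) (θ s / d i)))) := by
        intro s _
        rw [e, e, Finset.sum_filter, Finset.sum_filter, Finset.sum_add_distrib]
      rw [← Finset.sum_congr rfl hs', Finset.sum_comm, e]
      have hnn : ∀ (s : ℕ) (P : Tile), 0 ≤ ((if kt d l k (J s) (M s) (θ s / d i) P then g P else 0) +
        (if kt d l i (J s) (M s) (θ s / d i) P then g P else 0)) := by
        intro s P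
        have := hg0 P
        split_ifs <;> linarith
      refine le_trans (Finset.sum_le_sum fun P hP => ?_) (Finset.sum_le_sum_of_subset_of_nonneg Finset.sdiff_subset
        fun P _ _ => Finset.sum_nonneg fun s _ => hnn s P)
      obtain ⟨q1, q2⟩ := Finset.mem_sdiff.1 hP
      obtain ⟨s, hs, q3, q4⟩ := h4 P q1 q2
      refine le_trans ?_ (Finset.single_le_sum (fun s _ => hnn s P) (Finset.mem_range.2 hs))
      have := hg0 P
      rcases q4 with q4 | q4
      · rw [if_pos (show kt d l k (J s) (M s) (θ s / d i) P from ⟨q3, q4⟩)]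
        split_ifs <;> linarith
      · have : kt d l i (J s) (M s) (θ s / d i) P := ⟨q3, by rw [hmul]; exact q4⟩
        rw [if_pos this]
        split_ifs <;> linarith
    have hsum : Lam φ f PP = Lam φ f PP' + Lam φ f (PP \ PP') := by
      unfold Lam; rw [add_comm]; exact (Finset.sum_sdiff h1).symm
    have hpi : 0 ≤ ∏ i, σ i := Finset.prod_nonneg fun i _ => hσ i
    rw [hsum]
    refine add_le_add le_rfl (hcov.trans ?_)
    calc _ ≤ ∑ s ∈ Finset.range n, ((∏ i, σ i) * 2 ^ J s + (∏ i, σ i) * 2 ^ J s) := by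
          refine Finset.sum_le_sum fun s _ => add_le_add ?_ ?_
          · exact tree_est hm.dne hσ hs (Finset.filter_subset _ _) (fun P hP => (Finset.mem_filter.1 hP).2)
          · exact tree_est hm.dne hσ hs (Finset.filter_subset _ _) (fun P hP => (Finset.mem_filter.1 hP).2)
      _ = 2 * (∏ i, σ i) * ∑ s ∈ Finset.range n, (2 : ℝ) ^ J s := by
          rw [Finset.mul_sum]; refine Finset.sum_congr rfl fun s _ => by ring
      _ ≤ 2 * (∏ i, σ i) * (K * ‖f i‖ ^ 2 / τ ^ 2) := by
          gcongr
          rw [le_div_iff₀ (by positivity)]; linarith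
      _ = _ := by ring

lemma size_step : ∃ K : ℝ, 1 ≤ K ∧ ∀ (d : Fin 3 → ℝ) (C2 : ℝ) (N : ℕ) (φ : Fin 3 → Tile → H) (l : Fin 3 → Tile → ℝ)
    (ε : Fin 3 → Fin 3 → ℝ) (PP : Finset Tile) (f : Fin 3 → H) (σ : Fin 3 → ℝ) (i : Fin 3) (τ : ℝ),
    6 ≤ N → Model d C2 N φ l ε PP → (∀ i, 0 ≤ σ i) → (∀ i, SizeLE d φ l f i (σ i) PP) → 0 < τ → σ i ≤ 2 * τ →
    ∃ PP' ⊆ PP, SizeLE d φ l f i τ PP' ∧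
      Lam φ f PP ≤ Lam φ f PP' + K * (∏ i, σ i) * (‖f i‖ ^ 2 / τ ^ 2) := by
  classical
  obtain ⟨K, hK, h⟩ := size_step1
  refine ⟨2 * K, by linarith, fun d C2 N φ l ε PP f σ i τ hN hm hσ hs hτ hστ => ?_⟩
  obtain ⟨PP1, a1, a2, a3⟩ := h d C2 N φ l ε PP f σ i (i + 1) τ hN hm hσ hs hτ hστ (by fin_cases i <;> decide)
  obtain ⟨PP2, b1, b2, b3⟩ := h d C2 N φ l ε PP1 f σ i (i + 2) τ hN (hm.mono a1) hσ (fun i => (hs i).mono a1) hτ hστ (by fin_cases i <;> decide)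
  refine ⟨PP2, b1.trans a1, ?_, by linarith⟩
  intro k hk J M θ
  have hk' : k = i + 1 ∨ k = i + 2 := by revert hk; fin_cases i <;> fin_cases k <;> decide
  rcases hk' with rfl | rfl
  · exact (SS_mono (Finset.filter_subset_filter _ b1)).trans (a2 J M θ)
  · exact b2 J M θ

end BHT

namespace BHT

lemma min_sum {r w : ℝ} (hr : 1 < r) (hw : 0 < w) (n : ℕ) :
    ∑ m ∈ Finset.range n, min (w * r ^ m) (w * r ^ m)⁻¹ ≤ 2 * (r + 1) / (r - 1) := by
  set G : ℕ → ℝ := fun m => (w * r ^ m) / (1 + w * r ^ m) with hG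
  have hr0 : 0 < r := by linarith
  have hstep : ∀ m : ℕ, (r - 1) / (2 * (r + 1)) * min (w * r ^ m) (w * r ^ m)⁻¹ ≤ G (m + 1) - G m := by
    intro m
    simp only [hG, pow_succ]
    set x := w * r ^ m with hx
    have hx0 : 0 < x := by positivity
    rw [← mul_assoc, ← hx]
    have e : x * r / (1 + x * r) - x / (1 + x) = (r - 1) * (x / ((1 + x * r) * (1 + x))) := by
      field_simp; ring
    rw [e, div_mul_eq_mul_div, mul_div_assoc]
    refine mul_le_mul_of_nonneg_left ?_ (by linarith)
    rw [div_le_div_iff₀ (by positivity) (by positivity)]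
    rcases le_total x 1 with h | h
    · calc min x x⁻¹ * ((1 + x * r) * (1 + x)) ≤ x * ((1 + 1 * r) * (1 + 1)) := by
            gcongr
            exact min_le_left _ _
        _ = _ := by ring
    · calc min x x⁻¹ * ((1 + x * r) * (1 + x)) ≤ x⁻¹ * ((x + x * r) * (x + x)) := by
            gcongr
            exact min_le_right _ _
        _ = _ := by field_simp; ring
  have h1 := Finset.sum_le_sum fun m (_ : m ∈ Finset.range n) => hstep m
  rw [← Finset.mul_sum, Finset.sum_range_sub] at h1
  have h2 : G n - G 0 ≤ 1 := by
    have a1 : G n ≤ 1 := by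
      simp only [hG]; rw [div_le_one (by positivity)]; linarith
    have a2 : 0 ≤ G 0 := by simp only [hG]; positivity
    linarith
  have h3 := h1.trans h2
  rw [le_div_iff₀ (by linarith)]
  rw [div_mul_eq_mul_div, div_le_one (by linarith)] at h3
  linarith

lemma min_geo {s x y θ : ℝ} (hs : min (Real.exp x) (Real.exp y) = s) (h0 : 0 ≤ θ) (h1 : θ ≤ 1) :
    s ≤ Real.exp (θ * x + (1 - θ) * y) := by
  rw [← hs]
  rcases le_total x y with h | h
  · rw [min_eq_left (Real.exp_le_exp.2 h), Real.exp_le_exp]; nlinarith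
  · rw [min_eq_right (Real.exp_le_exp.2 h), Real.exp_le_exp]; nlinarith

lemma iter_step : ∃ K : ℝ, 1 ≤ K ∧ ∀ (d : Fin 3 → ℝ) (C2 : ℝ) (N : ℕ) (φ : Fin 3 → Tile → H) (l : Fin 3 → Tile → ℝ)
    (ε : Fin 3 → Fin 3 → ℝ) (PP : Finset Tile) (f : Fin 3 → H) (s E : Fin 3 → ℝ) (v : ℝ),
    6 ≤ N → Model d C2 N φ l ε PP → (∀ i, 0 < s i) → (∀ i, 0 < E i) → (∀ i, ‖f i‖ ≤ E i) → 0 < v →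
    (∀ i, SizeLE d φ l f i (min (s i) (v * E i)) PP) →
    ∃ PP' ⊆ PP, (∀ i, SizeLE d φ l f i (min (s i) (v / 2 * E i)) PP') ∧
      Lam φ f PP ≤ Lam φ f PP' + K * ((v ^ 2)⁻¹ * ∏ i, min (s i) (v * E i)) := by
  obtain ⟨K, hK, h⟩ := size_step
  refine ⟨12 * K, by linarith, fun d C2 N φ l ε PP f s E v hN hm hs hE hf hv hsz => ?_⟩
  have hσ : ∀ i, 0 ≤ min (s i) (v * E i) := fun i => le_min (hs i).le (mul_pos hv (hE i)).le
  have hone : ∀ (i : Fin 3) (Q : Finset Tile), Q ⊆ PP → ∃ Q' ⊆ Q, SizeLE d φ l f i (min (s i) (v / 2 * E i)) Q' ∧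
      Lam φ f Q ≤ Lam φ f Q' + 4 * K * ((v ^ 2)⁻¹ * ∏ i, min (s i) (v * E i)) := by
    intro i Q hQ
    have hEi := hE i
    obtain ⟨Q', q1, q2, q3⟩ := h d C2 N φ l ε Q f (fun i => min (s i) (v * E i)) i (v / 2 * E i) hN (hm.mono hQ) hσ
      (fun i => (hsz i).mono hQ) (by positivity) (by refine (min_le_right _ _).trans ?_; linarith)
    refine ⟨Q', q1, ?_, q3.trans ?_⟩
    · rcases le_total (s i) (v / 2 * E i) with h1 | h1
      · rw [min_eq_left h1]
        have h2 := ((hsz i).mono hQ).mono q1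
        rwa [min_eq_left (by nlinarith)] at h2
      · rw [min_eq_right h1]; exact q2
    · have hpi : 0 ≤ ∏ i, min (s i) (v * E i) := Finset.prod_nonneg fun i _ => hσ i
      have h3 : ‖f i‖ ^ 2 / (v / 2 * E i) ^ 2 ≤ 4 * (v ^ 2)⁻¹ := by
        rw [div_le_iff₀ (by positivity)]
        calc ‖f i‖ ^ 2 ≤ E i ^ 2 := by gcongr; exact hf i
          _ = _ := by field_simp; ring
      calc _ ≤ Lam φ f Q' + K * (∏ i, min (s i) (v * E i)) * (4 * (v ^ 2)⁻¹) := by gcongr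
        _ = _ := by ring
  obtain ⟨P1, a1, a2, a3⟩ := hone 0 PP subset_rfl
  obtain ⟨P2, b1, b2, b3⟩ := hone 1 P1 a1
  obtain ⟨P3, c1, c2, c3⟩ := hone 2 P2 (b1.trans a1)
  refine ⟨P3, c1.trans (b1.trans a1), ?_, by linarith⟩
  intro i
  fin_cases i
  · exact (a2.mono b1).mono c1
  · exact b2.mono c1
  · exact c2

lemma Fbound (θ : Fin 3 → ℝ) (h0 : ∀ i, 0 < θ i) (h1 : ∀ i, θ i < 1) (hsum : θ 0 + θ 1 + θ 2 = 1) :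
    ∃ C : ℝ, 0 < C ∧ ∀ (d : Fin 3 → ℝ) (C2 : ℝ) (N : ℕ) (φ : Fin 3 → Tile → H) (l : Fin 3 → Tile → ℝ)
    (ε : Fin 3 → Fin 3 → ℝ) (PP : Finset Tile) (f : Fin 3 → H) (s E : Fin 3 → ℝ),
    6 ≤ N → Model d C2 N φ l ε PP → (∀ i, 0 < s i) → (∀ i, 0 < E i) → (∀ i, ‖f i‖ ≤ E i) →
    (∀ i, SizeLE d φ l f i (s i) PP) → Lam φ f PP ≤ C * ∏ i, s i ^ θ i * E i ^ (1 - θ i) := by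
  obtain ⟨K, hK, h⟩ := iter_step
  obtain ⟨κ, hκ, hκθ⟩ : ∃ κ : ℝ, 0 < κ ∧ ∀ i, κ / 3 ≤ θ i ∧ θ i + κ / 3 ≤ 1 := by
    set κ := min (min (min (θ 0) (θ 1)) (θ 2)) (min (min (1 - θ 0) (1 - θ 1)) (1 - θ 2)) with hκ
    have hpos : 0 < κ := by
      have := h0 0; have := h0 1; have := h0 2; have := h1 0; have := h1 1; have := h1 2
      simp only [hκ, lt_min_iff]
      refine ⟨⟨⟨?_, ?_⟩, ?_⟩, ⟨?_, ?_⟩, ?_⟩ <;> linarith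
    refine ⟨κ, hpos, ?_⟩
    have a0 : κ ≤ θ 0 := (min_le_left _ _).trans ((min_le_left _ _).trans (min_le_left _ _))
    have a1 : κ ≤ θ 1 := (min_le_left _ _).trans ((min_le_left _ _).trans (min_le_right _ _))
    have a2 : κ ≤ θ 2 := (min_le_left _ _).trans (min_le_right _ _)
    have b0 : κ ≤ 1 - θ 0 := (min_le_right _ _).trans ((min_le_left _ _).trans (min_le_left _ _))
    have b1 : κ ≤ 1 - θ 1 := (min_le_right _ _).trans ((min_le_left _ _).trans (min_le_right _ _))
    have b2 : κ ≤ 1 - θ 2 := (min_le_right _ _).trans (min_le_right _ _)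
    intro i
    fin_cases i
    · simp only [Fin.zero_eta]; constructor <;> linarith
    · simp only [Fin.mk_one]; constructor <;> linarith
    · simp only [Fin.reduceFinMk]; constructor <;> linarith
  set r : ℝ := Real.exp (κ * Real.log 2) with hr
  have hr1 : 1 < r := by
    rw [hr, Real.one_lt_exp_iff]
    have := Real.log_pos (show (1 : ℝ) < 2 by norm_num)
    positivity
  refine ⟨K * (2 * (r + 1) / (r - 1)), by have : 0 < r - 1 := by linarith
                                          positivity, fun d C2 N φ l ε PP f s E hN hm hs hE hf hsz => ?_⟩
  set v0 : ℝ := ∑ i, s i / E i with hv0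
  have hv0pos : 0 < v0 := Finset.sum_pos (fun i _ => div_pos (hs i) (hE i)) Finset.univ_nonempty
  have hv0s : ∀ i, s i ≤ v0 * E i := by
    intro i
    rw [← div_le_iff₀ (hE i)]
    exact Finset.single_le_sum (f := fun i => s i / E i) (fun i _ => (div_pos (hs i) (hE i)).le) (Finset.mem_univ i)
  set v : ℕ → ℝ := fun m => v0 / 2 ^ m with hv
  have hvpos : ∀ m, 0 < v m := fun m => by simp only [hv]; positivity
  have hiter : ∀ n : ℕ, ∃ Q ⊆ PP, (∀ i, SizeLE d φ l f i (min (s i) (v n * E i)) Q) ∧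
      Lam φ f PP ≤ Lam φ f Q + K * ∑ m ∈ Finset.range n, ((v m ^ 2)⁻¹ * ∏ i, min (s i) (v m * E i)) := by
    intro n
    induction n with
    | zero =>
      refine ⟨PP, subset_rfl, fun i => ?_, by simp⟩
      rw [min_eq_left (by simp only [hv, pow_zero, div_one]; exact hv0s i)]
      exact hsz i
    | succ n ih =>
      obtain ⟨Q, q1, q2, q3⟩ := ih
      obtain ⟨Q', a1, a2, a3⟩ := h d C2 N φ l ε Q f s E (v n) hN (hm.mono q1) hs hE hf (hvpos n) q2
      refine ⟨Q', a1.trans q1, ?_, ?_⟩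
      · intro i
        have := a2 i
        have e : v n / 2 = v (n + 1) := by simp only [hv, pow_succ]; field_simp
        rwa [e] at this
      · rw [Finset.sum_range_succ, mul_add]; linarith
  set x : Fin 3 → ℝ := fun i => Real.log (s i) with hx
  set y : Fin 3 → ℝ := fun i => Real.log (E i) with hy
  have ex : ∀ i, s i = Real.exp (x i) := fun i => (Real.exp_log (hs i)).symm
  have ey : ∀ i, E i = Real.exp (y i) := fun i => (Real.exp_log (hE i)).symm
  set Mx : ℝ := ∏ i, s i ^ θ i * E i ^ (1 - θ i) with hMx
  have eM : Mx = Real.exp (∑ i, (θ i * x i + (1 - θ i) * y i)) := by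
    rw [hMx, Real.exp_sum]
    refine Finset.prod_congr rfl fun i _ => ?_
    rw [Real.exp_add, Real.rpow_def_of_pos (hs i), Real.rpow_def_of_pos (hE i), mul_comm (θ i), mul_comm (1 - θ i)]
  have hMpos : 0 < Mx := by rw [eM]; exact Real.exp_pos _
  set w : ℝ := Real.exp (κ * ((x 0 - y 0 + (x 1 - y 1) + (x 2 - y 2)) / 3 - Real.log v0)) with hw
  have hterm : ∀ m : ℕ, (v m ^ 2)⁻¹ * ∏ i, min (s i) (v m * E i) ≤ Mx * min (w * r ^ m) (w * r ^ m)⁻¹ := by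
    intro m
    set t : ℝ := Real.log v0 - m * Real.log 2 with ht
    have et : v m = Real.exp t := by
      rw [ht, Real.exp_sub, Real.exp_log hv0pos, Real.exp_nat_mul, Real.exp_log (by norm_num)]
    have ew : w * r ^ m = Real.exp (κ * ((x 0 - y 0 + (x 1 - y 1) + (x 2 - y 2)) / 3 - t)) := by
      rw [hw, hr, ← Real.exp_nat_mul, ← Real.exp_add, ht]; congr 1; ring
    have hmin : ∀ (i : Fin 3) (ϑ : ℝ), 0 ≤ ϑ → ϑ ≤ 1 → min (s i) (v m * E i) ≤ Real.exp (ϑ * x i + (1 - ϑ) * (t + y i)) := by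
      intro i ϑ a b
      refine min_geo ?_ a b
      rw [← ex i, Real.exp_add, ← et, ← ey i]
    have hpos : ∀ i, 0 ≤ min (s i) (v m * E i) := fun i => le_min (hs i).le (mul_pos (hvpos m) (hE i)).le
    have ev : (v m ^ 2)⁻¹ = Real.exp (-2 * t) := by
      rw [et, ← Real.exp_nat_mul, ← Real.exp_neg]; congr 1; push_cast; ring
    rw [mul_min_of_nonneg _ _ hMpos.le, ev, ew, ← Real.exp_neg, eM, ← Real.exp_add, ← Real.exp_add, Fin.prod_univ_three, Fin.sum_univ_three]
    have ht2 : θ 2 = 1 - θ 0 - θ 1 := by linarith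
    apply le_min
    · have p := fun i => hmin i (θ i + κ / 3) (by have := h0 i; positivity) (hκθ i).2
      calc _ ≤ Real.exp (-2 * t) * (Real.exp ((θ 0 + κ / 3) * x 0 + (1 - (θ 0 + κ / 3)) * (t + y 0)) *
            Real.exp ((θ 1 + κ / 3) * x 1 + (1 - (θ 1 + κ / 3)) * (t + y 1)) *
            Real.exp ((θ 2 + κ / 3) * x 2 + (1 - (θ 2 + κ / 3)) * (t + y 2))) := by
            refine mul_le_mul_of_nonneg_left ?_ (Real.exp_pos _).le
            exact mul_le_mul (mul_le_mul (p 0) (p 1) (hpos 1) (Real.exp_pos _).le) (p 2) (hpos 2) (by positivity)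
        _ = _ := by
            rw [← Real.exp_add, ← Real.exp_add, ← Real.exp_add]; congr 1; rw [ht2]; ring
    · have p := fun i => hmin i (θ i - κ / 3) (by linarith [(hκθ i).1]) (by linarith [h1 i])
      calc _ ≤ Real.exp (-2 * t) * (Real.exp ((θ 0 - κ / 3) * x 0 + (1 - (θ 0 - κ / 3)) * (t + y 0)) *
            Real.exp ((θ 1 - κ / 3) * x 1 + (1 - (θ 1 - κ / 3)) * (t + y 1)) *
            Real.exp ((θ 2 - κ / 3) * x 2 + (1 - (θ 2 - κ / 3)) * (t + y 2))) := by
            refine mul_le_mul_of_nonneg_left ?_ (Real.exp_pos _).le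
            exact mul_le_mul (mul_le_mul (p 0) (p 1) (hpos 1) (Real.exp_pos _).le) (p 2) (hpos 2) (by positivity)
        _ = _ := by
            rw [← Real.exp_add, ← Real.exp_add, ← Real.exp_add]; congr 1; rw [ht2]; ring
  have hsumt : ∀ n : ℕ, ∑ m ∈ Finset.range n, ((v m ^ 2)⁻¹ * ∏ i, min (s i) (v m * E i)) ≤ Mx * (2 * (r + 1) / (r - 1)) := by
    intro n
    refine (Finset.sum_le_sum fun m _ => hterm m).trans ?_
    rw [← Finset.mul_sum]
    exact mul_le_mul_of_nonneg_left (min_sum hr1 (Real.exp_pos _) n) hMpos.le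
  -- limiting argument
  set c : ℝ := ∑ P ∈ PP, (2 : ℝ) ^ P.1 * ((v0 * E 0) * (s 1 * s 2)) with hc
  have hlam : ∀ n : ℕ, Lam φ f PP ≤ c / 2 ^ n + K * (Mx * (2 * (r + 1) / (r - 1))) := by
    intro n
    obtain ⟨Q, q1, q2, q3⟩ := hiter n
    refine q3.trans (add_le_add ?_ (mul_le_mul_of_nonneg_left (hsumt n) (by linarith)))
    have hq : ∀ i, ∀ P ∈ Q, ‖inner ℂ (φ i P) (f i)‖ ≤ min (s i) (v n * E i) := fun i P hP =>
      (q2 i).single hm.dne (le_min (hs i).le (mul_pos (hvpos n) (hE i)).le) hP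
    rw [hc, Finset.sum_div]
    refine le_trans (Finset.sum_le_sum fun P hP => ?_) (Finset.sum_le_sum_of_subset_of_nonneg q1 fun P _ _ => by
      have := hs 1; have := hs 2; have := hE 0; positivity)
    rw [Fin.prod_univ_three]
    have i0 := (hq 0 P hP).trans (min_le_right _ _)
    have i1 := (hq 1 P hP).trans (min_le_left _ _)
    have i2 := (hq 2 P hP).trans (min_le_left _ _)
    have := hs 1; have := hs 2; have := hE 0; have := hvpos n
    calc _ ≤ (2 : ℝ) ^ P.1 * ((v n * E 0) * s 1 * s 2) := by gcongr
      _ = _ := by simp only [hv]; field_simp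
  have hlim : Tendsto (fun n : ℕ => c / 2 ^ n + K * (Mx * (2 * (r + 1) / (r - 1)))) atTop
      (nhds (0 + K * (Mx * (2 * (r + 1) / (r - 1))))) := by
    refine Tendsto.add_const _ ?_
    exact tendsto_const_nhds.div_atTop (tendsto_pow_atTop_atTop_of_one_lt (by norm_num))
  have := ge_of_tendsto' hlim hlam
  refine this.trans (le_of_eq ?_)
  ring

end BHT

namespace BHT

lemma mem_fat {J : ℕ} {M x : ℤ} (c : ℤ) : x ∈ Finset.Ico ((M - c) * 2 ^ J) ((M + c + 1) * 2 ^ J) ↔ |x / 2 ^ J - M| ≤ c := by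
  have h : (0 : ℤ) < 2 ^ J := by positivity
  rw [Finset.mem_Ico, abs_le, ← Int.le_ediv_iff_mul_le h, ← Int.ediv_lt_iff_lt_mul h]
  constructor <;> rintro ⟨h1, h2⟩ <;> constructor <;> linarith

lemma fat_up {J J' : ℕ} {M x c : ℤ} (h : J ≤ J') (hc : 0 ≤ c) (hx : |x / 2 ^ J - M| ≤ c) :
    |x / 2 ^ J' - M / 2 ^ (J' - J)| ≤ c := by
  obtain ⟨s, rfl⟩ := Nat.exists_eq_add_of_le h
  rw [Nat.add_sub_cancel_left, pow_add, ← Int.ediv_ediv_of_nonneg (by positivity)]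
  set y := x / 2 ^ J
  have h0 : (0 : ℤ) < 2 ^ s := by positivity
  have h1 : (1 : ℤ) ≤ 2 ^ s := h0
  rw [abs_le] at hx ⊢
  constructor
  · have : M / 2 ^ s - c ≤ y / 2 ^ s := by
      rw [Int.le_ediv_iff_mul_le h0]
      have := Int.ediv_mul_le M h0.ne'
      nlinarith
    linarith
  · have : y / 2 ^ s < M / 2 ^ s + c + 1 := by
      rw [Int.ediv_lt_iff_lt_mul h0]
      have := Int.lt_ediv_add_one_mul_self M h0
      nlinarith
    linarith

lemma exc1 (S : Finset ℤ) (s : ℕ) : ∃ Ω : Finset ℤ, 4 * Ω.card ≤ s ∧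
    ∀ (J : ℕ) (M : ℤ), 20 * S.card * 2 ^ J < s * (S.filter (fun x => x / 2 ^ J = M)).card →
      ∀ x : ℤ, |x / 2 ^ J - M| ≤ 2 → x ∈ Ω := by
  classical
  rcases S.eq_empty_or_nonempty with rfl | hne
  · exact ⟨∅, by simp, by simp⟩
  set bad : ℕ × ℤ → Prop := fun p => 20 * S.card * 2 ^ p.1 < s * (S.filter (fun x => x / 2 ^ p.1 = p.2)).card with hbad
  set Bd : Finset (ℕ × ℤ) := ((Finset.range s ×ˢ S).image (fun p : ℕ × ℤ => (p.1, p.2 / 2 ^ p.1))).filter bad with hBd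
  have hmem : ∀ p, p ∈ Bd ↔ bad p := by
    intro p
    rw [hBd, Finset.mem_filter]
    refine ⟨fun h => h.2, fun h => ⟨?_, h⟩⟩
    have h1 : (S.filter (fun x => x / 2 ^ p.1 = p.2)).card ≤ S.card := Finset.card_filter_le _ _
    have h2 : 0 < (S.filter (fun x => x / 2 ^ p.1 = p.2)).card := by
      rcases Nat.eq_zero_or_pos (S.filter (fun x => x / 2 ^ p.1 = p.2)).card with h0 | h0
      · simp [hbad, h0] at h
      · exact h0
    obtain ⟨x, hx⟩ := Finset.card_pos.1 h2
    rw [Finset.mem_filter] at hx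
    have h3 : 20 * 2 ^ p.1 < s := by
      have h4 : 20 * S.card * 2 ^ p.1 < s * S.card := lt_of_lt_of_le h (Nat.mul_le_mul_left _ h1)
      have : (20 * 2 ^ p.1) * S.card < s * S.card := by linarith
      exact lt_of_mul_lt_mul_right this (Nat.zero_le _)
    have h5 : p.1 < 2 ^ p.1 := Nat.lt_two_pow_self
    refine Finset.mem_image.2 ⟨(p.1, x), Finset.mem_product.2 ⟨Finset.mem_range.2 (by omega), hx.1⟩, ?_⟩
    simp [hx.2]
  set R : ℕ × ℤ → ℕ × ℤ → Prop := fun p q => p.1 ≤ q.1 ∧ p.2 / 2 ^ (q.1 - p.1) = q.2 with hR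
  have Rtrans : ∀ p q r, R p q → R q r → R p r := by
    rintro ⟨a, m⟩ ⟨b, n⟩ ⟨c, o⟩ ⟨h1, h2⟩ ⟨h3, h4⟩
    simp only at h1 h2 h3 h4
    refine ⟨h1.trans h3, ?_⟩
    simp only
    rw [← h4, ← h2, Int.ediv_ediv_of_nonneg (by positivity), ← pow_add]
    congr 2; omega
  set Mx := Bd.filter (fun p => ∀ q ∈ Bd, R p q → q = p) with hMx
  have hmax : ∀ p ∈ Bd, ∃ q ∈ Mx, R p q := by
    intro p hp
    obtain ⟨q, hq, hq2⟩ := Finset.exists_max_image (Bd.filter (R p)) (fun q => q.1)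
      ⟨p, Finset.mem_filter.2 ⟨hp, le_refl _, by simp⟩⟩
    rw [Finset.mem_filter] at hq
    refine ⟨q, Finset.mem_filter.2 ⟨hq.1, fun r hr hqr => ?_⟩, hq.2⟩
    have := hq2 r (Finset.mem_filter.2 ⟨hr, Rtrans _ _ _ hq.2 hqr⟩)
    have e : r.1 = q.1 := le_antisymm this hqr.1
    have h2 := hqr.2
    rw [e] at h2
    simp at h2
    exact Prod.ext e h2.symm
  refine ⟨Mx.biUnion (fun p => Finset.Ico ((p.2 - 2) * 2 ^ p.1) ((p.2 + 2 + 1) * 2 ^ p.1)), ?_, ?_⟩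
  · have hc : ∀ p : ℕ × ℤ, (Finset.Ico ((p.2 - 2) * 2 ^ p.1) ((p.2 + 2 + 1) * 2 ^ p.1)).card = 5 * 2 ^ p.1 := by
      intro p
      rw [Int.card_Ico]
      have : (p.2 + 2 + 1) * 2 ^ p.1 - (p.2 - 2) * 2 ^ p.1 = ((5 * 2 ^ p.1 : ℕ) : ℤ) := by push_cast; ring
      rw [this, Int.toNat_natCast]
    have h1 : (Mx.biUnion (fun p => Finset.Ico ((p.2 - 2) * 2 ^ p.1) ((p.2 + 2 + 1) * 2 ^ p.1))).card ≤
        ∑ p ∈ Mx, 5 * 2 ^ p.1 := Finset.card_biUnion_le.trans (Finset.sum_le_sum fun p _ => (hc p).le)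
    have h2 : ∑ p ∈ Mx, (S.filter (fun x => x / 2 ^ p.1 = p.2)).card ≤ S.card := by
      rw [← Finset.card_biUnion]
      · exact Finset.card_le_card (Finset.biUnion_subset.2 fun p _ => Finset.filter_subset _ _)
      · intro p hp q hq hpq
        rw [Function.onFun, Finset.disjoint_left]
        intro x hx hy
        rw [Finset.mem_filter] at hx hy
        apply hpq
        rw [hMx, Finset.mem_coe, Finset.mem_filter] at hp hq
        rcases le_total p.1 q.1 with h | h
        · refine (hp.2 q hq.1 ⟨h, ?_⟩).symm
          rw [← hx.2, ← hy.2, Int.ediv_ediv_of_nonneg (by positivity), ← pow_add]; congr 2; omega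
        · refine (hq.2 p hp.1 ⟨h, ?_⟩)
          rw [← hx.2, ← hy.2, Int.ediv_ediv_of_nonneg (by positivity), ← pow_add]; congr 2; omega
    have h3 : ∑ p ∈ Mx, 20 * S.card * 2 ^ p.1 ≤ s * S.card := by
      calc _ ≤ ∑ p ∈ Mx, s * (S.filter (fun x => x / 2 ^ p.1 = p.2)).card :=
            Finset.sum_le_sum fun p hp => ((hmem p).1 (Finset.mem_filter.1 hp).1).le
        _ = s * ∑ p ∈ Mx, (S.filter (fun x => x / 2 ^ p.1 = p.2)).card := by rw [Finset.mul_sum]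
        _ ≤ _ := Nat.mul_le_mul_left _ h2
    have h4 : (∑ p ∈ Mx, 20 * 2 ^ p.1) * S.card ≤ s * S.card := by
      rw [Finset.sum_mul]
      refine le_trans (le_of_eq (Finset.sum_congr rfl fun p _ => by ring)) h3
    have h5 := le_of_mul_le_mul_right h4 (Finset.card_pos.2 hne)
    calc _ ≤ 4 * ∑ p ∈ Mx, 5 * 2 ^ p.1 := Nat.mul_le_mul_left _ h1
      _ = ∑ p ∈ Mx, 20 * 2 ^ p.1 := by rw [Finset.mul_sum]; exact Finset.sum_congr rfl fun p _ => by ring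
      _ ≤ s := h5
  · intro J M hJM x hx
    obtain ⟨q, hq, hR1, hR2⟩ := hmax (J, M) ((hmem _).2 hJM)
    simp only at hR1 hR2
    refine Finset.mem_biUnion.2 ⟨q, hq, (mem_fat 2).2 ?_⟩
    rw [← hR2]
    exact fat_up hR1 (by norm_num) hx

lemma exc (S : Fin 3 → Finset ℤ) (e : Fin 3) : ∃ Ω : Finset ℤ, 2 * Ω.card ≤ (S e).card ∧
    ∀ i, i ≠ e → ∀ (J : ℕ) (M : ℤ), 20 * (S i).card * 2 ^ J < (S e).card * ((S i).filter (fun x => x / 2 ^ J = M)).card →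
      ∀ x : ℤ, |x / 2 ^ J - M| ≤ 2 → x ∈ Ω := by
  classical
  choose Ω h1 h2 using fun i => exc1 (S i) (S e).card
  refine ⟨(Finset.univ.erase e).biUnion Ω, ?_, fun i hi J M h x hx => ?_⟩
  · have h3 : ((Finset.univ.erase e).biUnion Ω).card ≤ ∑ i ∈ Finset.univ.erase e, (Ω i).card := Finset.card_biUnion_le
    have h4 : ∑ i ∈ Finset.univ.erase e, 4 * (Ω i).card ≤ ∑ i ∈ Finset.univ.erase e, (S e).card :=
      Finset.sum_le_sum fun i _ => h1 i
    rw [← Finset.mul_sum, Finset.sum_const, Finset.card_erase_of_mem (Finset.mem_univ _)] at h4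
    simp at h4
    omega
  · exact Finset.mem_biUnion.2 ⟨i, Finset.mem_erase.2 ⟨hi, Finset.mem_univ _⟩, h2 i J M h x hx⟩

/-- density from not being contained in the exceptional set -/
lemma dens {S : Finset ℤ} {s : ℕ} (hs : 0 < s) {Ω : Finset ℤ}
    (hΩ : ∀ (J : ℕ) (M : ℤ), 20 * S.card * 2 ^ J < s * (S.filter (fun x => x / 2 ^ J = M)).card →
      ∀ x : ℤ, |x / 2 ^ J - M| ≤ 2 → x ∈ Ω) {P : Tile} {k : ℕ} {z : ℤ} (hz : near P k z) (hzΩ : z ∉ Ω) (r : ℕ) :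
    ((S.filter (near P r)).card : ℝ) ≤ (60 * 2 ^ k * ((S.card : ℝ) / s)) * 2 ^ (P.1 + r) := by
  have hs' : (0 : ℝ) < s := by exact_mod_cast hs
  have key : ∀ r, k ≤ r → ((S.filter (near P r)).card : ℝ) ≤ 60 * ((S.card : ℝ) / s) * 2 ^ (P.1 + r) := by
    intro r hr
    have hz' := near_mono hr hz
    set M := P.2.1 / 2 ^ r with hM
    set J := P.1 + r with hJ
    have hone : ∀ c : ℤ, |c| ≤ 1 → s * (S.filter (fun x => x / 2 ^ J = M + c)).card ≤ 20 * S.card * 2 ^ J := by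
      intro c hc
      by_contra hcon
      push Not at hcon
      apply hzΩ
      refine hΩ J (M + c) hcon z ?_
      have h1 : |z / 2 ^ J - M| ≤ 1 := hz'
      rw [abs_le] at *
      constructor <;> linarith [h1.1, h1.2, hc.1, hc.2]
    have hsub : S.filter (near P r) ⊆ (S.filter (fun x => x / 2 ^ J = M + -1)) ∪ ((S.filter (fun x => x / 2 ^ J = M + 0)) ∪
        (S.filter (fun x => x / 2 ^ J = M + 1))) := by
      intro x hx
      rw [Finset.mem_filter] at hx
      have h1 : |x / 2 ^ J - M| ≤ 1 := hx.2
      rw [abs_le] at h1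
      simp only [Finset.mem_union, Finset.mem_filter, hx.1, true_and]
      omega
    have h2 := (Finset.card_le_card hsub).trans ((Finset.card_union_le _ _).trans
      (Nat.add_le_add_left (Finset.card_union_le _ _) _))
    have a1 := hone (-1) (by norm_num)
    have a2 := hone 0 (by norm_num)
    have a3 := hone 1 (by norm_num)
    have h3 : s * (S.filter (near P r)).card ≤ 60 * S.card * 2 ^ J := by
      calc _ ≤ _ := Nat.mul_le_mul_left _ h2
        _ ≤ _ := by rw [mul_add, mul_add]; linarith
    have h4 : (s : ℝ) * (S.filter (near P r)).card ≤ 60 * S.card * 2 ^ J := by exact_mod_cast h3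
    have : 60 * ((S.card : ℝ) / s) * 2 ^ J = (60 * S.card * 2 ^ J) / s := by ring
    rw [this, le_div_iff₀ hs']
    linarith
  have hx : (0 : ℝ) ≤ (S.card : ℝ) / s := by positivity
  rcases le_total k r with h | h
  · refine (key r h).trans ?_
    gcongr
    have : (1 : ℝ) ≤ 2 ^ k := one_le_pow₀ (by norm_num)
    linarith
  · have h1 : (S.filter (near P r)).card ≤ (S.filter (near P k)).card := by
      apply Finset.card_le_card
      intro x hx
      rw [Finset.mem_filter] at hx ⊢
      exact ⟨hx.1, near_mono h hx.2⟩
    have h2 : ((S.filter (near P r)).card : ℝ) ≤ (S.filter (near P k)).card := by exact_mod_cast h1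
    refine h2.trans ((key k le_rfl).trans ?_)
    have : (1 : ℝ) ≤ 2 ^ r := one_le_pow₀ (by norm_num)
    have e : (60 * 2 ^ k * ((S.card : ℝ) / s)) * 2 ^ (P.1 + r) = 60 * ((S.card : ℝ) / s) * 2 ^ (P.1 + k) * 2 ^ r := by
      rw [pow_add, pow_add]; ring
    rw [e]
    exact le_mul_of_one_le_right (by positivity) this

lemma dens3 (S : Finset ℤ) (P : Tile) (r : ℕ) : ((S.filter (near P r)).card : ℝ) ≤ 3 * 2 ^ (P.1 + r) := by
  have h : S.filter (near P r) ⊆ Finset.Ico ((P.2.1 / 2 ^ r - 1) * 2 ^ (P.1 + r)) ((P.2.1 / 2 ^ r + 1 + 1) * 2 ^ (P.1 + r)) := by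
    intro x hx
    rw [Finset.mem_filter] at hx
    exact (mem_fat 1).2 hx.2
  have h2 := Finset.card_le_card h
  rw [Int.card_Ico] at h2
  have : (P.2.1 / 2 ^ r + 1 + 1) * 2 ^ (P.1 + r) - (P.2.1 / 2 ^ r - 1) * 2 ^ (P.1 + r) = ((3 * 2 ^ (P.1 + r) : ℕ) : ℤ) := by
    push_cast; ring
  rw [this, Int.toNat_natCast] at h2
  exact_mod_cast h2

end BHT

namespace BHT

/-- tiles of a tree with pairwise disjoint or equal intervals -/
lemma tree_disj {T : Finset Tile} {J : ℕ} {M : ℤ} (hT : ∀ P ∈ T, inTop J M P)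
    (hd : ∀ P ∈ T, ∀ Q ∈ T, P.1 < Q.1 → P.2.1 / 2 ^ (Q.1 - P.1) ≠ Q.2.1)
    (hu : ∀ P ∈ T, ∀ Q ∈ T, P.1 = Q.1 → P.2.1 = Q.2.1 → P = Q) : ∑ P ∈ T, (2 : ℝ) ^ P.1 ≤ 2 ^ J := by
  classical
  have h1 : ∑ P ∈ T, 2 ^ P.1 ≤ 2 ^ J := by
    rw [← card_dyad J M]
    have : ∑ P ∈ T, 2 ^ P.1 = ∑ P ∈ T, (dyad P.1 P.2.1).card := Finset.sum_congr rfl fun P _ => (card_dyad _ _).symm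
    rw [this, ← Finset.card_biUnion]
    · apply Finset.card_le_card
      intro x hx
      obtain ⟨P, hP, hx⟩ := Finset.mem_biUnion.1 hx
      obtain ⟨h1, h2⟩ := hT P hP
      rw [mem_dyad] at hx ⊢
      rw [← h2, ← hx, Int.ediv_ediv_of_nonneg (by positivity), ← pow_add]; congr 2; omega
    · intro P hP Q hQ hPQ
      rw [Function.onFun, Finset.disjoint_left]
      intro x hx hy
      rw [mem_dyad] at hx hy
      apply hPQ
      have hlt : ∀ P ∈ T, ∀ Q ∈ T, x / 2 ^ P.1 = P.2.1 → x / 2 ^ Q.1 = Q.2.1 → ¬ P.1 < Q.1 := by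
        intro P hP Q hQ hx hy h
        apply hd P hP Q hQ h
        rw [← hx, ← hy, Int.ediv_ediv_of_nonneg (by positivity), ← pow_add]; congr 2; omega
      have e : P.1 = Q.1 := le_antisymm (not_lt.1 (hlt Q hQ P hP hy hx)) (not_lt.1 (hlt P hP Q hQ hx hy))
      exact hu P hP Q hQ e (by rw [← hx, ← hy, e])
  exact_mod_cast h1

section
variable {d : Fin 3 → ℝ} {C2 : ℝ} {N : ℕ} {φ : Fin 3 → Tile → H} {l : Fin 3 → Tile → ℝ}
    {ε : Fin 3 → Fin 3 → ℝ} {PP : Finset Tile} {f : Fin 3 → H}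

lemma near_anc {P Q : Tile} {k : ℕ} (h : P.1 < Q.1) (hq : P.2.1 / 2 ^ (Q.1 - P.1) = Q.2.1) {z : ℤ}
    (hz : near P (k + 1) z) : near Q k z := by
  unfold near at *
  have := fat_up (J := P.1 + (k + 1)) (J' := Q.1 + k) (by omega) (by norm_num) hz
  rw [Int.ediv_ediv_of_nonneg (by positivity), ← pow_add] at this
  rw [← hq, Int.ediv_ediv_of_nonneg (by positivity), ← pow_add]
  convert this using 5
  omega

lemma size_far (hm : Model d C2 N φ l ε PP) (hN : 2 ≤ N) {e : Fin 3} {S : Finset ℤ} {Ω : Finset ℤ} {k : ℕ}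
    (hS : ∀ x ∈ S, x ∉ Ω) (hf : ∀ x, ‖f e x‖ ≤ if x ∈ S then 1 else 0)
    (h1 : ∀ P ∈ PP, ∀ z, near P k z → z ∈ Ω) (h2 : ∀ P ∈ PP, ∃ z, near P (k + 1) z ∧ z ∉ Ω) :
    SizeLE d φ l f e (2 ^ (N + 1) * 3 * ((2 : ℝ) ^ ((k + 1) * (N - 1)))⁻¹) PP := by
  classical
  intro i hi J M θ
  set T := PP.filter (kt d l i J M θ)
  have hT : ∀ P ∈ T, P ∈ PP ∧ kt d l i J M θ P := fun P hP => Finset.mem_filter.1 hP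
  have hco : ∀ P ∈ T, ‖inner ℂ (φ e P) (f e)‖ ≤ 2 ^ (N + 1) * 3 * ((2 : ℝ) ^ ((k + 1) * (N - 1)))⁻¹ := by
    intro P hP
    refine coef_le hN ((hm.pk e).bd P (hT P hP).1) (by norm_num) (dens3 S P) (k + 1) ?_ hf
    intro x hx r hr hn
    exact hS x hx (h1 P (hT P hP).1 x (near_mono (by omega) hn))
  have hd : ∑ P ∈ T, (2 : ℝ) ^ P.1 ≤ 2 ^ J := by
    refine tree_disj (M := M) (fun P hP => (hT P hP).2.1) ?_ ?_
    · intro P hP Q hQ hlt heq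
      obtain ⟨z, hz, hzΩ⟩ := h2 P (hT P hP).1
      exact hzΩ (h1 Q (hT Q hQ).1 z (near_anc hlt heq hz))
    · intro P hP Q hQ h3 h4
      refine Prod.ext h3 (Prod.ext h4 ?_)
      refine hm.lab i P (hT P hP).1 Q (hT Q hQ).1 h3 ?_
      have a := (hT P hP).2.2
      have b := (hT Q hQ).2.2
      rw [← h3] at b
      rw [abs_le] at *
      constructor <;> linarith [a.1, a.2, b.1, b.2]
  unfold SS
  calc _ ≤ ∑ P ∈ T, (2 : ℝ) ^ P.1 * (2 ^ (N + 1) * 3 * ((2 : ℝ) ^ ((k + 1) * (N - 1)))⁻¹) ^ 2 := by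
        refine Finset.sum_le_sum fun P hP => ?_
        gcongr
        exact hco P hP
    _ = (2 ^ (N + 1) * 3 * ((2 : ℝ) ^ ((k + 1) * (N - 1)))⁻¹) ^ 2 * ∑ P ∈ T, (2 : ℝ) ^ P.1 := by
        rw [← Finset.sum_mul, mul_comm]
    _ ≤ _ := by gcongr

lemma size_tree {K : ℝ} (hK0 : 0 ≤ K) (hK : ∀ (φ : Tile → H) (l : Tile → ℝ) (T : Finset Tile)
    (J : ℕ) (M : ℤ) (θ : ℝ) (f : H) (S : Finset ℤ) (lam : ℝ), 0 ≤ lam → Pk N φ l T → LTree φ l T J M θ C2 →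
    (∀ x, ‖f x‖ ≤ if x ∈ S then 1 else 0) →
    (∀ P ∈ T, ∀ r, ((S.filter (near P r)).card : ℝ) ≤ lam * 2 ^ (P.1 + r)) →
    SS φ f T ≤ K * lam ^ 2 * 2 ^ J) (hm : Model d C2 N φ l ε PP) {e : Fin 3} {S : Finset ℤ} {lam : ℝ} (hlam : 0 ≤ lam)
    (hf : ∀ x, ‖f e x‖ ≤ if x ∈ S then 1 else 0)
    (hd : ∀ P ∈ PP, ∀ r, ((S.filter (near P r)).card : ℝ) ≤ lam * 2 ^ (P.1 + r)) :
    SizeLE d φ l f e (√K * lam) PP := by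
  classical
  intro i hi J M θ
  rw [mul_pow, Real.sq_sqrt hK0]
  have hs := Finset.filter_subset (kt d l i J M θ) PP
  exact hK (φ e) (l e) _ J M (d e * θ) (f e) S lam hlam ((hm.pk e).mono hs)
    (hm.ltree hs hi.symm fun P hP => (Finset.mem_filter.1 hP).2) hf fun P hP => hd P (hs hP)

lemma SizeLE.le {i : Fin 3} {σ σ' : ℝ} (h : SizeLE d φ l f i σ PP) (h0 : 0 ≤ σ) (hs : σ ≤ σ') : SizeLE d φ l f i σ' PP :=
  fun k hk J M θ => (h k hk J M θ).trans (by gcongr)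

end

lemma core_num {θ : Fin 3 → ℝ} (hsum : θ 0 + θ 1 + θ 2 = 1) {e : Fin 3} {N : ℕ} (hNθ : 2 ≤ N * θ e) {W : ℝ} (hW : 0 < W)
    (k : ℕ) {S : Fin 3 → ℝ} (hS : ∀ i, 0 < S i) :
    ∏ i, (W * (2 : ℝ) ^ ((k : ℝ) * (1 - if i = e then (N : ℝ) else 0)) * (S i / S e)) ^ θ i * (√(S i)) ^ (1 - θ i) ≤
      W * (1 / 2) ^ k * ∏ i, S i ^ ((1 + θ i) / 2 - if i = e then 1 else 0) := by
  have hs : ∑ i, θ i = 1 := by rw [Fin.sum_univ_three]; exact hsum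
  have h1 : ∀ i, (W * (2 : ℝ) ^ ((k : ℝ) * (1 - if i = e then (N : ℝ) else 0)) * (S i / S e)) ^ θ i * (√(S i)) ^ (1 - θ i) =
      (W ^ θ i * (2 : ℝ) ^ ((k : ℝ) * (1 - if i = e then (N : ℝ) else 0) * θ i) * (S e) ^ (- θ i)) * S i ^ ((1 + θ i) / 2) := by
    intro i
    rw [Real.mul_rpow (by positivity) (by have := hS i; have := hS e; positivity), Real.mul_rpow (by positivity) (by positivity),
      ← Real.rpow_mul (by norm_num), Real.div_rpow (hS i).le (hS e).le, Real.sqrt_eq_rpow, ← Real.rpow_mul (hS i).le,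
      Real.rpow_neg (hS e).le]
    have : S i ^ ((1 + θ i) / 2) = S i ^ θ i * S i ^ (1 / 2 * (1 - θ i)) := by
      rw [← Real.rpow_add (hS i)]; congr 1; ring
    rw [this]; ring
  have h2 : ∀ i, S i ^ ((1 + θ i) / 2 - if i = e then 1 else 0) = S i ^ ((1 + θ i) / 2) * (S e) ^ (- if i = e then (1 : ℝ) else 0) := by
    intro i
    split_ifs with h
    · rw [h, ← Real.rpow_add (hS e)]; rfl
    · simp
  have pS : ∀ g : Fin 3 → ℝ, ∀ a : ℝ, 0 < a → ∏ i, a ^ g i = a ^ ∑ i, g i := fun g a ha =>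
    (Real.rpow_sum_of_pos ha g _).symm
  rw [Finset.prod_congr rfl fun i _ => h1 i, Finset.prod_congr rfl fun i _ => h2 i]
  simp only [Finset.prod_mul_distrib]
  rw [pS _ _ hW, pS _ _ (by norm_num : (0 : ℝ) < 2), pS _ _ (hS e), pS _ _ (hS e), hs, Finset.sum_neg_distrib,
    Finset.sum_neg_distrib, hs]
  have e1 : ∑ i, (if i = e then (1 : ℝ) else 0) = 1 := by simp
  have e2 : ∑ i, (k : ℝ) * (1 - if i = e then (N : ℝ) else 0) * θ i = k * (1 - N * θ e) := by
    have : ∀ i, (k : ℝ) * (1 - if i = e then (N : ℝ) else 0) * θ i = k * θ i - k * (if i = e then (N : ℝ) * θ i else 0) := by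
      intro i; split_ifs <;> ring
    rw [Finset.sum_congr rfl fun i _ => this i, Finset.sum_sub_distrib, ← Finset.mul_sum, ← Finset.mul_sum, hs]
    simp; ring
  rw [e1, e2, Real.rpow_one]
  have h3 : (2 : ℝ) ^ ((k : ℝ) * (1 - N * θ e)) ≤ (1 / 2) ^ k := by
    have : ((1 : ℝ) / 2) ^ k = 2 ^ (-(k : ℝ)) := by
      rw [Real.rpow_neg (by norm_num), Real.rpow_natCast, one_div, inv_pow]
    rw [this]
    apply Real.rpow_le_rpow_of_exponent_le (by norm_num)
    have : (0 : ℝ) ≤ k := Nat.cast_nonneg k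
    nlinarith
  have h4 : 0 < S e ^ (-1 : ℝ) := Real.rpow_pos_of_pos (hS e) _
  have h5 : 0 < ∏ i, S i ^ ((1 + θ i) / 2) := Finset.prod_pos fun i _ => Real.rpow_pos_of_pos (hS i) _
  calc _ ≤ (W * (1 / 2) ^ k * S e ^ (-1 : ℝ)) * ∏ i, S i ^ ((1 + θ i) / 2) := by gcongr
    _ = _ := by ring

lemma core (θ : Fin 3 → ℝ) (hθ : ∀ i, 0 < θ i ∧ θ i < 1) (hsum : θ 0 + θ 1 + θ 2 = 1) (e : Fin 3) (N : ℕ) (hN : 6 ≤ N)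
    (hNθ : 2 ≤ N * θ e) (C2 : ℝ) (hC2 : 0 ≤ C2) : ∃ C : ℝ, 0 < C ∧ ∀ (d : Fin 3 → ℝ) (φ : Fin 3 → Tile → H)
    (l : Fin 3 → Tile → ℝ) (ε : Fin 3 → Fin 3 → ℝ) (PP : Finset Tile) (f : Fin 3 → H) (S : Fin 3 → Finset ℤ)
    (Ω : Finset ℤ), Model d C2 N φ l ε PP → (∀ i, (S i).Nonempty) →
    (∀ i, i ≠ e → ∀ (J : ℕ) (M : ℤ), 20 * (S i).card * 2 ^ J < (S e).card * ((S i).filter (fun x => x / 2 ^ J = M)).card →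
      ∀ x : ℤ, |x / 2 ^ J - M| ≤ 2 → x ∈ Ω) →
    (∀ i x, ‖f i x‖ ≤ if x ∈ S i then 1 else 0) → (∀ x ∈ Ω, f e x = 0) →
    Lam φ f PP ≤ C * ∏ i, ((S i).card : ℝ) ^ ((1 + θ i) / 2 - if i = e then 1 else 0) := by
  classical
  obtain ⟨K, hK0, hK⟩ := treeD N hN C2 hC2
  obtain ⟨CF, hCF, hF⟩ := Fbound θ (fun i => (hθ i).1) (fun i => (hθ i).2) hsum
  set W : ℝ := 60 * (√K + 2 ^ (N + 1)) with hW
  have hWp : 0 < W := by positivity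
  refine ⟨CF * W * 2, by positivity, fun d φ l ε PP f S Ω hm hne hΩ hf hfe => ?_⟩
  have hSp : ∀ i, (0 : ℝ) < (S i).card := fun i => by exact_mod_cast Finset.card_pos.2 (hne i)
  have hex : ∀ P : Tile, ∃ k, ∃ z, near P k z ∧ z ∉ Ω := by
    intro P
    obtain ⟨z, hz⟩ := Infinite.exists_notMem_finset Ω
    obtain ⟨R, hR⟩ := exists_near P {z}
    exact ⟨R, z, hR z (Finset.mem_singleton_self z), hz⟩
  set kk : Tile → ℕ := fun P => Nat.find (hex P) with hkk
  obtain ⟨G, hG⟩ : ∃ G, G = ∏ i, ((S i).card : ℝ) ^ ((1 + θ i) / 2 - if i = e then 1 else 0) := ⟨_, rfl⟩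
  rw [← hG]
  have hGp : 0 < G := hG ▸ Finset.prod_pos fun i _ => Real.rpow_pos_of_pos (hSp i) _
  have hfe' : ∀ x, ‖f e x‖ ≤ if x ∈ S e \ Ω then 1 else 0 := by
    intro x
    by_cases hx : x ∈ Ω
    · simp [hfe x hx, hx]
    · have := hf e x
      simpa [hx] using this
  have layer : ∀ k, Lam φ f (PP.filter (fun P => kk P = k)) ≤ CF * W * G * (1 / 2) ^ k := by
    intro k
    set Pk' := PP.filter (fun P => kk P = k) with hPk'
    have hmk : Model d C2 N φ l ε Pk' := hm.mono (Finset.filter_subset _ _)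
    have hz : ∀ P ∈ Pk', ∃ z, near P k z ∧ z ∉ Ω := by
      intro P hP
      have := Nat.find_spec (hex P)
      rwa [show Nat.find (hex P) = k from (Finset.mem_filter.1 hP).2] at this
    have hz' : ∀ P ∈ Pk', ∀ j < k, ∀ z, near P j z → z ∈ Ω := by
      intro P hP j hj z hn
      have := Nat.find_min (hex P) (m := j) (by rwa [show Nat.find (hex P) = k from (Finset.mem_filter.1 hP).2])
      by_contra hcon
      exact this ⟨z, hn, hcon⟩
    have hNr : (((N - 1 : ℕ) : ℝ)) = N - 1 := by
      rw [Nat.cast_sub (by omega)]; simp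
    have := hF d C2 N φ l ε Pk' f (fun i => W * (2 : ℝ) ^ ((k : ℝ) * (1 - if i = e then (N : ℝ) else 0)) * ((S i).card / (S e).card))
      (fun i => √((S i).card : ℝ)) hN hmk
      (fun i => by have := hSp i; have := hSp e; positivity)
      (fun i => Real.sqrt_pos.2 (hSp i))
      (fun i => Real.le_sqrt_of_sq_le (norm_sq_le_card (hf i))) ?_
    · refine this.trans ?_
      have h2 := core_num hsum hNθ hWp k hSp
      rw [← hG] at h2
      calc _ ≤ CF * (W * (1 / 2) ^ k * G) := by gcongr
        _ = _ := by ring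
    · intro i
      by_cases hi : i = e
      · subst hi
        have e1 : (2 : ℝ) ^ ((k : ℝ) * (1 - if i = i then (N : ℝ) else 0)) = ((2 : ℝ) ^ (k * (N - 1)))⁻¹ := by
          rw [← Real.rpow_natCast, ← Real.rpow_neg (by norm_num)]
          congr 1
          push_cast
          rw [hNr, if_pos rfl]; ring
        beta_reduce
        rw [e1, div_self (hSp i).ne', mul_one]
        rcases k with _ | k
        · refine (size_tree hK0.le hK hmk (by norm_num : (0 : ℝ) ≤ 3) hfe' fun P _ r => dens3 _ P r).le (by positivity) ?_
          simp only [zero_mul, pow_zero, inv_one, mul_one, hW]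
          have : 0 ≤ √K := Real.sqrt_nonneg K
          have : (0 : ℝ) < 2 ^ (N + 1) := by positivity
          linarith
        · refine (size_far hmk (by omega) (fun x hx => (Finset.mem_sdiff.1 hx).2) hfe' (fun P hP z hn => hz' P hP k (by omega) z hn) hz).le
            (by positivity) ?_
          gcongr
          have : 0 ≤ √K := Real.sqrt_nonneg K
          have : (0 : ℝ) < 2 ^ (N + 1) := by positivity
          rw [hW]; linarith
      · simp only [if_neg hi, sub_zero, mul_one, Real.rpow_natCast]
        refine (size_tree hK0.le hK hmk (lam := 60 * 2 ^ k * ((S i).card / (S e).card)) (by positivity) (hf i) fun P hP r => ?_).le (by positivity) ?_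
        · obtain ⟨z, hz1, hz2⟩ := hz P hP
          exact dens (Finset.card_pos.2 (hne e)) (hΩ i hi) hz1 hz2 r
        · rw [← mul_assoc, ← mul_assoc]
          have : 0 ≤ √K := Real.sqrt_nonneg K
          have : (0 : ℝ) < 2 ^ (N + 1) := by positivity
          gcongr
          rw [hW]; linarith
  calc Lam φ f PP = ∑ k ∈ PP.image kk, Lam φ f (PP.filter (fun P => kk P = k)) := by
        unfold Lam
        rw [Finset.sum_fiberwise_of_maps_to (fun P hP => Finset.mem_image_of_mem _ hP)]
    _ ≤ ∑ k ∈ PP.image kk, CF * W * G * (1 / 2) ^ k := Finset.sum_le_sum fun k _ => layer k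
    _ = CF * W * G * ∑ k ∈ PP.image kk, (1 / 2 : ℝ) ^ k := by rw [Finset.mul_sum]
    _ ≤ CF * W * G * 2 := by
        gcongr
        have := summable_geometric_two.sum_le_tsum (PP.image kk) (fun k _ => by positivity)
        rwa [tsum_geometric_two] at this
    _ = _ := by ring

end BHT

namespace BHT

/-- `f` is band limited to `[a,b]` with smooth frequency profile. -/
def Band (f : ℝ → ℂ) (a b : ℝ) : Prop :=
  ∃ F : ℝ → ℂ, ContDiff ℝ (⊤ : ℕ∞) F ∧ (∀ ξ, (ξ < a ∨ b < ξ) → F ξ = 0) ∧ ∀ x, f x = ∫ ξ, F ξ * ee (x * ξ)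

lemma contDiff_ee : ContDiff ℝ (⊤ : ℕ∞) ee := by
  unfold ee
  apply Complex.contDiff_exp.comp
  apply ContDiff.mul _ contDiff_const
  exact Complex.ofRealCLM.contDiff.comp ((contDiff_const (c := 2 * π)).mul contDiff_id)

lemma cs {F : ℝ → ℂ} {a b : ℝ} (h : ∀ ξ, (ξ < a ∨ b < ξ) → F ξ = 0) : HasCompactSupport F := by
  refine HasCompactSupport.intro (isCompact_Icc (a := a) (b := b)) fun x hx => h x ?_
  rw [Set.mem_Icc, not_and_or, not_le, not_le] at hx
  exact hx

lemma fourier_ee (F : ℝ → ℂ) (x : ℝ) : ∫ ξ, F ξ * ee (x * ξ) = 𝓕 F (-x) := by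
  rw [Real.fourier_real_eq_integral_exp_smul]
  congr 1; ext ξ
  unfold ee
  rw [smul_eq_mul, mul_comm]
  congr 3; push_cast; ring

lemma integrable_ee {F : ℝ → ℂ} {a b : ℝ} (hF : Continuous F) (h : ∀ ξ, (ξ < a ∨ b < ξ) → F ξ = 0) (x : ℝ) :
    Integrable (fun ξ => F ξ * ee (x * ξ)) := by
  apply Continuous.integrable_of_hasCompactSupport
  · have := contDiff_ee.continuous
    fun_prop
  · exact (cs h).mul_right

lemma Band.add {f g : ℝ → ℂ} {a b : ℝ} (hf : Band f a b) (hg : Band g a b) : Band (fun x => f x + g x) a b := by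
  obtain ⟨F, hF, h1, h2⟩ := hf
  obtain ⟨G, hG, h3, h4⟩ := hg
  refine ⟨fun ξ => F ξ + G ξ, hF.add hG, fun ξ h => by simp [h1 ξ h, h3 ξ h], fun x => ?_⟩
  beta_reduce
  rw [h2, h4, ← integral_add (integrable_ee hF.continuous h1 x) (integrable_ee hG.continuous h3 x)]
  congr 1; ext ξ; ring

lemma Band.const_mul {f : ℝ → ℂ} {a b : ℝ} (hf : Band f a b) (c : ℂ) : Band (fun x => c * f x) a b := by
  obtain ⟨F, hF, h1, h2⟩ := hf
  refine ⟨fun ξ => c * F ξ, contDiff_const.mul hF, fun ξ h => by simp [h1 ξ h], fun x => ?_⟩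
  beta_reduce
  rw [h2, ← integral_const_mul]
  congr 1; ext ξ; ring

lemma band_zero (a b : ℝ) : Band (fun _ => 0) a b :=
  ⟨fun _ => 0, contDiff_const, fun _ _ => rfl, fun x => by simp⟩

lemma Band.sum {ι : Type*} {f : ι → ℝ → ℂ} {a b : ℝ} (s : Finset ι) (hf : ∀ i ∈ s, Band (f i) a b) :
    Band (fun x => ∑ i ∈ s, f i x) a b := by
  classical
  induction s using Finset.induction_on with
  | empty => simpa using band_zero a b
  | insert i s hi ih =>
    simp only [Finset.sum_insert hi]
    exact (hf i (Finset.mem_insert_self i s)).add (ih fun j hj => hf j (Finset.mem_insert_of_mem hj))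

lemma Band.mono {f : ℝ → ℂ} {a b a' b' : ℝ} (hf : Band f a b) (h1 : a' ≤ a) (h2 : b ≤ b') : Band f a' b' := by
  obtain ⟨F, hF, h3, h4⟩ := hf
  exact ⟨F, hF, fun ξ h => h3 ξ (h.imp (fun h => h.trans_le h1) (fun h => h2.trans_lt h)), h4⟩

lemma Band.conj {f : ℝ → ℂ} {a b : ℝ} (hf : Band f a b) : Band (fun x => starRingEnd ℂ (f x)) (-b) (-a) := by
  obtain ⟨F, hF, h1, h2⟩ := hf
  refine ⟨fun ξ => starRingEnd ℂ (F (-ξ)), ?_, fun ξ h => ?_, fun x => ?_⟩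
  · exact (Complex.conjCLE.contDiff).comp (hF.comp contDiff_neg)
  · beta_reduce
    rw [h1 (-ξ) (by rcases h with h | h; right; linarith; left; linarith), map_zero]
  · beta_reduce
    rw [h2, ← integral_conj, ← integral_neg_eq_self]
    congr 1; ext ξ
    rw [map_mul]
    congr 1
    unfold ee
    rw [← Complex.exp_conj, map_mul, Complex.conj_I, Complex.conj_ofReal]
    congr 1; push_cast; ring

lemma Band.modul {f : ℝ → ℂ} {a b : ℝ} (hf : Band f a b) (ω : ℝ) : Band (fun x => f x * ee (ω * x)) (a + ω) (b + ω) := by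
  obtain ⟨F, hF, h1, h2⟩ := hf
  refine ⟨fun ξ => F (ξ - ω), hF.comp (by fun_prop), fun ξ h => h1 _ ?_, fun x => ?_⟩
  · rcases h with h | h
    · left; linarith
    · right; linarith
  · beta_reduce
    rw [h2, ← integral_mul_const, ← integral_sub_right_eq_self (fun ξ => F ξ * ee (x * ξ) * ee (ω * x)) ω]
    congr 1; ext ξ
    rw [mul_assoc, ← ee_add]; congr 2; ring

/-- affine substitution -/
lemma Band.affine {f : ℝ → ℂ} {a b : ℝ} (hf : Band f a b) (y : ℝ) {c : ℝ} (hc : c ≠ 0) {a' b' : ℝ}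
    (h : ∀ ξ, a ≤ ξ → ξ ≤ b → a' ≤ c * ξ ∧ c * ξ ≤ b') : Band (fun t => f (y + c * t)) a' b' := by
  obtain ⟨F, hF, h1, h2⟩ := hf
  refine ⟨fun ξ => ((|c⁻¹| : ℝ) : ℂ) * (F (c⁻¹ * ξ) * ee (y * (c⁻¹ * ξ))), ?_, fun ξ hξ => ?_, fun t => ?_⟩
  · refine contDiff_const.mul ((hF.comp (by fun_prop)).mul (contDiff_ee.comp (by fun_prop)))
  · have : F (c⁻¹ * ξ) = 0 := by
      apply h1
      by_contra hcon
      push Not at hcon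
      have := h _ hcon.1 hcon.2
      rw [mul_inv_cancel_left₀ hc] at this
      rcases hξ with hξ | hξ
      · linarith [this.1]
      · linarith [this.2]
    simp [this]
  · have := Measure.integral_comp_mul_left (fun ξ => F ξ * ee ((y + c * t) * ξ)) c⁻¹
    rw [inv_inv] at this
    have h3 : ∫ ξ, ((|c⁻¹| : ℝ) : ℂ) * (F (c⁻¹ * ξ) * ee (y * (c⁻¹ * ξ))) * ee (t * ξ) =
        ((|c⁻¹| : ℝ) : ℂ) * ∫ ξ, F (c⁻¹ * ξ) * ee ((y + c * t) * (c⁻¹ * ξ)) := by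
      rw [← integral_const_mul]
      congr 1; ext ξ
      have : ee ((y + c * t) * (c⁻¹ * ξ)) = ee (y * (c⁻¹ * ξ)) * ee (t * ξ) := by
        rw [← ee_add]; congr 1; field_simp
      rw [this]; ring
    beta_reduce
    rw [h3, this, h2, Complex.real_smul, ← mul_assoc, ← Complex.ofReal_mul]
    have : |c⁻¹| * |c| = 1 := by rw [← abs_mul, inv_mul_cancel₀ hc, abs_one]
    rw [this]; simp

open scoped Convolution in
lemma Band.mul {f g : ℝ → ℂ} {a b c d : ℝ} (hf : Band f a b) (hg : Band g c d) :
    Band (fun x => f x * g x) (a + c) (b + d) := by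
  obtain ⟨F, hF, h1, h2⟩ := hf
  obtain ⟨G, hG, h3, h4⟩ := hg
  refine ⟨F ⋆[ContinuousLinearMap.mul ℂ ℂ, volume] G, ?_, fun ξ h => ?_, fun x => ?_⟩
  · exact (cs h1).contDiff_convolution_left (𝕜 := ℝ) ((ContinuousLinearMap.mul ℝ ℂ)) hF hG.continuous.locallyIntegrable
  · rw [convolution_def]
    rw [integral_eq_zero_of_ae]
    filter_upwards with t
    by_cases ht : t < a ∨ b < t
    · simp [h1 t ht]
    · push Not at ht
      have : G (ξ - t) = 0 := by
        apply h3
        rcases h with h | h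
        · left; linarith [ht.1]
        · right; linarith [ht.2]
      simp [this]
  · beta_reduce
    rw [h2, h4, fourier_ee, fourier_ee, fourier_ee, Real.fourier_mul_convolution_eq]
    · exact hF.continuous.integrable_of_hasCompactSupport (cs h1)
    · exact hG.continuous.integrable_of_hasCompactSupport (cs h3)

lemma Band.schwartz {f : ℝ → ℂ} {a b : ℝ} (hf : Band f a b) : ∃ g : 𝓢(ℝ, ℂ), (∀ x, g x = f x) ∧
    ∀ ξ, (ξ < a ∨ b < ξ) → 𝓕 g ξ = 0 := by
  obtain ⟨F, hF, h1, h2⟩ := hf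
  refine ⟨𝓕⁻ ((cs h1).toSchwartzMap hF), fun x => ?_, fun ξ h => ?_⟩
  · rw [SchwartzMap.fourierInv_coe, Real.fourierInv_eq_fourier_neg, h2, fourier_ee]
    rfl
  · rw [FourierTransform.fourier_fourierInv_eq]
    exact h1 ξ h

lemma Band.poisson {f : ℝ → ℂ} {a b : ℝ} (hf : Band f a b) (h : ∀ m : ℤ, (m : ℝ) < a ∨ b < m) : ∑' n : ℤ, f n = 0 := by
  obtain ⟨g, hg, hg2⟩ := hf.schwartz
  have := g.tsum_eq_tsum_fourier 0
  simp only [zero_add, hg] at this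
  rw [this]
  have h2 : ∀ n : ℤ, 𝓕 g (n : ℝ) * fourier n ((0 : ℝ) : UnitAddCircle) = 0 := fun n => by rw [hg2 _ (h n), zero_mul]
  rw [tsum_congr h2, tsum_zero]

lemma schwartz_decay (g : 𝓢(ℝ, ℂ)) (N : ℕ) : ∃ C : ℝ, 0 < C ∧ ∀ x, ‖g x‖ ≤ C * ((1 + |x|) ^ N)⁻¹ := by
  have h := g.one_add_le_sup_seminorm_apply (𝕜 := ℝ) (m := (N, 0)) (k := N) (n := 0) le_rfl le_rfl
  refine ⟨2 ^ N * ((Finset.Iic (N, 0)).sup fun m => SchwartzMap.seminorm ℝ m.1 m.2) g + 1,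
    by have := apply_nonneg ((Finset.Iic (N, 0)).sup fun m => SchwartzMap.seminorm ℝ (F := ℂ) (E := ℝ) m.1 m.2) g; positivity, fun x => ?_⟩
  have := h x
  rw [norm_iteratedFDeriv_zero] at this
  rw [← div_eq_mul_inv, le_div_iff₀ (by positivity)]
  rw [Real.norm_eq_abs] at this
  linarith

end BHT

namespace BHT

lemma ee_int (n : ℤ) : ee n = 1 := by
  unfold ee
  rw [Complex.exp_eq_one_iff]
  exact ⟨n, by push_cast; ring⟩

lemma sT_smooth : ContDiff ℝ (⊤ : ℕ∞) Real.smoothTransition := Real.smoothTransition.contDiff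

lemma integral_ee_unit (n : ℤ) : ∫ ξ in (0:ℝ)..1, ee (n * ξ) = if n = 0 then 1 else 0 := by
  split_ifs with h
  · subst h; simp [ee]
  · have hn : (n : ℂ) ≠ 0 := by exact_mod_cast h
    have hc : (2 * π * n * I : ℂ) ≠ 0 := by
      simp [hn, Real.pi_ne_zero]
    have := integral_exp_mul_complex (a := 0) (b := 1) hc
    have h2 : ∀ ξ : ℝ, ee (n * ξ) = Complex.exp (2 * π * n * I * ξ) := fun ξ => by
      unfold ee; congr 1; push_cast; ring
    simp_rw [h2]
    rw [this]
    have h3 := ee_int n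
    have h4 : Complex.exp (2 * π * n * I * (1:ℝ)) = 1 := by
      rw [← h3]; unfold ee; congr 1; push_cast; ring
    rw [h4]; simp

lemma exists_psi : ∃ ψ : ℝ → ℂ, Band ψ (-1) 1 ∧ ∀ n : ℤ, ψ n = if n = 0 then 1 else 0 := by
  obtain ⟨χ, hχ⟩ : ∃ χ : ℝ → ℂ, χ = fun ξ => ((Real.smoothTransition (ξ + 1) - Real.smoothTransition ξ : ℝ) : ℂ) := ⟨_, rfl⟩
  have hsm : ContDiff ℝ (⊤ : ℕ∞) χ := by
    rw [hχ]
    exact Complex.ofRealCLM.contDiff.comp ((sT_smooth.comp (contDiff_id.add contDiff_const)).sub sT_smooth)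
  have hs : ∀ ξ, (ξ < -1 ∨ 1 < ξ) → χ ξ = 0 := by
    intro ξ h
    rw [hχ]
    rcases h with h | h
    · simp [Real.smoothTransition.zero_of_nonpos (show ξ + 1 ≤ 0 by linarith), Real.smoothTransition.zero_of_nonpos (show ξ ≤ 0 by linarith)]
    · simp [Real.smoothTransition.one_of_one_le (show 1 ≤ ξ + 1 by linarith), Real.smoothTransition.one_of_one_le (show 1 ≤ ξ by linarith)]
  refine ⟨fun x => ∫ ξ, χ ξ * ee (x * ξ), ⟨χ, hsm, hs, fun x => rfl⟩, fun n => ?_⟩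
  have hee := contDiff_ee.continuous
  have hχc := hsm.continuous
  have hc : Continuous fun ξ => χ ξ * ee (n * ξ) := by fun_prop
  have h1 : ∫ ξ, χ ξ * ee (n * ξ) = ∫ ξ in (-1:ℝ)..1, χ ξ * ee (n * ξ) := by
    rw [intervalIntegral.integral_of_le (by norm_num), ← integral_Icc_eq_integral_Ioc]
    symm
    apply setIntegral_eq_integral_of_forall_compl_eq_zero
    intro x hx
    rw [Set.mem_Icc, not_and_or, not_le, not_le] at hx
    rw [hs x hx, zero_mul]
  have h2 : ∫ ξ in (-1:ℝ)..0, χ ξ * ee (n * ξ) = ∫ ξ in (0:ℝ)..1, χ (ξ - 1) * ee (n * ξ) := by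
    have := intervalIntegral.integral_comp_sub_right (a := 0) (b := 1) (fun ξ => χ ξ * ee (n * ξ)) 1
    norm_num at this
    rw [← this]
    apply intervalIntegral.integral_congr
    intro ξ _
    beta_reduce
    have : ee (n * ξ) = ee (n * (ξ - 1)) * ee n := by rw [← ee_add]; congr 1; ring
    rw [this, ee_int, mul_one]
  beta_reduce
  rw [h1, ← intervalIntegral.integral_add_adjacent_intervals (hc.intervalIntegrable (-1) 0) (hc.intervalIntegrable 0 1), h2,
    ← intervalIntegral.integral_add (by apply Continuous.intervalIntegrable; fun_prop) (hc.intervalIntegrable 0 1),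
    ← integral_ee_unit]
  apply intervalIntegral.integral_congr
  intro ξ hξ
  rw [Set.uIcc_of_le (by norm_num), Set.mem_Icc] at hξ
  beta_reduce
  rw [hχ]
  beta_reduce
  rw [Real.smoothTransition.one_of_one_le (show 1 ≤ ξ + 1 by linarith), Real.smoothTransition.zero_of_nonpos (show ξ - 1 ≤ 0 by linarith), sub_add_cancel]
  push_cast; ring

lemma exists_kernel (a : ℝ) (ha : 0 < a) : ∃ γ u : ℝ → ℂ, Band γ (a / 2) (2 * a) ∧ Band u a (2 * a) ∧ u 0 = 1 ∧
    ∀ t : ℝ, -(2 * π * I * t) * γ t = u (t / 2) - u t := by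
  obtain ⟨h, hh⟩ : ∃ h : ℝ → ℂ, h = fun ξ => ((Real.smoothTransition (ξ / a - 1) : ℝ) : ℂ) := ⟨_, rfl⟩
  have hsm : ContDiff ℝ (⊤ : ℕ∞) h := by
    rw [hh]
    exact Complex.ofRealCLM.contDiff.comp (sT_smooth.comp ((contDiff_id.div_const a).sub contDiff_const))
  have h0 : ∀ ξ, ξ ≤ a → h ξ = 0 := fun ξ hξ => by
    rw [hh]; beta_reduce
    rw [Real.smoothTransition.zero_of_nonpos (by rw [sub_nonpos, div_le_one ha]; exact hξ)]; simp
  have h1 : ∀ ξ, 2 * a ≤ ξ → h ξ = 1 := fun ξ hξ => by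
    rw [hh]; beta_reduce
    rw [Real.smoothTransition.one_of_one_le (by rw [le_sub_iff_add_le, le_div_iff₀ ha]; linarith)]; simp
  have hd : ContDiff ℝ (⊤ : ℕ∞) (deriv h) := by
    exact (contDiff_infty_iff_deriv.1 hsm).2
  have hd0 : ∀ ξ, (ξ < a ∨ 2 * a < ξ) → deriv h ξ = 0 := by
    intro ξ hξ
    rcases hξ with hξ | hξ
    · have : h =ᶠ[nhds ξ] fun _ => 0 := by
        filter_upwards [Iio_mem_nhds hξ] with y hy using h0 y (le_of_lt hy)
      rw [this.deriv_eq]; simp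
    · have : h =ᶠ[nhds ξ] fun _ => 1 := by
        filter_upwards [Ioi_mem_nhds hξ] with y hy using h1 y (le_of_lt hy)
      rw [this.deriv_eq]; simp
  obtain ⟨Γ, hΓ⟩ : ∃ Γ : ℝ → ℂ, Γ = fun ξ => h (2 * ξ) - h ξ := ⟨_, rfl⟩
  have hΓs : ContDiff ℝ (⊤ : ℕ∞) Γ := by
    rw [hΓ]; exact (hsm.comp (contDiff_const.mul contDiff_id)).sub hsm
  have hΓ0 : ∀ ξ, (ξ < a / 2 ∨ 2 * a < ξ) → Γ ξ = 0 := by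
    intro ξ hξ
    rw [hΓ]; beta_reduce
    rcases hξ with hξ | hξ
    · rw [h0 _ (by linarith), h0 _ (by linarith), sub_zero]
    · rw [h1 _ (by linarith), h1 _ (by linarith), sub_self]
  obtain ⟨u, hu⟩ : ∃ u : ℝ → ℂ, u = fun x => ∫ ξ, deriv h ξ * ee (x * ξ) := ⟨_, rfl⟩
  have hdiff : Differentiable ℝ h := hsm.differentiable (by simp)
  refine ⟨fun x => ∫ ξ, Γ ξ * ee (x * ξ), u, ⟨Γ, hΓs, hΓ0, fun x => rfl⟩, ⟨_, hd, hd0, fun x => by rw [hu]⟩, ?_, fun t => ?_⟩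
  · rw [hu]; beta_reduce
    simp only [zero_mul, ee_zero, mul_one]
    have : ∫ ξ, deriv h ξ = ∫ ξ in a..(2 * a), deriv h ξ := by
      rw [intervalIntegral.integral_of_le (by linarith), ← integral_Icc_eq_integral_Ioc]
      symm
      apply setIntegral_eq_integral_of_forall_compl_eq_zero
      intro x hx
      rw [Set.mem_Icc, not_and_or, not_le, not_le] at hx
      exact hd0 x hx
    rw [this, intervalIntegral.integral_deriv_eq_sub (fun x _ => hdiff x) (hd.continuous.intervalIntegrable _ _), h0 a le_rfl, h1 _ le_rfl, sub_zero]
  · have hΓd : Differentiable ℝ Γ := hΓs.differentiable (by simp)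
    have hdc : ∀ ξ, deriv Γ ξ = 2 * deriv h (2 * ξ) - deriv h ξ := by
      intro ξ
      rw [hΓ]
      have e1 : HasDerivAt (fun ξ : ℝ => h (2 * ξ)) (2 * deriv h (2 * ξ)) ξ := by
        have := (hdiff (2 * ξ)).hasDerivAt.scomp ξ ((hasDerivAt_id ξ).const_mul 2)
        simpa [Function.comp_def] using this
      exact (e1.sub (hdiff ξ).hasDerivAt).deriv
    have hΓ'c : Continuous (deriv Γ) := by
      have := hd.continuous
      rw [funext hdc]; fun_prop
    have hF := Real.fourier_deriv (f := Γ) (hΓs.continuous.integrable_of_hasCompactSupport (cs hΓ0)) hΓd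
      (hΓ'c.integrable_of_hasCompactSupport (cs hΓ0).deriv)
    have hF2 := congrFun hF (-t)
    rw [← fourier_ee, ← fourier_ee, smul_eq_mul] at hF2
    have e2 : ∫ ξ, deriv Γ ξ * ee (t * ξ) = u (t / 2) - u t := by
      have e3 : ∫ ξ, (2 * deriv h (2 * ξ)) * ee (t * ξ) = u (t / 2) := by
        have := Measure.integral_comp_mul_left (fun ξ => deriv h ξ * ee (t / 2 * ξ)) 2
        rw [hu]; beta_reduce
        rw [abs_of_pos (by norm_num)] at this
        have e4 : ∫ ξ, deriv h ξ * ee (t / 2 * ξ) = 2 * ∫ ξ, deriv h (2 * ξ) * ee (t / 2 * (2 * ξ)) := by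
          rw [this, Complex.real_smul]; push_cast; ring
        rw [e4, ← integral_const_mul]
        congr 1; ext ξ
        rw [mul_assoc]; congr 3; ring
      have hc2 : HasCompactSupport fun ξ => 2 * deriv h (2 * ξ) := by
        apply cs (a := a / 2) (b := a)
        intro ξ hξ
        rw [hd0 _ (by rcases hξ with h | h; left; linarith; right; linarith), mul_zero]
      have hee := contDiff_ee.continuous
      have hdcont := hd.continuous
      rw [← e3]
      rw [hu]; beta_reduce
      rw [← integral_sub]
      · congr 1; ext ξ; rw [hdc]; ring
      · exact Continuous.integrable_of_hasCompactSupport (by fun_prop) hc2.mul_right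
      · exact integrable_ee hdcont hd0 t
    rw [← e2, hF2]
    push_cast; ring

lemma Band.decay {f : ℝ → ℂ} {a b : ℝ} (hf : Band f a b) (N : ℕ) : ∃ C : ℝ, 0 < C ∧ ∀ x, ‖f x‖ ≤ C * ((1 + |x|) ^ N)⁻¹ := by
  obtain ⟨g, hg, -⟩ := hf.schwartz
  obtain ⟨C, hC, h⟩ := schwartz_decay g N
  exact ⟨C, hC, fun x => by rw [← hg]; exact h x⟩

lemma Band.deriv_decay {f : ℝ → ℂ} {a b : ℝ} (hf : Band f a b) (N : ℕ) : ∃ C : ℝ, 0 < C ∧ Differentiable ℝ f ∧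
    ∀ x, ‖deriv f x‖ ≤ C * ((1 + |x|) ^ N)⁻¹ := by
  obtain ⟨g, hg, -⟩ := hf.schwartz
  obtain ⟨C, hC, h⟩ := schwartz_decay (SchwartzMap.derivCLM ℂ ℂ g) N
  have : (fun x => g x) = f := funext hg
  refine ⟨C, hC, by rw [← this]; exact g.differentiable, fun x => ?_⟩
  have := h x
  rw [SchwartzMap.derivCLM_apply] at this
  rwa [← funext hg]

end BHT

namespace BHT

/-- frequency-localising kernel -/
noncomputable def Phi (ψ : ℝ → ℂ) (j : ℕ) (l : ℤ) (x : ℝ) : ℂ :=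
  (((2 ^ j)⁻¹ : ℝ) : ℂ) * ψ (x / 2 ^ j) * ee ((l : ℝ) / 2 ^ j * x)

/-- frequency-localised piece of `f` -/
noncomputable def fl (ψ : ℝ → ℂ) (S : Finset ℤ) (f : ℤ → ℂ) (j : ℕ) (l : ℤ) (x : ℝ) : ℂ :=
  ∑ y ∈ S, f y * Phi ψ j l (x - y)

/-- kernel at scale `j` -/
noncomputable def Kj (γ : ℝ → ℂ) (j : ℕ) (t : ℝ) : ℂ := (((2 ^ j)⁻¹ : ℝ) : ℂ) * γ (t / 2 ^ j)

lemma ee_pow (x : ℝ) (n : ℕ) : ee x ^ n = ee (n * x) := by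
  unfold ee; rw [← Complex.exp_nat_mul]; congr 1; push_cast; ring

lemma ee_eq_one {x : ℝ} (h : ee x = 1) : ∃ n : ℤ, x = n := by
  unfold ee at h
  rw [Complex.exp_eq_one_iff] at h
  obtain ⟨n, hn⟩ := h
  refine ⟨n, ?_⟩
  have h2 : ((2 * π * x : ℝ) : ℂ) * I = ((2 * π * n : ℝ) : ℂ) * I := by rw [hn]; push_cast; ring
  have h3 := mul_right_cancel₀ Complex.I_ne_zero h2
  have h4 : 2 * π * x = 2 * π * n := by exact_mod_cast h3
  exact mul_left_cancel₀ (by positivity) h4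

lemma sum_Phi {ψ : ℝ → ℂ} (hψ : ∀ n : ℤ, ψ n = if n = 0 then 1 else 0) (j : ℕ) (x : ℤ) :
    ∑ l ∈ Finset.Ico (0:ℤ) (2 ^ j), Phi ψ j l x = if x = 0 then 1 else 0 := by
  unfold Phi
  rw [← Finset.mul_sum]
  have hI : Finset.Ico (0:ℤ) (2 ^ j) = (Finset.range (2 ^ j)).image (fun n : ℕ => (n : ℤ)) := by
    ext x
    simp only [Finset.mem_Ico, Finset.mem_image, Finset.mem_range]
    constructor
    · rintro ⟨h1, h2⟩
      refine ⟨x.toNat, ?_, Int.toNat_of_nonneg h1⟩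
      have : ((x.toNat : ℕ) : ℤ) < ((2 ^ j : ℕ) : ℤ) := by rw [Int.toNat_of_nonneg h1]; push_cast; exact h2
      exact_mod_cast this
    · rintro ⟨n, hn, rfl⟩
      exact ⟨by positivity, by exact_mod_cast hn⟩
  have h1 : ∑ l ∈ Finset.Ico (0:ℤ) (2 ^ j), ee ((l : ℝ) / 2 ^ j * x) = ∑ n ∈ Finset.range (2 ^ j), ee ((x : ℝ) / 2 ^ j) ^ n := by
    rw [hI, Finset.sum_image (fun a _ b _ h => by exact_mod_cast h)]
    apply Finset.sum_congr rfl
    intro n _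
    rw [ee_pow]; congr 1; push_cast; ring
  rw [h1]
  have h2j : (2:ℝ) ^ j ≠ 0 := by positivity
  by_cases hx : ee ((x : ℝ) / 2 ^ j) = 1
  · obtain ⟨m, hm⟩ := ee_eq_one hx
    rw [hx, hm, hψ]
    have : x = m * 2 ^ j := by
      rw [div_eq_iff h2j] at hm; exact_mod_cast hm
    by_cases hm0 : m = 0
    · subst hm0
      simp [this]
    · rw [if_neg hm0, if_neg (by rw [this]; positivity)]
      simp
  · have hg := mul_neg_geom_sum (ee ((x : ℝ) / 2 ^ j)) (2 ^ j)
    rw [ee_pow] at hg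
    have : ((2 ^ j : ℕ) : ℝ) * (x / 2 ^ j) = x := by push_cast; field_simp
    rw [this, ee_int, sub_self] at hg
    have h3 := (mul_eq_zero.1 hg).resolve_left (sub_ne_zero.2 (Ne.symm hx))
    rw [h3, mul_zero, if_neg]
    rintro rfl
    simp [ee_zero] at hx

lemma sum_fl {ψ : ℝ → ℂ} (hψ : ∀ n : ℤ, ψ n = if n = 0 then 1 else 0) {S : Finset ℤ} {f : ℤ → ℂ} (hf : ∀ x, x ∉ S → f x = 0)
    (j : ℕ) (x : ℤ) : ∑ l ∈ Finset.Ico (0:ℤ) (2 ^ j), fl ψ S f j l x = f x := by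
  unfold fl
  rw [Finset.sum_comm]
  have : ∀ y ∈ S, ∑ l ∈ Finset.Ico (0:ℤ) (2 ^ j), f y * Phi ψ j l ((x:ℝ) - y) = if x = y then f y else 0 := by
    intro y _
    rw [← Finset.mul_sum]
    have := sum_Phi hψ j (x - y)
    push_cast at this
    rw [this]
    by_cases h : x = y
    · simp [h]
    · simp [h, sub_eq_zero]
  rw [Finset.sum_congr rfl this, Finset.sum_ite_eq]
  split_ifs with h
  · rfl
  · exact (hf x h).symm

lemma Phi_band {ψ : ℝ → ℂ} (hψ : Band ψ (-1) 1) (j : ℕ) (l : ℤ) :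
    Band (Phi ψ j l) (((l:ℝ) - 1) / 2 ^ j) (((l:ℝ) + 1) / 2 ^ j) := by
  have h2 : (0:ℝ) < 2 ^ j := by positivity
  have h1 : Band (fun t => ψ (0 + (2 ^ j)⁻¹ * t)) (-1 / 2 ^ j) (1 / 2 ^ j) := by
    apply hψ.affine 0 (by positivity)
    intro ξ h h'
    rw [inv_mul_eq_div]
    constructor <;> gcongr
  have h3 := (h1.const_mul (((2 ^ j)⁻¹ : ℝ) : ℂ)).modul ((l:ℝ) / 2 ^ j)
  have h4 := h3.mono (a' := ((l:ℝ) - 1) / 2 ^ j) (b' := ((l:ℝ) + 1) / 2 ^ j) (by apply le_of_eq; ring) (by apply le_of_eq; ring)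
  convert h4 using 1
  ext x; unfold Phi; rw [zero_add, inv_mul_eq_div]

lemma fl_band {ψ : ℝ → ℂ} (hψ : Band ψ (-1) 1) (S : Finset ℤ) (f : ℤ → ℂ) (j : ℕ) (l : ℤ) :
    Band (fl ψ S f j l) (((l:ℝ) - 1) / 2 ^ j) (((l:ℝ) + 1) / 2 ^ j) := by
  unfold fl
  apply Band.sum
  intro y _
  apply Band.const_mul
  have := (Phi_band hψ j l).affine (-(y:ℝ)) (c := 1) one_ne_zero (a' := ((l:ℝ) - 1) / 2 ^ j) (b' := ((l:ℝ) + 1) / 2 ^ j)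
    (fun ξ h h' => by rw [one_mul]; exact ⟨h, h'⟩)
  convert this using 2
  congr 1; ring

lemma Kj_band {γ : ℝ → ℂ} {a : ℝ} (hγ : Band γ (a / 2) (2 * a)) (j : ℕ) :
    Band (Kj γ j) (a / 2 / 2 ^ j) (2 * a / 2 ^ j) := by
  have h2 : (0:ℝ) < 2 ^ j := by positivity
  have h1 : Band (fun t => γ (0 + (2 ^ j)⁻¹ * t)) (a / 2 / 2 ^ j) (2 * a / 2 ^ j) := by
    apply hγ.affine 0 (by positivity)
    intro ξ h h'
    rw [inv_mul_eq_div]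
    constructor <;> gcongr
  convert h1.const_mul (((2 ^ j)⁻¹ : ℝ) : ℂ) using 1
  ext x; unfold Kj; rw [zero_add, inv_mul_eq_div]

/-- one frequency piece of the form -/
noncomputable def FF (β : Fin 3 → ℤ) (g : Fin 3 → ℝ → ℂ) (k : ℝ → ℂ) (z : ℤ × ℤ) : ℂ :=
  (∏ i, g i ((z.1 : ℝ) - β i * z.2)) * k z.2

lemma summable_Z2 : Summable fun t : ℤ => ((1 + |(t:ℝ)|) ^ 2)⁻¹ := by
  obtain ⟨C, -, hC⟩ := Zbasic
  apply summable_of_sum_le (c := C) (fun t => by positivity)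
  intro X
  simpa using hC X 0

lemma FF_summable {β : Fin 3 → ℤ} {g : Fin 3 → ℝ → ℂ} {k : ℝ → ℂ} {a b : Fin 3 → ℝ} {c d : ℝ}
    (hg : ∀ i, Band (g i) (a i) (b i)) (hk : Band k c d) : Summable (FF β g k) := by
  choose C hC hC2 using fun i => (hg i).decay 2
  obtain ⟨D, hD, hD2⟩ := hk.decay 2
  have h1 : Summable fun z : ℤ × ℤ => ((1 + |(z.1:ℝ)|) ^ 2)⁻¹ * ((1 + |(z.2:ℝ)|) ^ 2)⁻¹ :=
    summable_Z2.mul_of_nonneg summable_Z2 (fun _ => by positivity) (fun _ => by positivity)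
  obtain ⟨e, he⟩ : ∃ e : ℤ × ℤ ≃ ℤ × ℤ, ∀ z, e z = (z.1 - β 0 * z.2, z.2) :=
    ⟨⟨fun z => (z.1 - β 0 * z.2, z.2), fun z => (z.1 + β 0 * z.2, z.2), fun z => by simp, fun z => by simp⟩, fun z => rfl⟩
  have h2 := (e.summable_iff.2 h1).mul_left (C 0 * C 1 * C 2 * D)
  refine Summable.of_norm_bounded h2 fun z => ?_
  unfold FF
  rw [Fin.prod_univ_three, norm_mul, norm_mul, norm_mul, Function.comp_apply, he]
  push_cast
  have one : ∀ x : ℝ, ((1 + |x|) ^ 2)⁻¹ ≤ 1 := fun x => by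
    apply inv_le_one_of_one_le₀
    have := abs_nonneg x
    nlinarith
  have e0 := hC2 0 ((z.1:ℝ) - β 0 * z.2)
  have e1 := (hC2 1 ((z.1:ℝ) - β 1 * z.2)).trans (mul_le_of_le_one_right (hC 1).le (one _))
  have e2 := (hC2 2 ((z.1:ℝ) - β 2 * z.2)).trans (mul_le_of_le_one_right (hC 2).le (one _))
  have e3 := hD2 z.2
  calc _ ≤ (C 0 * ((1 + |(z.1:ℝ) - β 0 * z.2|) ^ 2)⁻¹) * C 1 * C 2 * (D * ((1 + |(z.2:ℝ)|) ^ 2)⁻¹) := by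
        have := hC 0; have := hC 1; have := hC 2
        gcongr
    _ = _ := by ring

lemma band_x {β : Fin 3 → ℤ} {g : Fin 3 → ℝ → ℂ} {a b : Fin 3 → ℝ} (hg : ∀ i, Band (g i) (a i) (b i)) (t : ℝ) :
    Band (fun x => ∏ i, g i (x - β i * t)) (∑ i, a i) (∑ i, b i) := by
  have h : ∀ i, Band (fun x => g i (x - β i * t)) (a i) (b i) := fun i => by
    have := (hg i).affine (-(β i * t)) (c := 1) one_ne_zero (a' := a i) (b' := b i) (fun ξ h h' => by rw [one_mul]; exact ⟨h, h'⟩)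
    convert this using 3
    ring
  simp only [Fin.prod_univ_three, Fin.sum_univ_three]
  exact ((h 0).mul (h 1)).mul (h 2)

lemma FF_zero_x {β : Fin 3 → ℤ} {g : Fin 3 → ℝ → ℂ} {k : ℝ → ℂ} {a b : Fin 3 → ℝ} {c d : ℝ}
    (hg : ∀ i, Band (g i) (a i) (b i)) (hk : Band k c d) (h : ∀ m : ℤ, (m:ℝ) < ∑ i, a i ∨ ∑ i, b i < m) :
    ∑' z, FF β g k z = 0 := by
  have hs := FF_summable (β := β) hg hk
  have hs2 := (Equiv.prodComm ℤ ℤ).summable_iff.2 hs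
  rw [← (Equiv.prodComm ℤ ℤ).tsum_eq]
  change ∑' c, (FF β g k ∘ ⇑(Equiv.prodComm ℤ ℤ)) c = 0
  rw [hs2.tsum_prod]
  have : ∀ t : ℤ, ∑' x : ℤ, FF β g k ((Equiv.prodComm ℤ ℤ) (t, x)) = 0 := by
    intro t
    unfold FF
    simp only [Equiv.prodComm_apply, Prod.swap]
    rw [tsum_mul_right, (band_x hg (t:ℝ)).poisson h, zero_mul]
  exact (tsum_congr this).trans tsum_zero

lemma FF_zero_t {β : Fin 3 → ℤ} (hβ : ∀ i, β i ≠ 0) {g : Fin 3 → ℝ → ℂ} {k : ℝ → ℂ} {a b : Fin 3 → ℝ} {a' b' : Fin 3 → ℝ} {c d : ℝ}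
    (hg : ∀ i, Band (g i) (a i) (b i)) (hk : Band k c d)
    (hab : ∀ i ξ, a i ≤ ξ → ξ ≤ b i → a' i ≤ -β i * ξ ∧ -β i * ξ ≤ b' i)
    (h : ∀ m : ℤ, (m:ℝ) < ∑ i, a' i + c ∨ ∑ i, b' i + d < m) :
    ∑' z, FF β g k z = 0 := by
  have hs := FF_summable (β := β) hg hk
  rw [hs.tsum_prod]
  have : ∀ x : ℤ, ∑' t : ℤ, FF β g k (x, t) = 0 := by
    intro x
    have hB : ∀ i, Band (fun t => g i (x + (-(β i:ℝ)) * t)) (a' i) (b' i) := fun i =>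
      (hg i).affine x (neg_ne_zero.2 (by exact_mod_cast hβ i)) (hab i)
    have hB2 := (((hB 0).mul (hB 1)).mul (hB 2)).mul hk
    unfold FF
    simp only [Fin.prod_univ_three, Fin.sum_univ_three] at h ⊢
    rw [← hB2.poisson h]
    apply tsum_congr
    intro t
    simp only [neg_mul, sub_eq_add_neg]
  exact (tsum_congr this).trans tsum_zero

end BHT

namespace BHT

open Classical in
/-- element of `ℓ²` from a function -/
noncomputable def mkH (g : ℤ → ℂ) : H := if h : Memℓp g 2 then ⟨g, h⟩ else 0

lemma mkH_apply {g : ℤ → ℂ} (h : Memℓp g 2) (x : ℤ) : mkH g x = g x := by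
  unfold mkH; rw [dif_pos h]

lemma memlp_decay {g : ℤ → ℂ} {C : ℝ} (hC : ∀ x : ℤ, ‖g x‖ ≤ C * ((1 + |(x:ℝ)|) ^ 2)⁻¹) : Memℓp g 2 := by
  have h1 : Memℓp g 1 := by
    apply memℓp_gen
    simp only [ENNReal.toReal_one, Real.rpow_one]
    exact Summable.of_nonneg_of_le (fun _ => norm_nonneg _) hC (summable_Z2.mul_left C)
  exact h1.of_exponent_ge (by norm_num)

lemma Band.memlp {g : ℝ → ℂ} {a b : ℝ} (hg : Band g a b) : Memℓp (fun n : ℤ => g n) 2 := by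
  obtain ⟨C, -, h⟩ := hg.decay 2
  exact memlp_decay fun x => h x

lemma memlp_fin {g : ℤ → ℂ} {S : Finset ℤ} (h : ∀ x, x ∉ S → g x = 0) : Memℓp g 2 := by
  have : Memℓp g 0 := memℓp_zero (S.finite_toSet.subset fun x hx => by
    by_contra hc; exact hx (h x hc))
  exact this.of_exponent_ge (by norm_num)

/-- the wave packet -/
noncomputable def pkt (ψ : ℝ → ℂ) (c : ℝ) (N : ℕ) (P : Tile) (x0 l : ℤ) (η : ℝ) (y : ℝ) : ℂ :=
  ((c * (del P x0 ^ N)⁻¹ : ℝ) : ℂ) * starRingEnd ℂ (Phi ψ P.1 l (x0 - y)) * ee (-η * y)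

lemma pkt_band {ψ : ℝ → ℂ} (hψ : Band ψ (-1) 1) (c : ℝ) (N : ℕ) (P : Tile) (x0 l : ℤ) (η : ℝ) :
    Band (pkt ψ c N P x0 l η) (((l:ℝ) - 1) / 2 ^ P.1 - η) (((l:ℝ) + 1) / 2 ^ P.1 - η) := by
  have h1 := (Phi_band hψ P.1 l).affine (x0:ℝ) (c := -1) (by norm_num)
    (a' := -(((l:ℝ) + 1) / 2 ^ P.1)) (b' := -(((l:ℝ) - 1) / 2 ^ P.1)) (fun ξ h h' => ⟨by linarith, by linarith⟩)
  have h2 := (h1.conj.const_mul ((c * (del P x0 ^ N)⁻¹ : ℝ) : ℂ)).modul (-η)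
  rw [neg_neg, neg_neg] at h2
  rw [sub_eq_add_neg, sub_eq_add_neg _ η]
  convert h2 using 1
  unfold pkt
  ext y
  congr 5; ring

lemma ee_conj (x : ℝ) : starRingEnd ℂ (ee x) = ee (-x) := by
  unfold ee
  rw [← Complex.exp_conj, map_mul, Complex.conj_I, Complex.conj_ofReal]
  congr 1; push_cast; ring

lemma del_le (P : Tile) (x y : ℤ) : del P y ≤ del P x * (1 + |((x:ℝ) - y) / 2 ^ P.1|) := by
  unfold del
  have h1 : |(y:ℝ) / 2 ^ P.1 - P.2.1| ≤ |(x:ℝ) / 2 ^ P.1 - P.2.1| + |((x:ℝ) - y) / 2 ^ P.1| := by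
    have : (y:ℝ) / 2 ^ P.1 - P.2.1 = ((x:ℝ) / 2 ^ P.1 - P.2.1) - ((x:ℝ) - y) / 2 ^ P.1 := by ring
    rw [this]; exact abs_sub _ _
  have := abs_nonneg ((x:ℝ) / 2 ^ P.1 - P.2.1)
  have := abs_nonneg (((x:ℝ) - y) / 2 ^ P.1)
  nlinarith

lemma del_pow_le (N : ℕ) (P : Tile) (x y : ℤ) :
    (del P x ^ N)⁻¹ * ((1 + |((x:ℝ) - y) / 2 ^ P.1|) ^ N)⁻¹ ≤ (del P y ^ N)⁻¹ := by
  rw [← mul_inv, ← mul_pow]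
  have := del_pos P y
  gcongr
  exact del_le P x y

lemma pkt_bd {ψ : ℝ → ℂ} {C c : ℝ} {N : ℕ} (hC : ∀ x, ‖ψ x‖ ≤ C * ((1 + |x|) ^ N)⁻¹) (hc : 0 ≤ c) (hcC : c * C ≤ 1)
    (P : Tile) (x0 l : ℤ) (η : ℝ) (y : ℤ) : ‖pkt ψ c N P x0 l η y‖ ≤ ((2:ℝ) ^ P.1)⁻¹ * (del P y ^ N)⁻¹ := by
  have hd := del_pos P x0
  unfold pkt Phi
  rw [norm_mul, norm_ee, mul_one, norm_mul, Complex.norm_real, RCLike.norm_conj,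
    norm_mul (((((2 ^ P.1)⁻¹ : ℝ)) : ℂ) * _) _, norm_ee, mul_one, norm_mul (((2 ^ P.1)⁻¹ : ℝ) : ℂ) _,
    Complex.norm_real, Real.norm_of_nonneg (by positivity), Real.norm_of_nonneg (by positivity)]
  have h1 := hC (((x0:ℝ) - y) / 2 ^ P.1)
  have h2 := del_pow_le N P x0 y
  calc _ ≤ c * (del P x0 ^ N)⁻¹ * (((2:ℝ) ^ P.1)⁻¹ * (C * ((1 + |((x0:ℝ) - y) / 2 ^ P.1|) ^ N)⁻¹)) := by gcongr
    _ = (c * C) * (((2:ℝ) ^ P.1)⁻¹ * ((del P x0 ^ N)⁻¹ * ((1 + |((x0:ℝ) - y) / 2 ^ P.1|) ^ N)⁻¹)) := by ring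
    _ ≤ 1 * (((2:ℝ) ^ P.1)⁻¹ * (del P y ^ N)⁻¹) := by gcongr
    _ = _ := one_mul _

lemma pkt_demod (ψ : ℝ → ℂ) (c : ℝ) (N : ℕ) (P : Tile) (x0 l : ℤ) (η : ℝ) (y : ℝ) :
    pkt ψ c N P x0 l η y * ee (-(((l:ℝ) - 2 ^ P.1 * η) / 2 ^ P.1 * y)) =
      ((c * (del P x0 ^ N)⁻¹ : ℝ) : ℂ) * ee (-((l:ℝ) / 2 ^ P.1 * x0)) *
        ((((2 ^ P.1)⁻¹ : ℝ) : ℂ) * starRingEnd ℂ (ψ ((x0 - y) / 2 ^ P.1))) := by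
  unfold pkt Phi
  rw [map_mul, map_mul, ee_conj, Complex.conj_ofReal]
  have h2 : (2:ℝ) ^ P.1 ≠ 0 := by positivity
  have : ee (-((l:ℝ) / 2 ^ P.1 * x0)) = ee (-((l:ℝ) / 2 ^ P.1 * (x0 - y))) * ee (-η * y) * ee (-(((l:ℝ) - 2 ^ P.1 * η) / 2 ^ P.1 * y)) := by
    rw [← ee_add, ← ee_add]; congr 1; field_simp; ring
  rw [this]; ring

lemma pkt_df {ψ : ℝ → ℂ} {C c : ℝ} {N : ℕ} (hdiff : Differentiable ℝ ψ) (hC0 : 0 ≤ C) (hC : ∀ x, ‖deriv ψ x‖ ≤ C * ((1 + |x|) ^ N)⁻¹)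
    (hc : 0 ≤ c) (hcC : c * (2 ^ N * C) ≤ 1)
    (P : Tile) (x0 l : ℤ) (η : ℝ) (y : ℤ) :
    ‖pkt ψ c N P x0 l η (y + 1 : ℤ) * ee (-(((l:ℝ) - 2 ^ P.1 * η) / 2 ^ P.1 * (y + 1 : ℤ))) -
      pkt ψ c N P x0 l η y * ee (-(((l:ℝ) - 2 ^ P.1 * η) / 2 ^ P.1 * y))‖ ≤
      ((2:ℝ) ^ P.1)⁻¹ * ((2:ℝ) ^ P.1)⁻¹ * (del P y ^ N)⁻¹ := by
  have hd := del_pos P x0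
  rw [pkt_demod, pkt_demod, ← mul_sub, ← mul_sub, ← map_sub, norm_mul, norm_mul, norm_mul, norm_ee, mul_one, RCLike.norm_conj,
    Complex.norm_real, Complex.norm_real, Real.norm_of_nonneg (by positivity), Real.norm_of_nonneg (by positivity)]
  set u : ℝ := ((x0:ℝ) - y) / 2 ^ P.1 with hu
  have hj : (1:ℝ) ≤ 2 ^ P.1 := one_le_pow₀ (by norm_num)
  have hj1 : ((2:ℝ) ^ P.1)⁻¹ ≤ 1 := inv_le_one_of_one_le₀ hj
  have hj0 : 0 < ((2:ℝ) ^ P.1)⁻¹ := by positivity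
  have hu' : ((x0:ℝ) - (y + 1 : ℤ)) / 2 ^ P.1 = u - ((2:ℝ) ^ P.1)⁻¹ := by
    rw [hu]; push_cast; field_simp; ring
  rw [hu']
  have hm : ‖ψ (u - ((2:ℝ) ^ P.1)⁻¹) - ψ u‖ ≤ (2 ^ N * C * ((1 + |u|) ^ N)⁻¹) * ‖(u - ((2:ℝ) ^ P.1)⁻¹) - u‖ := by
    apply (convex_Icc (u - ((2:ℝ) ^ P.1)⁻¹) u).norm_image_sub_le_of_norm_deriv_le (fun x _ => hdiff x)
    · intro v hv
      refine (hC v).trans ?_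
      have h1 : |u| ≤ |v| + 1 := by
        have : |u - v| ≤ 1 := by rw [abs_le]; constructor <;> linarith [hv.1, hv.2]
        have := abs_sub_abs_le_abs_sub u v
        linarith
      have h2 : ((1 + |v|) ^ N)⁻¹ ≤ 2 ^ N * ((1 + |u|) ^ N)⁻¹ := by
        have : ((1 + |u|) / 2) ^ N ≤ (1 + |v|) ^ N := by
          gcongr
          have := abs_nonneg v
          linarith
        rw [div_pow] at this
        calc ((1 + |v|) ^ N)⁻¹ ≤ ((1 + |u|) ^ N / 2 ^ N)⁻¹ := by gcongr
          _ = _ := by rw [inv_div]; ring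
      calc C * ((1 + |v|) ^ N)⁻¹ ≤ C * (2 ^ N * ((1 + |u|) ^ N)⁻¹) := by gcongr
        _ = _ := by ring
    · rw [Set.mem_Icc]; constructor <;> linarith
    · rw [Set.mem_Icc]; constructor <;> linarith
  have e1 : ‖(u - ((2:ℝ) ^ P.1)⁻¹) - u‖ = ((2:ℝ) ^ P.1)⁻¹ := by
    rw [sub_sub_cancel_left, norm_neg, Real.norm_of_nonneg hj0.le]
  rw [e1] at hm
  have h2 := del_pow_le N P x0 y
  rw [← hu] at h2
  calc _ ≤ c * (del P x0 ^ N)⁻¹ * (((2:ℝ) ^ P.1)⁻¹ * ((2 ^ N * C * ((1 + |u|) ^ N)⁻¹) * ((2:ℝ) ^ P.1)⁻¹)) := by gcongr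
    _ = (c * (2 ^ N * C)) * (((2:ℝ) ^ P.1)⁻¹ * ((2:ℝ) ^ P.1)⁻¹ * ((del P x0 ^ N)⁻¹ * ((1 + |u|) ^ N)⁻¹)) := by ring
    _ ≤ 1 * (((2:ℝ) ^ P.1)⁻¹ * ((2:ℝ) ^ P.1)⁻¹ * (del P y ^ N)⁻¹) := by gcongr
    _ = _ := one_mul _

lemma pkt_inner {ψ : ℝ → ℂ} (hψ : Band ψ (-1) 1) (c : ℝ) (N : ℕ) (P : Tile) (x0 l : ℤ) (η : ℝ) {S : Finset ℤ} {f : ℤ → ℂ}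
    (hf : ∀ x, x ∉ S → f x = 0) :
    inner ℂ (mkH fun y => pkt ψ c N P x0 l η y) (mkH fun y => f y * ee (-η * y)) =
      ((c * (del P x0 ^ N)⁻¹ : ℝ) : ℂ) * fl ψ S f P.1 l x0 := by
  have h1 : Memℓp (fun y : ℤ => pkt ψ c N P x0 l η y) 2 := (pkt_band hψ c N P x0 l η).memlp
  have h2 : Memℓp (fun y : ℤ => f y * ee (-η * y)) 2 := memlp_fin (S := S) fun x hx => by rw [hf x hx, zero_mul]
  rw [lp.inner_eq_tsum]
  have h3 : ∀ y : ℤ, inner ℂ (mkH (fun y => pkt ψ c N P x0 l η y) y) (mkH (fun y => f y * ee (-η * y)) y) =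
      ((c * (del P x0 ^ N)⁻¹ : ℝ) : ℂ) * (f y * Phi ψ P.1 l (x0 - y)) := by
    intro y
    rw [mkH_apply h1, mkH_apply h2, RCLike.inner_apply]
    unfold pkt
    rw [map_mul, map_mul, Complex.conj_conj, Complex.conj_ofReal, ee_conj]
    have : ee (-η * y) * ee (-(-η * y)) = 1 := by rw [← ee_add]; simp [ee_zero]
    linear_combination ((c * (del P x0 ^ N)⁻¹ : ℝ) : ℂ) * (f y * Phi ψ P.1 l (x0 - y)) * this
  rw [tsum_congr h3, tsum_mul_left]
  unfold fl
  congr 1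
  apply tsum_eq_sum
  intro y hy
  rw [hf y hy, zero_mul]

lemma pkt_orth {ψ : ℝ → ℂ} (hψ : Band ψ (-1) 1) (c : ℝ) (N : ℕ) (P Q : Tile) (x0 x1 l l' : ℤ) (η : ℝ)
    (hP : 2 ≤ P.1) (hQ : 2 ≤ Q.1) (hh : |(l:ℝ) / 2 ^ P.1 - l' / 2 ^ Q.1| < 1 / 2)
    (h : ((2 : ℝ) ^ P.1)⁻¹ + ((2 : ℝ) ^ Q.1)⁻¹ < |(l:ℝ) / 2 ^ P.1 - l' / 2 ^ Q.1|) :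
    inner ℂ (mkH fun y => pkt ψ c N P x0 l η y) (mkH fun y => pkt ψ c N Q x1 l' η y) = 0 := by
  have b1 := pkt_band hψ c N P x0 l η
  have b2 := pkt_band hψ c N Q x1 l' η
  rw [lp.inner_eq_tsum]
  have h3 : ∀ y : ℤ, inner ℂ (mkH (fun y => pkt ψ c N P x0 l η y) y) (mkH (fun y => pkt ψ c N Q x1 l' η y) y) =
      (fun y : ℝ => starRingEnd ℂ (pkt ψ c N P x0 l η y) * pkt ψ c N Q x1 l' η y) y := by
    intro y
    rw [mkH_apply b1.memlp, mkH_apply b2.memlp, RCLike.inner_apply, mul_comm]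
  rw [tsum_congr h3]
  apply (b1.conj.mul b2).poisson
  intro m
  have q : ∀ n : ℕ, 2 ≤ n → ((2:ℝ) ^ n)⁻¹ ≤ 1 / 4 := fun n hn => by
    have : (2:ℝ) ^ 2 ≤ 2 ^ n := pow_le_pow_right₀ (by norm_num) hn
    calc ((2:ℝ) ^ n)⁻¹ ≤ ((2:ℝ) ^ 2)⁻¹ := by gcongr
      _ = _ := by norm_num
  have q1 := q P.1 hP
  have q2 := q Q.1 hQ
  set δ : ℝ := (l:ℝ) / 2 ^ P.1 - l' / 2 ^ Q.1 with hδ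
  set w : ℝ := ((2 : ℝ) ^ P.1)⁻¹ + ((2 : ℝ) ^ Q.1)⁻¹ with hw
  have e1 : -(((l:ℝ) + 1) / 2 ^ P.1 - η) + (((l':ℝ) - 1) / 2 ^ Q.1 - η) = -δ - w := by
    rw [hδ, hw]; ring
  have e2 : -(((l:ℝ) - 1) / 2 ^ P.1 - η) + (((l':ℝ) + 1) / 2 ^ Q.1 - η) = -δ + w := by
    rw [hδ, hw]; ring
  rw [e1, e2]
  have hw2 : w ≤ 1 / 2 := by linarith
  rw [abs_lt] at hh
  rcases lt_trichotomy m 0 with hm | hm | hm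
  · left
    have : (m:ℝ) ≤ -1 := by exact_mod_cast (by omega : m ≤ -1)
    linarith
  · subst hm
    rcases lt_abs.1 h with h | h
    · right; push_cast; linarith
    · left; push_cast; linarith
  · right
    have : (1:ℝ) ≤ m := by exact_mod_cast hm
    linarith

lemma exists_half_sup {g : ℤ → ℝ} (hg : ∀ x, 0 ≤ g x) {C : ℝ} (hC : ∀ x, g x ≤ C) : ∃ x0, ∀ x, g x ≤ 2 * g x0 := by
  by_contra hcon
  push Not at hcon
  have hb : BddAbove (Set.range g) := ⟨C, by rintro _ ⟨x, rfl⟩; exact hC x⟩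
  have hpos : 0 < ⨆ x, g x := by
    obtain ⟨x, hx⟩ := hcon 0
    exact lt_of_lt_of_le (lt_of_le_of_lt (by have := hg 0; positivity) hx) (le_ciSup hb x)
  obtain ⟨x, hx⟩ := exists_lt_of_lt_ciSup (show (⨆ x, g x) / 2 < ⨆ x, g x by linarith)
  obtain ⟨y, hy⟩ := hcon x
  have := le_ciSup hb y
  linarith

end BHT

namespace BHT

/-- direction vector -/
def dd (β : Fin 3 → ℤ) : Fin 3 → ℤ := ![β 1 - β 2, β 2 - β 0, β 0 - β 1]

/-- total size of the coefficients -/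
noncomputable def Bb (β : Fin 3 → ℤ) : ℝ := |(β 0 : ℝ)| + |(β 1 : ℝ)| + |(β 2 : ℝ)|

/-- class parameters -/
structure CP where
  s' : ℤ
  r : ℤ
  s : ℤ
  b : ℤ
  ρ : ℤ
  h : Fin 3 → ℤ
  μ : ℕ

/-- membership in a class -/
structure Cl (β : Fin 3 → ℤ) (m : ℕ) (κ : CP) (q : ℕ × (Fin 3 → ℤ)) : Prop where
  j2 : 2 ≤ q.1
  sum : q.2 0 + q.2 1 + q.2 2 = κ.s' * 2 ^ q.1 + κ.s
  dot : β 0 * q.2 0 + β 1 * q.2 1 + β 2 * q.2 2 = κ.r * 2 ^ q.1 + κ.b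
  md : q.2 0 % (7 * dd β 0) = κ.ρ
  half : ∀ i, q.2 i * 2 / 2 ^ q.1 = κ.h i
  mu : q.1 % m = κ.μ

/-- frequency labels recovered from the tile -/
def LT (β : Fin 3 → ℤ) (κ : CP) : Fin 3 → Tile → ℤ := fun i P =>
  ![P.2.2, (P.2.2 * dd β 1 - (β 2 * (κ.s' * 2 ^ P.1 + κ.s) - (κ.r * 2 ^ P.1 + κ.b))) / dd β 0,
    (P.2.2 * dd β 2 + (β 1 * (κ.s' * 2 ^ P.1 + κ.s) - (κ.r * 2 ^ P.1 + κ.b))) / dd β 0] i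

lemma LT_eq {β : Fin 3 → ℤ} (hd : ∀ i, dd β i ≠ 0) {m : ℕ} {κ : CP} {q : ℕ × (Fin 3 → ℤ)} (h : Cl β m κ q) (n : ℤ) (i : Fin 3) :
    LT β κ i (q.1, n, q.2 0) = q.2 i := by
  have h0 := hd 0
  fin_cases i
  · rfl
  · change (q.2 0 * dd β 1 - (β 2 * (κ.s' * 2 ^ q.1 + κ.s) - (κ.r * 2 ^ q.1 + κ.b))) / dd β 0 = q.2 1
    apply Int.ediv_eq_of_eq_mul_left h0
    rw [← h.sum, ← h.dot]; simp [dd]; ring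
  · change (q.2 0 * dd β 2 + (β 1 * (κ.s' * 2 ^ q.1 + κ.s) - (κ.r * 2 ^ q.1 + κ.b))) / dd β 0 = q.2 2
    apply Int.ediv_eq_of_eq_mul_left h0
    rw [← h.sum, ← h.dot]; simp [dd]; ring

/-- modulation parameters -/
noncomputable def et (β : Fin 3 → ℤ) (κ : CP) : Fin 3 → ℝ :=
  ![((κ.r : ℝ) - β 1 * κ.s') / dd β 2, ((β 0 : ℝ) * κ.s' - κ.r) / dd β 2, 0]

/-- signs -/
noncomputable def ep (β : Fin 3 → ℤ) (i k : Fin 3) : ℝ :=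
  (if k = i + 1 then -1 else 1) * (if 0 < dd β k then 1 else -1)

lemma lac_aux {x y dx dy Δ D A' σ E : ℝ} {u : ℝ} (h : x * dy - y * dx = Δ) (hσ : σ = 1 ∨ σ = -1) (hΔ : 7 * D ≤ σ * Δ) (hΔ' : σ * Δ ≤ A')
    (hdx : |dx| ≤ D) (hdy : |dy| ≤ D) (hdy1 : 1 ≤ |dy|) (hE : E = 1 ∨ E = -1) (hEdy : E * dy = |dy|)
    (hy : |y - dy * u| ≤ 3) : 4 ≤ σ * E * (x - dx * u) ∧ σ * E * (x - dx * u) ≤ A' + 3 * D := by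
  set w := σ * E * (x - dx * u) with hw
  have hE2 : E * E = 1 := by rcases hE with h | h <;> rw [h] <;> norm_num
  have h1 : w * |dy| = σ * Δ + σ * (dx * (y - dy * u)) := by
    rw [hw, ← hEdy, ← h]
    linear_combination σ * dy * (x - dx * u) * hE2
  have h2 : |σ * (dx * (y - dy * u))| ≤ 3 * D := by
    rw [abs_mul, abs_mul]
    have : |σ| = 1 := by rcases hσ with h | h <;> rw [h] <;> norm_num
    rw [this, one_mul]
    have := abs_nonneg dx
    have := abs_nonneg (y - dy * u)
    nlinarith
  have h3 := abs_le.1 h2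
  have hD : 1 ≤ D := hdy1.trans hdy
  have h4 : 4 * D ≤ w * |dy| := by linarith [h3.1]
  have hw0 : 0 < w := by
    by_contra hc
    push Not at hc
    have : w * |dy| ≤ 0 := mul_nonpos_of_nonpos_of_nonneg hc (abs_nonneg _)
    linarith
  constructor
  · by_contra hc
    push Not at hc
    have : w * |dy| < 4 * D := by nlinarith
    linarith
  · have : w ≤ w * |dy| := le_mul_of_one_le_right hw0.le hdy1
    linarith [h3.2]

lemma dd_le (β : Fin 3 → ℤ) (i : Fin 3) : |(dd β i : ℝ)| ≤ Bb β := by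
  have h0 := abs_nonneg (β 0 : ℝ)
  have h1 := abs_nonneg (β 1 : ℝ)
  have h2 := abs_nonneg (β 2 : ℝ)
  unfold Bb
  fin_cases i <;> simp [dd]
  · have := abs_sub (β 1 : ℝ) (β 2); linarith
  · have := abs_sub (β 2 : ℝ) (β 0); linarith
  · have := abs_sub (β 0 : ℝ) (β 1); linarith

lemma lac_class {β : Fin 3 → ℤ} (hd : ∀ i, dd β i ≠ 0) {s b : ℝ} (hs : |s| ≤ 3) (hb1 : 11 * Bb β ≤ b) (hb2 : b ≤ 49 * Bb β)
    {v : Fin 3 → ℝ} (hv : v 0 + v 1 + v 2 = s) (hv2 : β 0 * v 0 + β 1 * v 1 + β 2 * v 2 = b) (i k : Fin 3) (hik : i ≠ k) (u : ℝ)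
    (hu : |v k - dd β k * u| ≤ 3) : 4 ≤ ep β i k * (v i - dd β i * u) ∧ ep β i k * (v i - dd β i * u) ≤ 55 * Bb β + 8 := by
  have hB : ∀ m, |(β m : ℝ) * s| ≤ 3 * Bb β := by
    intro m
    rw [abs_mul]
    have : |(β m : ℝ)| ≤ Bb β := by
      have h0 := abs_nonneg (β 0 : ℝ)
      have h1 := abs_nonneg (β 1 : ℝ)
      have h2 := abs_nonneg (β 2 : ℝ)
      unfold Bb
      fin_cases m <;> simp <;> linarith
    have := abs_nonneg (β m : ℝ)
    have := abs_nonneg s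
    nlinarith
  have hB0 : 0 ≤ Bb β := by unfold Bb; positivity
  have hdk1 : ∀ k, 1 ≤ |(dd β k : ℝ)| := fun k => by
    have := Int.one_le_abs (hd k)
    exact_mod_cast this
  have hE : ∀ k, (if 0 < dd β k then (1:ℝ) else -1) * dd β k = |(dd β k : ℝ)| := fun k => by
    split_ifs with h
    · rw [abs_of_pos (by exact_mod_cast h), one_mul]
    · rw [abs_of_nonpos (by exact_mod_cast not_lt.1 h)]; ring
  have hE1 : ∀ k, (if 0 < dd β k then (1:ℝ) else -1) = 1 ∨ (if 0 < dd β k then (1:ℝ) else -1) = -1 := fun k => by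
    split_ifs <;> simp
  have key : ∀ σ Δ : ℝ, (σ = 1 ∨ σ = -1) → ∀ i k, v i * dd β k - v k * dd β i = Δ → 8 * Bb β ≤ σ * Δ → σ * Δ ≤ 52 * Bb β → |v k - dd β k * u| ≤ 3 →
      4 ≤ σ * (if 0 < dd β k then (1:ℝ) else -1) * (v i - dd β i * u) ∧ σ * (if 0 < dd β k then (1:ℝ) else -1) * (v i - dd β i * u) ≤ 55 * Bb β + 8 := by
    intro σ Δ hσ i k h1 h2 h3 h4
    have := lac_aux h1 hσ (D := Bb β) (by linarith) h3 (dd_le β i) (dd_le β k) (hdk1 k) (hE1 k) (hE k) h4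
    exact ⟨this.1, by linarith [this.2]⟩
  have e01 : v 0 * dd β 1 - v 1 * dd β 0 = β 2 * s - b := by rw [← hv, ← hv2]; simp [dd]; ring
  have e12 : v 1 * dd β 2 - v 2 * dd β 1 = β 0 * s - b := by rw [← hv, ← hv2]; simp [dd]; ring
  have e20 : v 2 * dd β 0 - v 0 * dd β 2 = β 1 * s - b := by rw [← hv, ← hv2]; simp [dd]; ring
  have b0 := abs_le.1 (hB 0)
  have b1 := abs_le.1 (hB 1)
  have b2 := abs_le.1 (hB 2)
  unfold ep
  by_cases hk : k = i + 1
  · rw [if_pos hk]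
    subst hk
    fin_cases i
    · exact key (-1) _ (by norm_num) 0 1 e01 (by linarith) (by linarith) hu
    · exact key (-1) _ (by norm_num) 1 2 e12 (by linarith) (by linarith) hu
    · exact key (-1) _ (by norm_num) 2 0 e20 (by linarith) (by linarith) hu
  · rw [if_neg hk]
    have : i = k + 1 := by clear hu; revert hk hik; revert i k; decide
    subst this
    fin_cases k
    · exact key 1 _ (by norm_num) 1 0 (show _ = b - β 2 * s by linarith) (by linarith) (by linarith) hu
    · exact key 1 _ (by norm_num) 2 1 (show _ = b - β 0 * s by linarith) (by linarith) (by linarith) hu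
    · exact key 1 _ (by norm_num) 0 2 (show _ = b - β 1 * s by linarith) (by linarith) (by linarith) hu

lemma et_sum {β : Fin 3 → ℤ} (hd : ∀ i, dd β i ≠ 0) (κ : CP) : et β κ 0 + et β κ 1 + et β κ 2 = κ.s' ∧
    β 0 * et β κ 0 + β 1 * et β κ 1 + β 2 * et β κ 2 = κ.r := by
  have h : (dd β 2 : ℝ) ≠ 0 := by exact_mod_cast hd 2
  have h2 : (dd β 2 : ℝ) = β 0 - β 1 := by simp [dd]
  have t0 : et β κ 0 = ((κ.r : ℝ) - β 1 * κ.s') / dd β 2 := rfl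
  have t1 : et β κ 1 = ((β 0 : ℝ) * κ.s' - κ.r) / dd β 2 := rfl
  have t2 : et β κ 2 = 0 := rfl
  rw [t0, t1, t2]
  constructor
  · field_simp
    rw [h2]; ring
  · field_simp
    rw [h2]; ring

lemma class_lab {β : Fin 3 → ℤ} (hd : ∀ i, dd β i ≠ 0) {m : ℕ} {κ : CP} {q q' : ℕ × (Fin 3 → ℤ)} (h : Cl β m κ q) (h' : Cl β m κ q')
    (hj : q.1 = q'.1) (i : Fin 3) (hi : |q.2 i - q'.2 i| ≤ 6) : q = q' := by
  have e1 := h.sum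
  have e1' := h'.sum
  have e2 := h.dot
  have e2' := h'.dot
  rw [hj, ← e1'] at e1
  rw [hj, ← e2'] at e2
  obtain ⟨k, hk⟩ : (7 * dd β 0) ∣ q.2 0 - q'.2 0 := Int.ModEq.dvd (h'.md.trans h.md.symm)
  have f1 : (q.2 1 - q'.2 1) = 7 * dd β 1 * k := by
    apply mul_left_cancel₀ (hd 0)
    have : (q.2 0 - q'.2 0) * dd β 1 = (q.2 1 - q'.2 1) * dd β 0 := by
      simp [dd]; linear_combination β 2 * e1 - e2
    rw [hk] at this; linear_combination -this
  have f2 : (q.2 2 - q'.2 2) = 7 * dd β 2 * k := by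
    apply mul_left_cancel₀ (hd 0)
    have : (q.2 0 - q'.2 0) * dd β 2 = (q.2 2 - q'.2 2) * dd β 0 := by
      simp [dd]; linear_combination -β 1 * e1 + e2
    rw [hk] at this; linear_combination -this
  have f : ∀ i, q.2 i - q'.2 i = 7 * dd β i * k := by
    intro i; fin_cases i
    · exact hk
    · exact f1
    · exact f2
  have hk0 : k = 0 := by
    by_contra hk0
    rw [f i, abs_mul, abs_mul] at hi
    have g1 := Int.one_le_abs hk0
    have g2 := Int.one_le_abs (hd i)
    norm_num at hi
    nlinarith
  apply Prod.ext hj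
  ext i
  have := f i
  rw [hk0, mul_zero] at this
  linarith

lemma class_half {l l' : ℤ} {j j' : ℕ} (h : l * 2 / 2 ^ j = l' * 2 / 2 ^ j') : |(l:ℝ) / 2 ^ j - l' / 2 ^ j'| < 1 / 2 := by
  have h1 := ediv_bounds (l * 2) j
  have h2 := ediv_bounds (l' * 2) j'
  rw [← h] at h2
  push_cast at h1 h2
  have e1 : (l:ℝ) * 2 / 2 ^ j = 2 * ((l:ℝ) / 2 ^ j) := by ring
  have e2 : (l':ℝ) * 2 / 2 ^ j' = 2 * ((l':ℝ) / 2 ^ j') := by ring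
  rw [e1] at h1
  rw [e2] at h2
  rw [abs_lt]
  constructor <;> linarith [h1.1, h1.2, h2.1, h2.2]

end BHT

namespace BHT

lemma sum_K_le (N : ℕ) : ∃ C : ℝ, 0 < C ∧ ∀ (j : ℕ) (T : Finset ℤ),
    ∑ t ∈ T, ((2:ℝ) ^ j)⁻¹ * ((1 + |(t:ℝ) / 2 ^ j|) ^ (N + 2))⁻¹ * (1 + |(t:ℝ) / 2 ^ j|) ^ N ≤ C := by
  obtain ⟨C, hC, h⟩ := L1
  refine ⟨C, by linarith, fun j T => ?_⟩
  have h2 : (0:ℝ) < 2 ^ j := by positivity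
  calc _ = ((2:ℝ) ^ j)⁻¹ * ∑ t ∈ T, ((1 + |(t:ℝ) / 2 ^ j - 0|) ^ 2)⁻¹ := by
        rw [Finset.mul_sum]
        apply Finset.sum_congr rfl
        intro t _
        rw [sub_zero]
        have : (1 + |(t:ℝ) / 2 ^ j|) ≠ 0 := by positivity
        rw [pow_add, mul_inv, mul_assoc, mul_assoc]
        congr 1
        field_simp
    _ ≤ ((2:ℝ) ^ j)⁻¹ * (C * 2 ^ j) := by gcongr; exact h T j 0
    _ = C := by field_simp

lemma class_bound (β : Fin 3 → ℤ) (hd : ∀ i, dd β i ≠ 0) (ψ γ : ℝ → ℂ) (hψ : Band ψ (-1) 1)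
    (hγ : Band γ (24 * Bb β / 2) (2 * (24 * Bb β))) (m : ℕ) (hm : 55 * Bb β + 8 ≤ 2 ^ m) (θ : Fin 3 → ℝ)
    (hθ : ∀ i, 0 < θ i ∧ θ i < 1) (hsum : θ 0 + θ 1 + θ 2 = 1) (e : Fin 3) :
    ∃ C : ℝ, 0 < C ∧ ∀ (κ : CP) (Q : Finset (ℕ × (Fin 3 → ℤ))) (f : Fin 3 → ℤ → ℂ) (S : Fin 3 → Finset ℤ)
    (Ω : Finset ℤ) (X T : Finset ℤ), |(κ.s : ℝ)| ≤ 3 → 11 * Bb β ≤ κ.b → κ.b ≤ 49 * Bb β → (∀ q ∈ Q, Cl β m κ q) →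
    (∀ i, (S i).Nonempty) →
    (∀ i, i ≠ e → ∀ (J : ℕ) (M : ℤ), 20 * (S i).card * 2 ^ J < (S e).card * ((S i).filter (fun x => x / 2 ^ J = M)).card →
      ∀ x : ℤ, |x / 2 ^ J - M| ≤ 2 → x ∈ Ω) →
    (∀ i x, ‖f i x‖ ≤ if x ∈ S i then 1 else 0) → (∀ x ∈ Ω, f e x = 0) →
    ∑ q ∈ Q, ∑ x ∈ X, ∑ t ∈ T, ‖FF β (fun i => fl ψ (S i) (f i) q.1 (q.2 i)) (Kj γ q.1) (x, t)‖ ≤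
      C * ∏ i, ((S i).card : ℝ) ^ ((1 + θ i) / 2 - if i = e then 1 else 0) := by
  classical
  have hB0 : 0 ≤ Bb β := by unfold Bb; positivity
  obtain ⟨N, hN6, hNθ⟩ : ∃ N : ℕ, 6 ≤ N ∧ 2 ≤ N * θ e := by
    obtain ⟨n, hn⟩ := exists_nat_ge (2 / θ e)
    refine ⟨max 6 n, le_max_left _ _, ?_⟩
    rw [div_le_iff₀ (hθ e).1] at hn
    refine hn.trans ?_
    have : (n:ℝ) ≤ ((max 6 n : ℕ) : ℝ) := by exact_mod_cast le_max_right _ _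
    have := (hθ e).1
    gcongr
  obtain ⟨C1, hC1, hcore⟩ := core θ hθ hsum e N hN6 hNθ (55 * Bb β + 8) (by linarith)
  obtain ⟨Cψ, hCψ, hψ1⟩ := hψ.decay N
  obtain ⟨Cψ', hCψ', hψd, hψ2⟩ := hψ.deriv_decay N
  obtain ⟨Cγ, hCγ, hγ1⟩ := hγ.decay (3 * N + 2)
  obtain ⟨CK, hCK, hK⟩ := sum_K_le (3 * N)
  obtain ⟨c, hc, hc1, hc2⟩ : ∃ c : ℝ, 0 < c ∧ c * Cψ ≤ 1 ∧ c * (2 ^ N * Cψ') ≤ 1 := by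
    refine ⟨(Cψ + 2 ^ N * Cψ')⁻¹, by positivity, ?_, ?_⟩
    · rw [inv_mul_le_iff₀ (by positivity)]; have : 0 < 2 ^ N * Cψ' := by positivity
      linarith
    · rw [inv_mul_le_iff₀ (by positivity)]; linarith
  set A : ℝ := 8 * ((2 + Bb β) ^ N) ^ 3 * (Cγ * CK) * (c⁻¹) ^ 3 with hA
  refine ⟨A * C1, by positivity, fun κ Q f S Ω X T hs hb1 hb2 hQ hne hΩ hf hfe => ?_⟩
  have hf0 : ∀ i x, x ∉ S i → f i x = 0 := fun i x hx => by
    have := hf i x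
    rw [if_neg hx] at this
    exact norm_le_zero_iff.1 this
  -- choice of points
  have hx0 : ∀ (i : Fin 3) (P : Tile), ∃ x0 : ℤ, ∀ x : ℤ, ‖fl ψ (S i) (f i) P.1 (LT β κ i P) x‖ * (del P x ^ N)⁻¹ ≤
      2 * (‖fl ψ (S i) (f i) P.1 (LT β κ i P) x0‖ * (del P x0 ^ N)⁻¹) := by
    intro i P
    obtain ⟨C, hC, h⟩ := (fl_band hψ (S i) (f i) P.1 (LT β κ i P)).decay 0
    apply exists_half_sup (g := fun x : ℤ => ‖fl ψ (S i) (f i) P.1 (LT β κ i P) x‖ * (del P x ^ N)⁻¹) (C := C)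
    · intro x; have := del_pos P x; positivity
    · intro x
      have h1 := h x
      rw [pow_zero, inv_one, mul_one] at h1
      have h2 : (del P x ^ N)⁻¹ ≤ 1 := inv_le_one_of_one_le₀ (one_le_pow₀ (one_le_del P x))
      have := del_pos P x
      calc _ ≤ C * 1 := by gcongr
        _ = C := mul_one C
  choose x0 hx0 using hx0
  obtain ⟨φ, hφ⟩ : ∃ φ : Fin 3 → Tile → H, φ = fun i P => mkH fun y => pkt ψ c N P (x0 i P) (LT β κ i P) (et β κ i) y := ⟨_, rfl⟩
  obtain ⟨l, hl⟩ : ∃ l : Fin 3 → Tile → ℝ, l = fun i P => (LT β κ i P : ℝ) - 2 ^ P.1 * et β κ i := ⟨_, rfl⟩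
  obtain ⟨F, hF⟩ : ∃ F : Fin 3 → H, F = fun i => mkH fun y => f i y * ee (-et β κ i * y) := ⟨_, rfl⟩
  obtain ⟨DD, hDD⟩ : ∃ DD : Finset ((_ : ℕ × (Fin 3 → ℤ)) × ℤ), DD = Q.sigma (fun q => X.image (fun x => x / 2 ^ q.1)) := ⟨_, rfl⟩
  obtain ⟨tl, htl⟩ : ∃ tl : ((_ : ℕ × (Fin 3 → ℤ)) × ℤ) → Tile, tl = fun w => (w.1.1, w.2, w.1.2 0) := ⟨_, rfl⟩
  have hinj : Set.InjOn tl DD := by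
    intro w hw w' hw' h
    rw [hDD, Finset.mem_coe, Finset.mem_sigma] at hw hw'
    rw [htl] at h
    simp only [Prod.mk.injEq] at h
    have := class_lab hd (hQ _ hw.1) (hQ _ hw'.1) h.1 0 (by rw [h.2.2]; simp)
    obtain ⟨w1, w2⟩ := w
    obtain ⟨w1', w2'⟩ := w'
    simp only at this h ⊢
    subst this
    rw [h.2.1]
  have hPP : ∀ P ∈ DD.image tl, ∃ q, Cl β m κ q ∧ P.1 = q.1 ∧ P.2.2 = q.2 0 ∧ ∀ i, LT β κ i P = q.2 i := by
    intro P hP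
    obtain ⟨w, hw, rfl⟩ := Finset.mem_image.1 hP
    rw [hDD, Finset.mem_sigma] at hw
    refine ⟨w.1, hQ _ hw.1, by rw [htl], by rw [htl], fun i => ?_⟩
    rw [htl]
    exact LT_eq hd (hQ _ hw.1) w.2 i
  have hmem : ∀ i P, Memℓp (fun y : ℤ => pkt ψ c N P (x0 i P) (LT β κ i P) (et β κ i) y) 2 := fun i P => (pkt_band hψ _ _ _ _ _ _).memlp
  have hmodel : Model (fun i => (dd β i : ℝ)) (55 * Bb β + 8) N φ l (ep β) (DD.image tl) := by
    refine ⟨fun i => ⟨fun P hP x => ?_, fun P hP x => ?_, fun P hP Q' hQ' h => ?_⟩, fun i => by exact_mod_cast hd i, fun i k => ?_, by linarith,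
      fun i k hik P hP u hu => ?_, fun P hP P' hP' hlt => ?_, fun i P hP P' hP' hj hi => ?_⟩
    · rw [hφ]; beta_reduce
      rw [mkH_apply (hmem i P)]
      exact pkt_bd hψ1 hc.le hc1 _ _ _ _ _
    · rw [hφ, hl]; beta_reduce
      rw [mkH_apply (hmem i P), mkH_apply (hmem i P)]
      exact pkt_df hψd hCψ'.le hψ2 hc.le hc2 _ _ _ _ _
    · obtain ⟨q, hq, hq1, hq2, hq3⟩ := hPP P hP
      obtain ⟨q', hq', hq1', hq2', hq3'⟩ := hPP Q' hQ'
      rw [hφ]; beta_reduce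
      have e1 : l i P / 2 ^ P.1 - l i Q' / 2 ^ Q'.1 = (LT β κ i P : ℝ) / 2 ^ P.1 - (LT β κ i Q' : ℝ) / 2 ^ Q'.1 := by
        rw [hl]; beta_reduce; field_simp; ring
      rw [e1] at h
      apply pkt_orth hψ c N P Q' _ _ _ _ _ (by rw [hq1]; exact hq.j2) (by rw [hq1']; exact hq'.j2) _ h
      rw [hq3, hq3', hq1, hq1']
      apply class_half
      rw [hq.half, hq'.half]
    · unfold ep; split_ifs <;> norm_num
    · obtain ⟨q, hq, hq1, hq2, hq3⟩ := hPP P hP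
      have et := et_sum hd κ
      have s1 := hq.sum
      have s2 := hq.dot
      have s1' : (q.2 0 : ℝ) + q.2 1 + q.2 2 = κ.s' * 2 ^ q.1 + κ.s := by exact_mod_cast s1
      have s2' : (β 0 : ℝ) * q.2 0 + β 1 * q.2 1 + β 2 * q.2 2 = κ.r * 2 ^ q.1 + κ.b := by exact_mod_cast s2
      have := lac_class hd hs hb1 hb2 (v := fun i => l i P)
        (by rw [hl]; simp only [hq3, hq1]; linear_combination s1' - 2 ^ q.1 * et.1)
        (by rw [hl]; simp only [hq3, hq1]; linear_combination s2' - 2 ^ q.1 * et.2) i k hik (2 ^ P.1 * u)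
        (by rw [mul_left_comm]; exact hu)
      rw [mul_left_comm (dd β i : ℝ)] at this
      exact this
    · obtain ⟨q, hq, hq1, hq2, hq3⟩ := hPP P hP
      obtain ⟨q', hq', hq1', hq2', hq3'⟩ := hPP P' hP'
      have hmm : P.1 % m = P'.1 % m := by rw [hq1, hq1', hq.mu, hq'.mu]
      have hle : P'.1 + m ≤ P.1 := by
        have : m ∣ P.1 - P'.1 := (Nat.modEq_iff_dvd' hlt.le).1 (Eq.symm hmm)
        have := Nat.le_of_dvd (by omega) this
        omega
      calc (55 * Bb β + 8) * 2 ^ P'.1 ≤ 2 ^ m * 2 ^ P'.1 := by gcongr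
        _ = 2 ^ (P'.1 + m) := by rw [pow_add]; ring
        _ ≤ 2 ^ P.1 := pow_le_pow_right₀ (by norm_num) hle
    · obtain ⟨q, hq, hq1, hq2, hq3⟩ := hPP P hP
      obtain ⟨q', hq', hq1', hq2', hq3'⟩ := hPP P' hP'
      have : q = q' := by
        apply class_lab hd hq hq' (by rw [← hq1, ← hq1', hj]) i
        rw [hl] at hi
        simp only [hq3, hq3', hj] at hi
        rw [show (q.2 i : ℝ) - 2 ^ P'.1 * et β κ i - (q'.2 i - 2 ^ P'.1 * et β κ i) = ((q.2 i - q'.2 i : ℤ) : ℝ) by push_cast; ring] at hi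
        exact_mod_cast hi
      rw [hq2, hq2', this]
  have hFmem : ∀ i, Memℓp (fun y : ℤ => f i y * ee (-et β κ i * y)) 2 := fun i => memlp_fin (S := S i) fun x hx => by rw [hf0 i x hx, zero_mul]
  have hmain := hcore (fun i => (dd β i : ℝ)) φ l (ep β) (DD.image tl) F S Ω hmodel hne hΩ
    (fun i x => by rw [hF]; beta_reduce; rw [mkH_apply (hFmem i), norm_mul, norm_ee, mul_one]; exact hf i x)
    (fun x hx => by rw [hF]; beta_reduce; rw [mkH_apply (hFmem e), hfe x hx, zero_mul])
  have hin : ∀ i P, ‖inner ℂ (φ i P) (F i)‖ = c * (‖fl ψ (S i) (f i) P.1 (LT β κ i P) (x0 i P)‖ * (del P (x0 i P) ^ N)⁻¹) := by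
    intro i P
    rw [hφ, hF]; beta_reduce
    have := del_pos P (x0 i P)
    rw [pkt_inner hψ _ _ _ _ _ _ (hf0 i), norm_mul, Complex.norm_real, Real.norm_of_nonneg (by positivity)]
    ring
  -- pointwise bound
  have hpt : ∀ w ∈ DD, ∀ x : ℤ, x / 2 ^ w.1.1 = w.2 → ∑ t ∈ T, ‖FF β (fun i => fl ψ (S i) (f i) w.1.1 (w.1.2 i)) (Kj γ w.1.1) (x, t)‖ ≤
      A * ∏ i, ‖inner ℂ (φ i (tl w)) (F i)‖ := by
    intro w hw x hx
    rw [hDD, Finset.mem_sigma] at hw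
    have hLT : ∀ i, LT β κ i (tl w) = w.1.2 i := fun i => by rw [htl]; exact LT_eq hd (hQ _ hw.1) w.2 i
    have ht1 : (tl w).1 = w.1.1 := by rw [htl]
    have ht2 : (tl w).2.1 = w.2 := by rw [htl]
    have hg : ∀ i (t : ℤ), ‖fl ψ (S i) (f i) w.1.1 (w.1.2 i) ((x:ℝ) - β i * t)‖ ≤
        2 * (2 + Bb β) ^ N * c⁻¹ * ‖inner ℂ (φ i (tl w)) (F i)‖ * (1 + |(t:ℝ) / 2 ^ w.1.1|) ^ N := by
      intro i t
      have h1 := hx0 i (tl w) (x - β i * t)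
      have hdp := del_pos (tl w) (x - β i * t)
      rw [← div_eq_mul_inv, div_le_iff₀ (by positivity)] at h1
      rw [hin]
      rw [hLT, ht1] at h1
      rw [hLT, ht1]
      push_cast at h1
      refine h1.trans ?_
      have hdel : del (tl w) (x - β i * t) ≤ (2 + Bb β) * (1 + |(t:ℝ) / 2 ^ w.1.1|) := by
        unfold del
        rw [ht1, ht2]
        have hb := ediv_bounds x w.1.1
        rw [hx] at hb
        push_cast
        have hβ : |(β i : ℝ)| ≤ Bb β := by
          have h0 := abs_nonneg (β 0 : ℝ)
          have h1 := abs_nonneg (β 1 : ℝ)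
          have h2 := abs_nonneg (β 2 : ℝ)
          unfold Bb
          fin_cases i <;> simp <;> linarith
        have e1 : ((x:ℝ) - β i * t) / 2 ^ w.1.1 - w.2 = ((x:ℝ) / 2 ^ w.1.1 - w.2) - β i * (t / 2 ^ w.1.1) := by ring
        have e2 : |((x:ℝ) / 2 ^ w.1.1 - w.2)| ≤ 1 := by rw [abs_le]; constructor <;> linarith [hb.1, hb.2]
        have e3 := abs_sub ((x:ℝ) / 2 ^ w.1.1 - w.2) (β i * (t / 2 ^ w.1.1))
        rw [abs_mul] at e3
        rw [e1]
        have := abs_nonneg ((t:ℝ) / 2 ^ w.1.1)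
        nlinarith
      have hd0 := del_pos (tl w) (x0 i (tl w))
      calc _ ≤ 2 * (‖fl ψ (S i) (f i) w.1.1 (w.1.2 i) (x0 i (tl w))‖ * (del (tl w) (x0 i (tl w)) ^ N)⁻¹) * ((2 + Bb β) * (1 + |(t:ℝ) / 2 ^ w.1.1|)) ^ N := by
            gcongr
        _ = _ := by rw [mul_pow]; field_simp
    have hkk : ∀ t : ℤ, ‖Kj γ w.1.1 t‖ ≤ Cγ * (((2:ℝ) ^ w.1.1)⁻¹ * ((1 + |(t:ℝ) / 2 ^ w.1.1|) ^ (3 * N + 2))⁻¹) := by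
      intro t
      unfold Kj
      rw [norm_mul, Complex.norm_real, Real.norm_of_nonneg (by positivity)]
      have := hγ1 ((t:ℝ) / 2 ^ w.1.1)
      calc _ ≤ ((2:ℝ) ^ w.1.1)⁻¹ * (Cγ * ((1 + |(t:ℝ) / 2 ^ w.1.1|) ^ (3 * N + 2))⁻¹) := by gcongr
        _ = _ := by ring
    set a : Fin 3 → ℝ := fun i => ‖inner ℂ (φ i (tl w)) (F i)‖ with ha
    have ha0 : ∀ i, 0 ≤ a i := fun i => norm_nonneg _
    calc ∑ t ∈ T, ‖FF β (fun i => fl ψ (S i) (f i) w.1.1 (w.1.2 i)) (Kj γ w.1.1) (x, t)‖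
        ≤ ∑ t ∈ T, (8 * ((2 + Bb β) ^ N) ^ 3 * (c⁻¹) ^ 3 * (∏ i, a i) * Cγ) * (((2:ℝ) ^ w.1.1)⁻¹ * ((1 + |(t:ℝ) / 2 ^ w.1.1|) ^ (3 * N + 2))⁻¹ *
            (1 + |(t:ℝ) / 2 ^ w.1.1|) ^ (3 * N)) := by
          refine Finset.sum_le_sum fun t _ => ?_
          unfold FF
          rw [norm_mul, norm_prod]
          calc _ ≤ (∏ i, (2 * (2 + Bb β) ^ N * c⁻¹ * a i * (1 + |(t:ℝ) / 2 ^ w.1.1|) ^ N)) *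
                (Cγ * (((2:ℝ) ^ w.1.1)⁻¹ * ((1 + |(t:ℝ) / 2 ^ w.1.1|) ^ (3 * N + 2))⁻¹)) := by
                gcongr with i
                · exact hg i t
                · exact hkk t
            _ = _ := by
                rw [Fin.prod_univ_three, Fin.prod_univ_three]
                rw [show (1 + |(t:ℝ) / 2 ^ w.1.1|) ^ (3 * N) = ((1 + |(t:ℝ) / 2 ^ w.1.1|) ^ N) ^ 3 by rw [← pow_mul, mul_comm]]
                ring
      _ = (8 * ((2 + Bb β) ^ N) ^ 3 * (c⁻¹) ^ 3 * (∏ i, a i) * Cγ) * ∑ t ∈ T, (((2:ℝ) ^ w.1.1)⁻¹ * ((1 + |(t:ℝ) / 2 ^ w.1.1|) ^ (3 * N + 2))⁻¹ *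
            (1 + |(t:ℝ) / 2 ^ w.1.1|) ^ (3 * N)) := by rw [Finset.mul_sum]
      _ ≤ (8 * ((2 + Bb β) ^ N) ^ 3 * (c⁻¹) ^ 3 * (∏ i, a i) * Cγ) * CK := by
          have : 0 ≤ ∏ i, a i := Finset.prod_nonneg fun i _ => ha0 i
          gcongr
          exact hK _ T
      _ = A * ∏ i, a i := by rw [hA]; ring
  calc ∑ q ∈ Q, ∑ x ∈ X, ∑ t ∈ T, ‖FF β (fun i => fl ψ (S i) (f i) q.1 (q.2 i)) (Kj γ q.1) (x, t)‖
      = ∑ q ∈ Q, ∑ n ∈ X.image (fun x => x / 2 ^ q.1), ∑ x ∈ X.filter (fun x => x / 2 ^ q.1 = n), ∑ t ∈ T,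
          ‖FF β (fun i => fl ψ (S i) (f i) q.1 (q.2 i)) (Kj γ q.1) (x, t)‖ := by
        refine Finset.sum_congr rfl fun q _ => ?_
        exact (Finset.sum_fiberwise_of_maps_to (fun x hx => Finset.mem_image_of_mem _ hx) _).symm
    _ = ∑ w ∈ DD, ∑ x ∈ X.filter (fun x => x / 2 ^ w.1.1 = w.2), ∑ t ∈ T,
          ‖FF β (fun i => fl ψ (S i) (f i) w.1.1 (w.1.2 i)) (Kj γ w.1.1) (x, t)‖ := by
        rw [hDD, Finset.sum_sigma]
    _ ≤ ∑ w ∈ DD, A * (2 ^ (tl w).1 * ∏ i, ‖inner ℂ (φ i (tl w)) (F i)‖) := by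
        refine Finset.sum_le_sum fun w hw => ?_
        have hp : 0 ≤ A * ∏ i, ‖inner ℂ (φ i (tl w)) (F i)‖ := mul_nonneg (by positivity) (Finset.prod_nonneg fun i _ => norm_nonneg _)
        calc _ ≤ ∑ x ∈ X.filter (fun x => x / 2 ^ w.1.1 = w.2), A * ∏ i, ‖inner ℂ (φ i (tl w)) (F i)‖ :=
              Finset.sum_le_sum fun x hx => hpt w hw x (Finset.mem_filter.1 hx).2
          _ ≤ ∑ x ∈ dyad w.1.1 w.2, A * ∏ i, ‖inner ℂ (φ i (tl w)) (F i)‖ :=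
              Finset.sum_le_sum_of_subset_of_nonneg (fun x hx => mem_dyad.2 (Finset.mem_filter.1 hx).2) (fun _ _ _ => hp)
          _ = _ := by
              rw [Finset.sum_const, card_dyad, nsmul_eq_mul]
              have ht1 : (tl w).1 = w.1.1 := by rw [htl]
              rw [ht1]; push_cast; ring
    _ = A * Lam φ F (DD.image tl) := by
        unfold Lam
        rw [Finset.sum_image hinj, Finset.mul_sum]
    _ ≤ A * (C1 * ∏ i, ((S i).card : ℝ) ^ ((1 + θ i) / 2 - if i = e then 1 else 0)) := by gcongr
    _ = _ := by ring

end BHT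

namespace BHT

/-- the trilinear form with kernel `K` -/
noncomputable def Lf (β : Fin 3 → ℤ) (K : ℤ → ℂ) (f : Fin 3 → ℤ → ℂ) : ℂ :=
  ∑' z : ℤ × ℤ, (∏ i, f i (z.1 - β i * z.2)) * K z.2

/-- if the integral does not vanish, the tile belongs to a class -/
lemma FF_class (β : Fin 3 → ℤ) (hd : ∀ i, dd β i ≠ 0) (hβ : ∀ i, β i ≠ 0) (ψ γ : ℝ → ℂ) (hψ : Band ψ (-1) 1)
    (hγ : Band γ (24 * Bb β / 2) (2 * (24 * Bb β))) (m : ℕ) (hm : 0 < m) :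
    ∃ 𝒦 : Finset CP, ∀ (S : Fin 3 → Finset ℤ) (f : Fin 3 → ℤ → ℂ) (q : ℕ × (Fin 3 → ℤ)), 2 ≤ q.1 →
      (∀ i, 0 ≤ q.2 i ∧ q.2 i < 2 ^ q.1) →
      ∑' z, FF β (fun i => fl ψ (S i) (f i) q.1 (q.2 i)) (Kj γ q.1) z ≠ 0 →
      ∃ κ ∈ 𝒦, |(κ.s : ℝ)| ≤ 3 ∧ 11 * Bb β ≤ κ.b ∧ κ.b ≤ 49 * Bb β ∧ Cl β m κ q := by
  classical
  have hB0 : 0 ≤ Bb β := by unfold Bb; positivity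
  have hB1 : 1 ≤ Bb β := by
    have h1 : (1:ℝ) ≤ |(β 0 : ℝ)| := by exact_mod_cast Int.one_le_abs (hβ 0)
    unfold Bb
    have := abs_nonneg (β 1 : ℝ)
    have := abs_nonneg (β 2 : ℝ)
    linarith
  obtain ⟨R, hR⟩ := exists_nat_ge (50 * Bb β + 6)
  obtain ⟨I, hI⟩ : ∃ I : Finset ℤ, I = Finset.Icc (-(R:ℤ)) R := ⟨_, rfl⟩
  have memI : ∀ x : ℤ, |(x:ℝ)| ≤ R → x ∈ I := by
    intro x hx
    rw [hI, Finset.mem_Icc]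
    have := abs_le.1 hx
    constructor
    · exact_mod_cast this.1
    · exact_mod_cast this.2
  refine ⟨(I ×ˢ I ×ˢ I ×ˢ I ×ˢ I ×ˢ (Fintype.piFinset (fun _ : Fin 3 => I)) ×ˢ Finset.range m).image
    (fun v => ⟨v.1, v.2.1, v.2.2.1, v.2.2.2.1, v.2.2.2.2.1, v.2.2.2.2.2.1, v.2.2.2.2.2.2⟩), ?_⟩
  rintro S f ⟨j, l⟩ hj hl hne
  simp only at hj hl hne
  have h2 : (0:ℝ) < 2 ^ j := by positivity
  have h21 : (1:ℝ) ≤ 2 ^ j := one_le_pow₀ (by norm_num)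
  have hlr : ∀ i, (0:ℝ) ≤ l i ∧ (l i : ℝ) ≤ 2 ^ j := fun i => ⟨by exact_mod_cast (hl i).1, by exact_mod_cast (hl i).2.le⟩
  have hg : ∀ i, Band (fl ψ (S i) (f i) j (l i)) (((l i:ℝ) - 1) / 2 ^ j) (((l i:ℝ) + 1) / 2 ^ j) := fun i => fl_band hψ _ _ _ _
  have hk := Kj_band hγ j
  -- first condition
  obtain ⟨s', hs1, hs2⟩ : ∃ s' : ℤ, ∑ i, ((l i:ℝ) - 1) / 2 ^ j ≤ s' ∧ (s':ℝ) ≤ ∑ i, ((l i:ℝ) + 1) / 2 ^ j := by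
    by_contra hc
    push Not at hc
    apply hne
    apply FF_zero_x hg hk
    intro n
    rcases lt_or_ge (n:ℝ) (∑ i, ((l i:ℝ) - 1) / 2 ^ j) with h | h
    · exact Or.inl h
    · exact Or.inr (hc n h)
  obtain ⟨r', hr1, hr2⟩ : ∃ r' : ℤ, ∑ i, (-(β i:ℝ) * l i - |(β i:ℝ)|) / 2 ^ j + 24 * Bb β / 2 / 2 ^ j ≤ r' ∧
      (r':ℝ) ≤ ∑ i, (-(β i:ℝ) * l i + |(β i:ℝ)|) / 2 ^ j + 2 * (24 * Bb β) / 2 ^ j := by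
    by_contra hc
    push Not at hc
    apply hne
    apply FF_zero_t hβ hg hk (a' := fun i => (-(β i:ℝ) * l i - |(β i:ℝ)|) / 2 ^ j) (b' := fun i => (-(β i:ℝ) * l i + |(β i:ℝ)|) / 2 ^ j)
    · intro i ξ h h'
      rw [div_le_iff₀ h2] at h ⊢
      rw [le_div_iff₀ h2] at h' ⊢
      have h3 : |ξ * 2 ^ j - l i| ≤ 1 := abs_le.2 ⟨by linarith, by linarith⟩
      have h4 : |(β i:ℝ) * (ξ * 2 ^ j - l i)| ≤ |(β i:ℝ)| := by
        rw [abs_mul]; exact mul_le_of_le_one_right (abs_nonneg _) h3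
      have := abs_le.1 h4
      constructor <;> nlinarith
    · intro n
      rcases lt_or_ge (n:ℝ) (∑ i, (-(β i:ℝ) * l i - |(β i:ℝ)|) / 2 ^ j + 24 * Bb β / 2 / 2 ^ j) with h | h
      · exact Or.inl h
      · exact Or.inr (hc n h)
  rw [← Finset.sum_div, div_le_iff₀ h2, Fin.sum_univ_three] at hs1
  rw [← Finset.sum_div, le_div_iff₀ h2, Fin.sum_univ_three] at hs2
  rw [← Finset.sum_div, ← add_div, div_le_iff₀ h2, Fin.sum_univ_three] at hr1
  rw [← Finset.sum_div, ← add_div, le_div_iff₀ h2, Fin.sum_univ_three] at hr2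
  obtain ⟨s, hs⟩ : ∃ s : ℤ, s = l 0 + l 1 + l 2 - s' * 2 ^ j := ⟨_, rfl⟩
  obtain ⟨b, hb⟩ : ∃ b : ℤ, b = β 0 * l 0 + β 1 * l 1 + β 2 * l 2 + r' * 2 ^ j := ⟨_, rfl⟩
  have hsr : (s:ℝ) = l 0 + l 1 + l 2 - s' * 2 ^ j := by rw [hs]; push_cast; ring
  have hbr : (b:ℝ) = β 0 * l 0 + β 1 * l 1 + β 2 * l 2 + r' * 2 ^ j := by rw [hb]; push_cast; ring
  have hs3 : |(s:ℝ)| ≤ 3 := abs_le.2 ⟨by linarith, by linarith⟩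
  have hBdef : |(β 0 : ℝ)| + |(β 1 : ℝ)| + |(β 2 : ℝ)| = Bb β := rfl
  have hb1 : 11 * Bb β ≤ b := by linarith
  have hb2 : b ≤ 49 * Bb β := by linarith
  have hμ := Nat.mod_lt j hm
  refine ⟨⟨s', -r', s, b, l 0 % (7 * dd β 0), fun i => l i * 2 / 2 ^ j, j % m⟩, ?_, hs3, hb1, hb2, ?_⟩
  · rw [Finset.mem_image]
    refine ⟨(s', -r', s, b, l 0 % (7 * dd β 0), fun i => l i * 2 / 2 ^ j, j % m), ?_, rfl⟩
    simp only [Finset.mem_product, Finset.mem_range, Fintype.mem_piFinset]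
    have key : ∀ (x A : ℝ), 0 ≤ A → |x * 2 ^ j| ≤ A * 2 ^ j → |x| ≤ A := by
      intro x A hA h
      rw [abs_mul, abs_of_pos h2] at h
      exact le_of_mul_le_mul_right h h2
    have hl0 := hlr 0
    have hl1 := hlr 1
    have hl2 := hlr 2
    refine ⟨memI _ ?_, memI _ ?_, memI _ ?_, memI _ ?_, memI _ ?_, fun i => memI _ ?_, hμ⟩
    · apply (key _ 6 (by norm_num) ?_).trans (by linarith)
      have := abs_le.1 hs3
      exact abs_le.2 ⟨by linarith, by linarith⟩
    · apply (key _ (50 * Bb β) (by linarith) ?_).trans (by linarith)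
      have e : ((-r' : ℤ) : ℝ) * 2 ^ j = β 0 * l 0 + β 1 * l 1 + β 2 * l 2 - b := by rw [hbr]; push_cast; ring
      have hm : ∀ i, |(β i : ℝ) * l i| ≤ |(β i : ℝ)| * 2 ^ j := fun i => by
        rw [abs_mul, abs_of_nonneg (hlr i).1]
        exact mul_le_mul_of_nonneg_left (hlr i).2 (abs_nonneg _)
      have q0 := abs_le.1 (hm 0)
      have q1 := abs_le.1 (hm 1)
      have q2 := abs_le.1 (hm 2)
      have q3 : Bb β * 2 ^ j = |(β 0:ℝ)| * 2 ^ j + |(β 1:ℝ)| * 2 ^ j + |(β 2:ℝ)| * 2 ^ j := by rw [← hBdef]; ring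
      have q4 : 49 * Bb β ≤ 49 * (Bb β * 2 ^ j) := by nlinarith
      rw [e]
      exact abs_le.2 ⟨by linarith, by nlinarith⟩
    · linarith
    · exact abs_le.2 ⟨by linarith, by linarith⟩
    · have h7 : (7 * dd β 0) ≠ 0 := mul_ne_zero (by norm_num) (hd 0)
      have e1 := Int.emod_nonneg (l 0) h7
      have e2 := Int.emod_lt_abs (l 0) h7
      have e3 : ((l 0 % (7 * dd β 0) : ℤ) : ℝ) < ((|7 * dd β 0| : ℤ) : ℝ) := by exact_mod_cast e2
      rw [abs_of_nonneg (by exact_mod_cast e1)]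
      have e4 := dd_le β 0
      push_cast at e3
      rw [abs_mul, abs_of_pos (by norm_num : (0:ℝ) < 7)] at e3
      push_cast
      linarith
    · have e1 : 0 ≤ l i * 2 / 2 ^ j := Int.ediv_nonneg (by linarith [(hl i).1]) (by positivity)
      have e2 : l i * 2 / 2 ^ j < 2 := by
        apply Int.ediv_lt_of_lt_mul (by positivity)
        linarith [(hl i).2]
      have e3 : ((l i * 2 / 2 ^ j : ℤ) : ℝ) < 2 := by exact_mod_cast e2
      rw [abs_of_nonneg (by exact_mod_cast e1)]
      linarith
  · exact ⟨hj, by simp only; rw [hs]; ring, by simp only; rw [hb]; ring, rfl, fun i => rfl, rfl⟩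

/-- the core estimate for the truncated form -/
lemma core_form0 (β : Fin 3 → ℤ) (hd : ∀ i, dd β i ≠ 0) (hβ : ∀ i, β i ≠ 0) (ψ γ : ℝ → ℂ) (hψ : Band ψ (-1) 1)
    (hψ2 : ∀ n : ℤ, ψ n = if n = 0 then 1 else 0)
    (hγ : Band γ (24 * Bb β / 2) (2 * (24 * Bb β))) (θ : Fin 3 → ℝ)
    (hθ : ∀ i, 0 < θ i ∧ θ i < 1) (hsum : θ 0 + θ 1 + θ 2 = 1) (e : Fin 3) :
    ∃ C : ℝ, 0 < C ∧ ∀ (J : ℕ) (f : Fin 3 → ℤ → ℂ) (S : Fin 3 → Finset ℤ) (Ω : Finset ℤ), (∀ i, (S i).Nonempty) →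
    (∀ i, i ≠ e → ∀ (J : ℕ) (M : ℤ), 20 * (S i).card * 2 ^ J < (S e).card * ((S i).filter (fun x => x / 2 ^ J = M)).card →
      ∀ x : ℤ, |x / 2 ^ J - M| ≤ 2 → x ∈ Ω) →
    (∀ i x, ‖f i x‖ ≤ if x ∈ S i then 1 else 0) → (∀ x ∈ Ω, f e x = 0) →
    ‖Lf β (fun t => ∑ j ∈ Finset.Ico 2 J, Kj γ j t) f‖ ≤
      C * ∏ i, ((S i).card : ℝ) ^ ((1 + θ i) / 2 - if i = e then 1 else 0) := by
  classical
  obtain ⟨m0, hm0⟩ := pow_unbounded_of_one_lt (55 * Bb β + 8) (by norm_num : (1:ℝ) < 2)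
  obtain ⟨m, hm, hmp⟩ : ∃ m : ℕ, 55 * Bb β + 8 ≤ 2 ^ m ∧ 0 < m :=
    ⟨m0 + 1, hm0.le.trans (pow_le_pow_right₀ (by norm_num) (by omega)), by omega⟩
  obtain ⟨C, hC, hb⟩ := class_bound β hd ψ γ hψ hγ m hm θ hθ hsum e
  obtain ⟨𝒦, hK⟩ := FF_class β hd hβ ψ γ hψ hγ m hmp
  refine ⟨(𝒦.card + 1) * C, by positivity, fun J f S Ω hS hΩ hf hfΩ => ?_⟩
  obtain ⟨D, hD⟩ : ∃ D : ℝ, D = ∏ i, ((S i).card : ℝ) ^ ((1 + θ i) / 2 - if i = e then 1 else 0) := ⟨_, rfl⟩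
  have hD0 : 0 ≤ D := by rw [hD]; exact Finset.prod_nonneg fun i _ => Real.rpow_nonneg (Nat.cast_nonneg _) _
  rw [← hD]
  obtain ⟨G, hG⟩ : ∃ G : ℕ × (Fin 3 → ℤ) → ℤ × ℤ → ℂ, G = fun q => FF β (fun i => fl ψ (S i) (f i) q.1 (q.2 i)) (Kj γ q.1) := ⟨_, rfl⟩
  have hGs : ∀ q, Summable (G q) := fun q => by rw [hG]; exact FF_summable (fun i => fl_band hψ _ _ _ _) (Kj_band hγ _)
  obtain ⟨QA, hQA⟩ : ∃ QA : Finset (ℕ × (Fin 3 → ℤ)), QA = (Finset.Ico 2 J).biUnion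
    (fun j => (Fintype.piFinset (fun _ : Fin 3 => Finset.Ico (0:ℤ) (2 ^ j))).image (fun l => (j, l))) := ⟨_, rfl⟩
  have hsumQ : ∀ F : ℕ × (Fin 3 → ℤ) → ℂ, ∑ q ∈ QA, F q = ∑ j ∈ Finset.Ico 2 J, ∑ l ∈ Fintype.piFinset (fun _ : Fin 3 => Finset.Ico (0:ℤ) (2 ^ j)), F (j, l) := by
    intro F
    rw [hQA, Finset.sum_biUnion]
    · refine Finset.sum_congr rfl fun j _ => ?_
      rw [Finset.sum_image]
      intro a _ b _ h
      exact (Prod.mk.inj h).2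
    · intro j _ j' _ hjj
      rw [Function.onFun, Finset.disjoint_left]
      intro a ha ha'
      rw [Finset.mem_image] at ha ha'
      obtain ⟨l, -, rfl⟩ := ha
      obtain ⟨l', -, h⟩ := ha'
      exact hjj (Prod.mk.inj h).1.symm
  have hpt : ∀ z : ℤ × ℤ, (∏ i, f i (z.1 - β i * z.2)) * ∑ j ∈ Finset.Ico 2 J, Kj γ j z.2 = ∑ q ∈ QA, G q z := by
    intro z
    rw [hsumQ, Finset.mul_sum]
    refine Finset.sum_congr rfl fun j _ => ?_
    rw [hG]
    simp only [FF]
    rw [← Finset.sum_mul]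
    congr 1
    rw [← Finset.prod_univ_sum (fun _ : Fin 3 => Finset.Ico (0:ℤ) (2 ^ j)) (fun i l => fl ψ (S i) (f i) j l ((z.1:ℝ) - β i * z.2))]
    refine Finset.prod_congr rfl fun i _ => ?_
    rw [← sum_fl hψ2 (S := S i) (f := f i) (fun x hx => by
      have := hf i x
      rw [if_neg hx] at this
      exact norm_le_zero_iff.1 this) j]
    push_cast
    rfl
  have hL : Lf β (fun t => ∑ j ∈ Finset.Ico 2 J, Kj γ j t) f = ∑ q ∈ QA, ∑' z, G q z := by
    unfold Lf
    rw [← Summable.tsum_finsetSum (fun q _ => hGs q)]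
    exact tsum_congr hpt
  have hQmem : ∀ q ∈ QA, 2 ≤ q.1 ∧ ∀ i, 0 ≤ q.2 i ∧ q.2 i < 2 ^ q.1 := by
    intro q hq
    rw [hQA, Finset.mem_biUnion] at hq
    obtain ⟨j, hj, hq⟩ := hq
    rw [Finset.mem_image] at hq
    obtain ⟨l, hl, rfl⟩ := hq
    refine ⟨(Finset.mem_Ico.1 hj).1, fun i => ?_⟩
    exact Finset.mem_Ico.1 (Fintype.mem_piFinset.1 hl i)
  obtain ⟨𝒦', hK'⟩ : ∃ 𝒦' : Finset CP, 𝒦' = 𝒦.filter (fun κ => |(κ.s : ℝ)| ≤ 3 ∧ 11 * Bb β ≤ κ.b ∧ κ.b ≤ 49 * Bb β) := ⟨_, rfl⟩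
  obtain ⟨Q, hQ⟩ : ∃ Q : Finset (ℕ × (Fin 3 → ℤ)), Q = QA.filter (fun q => ∃ κ ∈ 𝒦', Cl β m κ q) := ⟨_, rfl⟩
  have hL2 : Lf β (fun t => ∑ j ∈ Finset.Ico 2 J, Kj γ j t) f = ∑ q ∈ Q, ∑' z, G q z := by
    rw [hL, hQ]
    symm
    apply Finset.sum_subset (Finset.filter_subset _ _)
    intro q hq hq2
    by_contra hne
    apply hq2
    rw [Finset.mem_filter]
    refine ⟨hq, ?_⟩
    rw [hG] at hne
    obtain ⟨κ, h1, h2, h3, h4, h5⟩ := hK S f q (hQmem q hq).1 (hQmem q hq).2 hne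
    exact ⟨κ, by rw [hK', Finset.mem_filter]; exact ⟨h1, h2, h3, h4⟩, h5⟩
  have hex : ∀ q ∈ Q, ∃ κ ∈ 𝒦', Cl β m κ q := by
    intro q hq
    rw [hQ, Finset.mem_filter] at hq
    exact hq.2
  obtain ⟨kk, hkk⟩ : ∃ kk : ℕ × (Fin 3 → ℤ) → CP, ∀ q ∈ Q, kk q ∈ 𝒦' ∧ Cl β m (kk q) q := by
    by_cases hn : Nonempty CP
    · refine ⟨fun q => if h : ∃ κ ∈ 𝒦', Cl β m κ q then h.choose else hn.some, fun q hq => ?_⟩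
      have h := hex q hq
      simp only [dif_pos h]
      exact h.choose_spec
    · exact absurd ⟨⟨0, 0, 0, 0, 0, fun _ => 0, 0⟩⟩ hn
  have hfin : ∀ Z : Finset (ℤ × ℤ), ∑ z ∈ Z, ∑ q ∈ Q, ‖G q z‖ ≤ (𝒦.card + 1) * C * D := by
    intro Z
    obtain ⟨X, hX⟩ : ∃ X : Finset ℤ, X = Z.image Prod.fst := ⟨_, rfl⟩
    obtain ⟨T, hT⟩ : ∃ T : Finset ℤ, T = Z.image Prod.snd := ⟨_, rfl⟩
    calc ∑ z ∈ Z, ∑ q ∈ Q, ‖G q z‖ ≤ ∑ z ∈ X ×ˢ T, ∑ q ∈ Q, ‖G q z‖ := by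
          apply Finset.sum_le_sum_of_subset_of_nonneg
          · intro z hz
            rw [Finset.mem_product, hX, hT]
            exact ⟨Finset.mem_image_of_mem _ hz, Finset.mem_image_of_mem _ hz⟩
          · intro z _ _; positivity
      _ = ∑ q ∈ Q, ∑ x ∈ X, ∑ t ∈ T, ‖G q (x, t)‖ := by
          rw [Finset.sum_comm]
          refine Finset.sum_congr rfl fun q _ => ?_
          rw [Finset.sum_product]
      _ = ∑ κ ∈ 𝒦', ∑ q ∈ Q.filter (fun q => kk q = κ), ∑ x ∈ X, ∑ t ∈ T, ‖G q (x, t)‖ :=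
          (Finset.sum_fiberwise_of_maps_to (fun q hq => (hkk q hq).1) _).symm
      _ ≤ ∑ κ ∈ 𝒦', C * D := by
          refine Finset.sum_le_sum fun κ hκ => ?_
          rw [hK', Finset.mem_filter] at hκ
          rw [hG, hD]
          refine hb κ (Q.filter (fun q => kk q = κ)) f S Ω X T hκ.2.1 hκ.2.2.1 hκ.2.2.2 ?_ hS hΩ hf hfΩ
          intro q hq
          rw [Finset.mem_filter] at hq
          rw [← hq.2]
          exact (hkk q hq.1).2
      _ = 𝒦'.card * (C * D) := by rw [Finset.sum_const, nsmul_eq_mul]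
      _ ≤ (𝒦.card + 1) * (C * D) := by
          gcongr
          have : 𝒦'.card ≤ 𝒦.card + 1 := by rw [hK']; exact (Finset.card_filter_le _ _).trans (Nat.le_succ _)
          exact_mod_cast this
      _ = _ := by ring
  rw [hL2, ← Summable.tsum_finsetSum (fun q _ => hGs q)]
  have hs : Summable fun z => ∑ q ∈ Q, ‖G q z‖ := summable_of_sum_le (fun z => by positivity) hfin
  exact (tsum_of_norm_bounded hs.hasSum (fun z => norm_sum_le _ _)).trans (hs.tsum_le_of_sum_le hfin)
end BHT

namespace BHT

/-- trilinear forms on sequences -/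
abbrev TF := MultilinearMap ℂ (fun _ : Fin 3 => ℤ → ℂ) ℂ

/-- generalized restricted type estimates for the trilinear form -/
def Gd (C : (Fin 3 → ℝ) → Fin 3 → ℝ) (Λ : TF) : Prop :=
  ∀ S : Fin 3 → Finset ℤ, (∀ i, (S i).Nonempty) → ∀ e, ∃ S' ⊆ S e, (S e).card ≤ 2 * S'.card ∧
    ∀ θ : Fin 3 → ℝ, (∀ i, 0 < θ i ∧ θ i < 1) → θ 0 + θ 1 + θ 2 = 1 →
    ∀ f : Fin 3 → ℤ → ℂ, (∀ i x, ‖f i x‖ ≤ if x ∈ S i then 1 else 0) → (∀ x, x ∉ S' → f e x = 0) →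
      ‖Λ f‖ ≤ C θ e * ∏ i, ((S i).card : ℝ) ^ ((1 + θ i) / 2 - if i = e then 1 else 0)

lemma prod_rpow_exp {n : Fin 3 → ℝ} (hn : ∀ i, 0 < n i) (x : Fin 3 → ℝ) :
    ∏ i, n i ^ x i = Real.exp (x 0 * Real.log (n 0) + x 1 * Real.log (n 1) + x 2 * Real.log (n 2)) := by
  rw [Fin.prod_univ_three, Real.exp_add, Real.exp_add, Real.rpow_def_of_pos (hn 0), Real.rpow_def_of_pos (hn 1),
    Real.rpow_def_of_pos (hn 2)]
  simp only [mul_comm]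

lemma core_dom (C : (Fin 3 → ℝ) → Fin 3 → ℝ) (α : Fin 3 → ℝ) (hα : α 0 + α 1 + α 2 = 1) (e : Fin 3)
    (h1 : ∀ i, i ≠ e → 0 < α i ∧ α i < 1) (he : -(1/2) < α e) :
    ∃ D : ℝ, 0 < D ∧ ∀ Λ : TF, Gd C Λ → ∀ S : Fin 3 → Finset ℤ, (∀ i, (S i).Nonempty) → (∀ i, (S i).card ≤ (S e).card) →
      ∃ S' ⊆ S e, (S e).card ≤ 2 * S'.card ∧
      ∀ f : Fin 3 → ℤ → ℂ, (∀ i x, ‖f i x‖ ≤ if x ∈ S i then 1 else 0) → (∀ x, x ∉ S' → f e x = 0) →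
      ‖Λ f‖ ≤ D * ∏ i, ((S i).card : ℝ) ^ α i := by
  obtain ⟨δ, hδ0, hδ1, hδ2⟩ : ∃ δ : ℝ, 0 < δ ∧ δ ≤ 1/8 ∧ ∀ i, i ≠ e → δ ≤ (1 - α i) / 2 := by
    have hp : ∀ i, 0 < if i = e then 1 else (1 - α i) / 2 := by
      intro i
      split_ifs with h
      · norm_num
      · linarith [(h1 i h).2]
    refine ⟨min (1/8) (min (if (0:Fin 3) = e then 1 else (1 - α 0) / 2)
      (min (if (1:Fin 3) = e then 1 else (1 - α 1) / 2) (if (2:Fin 3) = e then 1 else (1 - α 2) / 2))), ?_, min_le_left _ _, ?_⟩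
    · exact lt_min (by norm_num) (lt_min (hp 0) (lt_min (hp 1) (hp 2)))
    · intro i hi
      refine (min_le_right _ _).trans ?_
      fin_cases i
      · refine (min_le_left _ _).trans ?_
        exact (if_neg hi).le
      · refine (min_le_right _ _).trans ((min_le_left _ _).trans ?_)
        exact (if_neg hi).le
      · refine (min_le_right _ _).trans ((min_le_right _ _).trans ?_)
        exact (if_neg hi).le
  obtain ⟨A, hA⟩ : ∃ A : Fin 3 → ℝ, A = fun i => max (α i) (1/2 + δ) := ⟨_, rfl⟩
  have hA1 : ∀ i, 1/2 + δ ≤ A i := fun i => by rw [hA]; exact le_max_right _ _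
  have hA2 : ∀ i, i ≠ e → A i < 1 := fun i hi => by rw [hA]; exact max_lt (h1 i hi).2 (by linarith)
  have hA3 : ∀ i, α i ≤ A i := fun i => by rw [hA]; exact le_max_left _ _
  have hA4 : ∀ i j, i ≠ e → j ≠ e → i ≠ j → A i + A j < 3/2 := by
    intro i j hi hj hij
    have hs : α i + α j + α e = 1 := by
      rw [← hα]; clear hA hA1 hA2 hA3 hδ2 h1 he
      fin_cases e <;> fin_cases i <;> fin_cases j <;> first | (exact absurd rfl hi) | (exact absurd rfl hj) | (exact absurd rfl hij) | (simp only [Fin.zero_eta, Fin.mk_one, Fin.reduceFinMk] <;> ring)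
    have q1 := hδ2 i hi
    have q2 := hδ2 j hj
    have q3 := (h1 i hi).2
    have q4 := (h1 j hj).2
    rw [hA]
    simp only
    rcases max_cases (α i) (1/2 + δ) with h | h <;> rcases max_cases (α j) (1/2 + δ) with h' | h' <;> rw [h.1, h'.1] <;> linarith
  obtain ⟨θ, hθ⟩ : ∃ θ : Fin 3 → ℝ, θ = fun i => if i = e then 3 - 2 * (A 0 + A 1 + A 2 - A e) else 2 * A i - 1 := ⟨_, rfl⟩
  have hθ1 : ∀ i, 0 < θ i ∧ θ i < 1 := by
    intro i
    rw [hθ]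
    simp only
    split_ifs with hi
    · have a0 := hA1 0
      have a1 := hA1 1
      have a2 := hA1 2
      fin_cases e
      · have := hA4 1 2 (by decide) (by decide) (by decide); simp only [Fin.zero_eta]; constructor <;> linarith
      · have := hA4 0 2 (by decide) (by decide) (by decide); simp only [Fin.mk_one]; constructor <;> linarith
      · have := hA4 0 1 (by decide) (by decide) (by decide); simp only [Fin.reduceFinMk]; constructor <;> linarith
    · have := hA1 i
      have := hA2 i hi
      constructor <;> linarith
  have hθ2 : θ 0 + θ 1 + θ 2 = 1 := by
    rw [hθ]
    clear hA4 hA2 hδ2 h1 he hθ1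
    fin_cases e <;> simp <;> ring
  refine ⟨max (C θ e) 1, lt_max_of_lt_right one_pos, fun Λ hΛ S hS hSe => ?_⟩
  obtain ⟨S', hS'1, hS'2, h⟩ := hΛ S hS e
  refine ⟨S', hS'1, hS'2, fun f hf hfS => (h θ hθ1 hθ2 f hf hfS).trans ?_⟩
  have hn : ∀ i, (0:ℝ) < (S i).card := fun i => by exact_mod_cast Finset.card_pos.2 (hS i)
  apply mul_le_mul (le_max_left _ _) _ (Finset.prod_nonneg fun i _ => Real.rpow_nonneg (hn i).le _) (by positivity)
  rw [prod_rpow_exp hn, prod_rpow_exp hn]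
  apply Real.exp_le_exp.2
  have hl : ∀ i, Real.log ((S i).card : ℝ) ≤ Real.log ((S e).card : ℝ) := fun i =>
    Real.log_le_log (hn i) (by exact_mod_cast hSe i)
  have hm : ∀ i, 0 ≤ (A i - α i) * (Real.log ((S e).card : ℝ) - Real.log ((S i).card : ℝ)) := fun i =>
    mul_nonneg (by linarith [hA3 i]) (by linarith [hl i])
  have m0 := hm 0
  have m1 := hm 1
  have m2 := hm 2
  rw [hθ]
  clear hA4 hA2 hδ2 h1 he hθ1 hm hl hθ hθ2 h hSe hfS
  generalize hL : (fun i => Real.log ((S i).card : ℝ)) = L at *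
  have e' : ∀ i, Real.log ((S i).card : ℝ) = L i := fun i => by rw [← hL]
  simp only [e'] at *
  fin_cases e
  · simp at *
    have : α 0 = 1 - α 1 - α 2 := by linarith
    rw [this]
    nlinarith
  · simp at *
    have : α 1 = 1 - α 0 - α 2 := by linarith
    rw [this]
    nlinarith
  · simp at *
    have : α 2 = 1 - α 0 - α 1 := by linarith
    rw [this]
    nlinarith
end BHT

namespace BHT

lemma restricted (C : (Fin 3 → ℝ) → Fin 3 → ℝ) (α : Fin 3 → ℝ) (hα : α 0 + α 1 + α 2 = 1) (hpos : ∀ i, 0 < α i) :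
    ∃ D : ℝ, 0 < D ∧ ∀ Λ : TF, Gd C Λ → ∀ (S : Fin 3 → Finset ℤ) (f : Fin 3 → ℤ → ℂ),
      (∀ i x, ‖f i x‖ ≤ if x ∈ S i then 1 else 0) → ‖Λ f‖ ≤ D * ∏ i, ((S i).card : ℝ) ^ α i := by
  classical
  have hp0 := hpos 0
  have hp1 := hpos 1
  have hp2 := hpos 2
  have hlt : ∀ i, α i < 1 := fun i => by fin_cases i <;> simp <;> linarith
  choose De hDe hcore using fun e => core_dom C α hα e (fun i _ => ⟨hpos i, hlt i⟩) (by linarith [hpos e])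
  obtain ⟨D0, hD0, hDD⟩ : ∃ D0 : ℝ, 0 < D0 ∧ ∀ e, De e ≤ D0 := by
    refine ⟨∑ e, De e, Finset.sum_pos (fun e _ => hDe e) ⟨0, Finset.mem_univ _⟩, fun e => ?_⟩
    exact Finset.single_le_sum (f := De) (fun e _ => (hDe e).le) (Finset.mem_univ e)
  obtain ⟨r, hr0, hr1, hr⟩ : ∃ r : ℝ, 0 < r ∧ r < 1 ∧ ∀ e, (1/2 : ℝ) ^ α e ≤ r := by
    obtain ⟨e, he⟩ := Finite.exists_max (fun e => (1/2 : ℝ) ^ α e)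
    exact ⟨(1/2 : ℝ) ^ α e, by positivity, Real.rpow_lt_one (by norm_num) (by norm_num) (hpos e), he⟩
  have h1r : 0 < 1 - r := by linarith
  refine ⟨D0 / (1 - r), by positivity, fun Λ hΛ => ?_⟩
  have main : ∀ (N : ℕ) (S : Fin 3 → Finset ℤ), ∑ i, (S i).card ≤ N → ∀ f : Fin 3 → ℤ → ℂ,
      (∀ i x, ‖f i x‖ ≤ if x ∈ S i then 1 else 0) → ‖Λ f‖ ≤ D0 / (1 - r) * ∏ i, ((S i).card : ℝ) ^ α i := by
    intro N
    induction N with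
    | zero =>
      intro S hS f hf
      have h0 : f 0 = 0 := by
        ext x
        have : (S 0).card = 0 := by
          have := Finset.single_le_sum (f := fun i => (S i).card) (fun _ _ => Nat.zero_le _) (Finset.mem_univ (0 : Fin 3))
          beta_reduce at this
          omega
        rw [Finset.card_eq_zero] at this
        have h := hf 0 x
        rw [this] at h
        simpa using h
      rw [Λ.map_coord_zero 0 h0, norm_zero]
      positivity
    | succ N ih =>
      intro S hS f hf
      by_cases hne : ∀ i, (S i).Nonempty
      swap
      · push Not at hne
        obtain ⟨i, hi⟩ := hne
        have h0 : f i = 0 := by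
          ext x
          have h := hf i x
          rw [hi] at h
          simpa using h
        rw [Λ.map_coord_zero i h0, norm_zero]
        have : 0 ≤ ∏ i, ((S i).card : ℝ) ^ α i := Finset.prod_nonneg fun i _ => Real.rpow_nonneg (Nat.cast_nonneg _) _
        positivity
      obtain ⟨e, he⟩ := Finite.exists_max (fun e => (S e).card)
      obtain ⟨S', hS'1, hS'2, hgood⟩ := hcore e Λ hΛ S hne he
      obtain ⟨P, hP⟩ : ∃ P : ℝ, P = ∏ i, ((S i).card : ℝ) ^ α i := ⟨_, rfl⟩
      have hP0 : 0 ≤ P := by rw [hP]; exact Finset.prod_nonneg fun i _ => Real.rpow_nonneg (Nat.cast_nonneg _) _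
      obtain ⟨g, hg⟩ : ∃ g : ℤ → ℂ, g = fun x => if x ∈ S' then f e x else 0 := ⟨_, rfl⟩
      obtain ⟨h, hh⟩ : ∃ h : ℤ → ℂ, h = fun x => if x ∈ S' then 0 else f e x := ⟨_, rfl⟩
      have hsplit : Λ f = Λ (Function.update f e g) + Λ (Function.update f e h) := by
        rw [← Λ.map_update_add]
        congr 1
        have : g + h = f e := by
          ext x; rw [hg, hh]; simp only [Pi.add_apply]; split_ifs <;> simp
        rw [this, Function.update_eq_self]
      have hbg : ‖Λ (Function.update f e g)‖ ≤ D0 * P := by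
        refine (hgood (Function.update f e g) ?_ ?_).trans ?_
        · intro i x
          by_cases hi : i = e
          · subst hi
            rw [Function.update_self, hg]
            simp only
            split_ifs with q1 q2 q2
            · have := hf i x; rwa [if_pos q2] at this
            · exact absurd (hS'1 q1) q2
            · simp
            · simp
          · rw [Function.update_of_ne hi]; exact hf i x
        · intro x hx
          rw [Function.update_self, hg]; simp [hx]
        · rw [← hP]
          exact mul_le_mul_of_nonneg_right (hDD e) hP0
      have hbh : ‖Λ (Function.update f e h)‖ ≤ D0 / (1 - r) * (r * P) := by
        have hc : (S e \ S').card + S'.card = (S e).card := Finset.card_sdiff_add_card_eq_card hS'1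
        have hSpos := Finset.card_pos.2 (hne e)
        refine (ih (Function.update S e (S e \ S')) ?_ (Function.update f e h) ?_).trans ?_
        · have : ∑ i, (Function.update S e (S e \ S') i).card < ∑ i, (S i).card := by
            apply Finset.sum_lt_sum
            · intro i _
              by_cases hi : i = e
              · subst hi; rw [Function.update_self]; omega
              · rw [Function.update_of_ne hi]
            · exact ⟨e, Finset.mem_univ _, by rw [Function.update_self]; omega⟩
          omega
        · intro i x
          by_cases hi : i = e
          · subst hi
            rw [Function.update_self, Function.update_self, hh]
            simp only [Finset.mem_sdiff]
            have := hf i x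
            by_cases q1 : x ∈ S'
            · simp [q1]
            · simpa [q1] using this
          · rw [Function.update_of_ne hi, Function.update_of_ne hi]; exact hf i x
        · apply mul_le_mul_of_nonneg_left _ (by positivity)
          have e1 : r * P = ∏ i, ((if i = e then r else 1) * ((S i).card : ℝ) ^ α i) := by
            rw [Finset.prod_mul_distrib, Finset.prod_ite_eq' Finset.univ e (fun _ => r), if_pos (Finset.mem_univ _), hP]
          rw [e1]
          apply Finset.prod_le_prod
          · intro i _; exact Real.rpow_nonneg (Nat.cast_nonneg _) _
          · intro i _
            by_cases hi : i = e
            · subst hi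
              rw [Function.update_self, if_pos rfl]
              have h2 : ((S i \ S').card : ℝ) ≤ 1/2 * (S i).card := by
                have : 2 * (S i \ S').card ≤ (S i).card := by omega
                have : (2:ℝ) * (S i \ S').card ≤ (S i).card := by exact_mod_cast this
                linarith
              calc _ ≤ (1/2 * ((S i).card : ℝ)) ^ α i := Real.rpow_le_rpow (Nat.cast_nonneg _) h2 (hpos i).le
                _ = (1/2 : ℝ) ^ α i * ((S i).card : ℝ) ^ α i := Real.mul_rpow (by norm_num) (Nat.cast_nonneg _)
                _ ≤ _ := mul_le_mul_of_nonneg_right (hr i) (Real.rpow_nonneg (Nat.cast_nonneg _) _)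
            · rw [Function.update_of_ne hi, if_neg hi, one_mul]
      rw [hsplit, ← hP]
      calc _ ≤ D0 * P + D0 / (1 - r) * (r * P) := (norm_add_le _ _).trans (add_le_add hbg hbh)
        _ = D0 / (1 - r) * P := by field_simp; ring
  exact fun S f hf => main _ S le_rfl f hf

/-- coefficient of the output -/
noncomputable def Tz (Λ : TF) (a b : ℤ → ℂ) (z : ℤ) : ℂ := Λ ![a, b, Pi.single z 1]

lemma lin3 (Λ : TF) (a b c : ℤ → ℂ) (V : Finset ℤ) (hc : ∀ x, x ∉ V → c x = 0) :
    Λ ![a, b, c] = ∑ z ∈ V, c z * Tz Λ a b z := by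
  classical
  have h1 : c = ∑ z ∈ V, c z • (Pi.single z (1:ℂ) : ℤ → ℂ) := by
    ext x
    rw [Finset.sum_apply]
    simp only [Pi.smul_apply, Pi.single_apply, smul_eq_mul, mul_ite, mul_one, mul_zero]
    rw [Finset.sum_ite_eq]
    split_ifs with h
    · rfl
    · exact hc x h
  have e : ∀ d : ℤ → ℂ, ![a, b, d] = Function.update ![a, b, 0] 2 d := fun d => by
    ext i x; fin_cases i <;> simp [Function.update]
  unfold Tz
  rw [h1, e, Λ.map_update_sum]
  refine Finset.sum_congr rfl fun z _ => ?_
  rw [Λ.map_update_smul, ← e, smul_eq_mul, ← h1]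

lemma zero3 (Λ : TF) (a b c : ℤ → ℂ) (h : a = 0 ∨ b = 0) : Λ ![a, b, c] = 0 := by
  rcases h with h | h
  · exact Λ.map_coord_zero 0 h
  · exact Λ.map_coord_zero 1 h

lemma weak_type (C : (Fin 3 → ℝ) → Fin 3 → ℝ) (s t : ℝ) (hs : 0 < s) (hs1 : s < 1) (ht : 0 < t) (ht1 : t < 1) (hst : s + t < 3/2) :
    ∃ D : ℝ, 0 < D ∧ ∀ Λ : TF, Gd C Λ → ∀ (S0 S1 E : Finset ℤ) (f0 f1 : ℤ → ℂ) (l : ℝ),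
      (∀ x, ‖f0 x‖ ≤ if x ∈ S0 then 1 else 0) → (∀ x, ‖f1 x‖ ≤ if x ∈ S1 then 1 else 0) → E.Nonempty → 0 ≤ l →
      (∀ z ∈ E, l ≤ ‖Tz Λ f0 f1 z‖) → l * (E.card : ℝ) ^ (s + t) ≤ D * ((S0.card : ℝ) ^ s * (S1.card : ℝ) ^ t) := by
  classical
  obtain ⟨s', hs'0, hs's, hs't⟩ : ∃ s' : ℝ, 0 < s' ∧ s' ≤ s ∧ s' < 1 - t :=
    ⟨min s ((1 - t) / 2), lt_min hs (by linarith), min_le_left _ _, (min_le_right _ _).trans_lt (by linarith)⟩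
  obtain ⟨t', ht'0, ht't, ht's⟩ : ∃ t' : ℝ, 0 < t' ∧ t' ≤ t ∧ t' < 1 - s :=
    ⟨min t ((1 - s) / 2), lt_min ht (by linarith), min_le_left _ _, (min_le_right _ _).trans_lt (by linarith)⟩
  obtain ⟨D1, hD1, H1⟩ := core_dom C ![s, t, 1 - s - t] (by simp) 2 (by
    intro i hi; fin_cases i
    · exact ⟨hs, hs1⟩
    · exact ⟨ht, ht1⟩
    · exact absurd rfl hi) (by simp; linarith)
  obtain ⟨D2, hD2, H2⟩ := restricted C ![s', t, 1 - t - s'] (by simp; ring) (by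
    intro i; fin_cases i
    · exact hs'0
    · exact ht
    · simp; linarith)
  obtain ⟨D3, hD3, H3⟩ := restricted C ![s, t', 1 - s - t'] (by simp) (by
    intro i; fin_cases i
    · exact hs
    · exact ht'0
    · simp; linarith)
  refine ⟨2 * (D1 + D2 + D3), by positivity, fun Λ hΛ S0 S1 E f0 f1 l hf0 hf1 hE hl hlE => ?_⟩
  by_cases hS0 : S0.Nonempty
  swap
  · obtain ⟨z, hz⟩ := hE
    have : f0 = 0 := by
      ext x
      have h := hf0 x
      rw [Finset.not_nonempty_iff_eq_empty.1 hS0] at h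
      simpa using h
    have h := hlE z hz
    rw [Tz, zero3 Λ _ _ _ (Or.inl this), norm_zero] at h
    rw [le_antisymm h hl, zero_mul]
    positivity
  by_cases hS1 : S1.Nonempty
  swap
  · obtain ⟨z, hz⟩ := hE
    have : f1 = 0 := by
      ext x
      have h := hf1 x
      rw [Finset.not_nonempty_iff_eq_empty.1 hS1] at h
      simpa using h
    have h := hlE z hz
    rw [Tz, zero3 Λ _ _ _ (Or.inr this), norm_zero] at h
    rw [le_antisymm h hl, zero_mul]
    positivity
  obtain ⟨n0, hn0⟩ : ∃ n0 : ℝ, n0 = S0.card := ⟨_, rfl⟩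
  obtain ⟨n1, hn1⟩ : ∃ n1 : ℝ, n1 = S1.card := ⟨_, rfl⟩
  obtain ⟨n2, hn2⟩ : ∃ n2 : ℝ, n2 = E.card := ⟨_, rfl⟩
  have h0 : 0 < n0 := by rw [hn0]; exact_mod_cast Finset.card_pos.2 hS0
  have h1 : 0 < n1 := by rw [hn1]; exact_mod_cast Finset.card_pos.2 hS1
  have h2 : 0 < n2 := by rw [hn2]; exact_mod_cast Finset.card_pos.2 hE
  have hf3 : ∀ (c : ℤ → ℂ), (∀ x, ‖c x‖ ≤ if x ∈ E then 1 else 0) → ∀ i x, ‖![f0, f1, c] i x‖ ≤ if x ∈ ![S0, S1, E] i then 1 else 0 := by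
    intro c hc i
    fin_cases i
    · exact hf0
    · exact hf1
    · exact hc
  have key : ∃ S' ⊆ E, E.card ≤ 2 * S'.card ∧ ∀ c : ℤ → ℂ, (∀ x, ‖c x‖ ≤ if x ∈ E then 1 else 0) → (∀ x, x ∉ S' → c x = 0) →
      ‖Λ ![f0, f1, c]‖ ≤ (D1 + D2 + D3) * (n0 ^ s * n1 ^ t * n2 ^ (1 - s - t)) := by
    by_cases c0 : n2 < n0
    · refine ⟨E, Finset.Subset.refl _, by omega, fun c hc _ => ?_⟩
      have := H2 Λ hΛ ![S0, S1, E] _ (hf3 c hc)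
      rw [Fin.prod_univ_three] at this
      simp only [Matrix.cons_val] at this
      rw [← hn0, ← hn1, ← hn2] at this
      refine this.trans ?_
      calc _ ≤ D2 * (n0 ^ s * n1 ^ t * n2 ^ (1 - s - t)) := by
            apply mul_le_mul_of_nonneg_left _ hD2.le
            have e1 : n0 ^ s = n0 ^ s' * n0 ^ (s - s') := by rw [← Real.rpow_add h0]; congr 1; ring
            have e2 : n2 ^ (1 - t - s') = n2 ^ (s - s') * n2 ^ (1 - s - t) := by rw [← Real.rpow_add h2]; congr 1; ring
            have e3 : n2 ^ (s - s') ≤ n0 ^ (s - s') := Real.rpow_le_rpow h2.le c0.le (by linarith)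
            rw [e1, e2]
            calc _ = n0 ^ s' * n1 ^ t * n2 ^ (1 - s - t) * n2 ^ (s - s') := by ring
              _ ≤ n0 ^ s' * n1 ^ t * n2 ^ (1 - s - t) * n0 ^ (s - s') := by gcongr
              _ = _ := by ring
        _ ≤ _ := by gcongr; linarith
    by_cases c1 : n2 < n1
    · refine ⟨E, Finset.Subset.refl _, by omega, fun c hc _ => ?_⟩
      have := H3 Λ hΛ ![S0, S1, E] _ (hf3 c hc)
      rw [Fin.prod_univ_three] at this
      simp only [Matrix.cons_val] at this
      rw [← hn0, ← hn1, ← hn2] at this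
      refine this.trans ?_
      calc _ ≤ D3 * (n0 ^ s * n1 ^ t * n2 ^ (1 - s - t)) := by
            apply mul_le_mul_of_nonneg_left _ hD3.le
            have e1 : n1 ^ t = n1 ^ t' * n1 ^ (t - t') := by rw [← Real.rpow_add h1]; congr 1; ring
            have e2 : n2 ^ (1 - s - t') = n2 ^ (t - t') * n2 ^ (1 - s - t) := by rw [← Real.rpow_add h2]; congr 1; ring
            have e3 : n2 ^ (t - t') ≤ n1 ^ (t - t') := Real.rpow_le_rpow h2.le c1.le (by linarith)
            rw [e1, e2]
            calc _ = n0 ^ s * n1 ^ t' * n2 ^ (1 - s - t) * n2 ^ (t - t') := by ring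
              _ ≤ n0 ^ s * n1 ^ t' * n2 ^ (1 - s - t) * n1 ^ (t - t') := by gcongr
              _ = _ := by ring
        _ ≤ _ := by gcongr; linarith
    push Not at c0 c1
    obtain ⟨S', a1, a2, a3⟩ := H1 Λ hΛ ![S0, S1, E] (by intro i; fin_cases i; exacts [hS0, hS1, hE]) (by
      rw [hn0, hn2] at c0
      rw [hn1, hn2] at c1
      intro i; fin_cases i
      · exact_mod_cast c0
      · exact_mod_cast c1
      · exact le_rfl)
    refine ⟨S', a1, a2, fun c hc hc2 => ?_⟩
    have := a3 _ (hf3 c hc) hc2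
    rw [Fin.prod_univ_three] at this
    simp only [Matrix.cons_val] at this
    rw [← hn0, ← hn1, ← hn2] at this
    refine this.trans ?_
    gcongr
    linarith
  obtain ⟨S', hS'E, hS'c, hb⟩ := key
  obtain ⟨c, hc⟩ : ∃ c : ℤ → ℂ, c = fun z => if z ∈ S' then (starRingEnd ℂ (Tz Λ f0 f1 z)) / ‖Tz Λ f0 f1 z‖ else 0 := ⟨_, rfl⟩
  have hcS : ∀ x, x ∉ S' → c x = 0 := fun x hx => by rw [hc]; simp [hx]
  have hc1 : ∀ x, ‖c x‖ ≤ if x ∈ E then 1 else 0 := by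
    intro x
    by_cases hx : x ∈ S'
    · rw [if_pos (hS'E hx), hc]
      simp only [if_pos hx, norm_div, RCLike.norm_conj, Complex.norm_real, norm_norm]
      exact div_self_le_one _
    · rw [hcS x hx, norm_zero]; split_ifs <;> norm_num
  have hb2 := hb c hc1 hcS
  rw [lin3 Λ f0 f1 c S' hcS] at hb2
  have e1 : ∑ z ∈ S', c z * Tz Λ f0 f1 z = ((∑ z ∈ S', ‖Tz Λ f0 f1 z‖ : ℝ) : ℂ) := by
    push_cast
    refine Finset.sum_congr rfl fun z hz => ?_
    rw [hc]
    simp only [if_pos hz]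
    rw [div_mul_eq_mul_div, mul_comm, Complex.mul_conj']
    by_cases h0 : (‖Tz Λ f0 f1 z‖ : ℂ) = 0
    · rw [h0]; simp
    · field_simp
  rw [e1, Complex.norm_real, Real.norm_of_nonneg (by positivity)] at hb2
  have e2 : l * n2 / 2 ≤ ∑ z ∈ S', ‖Tz Λ f0 f1 z‖ := by
    have h3 : ∑ z ∈ S', l ≤ ∑ z ∈ S', ‖Tz Λ f0 f1 z‖ := Finset.sum_le_sum fun z hz => hlE z (hS'E hz)
    rw [Finset.sum_const, nsmul_eq_mul] at h3
    have h4 : n2 ≤ 2 * S'.card := by rw [hn2]; exact_mod_cast hS'c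
    nlinarith
  have e3 := e2.trans hb2
  have e4 : n2 ^ (s + t) = n2 * n2 ^ (s + t - 1) := by
    nth_rewrite 2 [← Real.rpow_one n2]
    rw [← Real.rpow_add h2]; congr 1; ring
  have e5 : n2 ^ (1 - s - t) * n2 ^ (s + t - 1) = 1 := by
    rw [← Real.rpow_add h2, ← Real.rpow_zero n2]; congr 1; ring
  rw [← hn0, ← hn1, ← hn2, e4]
  have h6 : 0 < n2 ^ (s + t - 1) := Real.rpow_pos_of_pos h2 _
  calc l * (n2 * n2 ^ (s + t - 1)) = 2 * (l * n2 / 2 * n2 ^ (s + t - 1)) := by ring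
    _ ≤ 2 * (((D1 + D2 + D3) * (n0 ^ s * n1 ^ t * n2 ^ (1 - s - t))) * n2 ^ (s + t - 1)) := by gcongr
    _ = 2 * ((D1 + D2 + D3) * (n0 ^ s * n1 ^ t)) * (n2 ^ (1 - s - t) * n2 ^ (s + t - 1)) := by ring
    _ = _ := by rw [e5]; ring
end BHT

namespace BHT

lemma geo (c b : ℝ) (hc : 0 < c) (hb : 0 < b) : ∃ C : ℝ, 0 < C ∧ ∀ (y : ℝ) (M : Finset ℤ),
    ∑ m ∈ M, Real.exp (-(c * |m * b - y|)) ≤ C := by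
  obtain ⟨C, hC, h⟩ := Zbasic
  have hcb : 0 < c * b := by positivity
  obtain ⟨K, hK⟩ : ∃ K : ℝ, K = 2 + 4 / (c * b) ^ 2 := ⟨_, rfl⟩
  have hK0 : 0 < K := by rw [hK]; positivity
  refine ⟨K * C, by positivity, fun y M => ?_⟩
  calc ∑ m ∈ M, Real.exp (-(c * |m * b - y|)) ≤ ∑ m ∈ M, K * ((1 + |(m:ℝ) - y / b|) ^ 2)⁻¹ := by
        refine Finset.sum_le_sum fun m _ => ?_
        have e1 : c * |m * b - y| = (c * b) * |(m:ℝ) - y / b| := by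
          rw [show (m:ℝ) * b - y = ((m:ℝ) - y / b) * b by field_simp, abs_mul, abs_of_pos hb]; ring
        rw [e1, Real.exp_neg]
        set u := |(m:ℝ) - y / b| with hu
        have hu0 : 0 ≤ u := abs_nonneg _
        have h1 := Real.quadratic_le_exp_of_nonneg (mul_nonneg hcb.le hu0)
        have h2 : (1 + u) ^ 2 ≤ K * Real.exp (c * b * u) := by
          calc (1 + u) ^ 2 ≤ 2 + 2 * u ^ 2 := by nlinarith [sq_nonneg (1 - u)]
            _ = 2 + (4 / (c * b) ^ 2) * ((c * b * u) ^ 2 / 2) := by field_simp; ring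
            _ ≤ K * (1 + c * b * u + (c * b * u) ^ 2 / 2) := by
                have q1 : 0 ≤ 4 / (c * b) ^ 2 := by positivity
                have q2 : 0 ≤ (c * b * u) ^ 2 / 2 := by positivity
                have q3 : 0 ≤ c * b * u := by positivity
                rw [hK]; nlinarith [mul_nonneg q1 q3]
            _ ≤ _ := by gcongr
        rw [inv_le_iff_one_le_mul₀ (Real.exp_pos _)]
        rw [mul_assoc, mul_comm _ (Real.exp _), ← mul_assoc, ← div_eq_mul_inv, le_div_iff₀ (by positivity)]
        linarith
    _ = K * ∑ m ∈ M, ((1 + |(m:ℝ) - y / b|) ^ 2)⁻¹ := by rw [Finset.mul_sum]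
    _ ≤ _ := by gcongr; exact h M _

lemma lev (f : ℤ → ℂ) (V : Finset ℤ) (hf : ∀ x, x ∉ V → f x = 0) :
    ∃ (M : Finset ℤ) (E : ℤ → Finset ℤ) (h : ℤ → ℤ → ℂ), (∀ m x, ‖h m x‖ ≤ if x ∈ E m then 1 else 0) ∧
      (f = ∑ m ∈ M, (((2:ℝ) ^ ((m:ℝ) + 1) : ℝ) : ℂ) • h m) ∧
      (∀ p : ℝ, 0 < p → ∑ m ∈ M, ((2:ℝ) ^ (m:ℝ)) ^ p * ((E m).card : ℝ) ≤ ∑ x ∈ V, ‖f x‖ ^ p) ∧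
      (∀ p : ℝ, 0 < p → ∑ x ∈ V, ‖f x‖ ^ p ≤ ∑ m ∈ M, ((2:ℝ) ^ ((m:ℝ) + 1)) ^ p * ((E m).card : ℝ)) ∧
      (∀ m x, x ∈ E m → x ∈ V ∧ (2:ℝ) ^ (m:ℝ) ≤ ‖f x‖) := by
  classical
  obtain ⟨E, hE⟩ : ∃ E : ℤ → Finset ℤ, E = fun m => V.filter (fun x => f x ≠ 0 ∧ Int.log 2 ‖f x‖ = m) := ⟨_, rfl⟩
  obtain ⟨M, hM⟩ : ∃ M : Finset ℤ, M = V.image (fun x => Int.log 2 ‖f x‖) := ⟨_, rfl⟩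
  have hmem : ∀ m x, x ∈ E m ↔ x ∈ V ∧ f x ≠ 0 ∧ Int.log 2 ‖f x‖ = m := fun m x => by rw [hE]; simp
  have hlo : ∀ m x, x ∈ E m → (2:ℝ) ^ (m:ℝ) ≤ ‖f x‖ := by
    intro m x hx
    rw [hmem] at hx
    rw [Real.rpow_intCast, ← hx.2.2]
    exact_mod_cast Int.zpow_log_le_self (b := 2) (by norm_num) (norm_pos_iff.2 hx.2.1)
  have hup : ∀ m x, x ∈ E m → ‖f x‖ ≤ (2:ℝ) ^ ((m:ℝ) + 1) := by
    intro m x hx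
    rw [hmem] at hx
    have := Int.lt_zpow_succ_log_self (b := 2) (by norm_num) ‖f x‖
    rw [hx.2.2] at this
    rw [show (m:ℝ) + 1 = ((m + 1 : ℤ) : ℝ) by push_cast; ring, Real.rpow_intCast]
    exact_mod_cast this.le
  have hsum : ∀ p : ℝ, 0 < p → ∑ x ∈ V, ‖f x‖ ^ p = ∑ m ∈ M, ∑ x ∈ E m, ‖f x‖ ^ p := by
    intro p hp
    rw [← Finset.sum_fiberwise_of_maps_to (s := V) (t := M) (g := fun x => Int.log 2 ‖f x‖) (fun x hx => by rw [hM]; exact Finset.mem_image_of_mem _ hx)]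
    refine Finset.sum_congr rfl fun m _ => ?_
    symm
    apply Finset.sum_subset
    · intro x hx
      rw [hmem] at hx
      exact Finset.mem_filter.2 ⟨hx.1, hx.2.2⟩
    · intro x hx hx2
      rw [Finset.mem_filter] at hx
      rw [hmem] at hx2
      have : f x = 0 := by by_contra h; exact hx2 ⟨hx.1, h, hx.2⟩
      rw [this, norm_zero, Real.zero_rpow hp.ne']
  refine ⟨M, E, fun m x => if x ∈ E m then f x / (((2:ℝ) ^ ((m:ℝ) + 1) : ℝ) : ℂ) else 0, ?_, ?_, ?_, ?_, fun m x hx => ⟨((hmem m x).1 hx).1, hlo m x hx⟩⟩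
  · intro m x
    beta_reduce
    split_ifs with hx
    · rw [norm_div, Complex.norm_real, Real.norm_of_nonneg (by positivity)]
      exact div_le_one_of_le₀ (hup m x hx) (by positivity)
    · simp
  · ext x
    rw [Finset.sum_apply]
    simp only [Pi.smul_apply, smul_eq_mul]
    by_cases hx : f x = 0
    · rw [hx, Finset.sum_eq_zero]
      intro m _
      rw [if_neg (by rw [hmem]; tauto), mul_zero]
    · have hxV : x ∈ V := by by_contra h; exact hx (hf x h)
      rw [Finset.sum_eq_single (Int.log 2 ‖f x‖)]
      · rw [if_pos ((hmem _ _).2 ⟨hxV, hx, rfl⟩), mul_div_cancel₀]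
        have : (0:ℝ) < (2:ℝ) ^ (((Int.log 2 ‖f x‖ : ℤ) : ℝ) + 1) := by positivity
        exact_mod_cast this.ne'
      · intro m _ hm
        rw [if_neg (by rw [hmem]; intro h; exact hm h.2.2.symm), mul_zero]
      · intro h
        exact absurd (by rw [hM]; exact Finset.mem_image_of_mem _ hxV) h
  · intro p hp
    rw [hsum p hp]
    refine Finset.sum_le_sum fun m _ => ?_
    rw [mul_comm, ← nsmul_eq_mul]
    exact Finset.card_nsmul_le_sum _ _ _ fun x hx => Real.rpow_le_rpow (by positivity) (hlo m x hx) hp.le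
  · intro p hp
    rw [hsum p hp]
    refine Finset.sum_le_sum fun m _ => ?_
    rw [mul_comm, ← nsmul_eq_mul]
    exact Finset.sum_le_card_nsmul _ _ _ fun x hx => Real.rpow_le_rpow (by positivity) (hup m x hx) hp.le

lemma two_bounds {q ε : ℝ} (hq : 0 < q) (hε : 0 < ε) {u w n a : ℝ} (h1 : u + (1 / q + ε) * w ≤ a + ε * n)
    (h2 : u + (1 / q - ε) * w ≤ a - ε * n) : q * u + w ≤ q * a - q / (1 + 1 / (q * ε)) * |u - (a - 1 / q * n)| := by
  obtain ⟨x, hx⟩ : ∃ x, x = u + 1 / q * w - a := ⟨_, rfl⟩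
  have e1 : ε * |w - n| ≤ -x := by
    have : |ε * (w - n)| ≤ -x := abs_le.2 ⟨by rw [hx]; linarith, by rw [hx]; linarith⟩
    rwa [abs_mul, abs_of_pos hε] at this
  have hx0 : 0 ≤ -x := le_trans (by positivity) e1
  have e2 : u - (a - 1 / q * n) = x - 1 / q * (w - n) := by rw [hx]; ring
  have e3 : |u - (a - 1 / q * n)| ≤ -x * (1 + 1 / (q * ε)) := by
    rw [e2]
    calc _ ≤ |x| + |1 / q * (w - n)| := abs_sub _ _
      _ = -x + 1 / q * |w - n| := by
          rw [abs_mul, abs_of_pos (by positivity : 0 < 1 / q), ← abs_neg, abs_of_nonneg hx0]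
      _ ≤ -x + 1 / q * (-x / ε) := by
          gcongr
          rw [le_div_iff₀ hε]; linarith
      _ = _ := by field_simp; ring
  have e4 : q / (1 + 1 / (q * ε)) * |u - (a - 1 / q * n)| ≤ q * -x := by
    rw [div_mul_eq_mul_div, div_le_iff₀ (by positivity)]
    calc _ ≤ q * (-x * (1 + 1 / (q * ε))) := by gcongr
      _ = _ := by ring
  have e5 : q * x = q * u + w - q * a := by rw [hx]; field_simp
  linarith

lemma restricted_strong (C : (Fin 3 → ℝ) → Fin 3 → ℝ) (s t q : ℝ) (hs : 0 < s) (hs1 : s < 1) (ht : 0 < t) (ht1 : t < 1) (hst : s + t < 3/2)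
    (hq : s + t = 1 / q) :
    ∃ D : ℝ, 0 < D ∧ ∀ Λ : TF, Gd C Λ → ∀ (S0 S1 V : Finset ℤ) (f0 f1 : ℤ → ℂ),
      (∀ x, ‖f0 x‖ ≤ if x ∈ S0 then 1 else 0) → (∀ x, ‖f1 x‖ ≤ if x ∈ S1 then 1 else 0) →
      ∑ z ∈ V, ‖Tz Λ f0 f1 z‖ ^ q ≤ D * ((S0.card : ℝ) ^ s * (S1.card : ℝ) ^ t) ^ q := by
  classical
  have hq0 : 0 < q := by
    by_contra h
    have : 1 / q ≤ 0 := one_div_nonpos.2 (not_lt.1 h)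
    linarith
  obtain ⟨ε, hε, e1, e2, e3⟩ : ∃ ε : ℝ, 0 < ε ∧ ε < s ∧ s + ε < 1 ∧ s + ε + t < 3/2 := by
    refine ⟨min (s/2) (min ((1 - s)/2) ((3/2 - s - t)/2)), ?_, ?_, ?_, ?_⟩
    · exact lt_min (by linarith) (lt_min (by linarith) (by linarith))
    · exact (min_le_left _ _).trans_lt (by linarith)
    · have := (min_le_right (s/2) (min ((1 - s)/2) ((3/2 - s - t)/2))).trans (min_le_left _ _); linarith
    · have := (min_le_right (s/2) (min ((1 - s)/2) ((3/2 - s - t)/2))).trans (min_le_right _ _); linarith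
  obtain ⟨D1, hD1, H1⟩ := weak_type C (s + ε) t (by linarith) e2 ht ht1 e3
  obtain ⟨D2, hD2, H2⟩ := weak_type C (s - ε) t (by linarith) (by linarith) ht ht1 (by linarith)
  obtain ⟨CG, hCG, hgeo⟩ := geo (q / (1 + 1 / (q * ε))) (Real.log 2) (by positivity) (Real.log_pos (by norm_num))
  obtain ⟨D, hD⟩ : ∃ D : ℝ, D = D1 + D2 := ⟨_, rfl⟩
  have hD0 : 0 < D := by rw [hD]; positivity
  refine ⟨2 ^ q * (D ^ q * CG), by positivity, fun Λ hΛ S0 S1 V f0 f1 hf0 hf1 => ?_⟩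
  by_cases hzero : f0 = 0 ∨ f1 = 0
  · rw [Finset.sum_eq_zero]
    · positivity
    · intro z _
      rw [Tz, zero3 Λ _ _ _ hzero, norm_zero, Real.zero_rpow hq0.ne']
  push Not at hzero
  have hn : ∀ (f : ℤ → ℂ) (S : Finset ℤ), f ≠ 0 → (∀ x, ‖f x‖ ≤ if x ∈ S then 1 else 0) → (0:ℝ) < S.card := by
    intro f S hne hb
    rw [Nat.cast_pos, Finset.card_pos, Finset.nonempty_iff_ne_empty]
    rintro rfl
    apply hne
    ext x
    simpa using hb x
  obtain ⟨n0, hn0⟩ : ∃ n0 : ℝ, n0 = S0.card := ⟨_, rfl⟩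
  obtain ⟨n1, hn1⟩ : ∃ n1 : ℝ, n1 = S1.card := ⟨_, rfl⟩
  have h0 : 0 < n0 := by rw [hn0]; exact hn f0 S0 hzero.1 hf0
  have h1 : 0 < n1 := by rw [hn1]; exact hn f1 S1 hzero.2 hf1
  obtain ⟨g, hg⟩ : ∃ g : ℤ → ℂ, g = fun z => if z ∈ V then Tz Λ f0 f1 z else 0 := ⟨_, rfl⟩
  obtain ⟨M, E, -, -, -, -, hup, hlo⟩ := lev g V (fun x hx => by rw [hg]; simp [hx])
  obtain ⟨A, hA⟩ : ∃ A : ℝ, A = D * (n0 ^ s * n1 ^ t) := ⟨_, rfl⟩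
  have hA0 : 0 < A := by rw [hA]; positivity
  have hlA : ∀ D' : ℝ, 0 < D' → D' ≤ D → ∀ s', Real.log (D' * (n0 ^ s' * n1 ^ t)) ≤ Real.log A + (s' - s) * Real.log n0 := by
    intro D' hD' hDD s'
    have : Real.log A = Real.log D + (s * Real.log n0 + t * Real.log n1) := by
      rw [hA, Real.log_mul (by positivity) (by positivity), Real.log_mul (by positivity) (by positivity), Real.log_rpow h0, Real.log_rpow h1]
    rw [this, Real.log_mul (by positivity) (by positivity), Real.log_mul (by positivity) (by positivity), Real.log_rpow h0, Real.log_rpow h1]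
    have := Real.log_le_log hD' hDD
    linarith
  have key : ∀ m ∈ M, ((2:ℝ) ^ ((m:ℝ) + 1)) ^ q * ((E m).card : ℝ) ≤
      2 ^ q * (A ^ q * Real.exp (-(q / (1 + 1 / (q * ε)) * |m * Real.log 2 - (Real.log A - 1 / q * Real.log n0)|))) := by
    intro m _
    by_cases hEm : (E m).Nonempty
    swap
    · rw [Finset.not_nonempty_iff_eq_empty.1 hEm]; simp; positivity
    have he : (0:ℝ) < (E m).card := by exact_mod_cast Finset.card_pos.2 hEm
    have hl : ∀ z ∈ E m, (2:ℝ) ^ (m:ℝ) ≤ ‖Tz Λ f0 f1 z‖ := by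
      intro z hz
      have := hlo m z hz
      rw [hg] at this
      simpa [this.1] using this.2
    have w1 := H1 Λ hΛ S0 S1 (E m) f0 f1 _ hf0 hf1 hEm (by positivity) hl
    have w2 := H2 Λ hΛ S0 S1 (E m) f0 f1 _ hf0 hf1 hEm (by positivity) hl
    rw [← hn0, ← hn1] at w1 w2
    have l1 := (Real.log_le_log (by positivity) w1).trans (hlA D1 hD1 (by linarith) _)
    have l2 := (Real.log_le_log (by positivity) w2).trans (hlA D2 hD2 (by linarith) _)
    rw [Real.log_mul (by positivity) (by positivity), Real.log_rpow (by norm_num), Real.log_rpow he] at l1 l2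
    have tb := two_bounds hq0 hε (u := m * Real.log 2) (w := Real.log (E m).card) (n := Real.log n0) (a := Real.log A)
      (by rw [← hq]; linarith) (by rw [← hq]; linarith)
    have e4 : ((2:ℝ) ^ ((m:ℝ) + 1)) ^ q = 2 ^ q * Real.exp (q * (m * Real.log 2)) := by
      rw [Real.rpow_add (by norm_num), Real.rpow_one, Real.mul_rpow (by positivity) (by norm_num), ← Real.rpow_mul (by norm_num),
        Real.rpow_def_of_pos (by norm_num : (0:ℝ) < 2) ((m:ℝ) * q)]
      rw [mul_comm]; congr 2; ring
    have e5 : A ^ q = Real.exp (q * Real.log A) := by rw [Real.rpow_def_of_pos hA0, mul_comm]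
    rw [e4, e5, ← Real.exp_add, mul_assoc]
    apply mul_le_mul_of_nonneg_left _ (by positivity)
    nth_rewrite 1 [← Real.exp_log he]
    rw [← Real.exp_add]
    apply Real.exp_le_exp.2
    linarith
  calc ∑ z ∈ V, ‖Tz Λ f0 f1 z‖ ^ q = ∑ z ∈ V, ‖g z‖ ^ q := by
        refine Finset.sum_congr rfl fun z hz => ?_
        rw [hg]; simp [hz]
    _ ≤ _ := hup q hq0
    _ ≤ _ := Finset.sum_le_sum key
    _ = 2 ^ q * (A ^ q * ∑ m ∈ M, Real.exp (-(q / (1 + 1 / (q * ε)) * |m * Real.log 2 - (Real.log A - 1 / q * Real.log n0)|))) := by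
        rw [Finset.mul_sum, Finset.mul_sum]
    _ ≤ 2 ^ q * (A ^ q * CG) := by gcongr; exact hgeo _ M
    _ = _ := by
        rw [← hn0, ← hn1, hA, Real.mul_rpow hD0.le (by positivity)]; ring
end BHT

namespace BHT

lemma lin_01 (Λ : TF) {M N : Finset ℤ} (c d : ℤ → ℂ) (h k : ℤ → ℤ → ℂ) (g : ℤ → ℂ) :
    Λ ![∑ m ∈ M, c m • h m, ∑ n ∈ N, d n • k n, g] = ∑ m ∈ M, ∑ n ∈ N, c m * (d n * Λ ![h m, k n, g]) := by
  classical
  have e0 : ∀ a b : ℤ → ℂ, ![a, b, g] = Function.update ![0, b, g] 0 a := fun a b => by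
    ext i x; fin_cases i <;> simp [Function.update]
  have e1 : ∀ a b : ℤ → ℂ, ![a, b, g] = Function.update ![a, 0, g] 1 b := fun a b => by
    ext i x; fin_cases i <;> simp [Function.update]
  rw [e0, Λ.map_update_sum]
  refine Finset.sum_congr rfl fun m _ => ?_
  rw [Λ.map_update_smul, ← e0, e1, Λ.map_update_sum, smul_eq_mul, Finset.mul_sum]
  refine Finset.sum_congr rfl fun n _ => ?_
  rw [Λ.map_update_smul, ← e1, smul_eq_mul]

lemma norm_sum_rpow_le {ι : Type*} (s : Finset ι) (f : ι → ℂ) {q : ℝ} (hq : 0 < q) (hq1 : q ≤ 1) :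
    ‖∑ i ∈ s, f i‖ ^ q ≤ ∑ i ∈ s, ‖f i‖ ^ q := by
  classical
  induction s using Finset.induction_on with
  | empty => simp [Real.zero_rpow hq.ne']
  | insert i s hi ih =>
    rw [Finset.sum_insert hi, Finset.sum_insert hi]
    calc ‖f i + ∑ j ∈ s, f j‖ ^ q ≤ (‖f i‖ + ‖∑ j ∈ s, f j‖) ^ q := Real.rpow_le_rpow (norm_nonneg _) (norm_add_le _ _) hq.le
      _ ≤ ‖f i‖ ^ q + ‖∑ j ∈ s, f j‖ ^ q := by
          have := NNReal.rpow_add_le_add_rpow ‖f i‖₊ ‖∑ j ∈ s, f j‖₊ hq.le hq1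
          exact_mod_cast this
      _ ≤ _ := by gcongr

lemma lvl {s s' : ℝ} (hs : 0 < s) (m : ℝ) {n : ℝ} (hn : 0 ≤ n) :
    (2:ℝ) ^ m * n ^ s' = (((2:ℝ) ^ m) ^ (1 / s) * n) ^ s' * Real.exp (-(Real.log 2 * ((s' - s) * (m / s)))) := by
  rw [Real.mul_rpow (by positivity) hn, ← Real.rpow_mul (by positivity), ← Real.rpow_mul (by norm_num),
    Real.rpow_def_of_pos (by norm_num : (0:ℝ) < 2) m, Real.rpow_def_of_pos (by norm_num : (0:ℝ) < 2) (m * (1 / s * s'))]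
  rw [mul_right_comm, ← Real.exp_add]
  congr 2
  field_simp
  ring

lemma exp_abs_le {T X c d : ℝ} (h1 : T ≤ X * Real.exp (-(c * d))) (h2 : T ≤ X * Real.exp (-(c * -d))) :
    T ≤ X * Real.exp (-(c * |d|)) := by
  rcases abs_choice d with h | h <;> rw [h] <;> assumption

lemma strong1 (C : (Fin 3 → ℝ) → Fin 3 → ℝ) (s t q : ℝ) (hs : 0 < s) (hs1 : s < 1) (ht : 0 < t) (ht1 : t < 1) (hst : s + t < 3/2)
    (hq : s + t = 1 / q) (hq1 : q ≤ 1) :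
    ∃ D : ℝ, 0 < D ∧ ∀ Λ : TF, Gd C Λ → ∀ (V V' : Finset ℤ) (a b : ℤ → ℂ),
      (∀ x, x ∉ V → a x = 0) → (∀ x, x ∉ V → b x = 0) →
      ∑ x ∈ V, ‖a x‖ ^ (1 / s) ≤ 1 → ∑ x ∈ V, ‖b x‖ ^ (1 / t) ≤ 1 →
      ∑ z ∈ V', ‖Tz Λ a b z‖ ^ q ≤ D := by
  classical
  have hq0 : 0 < q := by
    by_contra h
    have : 1 / q ≤ 0 := one_div_nonpos.2 (not_lt.1 h)
    linarith
  obtain ⟨ε, hε, e1, e2, e3, e4⟩ : ∃ ε : ℝ, 0 < ε ∧ ε < s ∧ s + ε < 1 ∧ ε < t ∧ t + ε < 1 := by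
    refine ⟨min (min (s/2) ((1 - s)/2)) (min (t / 2) ((1 - t)/2)), ?_, ?_, ?_, ?_, ?_⟩
    · exact lt_min (lt_min (by linarith) (by linarith)) (lt_min (by linarith) (by linarith))
    · exact ((min_le_left _ _).trans (min_le_left _ _)).trans_lt (by linarith)
    · have := (min_le_left (min (s/2) ((1 - s)/2)) (min (t / 2) ((1 - t)/2))).trans (min_le_right _ _); linarith
    · exact ((min_le_right _ _).trans (min_le_left _ _)).trans_lt (by linarith)
    · have := (min_le_right (min (s/2) ((1 - s)/2)) (min (t / 2) ((1 - t)/2))).trans (min_le_right _ _); linarith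
  obtain ⟨D1, hD1, H1⟩ := restricted_strong C (s + ε) (t - ε) q (by linarith) e2 (by linarith) (by linarith) (by linarith) (by linarith)
  obtain ⟨D2, hD2, H2⟩ := restricted_strong C (s - ε) (t + ε) q (by linarith) (by linarith) (by linarith) e4 (by linarith) (by linarith)
  obtain ⟨c, hc⟩ : ∃ c : ℝ, c = q * (Real.log 2 * ε) := ⟨_, rfl⟩
  have hc0 : 0 < c := by have := Real.log_pos (by norm_num : (1:ℝ) < 2); rw [hc]; positivity
  obtain ⟨G1, hG1, hgeo1⟩ := geo c (1 / s) hc0 (by positivity)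
  obtain ⟨G2, hG2, hgeo2⟩ := geo c (1 / t) hc0 (by positivity)
  obtain ⟨D, hD⟩ : ∃ D : ℝ, D = D1 + D2 := ⟨_, rfl⟩
  have hD0 : 0 < D := by rw [hD]; positivity
  refine ⟨4 ^ q * D * (G2 + G1), by positivity, fun Λ hΛ V V' a b ha hb ha1 hb1 => ?_⟩
  obtain ⟨M, E, h, hh, ham, hMs, -, -⟩ := lev a V ha
  obtain ⟨N, F, k, hk, hbm, hNs, -, -⟩ := lev b V hb
  obtain ⟨x, hx⟩ : ∃ x : ℤ → ℝ, x = fun m : ℤ => ((2:ℝ) ^ (m:ℝ)) ^ (1 / s) * ((E m).card : ℝ) := ⟨_, rfl⟩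
  obtain ⟨y, hy⟩ : ∃ y : ℤ → ℝ, y = fun m : ℤ => ((2:ℝ) ^ (m:ℝ)) ^ (1 / t) * ((F m).card : ℝ) := ⟨_, rfl⟩
  have hx0 : ∀ m, 0 ≤ x m := fun m => by rw [hx]; positivity
  have hy0 : ∀ m, 0 ≤ y m := fun m => by rw [hy]; positivity
  have hxs : ∑ m ∈ M, x m ≤ 1 := by rw [hx]; exact (hMs _ (by positivity)).trans ha1
  have hys : ∑ m ∈ N, y m ≤ 1 := by rw [hy]; exact (hNs _ (by positivity)).trans hb1
  have one : ∀ m n : ℤ, ∀ δ : ℝ, 0 < s + δ → 0 < t - δ → 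
      ((2:ℝ) ^ (m:ℝ) * 2 ^ (n:ℝ)) ^ q * (((E m).card : ℝ) ^ (s + δ) * ((F n).card : ℝ) ^ (t - δ)) ^ q ≤
        (x m + y n) * Real.exp (-(q * (Real.log 2 * δ) * (m * (1 / s) - n * (1 / t)))) := by
    intro m n δ h1 h2
    have l1 := lvl (s' := s + δ) hs m (Nat.cast_nonneg (E m).card)
    have l2 := lvl (s' := t - δ) ht n (Nat.cast_nonneg (F n).card)
    have l3 : ((2:ℝ) ^ (m:ℝ) * 2 ^ (n:ℝ)) * (((E m).card : ℝ) ^ (s + δ) * ((F n).card : ℝ) ^ (t - δ)) =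
        (x m ^ (s + δ) * y n ^ (t - δ)) * Real.exp (-((Real.log 2 * δ) * (m * (1 / s) - n * (1 / t)))) := by
      rw [mul_mul_mul_comm, l1, l2, hx, hy, mul_mul_mul_comm, ← Real.exp_add]
      congr 2
      ring
    rw [← Real.mul_rpow (by positivity) (by positivity), l3, Real.mul_rpow (mul_nonneg (Real.rpow_nonneg (hx0 _) _) (Real.rpow_nonneg (hy0 _) _)) (by positivity),
      ← Real.exp_mul, Real.mul_rpow (Real.rpow_nonneg (hx0 _) _) (Real.rpow_nonneg (hy0 _) _), ← Real.rpow_mul (hx0 _), ← Real.rpow_mul (hy0 _)]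
    have e5 : -(Real.log 2 * δ * (m * (1 / s) - n * (1 / t))) * q = -(q * (Real.log 2 * δ) * (m * (1 / s) - n * (1 / t))) := by ring
    rw [e5]
    apply mul_le_mul_of_nonneg_right _ (Real.exp_pos _).le
    have e6 : (s + δ) * q + (t - δ) * q = 1 := by
      have : (s + t) * q = 1 := by rw [hq]; field_simp
      linarith
    have p1 : 0 < (s + δ) * q := by positivity
    have p2 : 0 < (t - δ) * q := by positivity
    have := Real.geom_mean_le_arith_mean2_weighted p1.le p2.le (hx0 m) (hy0 n) e6
    nlinarith [hx0 m, hy0 n]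
  have key : ∀ m n : ℤ, ((2:ℝ) ^ ((m:ℝ) + 1) * 2 ^ ((n:ℝ) + 1)) ^ q * ∑ z ∈ V', ‖Tz Λ (h m) (k n) z‖ ^ q ≤
      4 ^ q * D * (x m + y n) * Real.exp (-(c * |m * (1 / s) - n * (1 / t)|)) := by
    intro m n
    have e5 : ((2:ℝ) ^ ((m:ℝ) + 1) * 2 ^ ((n:ℝ) + 1)) ^ q = 4 ^ q * ((2:ℝ) ^ (m:ℝ) * 2 ^ (n:ℝ)) ^ q := by
      rw [← Real.mul_rpow (by norm_num) (by positivity), Real.rpow_add (by norm_num), Real.rpow_add (by norm_num), Real.rpow_one]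
      congr 1; ring
    rw [e5]
    apply exp_abs_le
    · have w := H1 Λ hΛ (E m) (F n) V' (h m) (k n) (hh m) (hk n)
      have o := one m n ε (by linarith) (by linarith)
      rw [← hc] at o
      calc _ ≤ 4 ^ q * ((2:ℝ) ^ (m:ℝ) * 2 ^ (n:ℝ)) ^ q * (D * (((E m).card : ℝ) ^ (s + ε) * ((F n).card : ℝ) ^ (t - ε)) ^ q) := by
            gcongr
            refine w.trans ?_
            gcongr
            linarith
        _ = 4 ^ q * D * (((2:ℝ) ^ (m:ℝ) * 2 ^ (n:ℝ)) ^ q * (((E m).card : ℝ) ^ (s + ε) * ((F n).card : ℝ) ^ (t - ε)) ^ q) := by ring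
        _ ≤ _ := mul_le_mul_of_nonneg_left o (by positivity)
        _ = _ := by ring
    · have w := H2 Λ hΛ (E m) (F n) V' (h m) (k n) (hh m) (hk n)
      have o := one m n (-ε) (by linarith) (by linarith)
      rw [show q * (Real.log 2 * -ε) * (m * (1 / s) - n * (1 / t)) = c * -(m * (1 / s) - n * (1 / t)) by rw [hc]; ring,
        sub_neg_eq_add, ← sub_eq_add_neg] at o
      calc _ ≤ 4 ^ q * ((2:ℝ) ^ (m:ℝ) * 2 ^ (n:ℝ)) ^ q * (D * (((E m).card : ℝ) ^ (s - ε) * ((F n).card : ℝ) ^ (t + ε)) ^ q) := by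
            gcongr
            refine w.trans ?_
            gcongr
            linarith
        _ = 4 ^ q * D * (((2:ℝ) ^ (m:ℝ) * 2 ^ (n:ℝ)) ^ q * (((E m).card : ℝ) ^ (s - ε) * ((F n).card : ℝ) ^ (t + ε)) ^ q) := by ring
        _ ≤ _ := mul_le_mul_of_nonneg_left o (by positivity)
        _ = _ := by ring
  have pt : ∀ z, ‖Tz Λ a b z‖ ^ q ≤ ∑ m ∈ M, ∑ n ∈ N, ((2:ℝ) ^ ((m:ℝ) + 1) * 2 ^ ((n:ℝ) + 1)) ^ q * ‖Tz Λ (h m) (k n) z‖ ^ q := by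
    intro z
    have e5 : Tz Λ a b z = ∑ m ∈ M, ∑ n ∈ N, (((2:ℝ) ^ ((m:ℝ) + 1) : ℝ) : ℂ) * ((((2:ℝ) ^ ((n:ℝ) + 1) : ℝ) : ℂ) * Tz Λ (h m) (k n) z) := by
      unfold Tz
      rw [← lin_01, ← ham, ← hbm]
    rw [e5]
    refine (norm_sum_rpow_le _ _ hq0 hq1).trans (Finset.sum_le_sum fun m _ => (norm_sum_rpow_le _ _ hq0 hq1).trans (Finset.sum_le_sum fun n _ => le_of_eq ?_))
    rw [← Real.mul_rpow (by positivity) (by positivity), norm_mul, norm_mul, Complex.norm_real, Complex.norm_real, Real.norm_of_nonneg (by positivity),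
      Real.norm_of_nonneg (by positivity), mul_assoc]
  calc ∑ z ∈ V', ‖Tz Λ a b z‖ ^ q ≤ ∑ z ∈ V', ∑ m ∈ M, ∑ n ∈ N, ((2:ℝ) ^ ((m:ℝ) + 1) * 2 ^ ((n:ℝ) + 1)) ^ q * ‖Tz Λ (h m) (k n) z‖ ^ q :=
        Finset.sum_le_sum fun z _ => pt z
    _ = ∑ m ∈ M, ∑ n ∈ N, ((2:ℝ) ^ ((m:ℝ) + 1) * 2 ^ ((n:ℝ) + 1)) ^ q * ∑ z ∈ V', ‖Tz Λ (h m) (k n) z‖ ^ q := by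
        rw [Finset.sum_comm]
        refine Finset.sum_congr rfl fun m _ => ?_
        rw [Finset.sum_comm]
        refine Finset.sum_congr rfl fun n _ => ?_
        rw [Finset.mul_sum]
    _ ≤ ∑ m ∈ M, ∑ n ∈ N, 4 ^ q * D * (x m + y n) * Real.exp (-(c * |m * (1 / s) - n * (1 / t)|)) :=
        Finset.sum_le_sum fun m _ => Finset.sum_le_sum fun n _ => key m n
    _ = 4 ^ q * D * (∑ m ∈ M, x m * ∑ n ∈ N, Real.exp (-(c * |n * (1 / t) - m * (1 / s)|)) +
          ∑ n ∈ N, y n * ∑ m ∈ M, Real.exp (-(c * |m * (1 / s) - n * (1 / t)|))) := by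
        simp only [Finset.mul_sum, mul_add, add_mul, Finset.sum_add_distrib]
        congr 1
        · refine Finset.sum_congr rfl fun m _ => Finset.sum_congr rfl fun n _ => ?_
          rw [abs_sub_comm]; ring
        · rw [Finset.sum_comm]
          refine Finset.sum_congr rfl fun m _ => Finset.sum_congr rfl fun n _ => ?_
          ring
    _ ≤ 4 ^ q * D * (∑ m ∈ M, x m * G2 + ∑ n ∈ N, y n * G1) := by
        have q1 : ∀ m, x m * ∑ n ∈ N, Real.exp (-(c * |n * (1 / t) - m * (1 / s)|)) ≤ x m * G2 :=
          fun m => mul_le_mul_of_nonneg_left (hgeo2 _ N) (hx0 m)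
        have q2 : ∀ n, y n * ∑ m ∈ M, Real.exp (-(c * |m * (1 / s) - n * (1 / t)|)) ≤ y n * G1 :=
          fun n => mul_le_mul_of_nonneg_left (hgeo1 _ M) (hy0 n)
        apply mul_le_mul_of_nonneg_left _ (by positivity)
        exact add_le_add (Finset.sum_le_sum fun m _ => q1 m) (Finset.sum_le_sum fun n _ => q2 n)
    _ ≤ _ := by
        rw [← Finset.sum_mul, ← Finset.sum_mul]
        gcongr
        · nlinarith
        · nlinarith

lemma Gd_perm (C : (Fin 3 → ℝ) → Fin 3 → ℝ) (σ : Equiv.Perm (Fin 3)) (Λ : TF) (hΛ : Gd C Λ) :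
    Gd (fun θ e => C (θ ∘ σ) (σ.symm e)) (Λ.domDomCongr σ) := by
  intro S hS e
  obtain ⟨S', h1, h2, h3⟩ := hΛ (S ∘ σ) (fun i => hS _) (σ.symm e)
  simp only [Function.comp_apply, Equiv.apply_symm_apply] at h1 h2
  refine ⟨S', h1, h2, fun θ hθ hs f hf hf0 => ?_⟩
  have hs' : (θ ∘ σ) 0 + (θ ∘ σ) 1 + (θ ∘ σ) 2 = 1 := by
    have := Equiv.sum_comp σ θ
    rw [Fin.sum_univ_three, Fin.sum_univ_three, hs] at this
    exact this
  have := h3 (θ ∘ σ) (fun i => hθ _) hs' (f ∘ σ) (fun i x => hf _ x) (fun x hx => by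
    simp only [Function.comp_apply, Equiv.apply_symm_apply]; exact hf0 x hx)
  refine this.trans (le_of_eq ?_)
  congr 1
  rw [← Equiv.prod_comp σ (fun i => ((S i).card : ℝ) ^ ((1 + θ i) / 2 - if i = e then 1 else 0))]
  refine Finset.prod_congr rfl fun i _ => ?_
  simp only [Function.comp_apply, Equiv.eq_symm_apply]

lemma dualize {p p' : ℝ} (hp : p.HolderConjugate p') (Λ : TF) (a b : ℤ → ℂ) (V : Finset ℤ) (D : ℝ) (hD : 0 < D)
    (H : ∀ c : ℤ → ℂ, (∀ x, x ∉ V → c x = 0) → ∑ x ∈ V, ‖c x‖ ^ p' ≤ 1 → ‖Λ ![a, b, c]‖ ≤ D) :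
    ∑ z ∈ V, ‖Tz Λ a b z‖ ^ p ≤ D ^ p := by
  classical
  obtain ⟨g, hg, hgs⟩ := (NNReal.isGreatest_Lp V (fun z => ‖Tz Λ a b z‖₊) hp).1
  beta_reduce at hgs
  obtain ⟨c, hc⟩ : ∃ c : ℤ → ℂ, c = fun z => if z ∈ V then ((g z : ℝ) : ℂ) * ((starRingEnd ℂ (Tz Λ a b z)) / ‖Tz Λ a b z‖) else 0 := ⟨_, rfl⟩
  have hc0 : ∀ x, x ∉ V → c x = 0 := fun x hx => by rw [hc]; simp [hx]
  have hcn : ∀ x, ‖c x‖ ≤ g x := by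
    intro x
    rw [hc]; beta_reduce
    split_ifs with hx
    · rw [norm_mul, norm_div, RCLike.norm_conj, Complex.norm_real, Complex.norm_real, norm_norm, Real.norm_of_nonneg (by positivity)]
      exact mul_le_of_le_one_right (by positivity) (div_self_le_one _)
    · simp
  have h1 := H c hc0 (by
    calc ∑ x ∈ V, ‖c x‖ ^ p' ≤ ∑ x ∈ V, (g x : ℝ) ^ p' :=
          Finset.sum_le_sum fun x _ => Real.rpow_le_rpow (norm_nonneg _) (hcn x) hp.symm.pos.le
      _ ≤ 1 := by exact_mod_cast hg)
  rw [lin3 Λ a b c V hc0] at h1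
  have e1 : ∑ z ∈ V, c z * Tz Λ a b z = ((∑ z ∈ V, (‖Tz Λ a b z‖ * g z) : ℝ) : ℂ) := by
    rw [Complex.ofReal_sum]
    refine Finset.sum_congr rfl fun z hz => ?_
    rw [hc]; beta_reduce
    rw [if_pos hz]
    by_cases h0 : (‖Tz Λ a b z‖ : ℂ) = 0
    · have : Tz Λ a b z = 0 := by simpa using h0
      simp [this]
    · have h2 : (starRingEnd ℂ (Tz Λ a b z)) * Tz Λ a b z = (‖Tz Λ a b z‖ : ℂ) ^ 2 := Complex.conj_mul' _
      push_cast
      field_simp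
      linear_combination (g z : ℂ) * h2
  rw [e1, Complex.norm_real] at h1
  have h2 : ((∑ z ∈ V, ‖Tz Λ a b z‖ ^ p) ^ (1 / p) : ℝ) ≤ D := by
    have h3 : ((∑ z ∈ V, (‖Tz Λ a b z‖ * g z) : ℝ)) = (∑ z ∈ V, ‖Tz Λ a b z‖ ^ p) ^ (1 / p) := by
      have := congrArg NNReal.toReal hgs
      push_cast at this
      exact this
    rw [← h3]
    exact (le_abs_self _).trans h1
  have h4 : 0 ≤ ∑ z ∈ V, ‖Tz Λ a b z‖ ^ p := Finset.sum_nonneg fun z _ => by positivity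
  calc _ = ((∑ z ∈ V, ‖Tz Λ a b z‖ ^ p) ^ (1 / p)) ^ p := by
        rw [← Real.rpow_mul h4, one_div, inv_mul_cancel₀ hp.pos.ne', Real.rpow_one]
    _ ≤ _ := Real.rpow_le_rpow (by positivity) h2 hp.pos.le
end BHT

namespace BHT

lemma lin_012 (Λ : TF) {M N L : Finset ℤ} (c d e : ℤ → ℂ) (h k g : ℤ → ℤ → ℂ) :
    Λ ![∑ m ∈ M, c m • h m, ∑ n ∈ N, d n • k n, ∑ l ∈ L, e l • g l] =
      ∑ m ∈ M, ∑ n ∈ N, ∑ l ∈ L, c m * (d n * (e l * Λ ![h m, k n, g l])) := by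
  classical
  rw [lin_01]
  refine Finset.sum_congr rfl fun m _ => Finset.sum_congr rfl fun n _ => ?_
  have e1 : ∀ b : ℤ → ℂ, ![h m, k n, b] = Function.update ![h m, k n, 0] 2 b := fun b => by
    ext i x; fin_cases i <;> simp [Function.update]
  rw [e1, Λ.map_update_sum, Finset.mul_sum, Finset.mul_sum]
  refine Finset.sum_congr rfl fun l _ => ?_
  rw [Λ.map_update_smul, ← e1, smul_eq_mul]

lemma triple_sum {M0 M1 M2 : Finset ℤ} {x0 x1 x2 : ℤ → ℝ} (hx0 : ∀ m, 0 ≤ x0 m) (hx1 : ∀ m, 0 ≤ x1 m) (hx2 : ∀ m, 0 ≤ x2 m)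
    (h0 : ∑ m ∈ M0, x0 m ≤ 1) (h1 : ∑ m ∈ M1, x1 m ≤ 1) (h2 : ∑ m ∈ M2, x2 m ≤ 1) {G : ℝ} (hG : 0 < G) (e : ℝ → ℝ)
    (he : ∀ r, 0 ≤ e r) (v0 v1 v2 : ℤ → ℝ) (hv0 : ∀ y, ∑ m ∈ M0, e (v0 m - y) ≤ G) (hv1 : ∀ y, ∑ m ∈ M1, e (v1 m - y) ≤ G)
    (hv2 : ∀ y, ∑ m ∈ M2, e (v2 m - y) ≤ G) :
    ∑ m ∈ M0, ∑ n ∈ M1, ∑ l ∈ M2, (x0 m * (e (v1 n - v0 m) * e (v2 l - v0 m)) + x1 n * (e (v0 m - v1 n) * e (v2 l - v1 n)) +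
      x2 l * (e (v0 m - v2 l) * e (v1 n - v2 l))) ≤ 3 * G ^ 2 := by
  have gen : ∀ (A B D : Finset ℤ) (x v w z : ℤ → ℝ), (∀ m, 0 ≤ x m) → ∑ m ∈ A, x m ≤ 1 → (∀ y, ∑ m ∈ B, e (w m - y) ≤ G) →
      (∀ y, ∑ m ∈ D, e (z m - y) ≤ G) → ∑ m ∈ A, ∑ n ∈ B, ∑ l ∈ D, x m * (e (w n - v m) * e (z l - v m)) ≤ G ^ 2 := by
    intro A B D x v w z hx hA hB hD
    calc _ = ∑ m ∈ A, x m * ((∑ n ∈ B, e (w n - v m)) * ∑ l ∈ D, e (z l - v m)) := by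
          refine Finset.sum_congr rfl fun m _ => ?_
          rw [Finset.sum_mul_sum, Finset.mul_sum]
          refine Finset.sum_congr rfl fun n _ => ?_
          rw [Finset.mul_sum]
      _ ≤ ∑ m ∈ A, x m * (G * G) := by
          refine Finset.sum_le_sum fun m _ => mul_le_mul_of_nonneg_left ?_ (hx m)
          exact mul_le_mul (hB _) (hD _) (Finset.sum_nonneg fun _ _ => he _) hG.le
      _ ≤ G ^ 2 := by rw [← Finset.sum_mul]; nlinarith [mul_pos hG hG]
  simp only [Finset.sum_add_distrib]
  have q0 := gen M0 M1 M2 x0 v0 v1 v2 hx0 h0 hv1 hv2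
  have q1 := gen M1 M0 M2 x1 v1 v0 v2 hx1 h1 hv0 hv2
  have q2 := gen M2 M0 M1 x2 v2 v0 v1 hx2 h2 hv0 hv1
  rw [Finset.sum_comm] at q1
  have q3 : ∑ m ∈ M0, ∑ n ∈ M1, ∑ l ∈ M2, x2 l * (e (v0 m - v2 l) * e (v1 n - v2 l)) =
      ∑ l ∈ M2, ∑ m ∈ M0, ∑ n ∈ M1, x2 l * (e (v0 m - v2 l) * e (v1 n - v2 l)) := by
    rw [Finset.sum_comm (s := M2) (t := M0)]
    exact Finset.sum_congr rfl fun m _ => Finset.sum_comm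
  linarith

lemma strong2 (C : (Fin 3 → ℝ) → Fin 3 → ℝ) (α : Fin 3 → ℝ) (hα : α 0 + α 1 + α 2 = 1) (hpos : ∀ i, 0 < α i) :
    ∃ D : ℝ, 0 < D ∧ ∀ Λ : TF, Gd C Λ → ∀ (V : Finset ℤ) (f : Fin 3 → ℤ → ℂ),
      (∀ i x, x ∉ V → f i x = 0) → (∀ i, ∑ x ∈ V, ‖f i x‖ ^ (1 / α i) ≤ 1) → ‖Λ f‖ ≤ D := by
  classical
  obtain ⟨ε, hε, hεα⟩ : ∃ ε : ℝ, 0 < ε ∧ ∀ i, ε < α i := by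
    obtain ⟨i, hi⟩ := Finite.exists_min α
    exact ⟨α i / 2, by linarith [hpos i], fun j => by linarith [hi j, hpos i]⟩
  obtain ⟨A, hA⟩ : ∃ A : Fin 3 → Fin 3 → Fin 3 → ℝ, A = fun i j l => α l + ε * ((if l = i then 1 else 0) - if l = j then 1 else 0) := ⟨_, rfl⟩
  have hAp : ∀ i j l, 0 < A i j l := by
    intro i j l
    rw [hA]; beta_reduce
    have := hεα l
    split_ifs <;> linarith
  have hAs : ∀ i j, A i j 0 + A i j 1 + A i j 2 = 1 := by
    intro i j
    rw [hA]; beta_reduce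
    have : ∀ i : Fin 3, ((if (0:Fin 3) = i then 1 else 0) + (if 1 = i then 1 else 0) + (if 2 = i then 1 else 0) : ℝ) = 1 := by
      intro i; fin_cases i <;> simp
    linear_combination hα + ε * (this i) - ε * (this j)
  choose Dd hDd hR using fun ij : Fin 3 × Fin 3 => restricted C (A ij.1 ij.2) (hAs _ _) (hAp _ _)
  obtain ⟨D, hD⟩ : ∃ D : ℝ, D = ∑ ij, Dd ij := ⟨_, rfl⟩
  have hDl : ∀ ij, Dd ij ≤ D := fun ij => by
    rw [hD]; exact Finset.single_le_sum (f := Dd) (fun e _ => (hDd e).le) (Finset.mem_univ ij)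
  have hD0 : 0 < D := (hDd (0,0)).trans_le (hDl _)
  obtain ⟨c, hc⟩ : ∃ c : ℝ, c = Real.log 2 * ε := ⟨_, rfl⟩
  have hc0 : 0 < c := by have := Real.log_pos (by norm_num : (1:ℝ) < 2); rw [hc]; positivity
  choose Gg hGg hgeo using fun i => geo (c / 2) (1 / α i) (by positivity) (by have := hpos i; positivity)
  obtain ⟨G, hG⟩ : ∃ G : ℝ, G = ∑ i, Gg i := ⟨_, rfl⟩
  have hGl : ∀ i, Gg i ≤ G := fun i => by
    rw [hG]; exact Finset.single_le_sum (f := Gg) (fun e _ => (hGg e).le) (Finset.mem_univ i)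
  have hG0 : 0 < G := (hGg 0).trans_le (hGl _)
  refine ⟨8 * D * (3 * G ^ 2), by positivity, fun Λ hΛ V f hf hf1 => ?_⟩
  choose M E h hh hfm hMs _ _ using fun i => lev (f i) V (hf i)
  obtain ⟨x, hx⟩ : ∃ x : Fin 3 → ℤ → ℝ, x = fun (i : Fin 3) (m : ℤ) => ((2:ℝ) ^ (m:ℝ)) ^ (1 / α i) * ((E i m).card : ℝ) := ⟨_, rfl⟩
  have hx0 : ∀ i m, 0 ≤ x i m := fun i m => by rw [hx]; positivity
  have hxs : ∀ i, ∑ m ∈ M i, x i m ≤ 1 := fun i => by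
    rw [hx]; exact (hMs i _ (by have := hpos i; positivity)).trans (hf1 i)
  obtain ⟨v, hv⟩ : ∃ v : Fin 3 → ℤ → ℝ, v = fun (i : Fin 3) (m : ℤ) => (m:ℝ) * (1 / α i) := ⟨_, rfl⟩
  obtain ⟨ef, hef⟩ : ∃ ef : ℝ → ℝ, ef = fun r => Real.exp (-(c / 2 * |r|)) := ⟨_, rfl⟩
  have hef0 : ∀ r, 0 ≤ ef r := fun r => by rw [hef]; positivity
  have hvG : ∀ i y, ∑ m ∈ M i, ef (v i m - y) ≤ G := fun i y => by
    rw [hef, hv]; exact (hgeo i y _).trans (hGl i)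
  -- single term
  have term : ∀ m n l : ℤ, (2:ℝ) ^ ((m:ℝ) + 1) * (2 ^ ((n:ℝ) + 1) * (2 ^ ((l:ℝ) + 1) * ‖Λ ![h 0 m, h 1 n, h 2 l]‖)) ≤
      8 * D * (x 0 m * (ef (v 1 n - v 0 m) * ef (v 2 l - v 0 m)) + x 1 n * (ef (v 0 m - v 1 n) * ef (v 2 l - v 1 n)) +
      x 2 l * (ef (v 0 m - v 2 l) * ef (v 1 n - v 2 l))) := by
    intro m n l
    obtain ⟨r, hr⟩ : ∃ r : Fin 3 → ℤ, r = ![m, n, l] := ⟨_, rfl⟩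
    obtain ⟨T, hT⟩ : ∃ T : ℝ, T = (2:ℝ) ^ ((m:ℝ) + 1) * (2 ^ ((n:ℝ) + 1) * (2 ^ ((l:ℝ) + 1) * ‖Λ ![h 0 m, h 1 n, h 2 l]‖)) := ⟨_, rfl⟩
    have hT2 : T = 8 * ((∏ i, (2:ℝ) ^ ((r i : ℤ) : ℝ)) * ‖Λ (fun i => h i (r i))‖) := by
      have : (fun i => h i (r i)) = ![h 0 m, h 1 n, h 2 l] := by
        rw [hr]; ext i; fin_cases i <;> rfl
      rw [hT, this, hr, Fin.prod_univ_three, Real.rpow_add (by norm_num), Real.rpow_add (by norm_num), Real.rpow_add (by norm_num), Real.rpow_one]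
      simp
      ring
    obtain ⟨X, hX⟩ : ∃ X : ℝ, X = x 0 m + x 1 n + x 2 l := ⟨_, rfl⟩
    have pair : ∀ i j, T ≤ 8 * D * X * Real.exp (-(c * (v i (r i) - v j (r j)))) := by
      intro i j
      have w := hR (i, j) Λ hΛ (fun i => E i (r i)) (fun i => h i (r i)) (fun i => hh i (r i))
      have hP : 0 ≤ ∏ l, ((E l (r l)).card : ℝ) ^ A i j l := Finset.prod_nonneg fun i _ => Real.rpow_nonneg (Nat.cast_nonneg _) _
      have w2 : ‖Λ (fun i => h i (r i))‖ ≤ D * ∏ l, ((E l (r l)).card : ℝ) ^ A i j l :=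
        w.trans (mul_le_mul_of_nonneg_right (hDl _) hP)
      have e1 : (∏ i, (2:ℝ) ^ ((r i : ℤ) : ℝ)) * ∏ l, ((E l (r l)).card : ℝ) ^ A i j l =
          (∏ l, x l (r l) ^ A i j l) * Real.exp (-(c * (v i (r i) - v j (r j)))) := by
        rw [← Finset.prod_mul_distrib]
        have : ∀ l, (2:ℝ) ^ ((r l : ℤ) : ℝ) * ((E l (r l)).card : ℝ) ^ A i j l =
            x l (r l) ^ A i j l * Real.exp (-(Real.log 2 * ((A i j l - α l) * (r l / α l)))) := fun l => by
          rw [hx]; exact lvl (hpos l) _ (Nat.cast_nonneg _)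
        rw [Finset.prod_congr rfl fun l _ => this l, Finset.prod_mul_distrib, ← Real.exp_sum]
        congr 2
        rw [Finset.sum_neg_distrib, ← Finset.mul_sum, hc, mul_assoc]
        congr 2
        rw [hA, hv]
        simp only [add_sub_cancel_left, mul_assoc, ← Finset.mul_sum, sub_mul, ite_mul, one_mul, zero_mul, Finset.sum_sub_distrib,
          Finset.sum_ite_eq', Finset.mem_univ, if_true]
        simp only [div_eq_mul_inv, one_mul]
      have e2 : ∏ l, x l (r l) ^ A i j l ≤ X := by
        have := Real.geom_mean_le_arith_mean3_weighted (hAp i j 0).le (hAp i j 1).le (hAp i j 2).le (hx0 0 (r 0)) (hx0 1 (r 1)) (hx0 2 (r 2)) (hAs i j)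
        rw [Fin.prod_univ_three]
        have y0 := hx0 0 (r 0)
        have y1 := hx0 1 (r 1)
        have y2 := hx0 2 (r 2)
        have z0 := hAp i j 0
        have z1 := hAp i j 1
        have z2 := hAp i j 2
        have s := hAs i j
        have hX' : X = x 0 (r 0) + x 1 (r 1) + x 2 (r 2) := by rw [hX, hr]; rfl
        rw [hX']
        have k0 : A i j 0 * x 0 (r 0) ≤ 1 * x 0 (r 0) := mul_le_mul_of_nonneg_right (by linarith) y0
        have k1 : A i j 1 * x 1 (r 1) ≤ 1 * x 1 (r 1) := mul_le_mul_of_nonneg_right (by linarith) y1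
        have k2 : A i j 2 * x 2 (r 2) ≤ 1 * x 2 (r 2) := mul_le_mul_of_nonneg_right (by linarith) y2
        linarith
      calc T = 8 * ((∏ i, (2:ℝ) ^ ((r i : ℤ) : ℝ)) * ‖Λ (fun i => h i (r i))‖) := hT2
        _ ≤ 8 * ((∏ i, (2:ℝ) ^ ((r i : ℤ) : ℝ)) * (D * ∏ l, ((E l (r l)).card : ℝ) ^ A i j l)) := by gcongr
        _ = 8 * D * ((∏ i, (2:ℝ) ^ ((r i : ℤ) : ℝ)) * ∏ l, ((E l (r l)).card : ℝ) ^ A i j l) := by ring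
        _ = 8 * D * ((∏ l, x l (r l) ^ A i j l) * Real.exp (-(c * (v i (r i) - v j (r j))))) := by rw [e1]
        _ ≤ 8 * D * (X * Real.exp (-(c * (v i (r i) - v j (r j))))) := by gcongr
        _ = _ := by ring
    have pabs : ∀ i j, T ≤ 8 * D * X * Real.exp (-(c * |v i (r i) - v j (r j)|)) := by
      intro i j
      apply exp_abs_le (pair i j)
      rw [neg_sub]
      exact pair j i
    have p01 : T ≤ 8 * D * X * Real.exp (-(c * |v 0 m - v 1 n|)) := by have := pabs 0 1; rw [hr] at this; exact this
    have p02 : T ≤ 8 * D * X * Real.exp (-(c * |v 0 m - v 2 l|)) := by have := pabs 0 2; rw [hr] at this; exact this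
    have p12 : T ≤ 8 * D * X * Real.exp (-(c * |v 1 n - v 2 l|)) := by have := pabs 1 2; rw [hr] at this; exact this
    obtain ⟨w, hw⟩ : ∃ w : ℝ, w = max |v 0 m - v 1 n| (max |v 0 m - v 2 l| |v 1 n - v 2 l|) := ⟨_, rfl⟩
    have pw : T ≤ 8 * D * X * Real.exp (-(c * w)) := by
      rw [hw]
      rcases max_choice |v 0 m - v 1 n| (max |v 0 m - v 2 l| |v 1 n - v 2 l|) with q | q <;> rw [q]
      · exact p01
      · rcases max_choice |v 0 m - v 2 l| |v 1 n - v 2 l| with q | q <;> rw [q] <;> assumption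
    have w01 : |v 0 m - v 1 n| ≤ w := by rw [hw]; exact le_max_left _ _
    have w02 : |v 0 m - v 2 l| ≤ w := by rw [hw]; exact (le_max_left _ _).trans (le_max_right _ _)
    have w12 : |v 1 n - v 2 l| ≤ w := by rw [hw]; exact (le_max_right _ _).trans (le_max_right _ _)
    have efm : ∀ y z, |y| ≤ w → |z| ≤ w → Real.exp (-(c * w)) ≤ ef y * ef z := by
      intro y z hy hz
      rw [hef]; beta_reduce
      rw [← Real.exp_add]
      apply Real.exp_le_exp.2
      nlinarith
    have k0 := mul_le_mul_of_nonneg_left (efm (v 1 n - v 0 m) (v 2 l - v 0 m) (by rwa [abs_sub_comm]) (by rwa [abs_sub_comm])) (hx0 0 m)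
    have k1 := mul_le_mul_of_nonneg_left (efm (v 0 m - v 1 n) (v 2 l - v 1 n) w01 (by rwa [abs_sub_comm])) (hx0 1 n)
    have k2 := mul_le_mul_of_nonneg_left (efm (v 0 m - v 2 l) (v 1 n - v 2 l) w02 w12) (hx0 2 l)
    rw [← hT]
    refine pw.trans ?_
    rw [mul_assoc]
    apply mul_le_mul_of_nonneg_left _ (by positivity)
    rw [hX, add_mul, add_mul]
    linarith
  have hexp : Λ f = ∑ m ∈ M 0, ∑ n ∈ M 1, ∑ l ∈ M 2, (((2:ℝ) ^ ((m:ℝ) + 1) : ℝ) : ℂ) * ((((2:ℝ) ^ ((n:ℝ) + 1) : ℝ) : ℂ) *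
      ((((2:ℝ) ^ ((l:ℝ) + 1) : ℝ) : ℂ) * Λ ![h 0 m, h 1 n, h 2 l])) := by
    rw [← lin_012, ← hfm, ← hfm, ← hfm]
    congr 1
    ext i; fin_cases i <;> rfl
  rw [hexp]
  refine (norm_sum_le _ _).trans (le_trans (Finset.sum_le_sum fun m _ => (norm_sum_le _ _).trans (Finset.sum_le_sum fun n _ => 
    (norm_sum_le _ _).trans (Finset.sum_le_sum fun l _ => (le_of_eq ?_ : _ ≤ (2:ℝ) ^ ((m:ℝ) + 1) * (2 ^ ((n:ℝ) + 1) * (2 ^ ((l:ℝ) + 1) * ‖Λ ![h 0 m, h 1 n, h 2 l]‖))).trans (term m n l)))) ?_)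
  · rw [norm_mul, norm_mul, norm_mul, Complex.norm_real, Complex.norm_real, Complex.norm_real, Real.norm_of_nonneg (by positivity),
      Real.norm_of_nonneg (by positivity), Real.norm_of_nonneg (by positivity)]
  · simp only [← Finset.mul_sum]
    apply mul_le_mul_of_nonneg_left _ (by positivity)
    exact triple_sum (hx0 0) (hx0 1) (hx0 2) (hxs 0) (hxs 1) (hxs 2) hG0 ef hef0 (v 0) (v 1) (v 2) (hvG 0) (hvG 1) (hvG 2)

lemma strongInf (C : (Fin 3 → ℝ) → Fin 3 → ℝ) (p : ℝ) (hp : 1 < p) :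
    ∃ D : ℝ, 0 < D ∧ ∀ Λ : TF, Gd C Λ → ∀ (V : Finset ℤ) (a b : ℤ → ℂ),
      (∀ x, x ∉ V → a x = 0) → (∀ x, x ∉ V → b x = 0) → (∀ x, ‖a x‖ ≤ 1) → ∑ x ∈ V, ‖b x‖ ^ p ≤ 1 →
      ∑ z ∈ V, ‖Tz Λ a b z‖ ^ p ≤ D := by
  obtain ⟨p', hpp⟩ : ∃ p', p.HolderConjugate p' := ⟨_, Real.HolderConjugate.conjExponent hp⟩
  obtain ⟨σ, hσ⟩ : ∃ σ : Equiv.Perm (Fin 3), σ = finRotate 3 * finRotate 3 := ⟨_, rfl⟩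
  have h1 := hpp.inv_add_inv_eq_one
  have i1 := hpp.inv_pos
  have i2 := hpp.symm.inv_pos
  obtain ⟨D, hD, H⟩ := strong1 (fun θ e => C (θ ∘ σ) (σ.symm e)) p⁻¹ p'⁻¹ 1 i1 (by linarith) i2 (by linarith) (by linarith) (by rw [h1]; norm_num) le_rfl
  refine ⟨D ^ p, by positivity, fun Λ hΛ V a b ha hb ha1 hb1 => ?_⟩
  refine dualize hpp Λ a b V D hD fun c hc hc1 => ?_
  have e1 : Λ ![a, b, c] = (Λ.domDomCongr σ) ![b, c, a] := by
    change _ = Λ _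
    congr 1
    rw [hσ]
    ext i; fin_cases i <;> rfl
  rw [e1, lin3 _ b c a V ha]
  have := H _ (Gd_perm C σ Λ hΛ) V V b c hb hc (by simpa using hb1) (by simpa using hc1)
  refine (norm_sum_le _ _).trans (le_trans (Finset.sum_le_sum fun x _ => ?_) this)
  rw [norm_mul, Real.rpow_one]
  exact mul_le_of_le_one_left (norm_nonneg _) (ha1 x)

/-- the unit ball condition in the sequence space of exponent `p` on a finite set -/
def Uc (p : ℝ≥0∞) (V : Finset ℤ) (a : ℤ → ℂ) : Prop :=
  (p = ∞ → ∀ x, ‖a x‖ ≤ 1) ∧ (p ≠ ∞ → ∑ x ∈ V, ‖a x‖ ^ p.toReal ≤ 1)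

lemma strong (C : (Fin 3 → ℝ) → Fin 3 → ℝ) (p₁ p₂ p₃ : ℝ≥0∞) (h₁ : 1 < p₁) (h₂ : 1 < p₂) (h₃ : 2/3 < p₃) (h₃' : p₃ < ∞)
    (hsum : 1/p₁ + 1/p₂ = 1/p₃) :
    ∃ D : ℝ, 0 < D ∧ ∀ Λ : TF, Gd C Λ → ∀ (V : Finset ℤ) (a b : ℤ → ℂ),
      (∀ x, x ∉ V → a x = 0) → (∀ x, x ∉ V → b x = 0) → Uc p₁ V a → Uc p₂ V b →
      ∑ z ∈ V, ‖Tz Λ a b z‖ ^ p₃.toReal ≤ D := by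
  have h30 : p₃ ≠ 0 := (lt_of_le_of_lt (zero_le) h₃).ne'
  have hgt : ∀ p : ℝ≥0∞, 1 < p → p ≠ ∞ → 1 < p.toReal := fun p hp ht => by
    rw [← ENNReal.toReal_one]; exact (ENNReal.toReal_lt_toReal (by simp) ht).2 hp
  by_cases t1 : p₁ = ∞
  · have e : p₂ = p₃ := by
      rw [t1] at hsum; simpa using hsum
    have t2 : p₂ ≠ ∞ := by rw [e]; exact h₃'.ne
    obtain ⟨D, hD, H⟩ := strongInf C p₂.toReal (hgt _ h₂ t2)
    refine ⟨D, hD, fun Λ hΛ V a b ha hb ha1 hb1 => ?_⟩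
    rw [← e]
    exact H Λ hΛ V a b ha hb (ha1.1 t1) (hb1.2 t2)
  by_cases t2 : p₂ = ∞
  · have e : p₁ = p₃ := by
      rw [t2] at hsum; simpa using hsum
    obtain ⟨σ, hσ⟩ : ∃ σ : Equiv.Perm (Fin 3), σ = Equiv.swap 0 1 := ⟨_, rfl⟩
    obtain ⟨D, hD, H⟩ := strongInf (fun θ e => C (θ ∘ σ) (σ.symm e)) p₁.toReal (hgt _ h₁ t1)
    refine ⟨D, hD, fun Λ hΛ V a b ha hb ha1 hb1 => ?_⟩
    rw [← e]
    have := H _ (Gd_perm C σ Λ hΛ) V b a hb ha (hb1.1 t2) (ha1.2 t1)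
    refine le_trans (le_of_eq (Finset.sum_congr rfl fun z _ => ?_)) this
    have e1 : Tz Λ a b z = Tz (Λ.domDomCongr σ) b a z := by
      unfold Tz
      change _ = Λ _
      congr 1
      rw [hσ]
      ext i; fin_cases i <;> simp [Equiv.swap_apply_def]
    rw [e1]
  obtain ⟨s, hs⟩ : ∃ s, s = 1 / p₁.toReal := ⟨_, rfl⟩
  obtain ⟨t, ht⟩ : ∃ t, t = 1 / p₂.toReal := ⟨_, rfl⟩
  obtain ⟨q, hq⟩ : ∃ q, q = p₃.toReal := ⟨_, rfl⟩
  have g1 := hgt _ h₁ t1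
  have g2 := hgt _ h₂ t2
  have hq23 : 2 / 3 < q := by
    rw [hq]
    have := (ENNReal.toReal_lt_toReal (by finiteness) h₃'.ne).2 h₃
    simpa using this
  have hst : s + t = 1 / q := by
    have := congrArg ENNReal.toReal hsum
    rw [ENNReal.toReal_add (by simp; intro h; simp [h] at h₁) (by simp; intro h; simp [h] at h₂)] at this
    simp only [one_div, ENNReal.toReal_inv] at this
    rw [hs, ht, hq]; simpa using this
  have s0 : 0 < s := by rw [hs]; positivity
  have t0 : 0 < t := by rw [ht]; positivity
  have s1 : s < 1 := by rw [hs, div_lt_one (by linarith)]; exact g1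
  have t11 : t < 1 := by rw [ht, div_lt_one (by linarith)]; exact g2
  have es : 1 / s = p₁.toReal := by rw [hs, one_div_one_div]
  have et : 1 / t = p₂.toReal := by rw [ht, one_div_one_div]
  have hq0 : 0 < q := by linarith
  by_cases hq1 : q ≤ 1
  · obtain ⟨D, hD, H⟩ := strong1 C s t q s0 s1 t0 t11 (by rw [hst, div_lt_iff₀ hq0]; linarith) hst hq1
    refine ⟨D, hD, fun Λ hΛ V a b ha hb ha1 hb1 => ?_⟩
    rw [← hq]
    exact H Λ hΛ V V a b ha hb (by rw [es]; exact ha1.2 t1) (by rw [et]; exact hb1.2 t2)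
  · push Not at hq1
    obtain ⟨q', hqq⟩ : ∃ q', q.HolderConjugate q' := ⟨_, Real.HolderConjugate.conjExponent hq1⟩
    have h1 := hqq.inv_add_inv_eq_one
    have i2 := hqq.symm.inv_pos
    obtain ⟨D, hD, H⟩ := strong2 C ![s, t, q'⁻¹] (by simp only [Matrix.cons_val]; rw [hst, one_div]; exact h1) (by
      intro i; fin_cases i
      · exact s0
      · exact t0
      · exact i2)
    refine ⟨D ^ q, by positivity, fun Λ hΛ V a b ha hb ha1 hb1 => ?_⟩
    rw [← hq]
    refine dualize hqq Λ a b V D hD fun c hc hc1 => H Λ hΛ V _ ?_ ?_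
    · intro i; fin_cases i
      · exact ha
      · exact hb
      · exact hc
    · intro i; fin_cases i
      · simpa [es] using ha1.2 t1
      · simpa [et] using hb1.2 t2
      · simpa using hc1
end BHT

namespace BHT

lemma kernel_lim (a : ℝ) (γ u : ℝ → ℂ) (hu : Band u a (2 * a)) (hu0 : u 0 = 1)
    (hγ : ∀ t : ℝ, -(2 * π * I * t) * γ t = u (t / 2) - u t) :
    ∃ (κ : ℤ → ℂ) (A : ℝ), 0 < A ∧ (∀ t : ℤ, Tendsto (fun J : ℕ => ∑ j ∈ Finset.Ico 2 J, Kj γ j t) atTop (nhds (κ t))) ∧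
      ∀ t : ℤ, ‖-(2 * π * I) * κ t - (t:ℂ)⁻¹‖ ≤ A * ((1 + |(t:ℝ)|) ^ 2)⁻¹ := by
  classical
  obtain ⟨-, -, hdiff, -⟩ := hu.deriv_decay 0
  have hcont : Continuous u := hdiff.continuous
  obtain ⟨B, hB, hdec⟩ := hu.decay 1
  have hpi : (2 * π * I : ℂ) ≠ 0 := by simp [Real.pi_ne_zero]
  have tele : ∀ (t : ℝ) (J : ℕ), 2 ≤ J → -(2 * π * I * t) * ∑ j ∈ Finset.Ico 2 J, Kj γ j t = u (t / 2 ^ J) - u (t / 2 ^ 2) := by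
    intro t J hJ
    induction J, hJ using Nat.le_induction with
    | base => simp
    | succ J hJ ih =>
      rw [Finset.sum_Ico_succ_top hJ, mul_add, ih]
      have h1 := hγ (t / 2 ^ J)
      have h2 : -(2 * π * I * t) * Kj γ J t = u (t / 2 ^ (J + 1)) - u (t / 2 ^ J) := by
        rw [pow_succ, ← div_div, ← h1, Kj]
        push_cast
        field_simp
      rw [h2]; ring
  have h0 : ∃ κ0 : ℂ, Tendsto (fun J : ℕ => ∑ j ∈ Finset.Ico 2 J, Kj γ j 0) atTop (nhds κ0) := by
    have hs : Summable fun j : ℕ => Kj γ j 0 := by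
      unfold Kj
      have : Summable fun j : ℕ => ((1/2 : ℝ) ^ j : ℝ) := summable_geometric_of_lt_one (by norm_num) (by norm_num)
      have h2 : Summable fun j : ℕ => (((2 ^ j)⁻¹ : ℝ) : ℂ) := by
        rw [Complex.summable_ofReal]
        simpa using this
      simpa using h2.mul_right (γ 0)
    refine ⟨(∑' j, Kj γ j 0) - ∑ j ∈ Finset.range 2, Kj γ j 0, ?_⟩
    have := (hs.hasSum.tendsto_sum_nat).sub_const (∑ j ∈ Finset.range 2, Kj γ j 0)
    refine this.congr' ?_
    filter_upwards [eventually_ge_atTop 2] with J hJ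
    rw [Finset.sum_Ico_eq_sub _ hJ]
  obtain ⟨κ0, hκ0⟩ := h0
  refine ⟨fun t => if t = 0 then κ0 else (u 0 - u (t / 2 ^ 2)) / (-(2 * π * I * t)), ‖(2 * π * I) * κ0‖ + 8 * B, by positivity, ?_, ?_⟩
  · intro t
    by_cases ht : t = 0
    · simp only [ht, if_true]; simpa using hκ0
    · beta_reduce
      rw [if_neg ht]
      have htc : (t:ℂ) ≠ 0 := by exact_mod_cast ht
      have hne : -(2 * π * I * t) ≠ 0 := neg_ne_zero.2 (mul_ne_zero hpi htc)
      have hl : Tendsto (fun J : ℕ => (u ((t:ℝ) / 2 ^ J) - u ((t:ℝ) / 2 ^ 2)) / (-(2 * π * I * t))) atTop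
          (nhds ((u 0 - u ((t:ℝ) / 2 ^ 2)) / (-(2 * π * I * t)))) := by
        apply Tendsto.div_const
        apply Tendsto.sub_const
        apply (hcont.tendsto 0).comp
        have : Tendsto (fun J : ℕ => (t:ℝ) * (1/2) ^ J) atTop (nhds ((t:ℝ) * 0)) :=
          (tendsto_pow_atTop_nhds_zero_of_lt_one (by norm_num) (by norm_num)).const_mul _
        rw [mul_zero] at this
        refine this.congr fun J => ?_
        rw [div_pow, one_pow]; ring
      refine hl.congr' ?_
      filter_upwards [eventually_ge_atTop 2] with J hJ
      rw [← tele t J hJ]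
      push_cast
      field_simp
  · intro t
    beta_reduce
    split_ifs with ht
    · rw [ht]
      simp only [Int.cast_zero, inv_zero, sub_zero, abs_zero, add_zero, one_pow, inv_one, mul_one]
      rw [neg_mul, norm_neg]
      linarith
    · have htc : (t:ℂ) ≠ 0 := by exact_mod_cast ht
      have e1 : -(2 * π * I) * ((u 0 - u (t / 2 ^ 2)) / (-(2 * π * I * t))) - (t:ℂ)⁻¹ = -u (t / 2 ^ 2) / t := by
        rw [hu0]
        have : (π:ℂ) ≠ 0 := by exact_mod_cast Real.pi_ne_zero
        field_simp
        ring
      rw [e1, norm_div, norm_neg]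
      have h1 : (1:ℝ) ≤ |(t:ℝ)| := by exact_mod_cast Int.one_le_abs ht
      have h2 := hdec ((t:ℝ) / 2 ^ 2)
      rw [abs_div, pow_one, abs_of_pos (by norm_num : (0:ℝ) < 2 ^ 2)] at h2
      have h3 : ‖(t:ℂ)‖ = |(t:ℝ)| := by
        rw [show (t:ℂ) = ((t:ℝ):ℂ) by push_cast; rfl, Complex.norm_real, Real.norm_eq_abs]
      rw [h3]
      set y := |(t:ℝ)| with hy
      calc ‖u ((t:ℝ) / 2 ^ 2)‖ / y ≤ B * (1 + y / 2 ^ 2)⁻¹ / y := by gcongr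
        _ ≤ 8 * B * ((1 + y) ^ 2)⁻¹ := by
            rw [div_le_iff₀ (by linarith), ← div_eq_mul_inv, ← div_eq_mul_inv, div_mul_eq_mul_div, div_le_div_iff₀ (by positivity) (by positivity)]
            have : (1 + y) ^ 2 ≤ 8 * y * (1 + y / 2 ^ 2) := by nlinarith
            nlinarith [mul_le_mul_of_nonneg_left this hB.le]
        _ ≤ _ := by gcongr; linarith [norm_nonneg ((2 * π * I) * κ0)]

/-- the truncated trilinear form -/
noncomputable def LamT (α : ℤ) (K : ℤ → ℂ) (W : Finset ℤ) : TF :=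
  ∑ z ∈ W ×ˢ W, K (z.1 - z.2) • (MultilinearMap.mkPiAlgebra ℂ (Fin 3) ℂ).compLinearMap
    (fun i => LinearMap.proj (![z.2, z.1 - α * (z.1 - z.2), z.1] i))

lemma LamT_apply (α : ℤ) (K : ℤ → ℂ) (W : Finset ℤ) (f : Fin 3 → ℤ → ℂ) :
    LamT α K W f = ∑ z ∈ W ×ˢ W, K (z.1 - z.2) * (f 0 z.2 * f 1 (z.1 - α * (z.1 - z.2)) * f 2 z.1) := by
  unfold LamT
  simp [MultilinearMap.sum_apply, MultilinearMap.mkPiAlgebra_apply, Fin.prod_univ_three]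

lemma LamT_Lf (α c : ℤ) (K : ℤ → ℂ) (W : Finset ℤ) (f : Fin 3 → ℤ → ℂ) :
    LamT α K W f = Lf ![1 + c, α + c, c] K ![fun x => if x ∈ W then f 0 x else 0, f 1, fun x => if x ∈ W then f 2 x else 0] := by
  classical
  obtain ⟨φ, hφ⟩ : ∃ φ : ℤ × ℤ → ℤ × ℤ, φ = fun z => (z.1 + c * (z.1 - z.2), z.1 - z.2) := ⟨_, rfl⟩
  have hinj : Function.Injective φ := by
    rintro ⟨a, b⟩ ⟨a', b'⟩ h
    rw [hφ] at h
    simp only [Prod.mk.injEq] at h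
    have h1 : a = a' := by have := h.1; rw [h.2] at this; linarith
    rw [h1] at h ⊢
    have h2 := h.2
    rw [show b = b' by linarith]
  rw [Lf, tsum_eq_sum (s := (W ×ˢ W).image φ), Finset.sum_image (fun _ _ _ _ h => hinj h), LamT_apply]
  · refine Finset.sum_congr rfl fun z hz => ?_
    rw [Finset.mem_product] at hz
    rw [hφ, Fin.prod_univ_three]
    simp only [Matrix.cons_val]
    have e0 : z.1 + c * (z.1 - z.2) - (1 + c) * (z.1 - z.2) = z.2 := by ring
    have e1 : z.1 + c * (z.1 - z.2) - (α + c) * (z.1 - z.2) = z.1 - α * (z.1 - z.2) := by ring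
    have e2 : z.1 + c * (z.1 - z.2) - c * (z.1 - z.2) = z.1 := by ring
    rw [e0, e1, e2, if_pos hz.1, if_pos hz.2]
    ring
  · intro z hz
    rw [Fin.prod_univ_three]
    simp only [Matrix.cons_val]
    by_cases h1 : z.1 - (1 + c) * z.2 ∈ W
    · by_cases h2 : z.1 - c * z.2 ∈ W
      · exfalso
        apply hz
        rw [Finset.mem_image]
        refine ⟨(z.1 - c * z.2, z.1 - (1 + c) * z.2), Finset.mem_product.2 ⟨h2, h1⟩, ?_⟩
        rw [hφ]
        ext <;> simp <;> ring
      · rw [if_neg h2]; ring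
    · rw [if_neg h1]; ring

lemma LamT_Tz (α : ℤ) (K : ℤ → ℂ) (W : Finset ℤ) (a b : ℤ → ℂ) (n : ℤ) (hn : n ∈ W) :
    Tz (LamT α K W) a b n = ∑ x ∈ W, K (n - x) * (a x * b (n - α * (n - x))) := by
  classical
  rw [Tz, LamT_apply, Finset.sum_product, Finset.sum_eq_single n]
  · simp
  · intro m _ hm
    simp [Pi.single_apply, hm]
  · intro h; exact absurd hn h

lemma exists_form (α : ℤ) (hα0 : α ≠ 0) (hα1 : α ≠ 1) :
    ∃ (C : (Fin 3 → ℝ) → Fin 3 → ℝ) (K : ℕ → ℤ → ℂ) (κ : ℤ → ℂ) (A : ℝ), 0 < A ∧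
      (∀ J W, Gd C (LamT α (K J) W)) ∧ (∀ t, Tendsto (fun J => K J t) atTop (nhds (κ t))) ∧
      ∀ t : ℤ, ‖-(2 * π * I) * κ t - (t:ℂ)⁻¹‖ ≤ A * ((1 + |(t:ℝ)|) ^ 2)⁻¹ := by
  classical
  obtain ⟨c, hc⟩ : ∃ c : ℤ, c = |α| + 1 := ⟨_, rfl⟩
  have hc1 : -α ≤ |α| := neg_le_abs α
  have hc2 : 0 ≤ |α| := abs_nonneg α
  obtain ⟨β, hβ⟩ : ∃ β : Fin 3 → ℤ, β = ![1 + c, α + c, c] := ⟨_, rfl⟩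
  have hd : ∀ i, dd β i ≠ 0 := by
    intro i
    rw [hβ]
    fin_cases i <;> simp [dd] <;> omega
  have hβ0 : ∀ i, β i ≠ 0 := by
    intro i
    rw [hβ]
    fin_cases i <;> simp <;> omega
  have hB : 0 < 24 * Bb β := by
    unfold Bb
    have : 0 < |(β 2 : ℝ)| := abs_pos.2 (by exact_mod_cast hβ0 2)
    positivity
  obtain ⟨ψ, hψ, hψ2⟩ := exists_psi
  obtain ⟨γ, u, hγ, hu, hu0, hrel⟩ := exists_kernel (24 * Bb β) hB
  obtain ⟨κ, A, hA, hlim, hk⟩ := kernel_lim _ γ u hu hu0 hrel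
  have ex : ∀ (θ : Fin 3 → ℝ) (e : Fin 3), ∃ C : ℝ, (∀ i, 0 < θ i ∧ θ i < 1) → θ 0 + θ 1 + θ 2 = 1 → 
    ∀ (J : ℕ) (f : Fin 3 → ℤ → ℂ) (S : Fin 3 → Finset ℤ) (Ω : Finset ℤ), (∀ i, (S i).Nonempty) →
    (∀ i, i ≠ e → ∀ (J : ℕ) (M : ℤ), 20 * (S i).card * 2 ^ J < (S e).card * ((S i).filter (fun x => x / 2 ^ J = M)).card →
      ∀ x : ℤ, |x / 2 ^ J - M| ≤ 2 → x ∈ Ω) →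
    (∀ i x, ‖f i x‖ ≤ if x ∈ S i then 1 else 0) → (∀ x ∈ Ω, f e x = 0) →
    ‖Lf β (fun t => ∑ j ∈ Finset.Ico 2 J, Kj γ j t) f‖ ≤
      C * ∏ i, ((S i).card : ℝ) ^ ((1 + θ i) / 2 - if i = e then 1 else 0) := by
    intro θ e
    by_cases h : (∀ i, 0 < θ i ∧ θ i < 1) ∧ θ 0 + θ 1 + θ 2 = 1
    · obtain ⟨C, -, hC⟩ := core_form0 β hd hβ0 ψ γ hψ hψ2 hγ θ h.1 h.2 e
      exact ⟨C, fun _ _ => hC⟩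
    · exact ⟨0, fun h1 h2 => absurd ⟨h1, h2⟩ h⟩
  choose C hC using ex
  refine ⟨C, fun J t => ∑ j ∈ Finset.Ico 2 J, Kj γ j t, κ, A, hA, ?_, hlim, hk⟩
  intro J W S hS e
  obtain ⟨Ω, hΩ, hΩ2⟩ := exc S e
  refine ⟨S e \ Ω, Finset.sdiff_subset, ?_, fun θ hθ hs f hf hfe => ?_⟩
  · have := Finset.le_card_sdiff Ω (S e)
    omega
  rw [LamT_Lf α c, ← hβ]
  have hle : ∀ i x, ‖(![fun x => if x ∈ W then f 0 x else 0, f 1, fun x => if x ∈ W then f 2 x else 0] : Fin 3 → ℤ → ℂ) i x‖ ≤ ‖f i x‖ := by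
    intro i x
    fin_cases i
    · simp only [Fin.zero_eta, Matrix.cons_val]; split_ifs <;> simp
    · exact le_rfl
    · simp only [Fin.reduceFinMk, Matrix.cons_val]; split_ifs <;> simp
  refine hC θ e hθ hs J _ S Ω hS hΩ2 (fun i x => (hle i x).trans (hf i x)) (fun x hx => ?_)
  rw [← norm_le_zero_iff]
  refine (hle e x).trans ?_
  rw [hfe x (by simp [hx]), norm_zero]
end BHT

namespace BHT

lemma shift_sum (g : ℤ → ℝ) (V W : Finset ℤ) (hg : ∀ x, 0 ≤ g x) (hV : ∀ x, x ∉ V → g x = 0) (s : ℤ) :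
    ∑ n ∈ W, g (n - s) ≤ ∑ x ∈ V, g x := by
  classical
  calc ∑ n ∈ W, g (n - s) = ∑ x ∈ W.image (fun n => n - s), g x := by
        rw [Finset.sum_image]
        intro x _ y _ h
        simpa using h
    _ ≤ ∑ x ∈ W.image (fun n => n - s) ∪ V, g x := Finset.sum_le_sum_of_subset_of_nonneg Finset.subset_union_left fun x _ _ => hg x
    _ = ∑ x ∈ V, g x := by
        symm
        exact Finset.sum_subset Finset.subset_union_right fun x _ hx => hV x hx

lemma rho_sum (q : ℝ) (hq : 1 / 2 < q) : ∃ C : ℝ, 0 < C ∧ ∀ T : Finset ℤ, ∑ t ∈ T, (((1 + |(t:ℝ)|) ^ 2)⁻¹) ^ q ≤ C := by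
  classical
  have hs := Real.summable_abs_int_rpow (b := 2 * q) (by linarith)
  have h0 : ∀ n : ℤ, 0 ≤ |(n:ℝ)| ^ (-(2 * q)) := fun n => by positivity
  refine ⟨(∑' n : ℤ, |(n:ℝ)| ^ (-(2 * q))) + 1, add_pos_of_nonneg_of_pos (tsum_nonneg h0) one_pos, fun T => ?_⟩
  calc _ ≤ ∑ t ∈ T, (|(t:ℝ)| ^ (-(2 * q)) + if t = 0 then 1 else 0) := by
        refine Finset.sum_le_sum fun t _ => ?_
        split_ifs with ht
        · have := h0 t
          have h1 : (((1 + |(t:ℝ)|) ^ 2)⁻¹) ^ q = 1 := by rw [ht]; simp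
          linarith
        · rw [add_zero, Real.rpow_neg (abs_nonneg _), Real.rpow_mul (abs_nonneg _), ← Real.inv_rpow (by positivity)]
          have h1 : 0 < |(t:ℝ)| := abs_pos.2 (by exact_mod_cast ht)
          apply Real.rpow_le_rpow (by positivity) _ (by linarith)
          rw [Real.rpow_two]
          gcongr
          linarith
    _ = ∑ t ∈ T, |(t:ℝ)| ^ (-(2 * q)) + ∑ t ∈ T, (if t = 0 then (1:ℝ) else 0) := Finset.sum_add_distrib
    _ ≤ _ := by
        apply add_le_add (hs.sum_le_tsum T fun n _ => h0 n)
        rw [Finset.sum_ite_eq']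
        split_ifs <;> norm_num

lemma conv_bound (q : ℝ) (hq : 2 / 3 < q) : ∃ C : ℝ, 0 < C ∧ ∀ (W T : Finset ℤ) (h : ℤ → ℤ → ℝ), (∀ n t, 0 ≤ h n t) →
    (∀ t, ∑ n ∈ W, h n t ^ q ≤ 1) → ∑ n ∈ W, (∑ t ∈ T, ((1 + |(t:ℝ)|) ^ 2)⁻¹ * h n t) ^ q ≤ C := by
  classical
  have hq0 : 0 < q := by linarith
  have hr0 : ∀ t : ℤ, 0 ≤ ((1 + |(t:ℝ)|) ^ 2)⁻¹ := fun t => by positivity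
  by_cases h1 : q ≤ 1
  · obtain ⟨C, hC, hb⟩ := rho_sum q (by linarith)
    refine ⟨C, hC, fun W T h h0 hs => ?_⟩
    calc _ ≤ ∑ n ∈ W, ∑ t ∈ T, (((1 + |(t:ℝ)|) ^ 2)⁻¹) ^ q * h n t ^ q := by
          refine Finset.sum_le_sum fun n _ => ?_
          have := norm_sum_rpow_le T (fun t => (((((1 + |(t:ℝ)|) ^ 2)⁻¹ * h n t : ℝ)) : ℂ)) hq0 h1
          rw [← Complex.ofReal_sum, Complex.norm_real, Real.norm_of_nonneg (Finset.sum_nonneg fun t _ => mul_nonneg (hr0 t) (h0 n t))] at this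
          refine this.trans (le_of_eq (Finset.sum_congr rfl fun t _ => ?_))
          rw [Complex.norm_real, Real.norm_of_nonneg (mul_nonneg (hr0 t) (h0 n t)), Real.mul_rpow (hr0 t) (h0 n t)]
      _ = ∑ t ∈ T, (((1 + |(t:ℝ)|) ^ 2)⁻¹) ^ q * ∑ n ∈ W, h n t ^ q := by
          rw [Finset.sum_comm]
          exact Finset.sum_congr rfl fun t _ => by rw [Finset.mul_sum]
      _ ≤ ∑ t ∈ T, (((1 + |(t:ℝ)|) ^ 2)⁻¹) ^ q * 1 :=
          Finset.sum_le_sum fun t _ => mul_le_mul_of_nonneg_left (hs t) (Real.rpow_nonneg (hr0 t) _)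
      _ ≤ C := by simpa using hb T
  · push Not at h1
    obtain ⟨C, hC, hb⟩ := rho_sum 1 (by norm_num)
    simp only [Real.rpow_one] at hb
    refine ⟨C ^ (q - 1) * C, by positivity, fun W T h h0 hs => ?_⟩
    have hS : 0 ≤ ∑ t ∈ T, ((1 + |(t:ℝ)|) ^ 2)⁻¹ := Finset.sum_nonneg fun t _ => hr0 t
    calc _ ≤ ∑ n ∈ W, C ^ (q - 1) * ∑ t ∈ T, ((1 + |(t:ℝ)|) ^ 2)⁻¹ * h n t ^ q := by
          refine Finset.sum_le_sum fun n _ => ?_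
          have hS2 : 0 ≤ ∑ t ∈ T, ((1 + |(t:ℝ)|) ^ 2)⁻¹ * h n t ^ q :=
            Finset.sum_nonneg fun t _ => mul_nonneg (hr0 t) (Real.rpow_nonneg (h0 n t) _)
          have := Real.inner_le_weight_mul_Lp_of_nonneg T h1.le (fun t : ℤ => ((1 + |(t:ℝ)|) ^ 2)⁻¹) (h n) hr0 (h0 n)
          refine (Real.rpow_le_rpow (Finset.sum_nonneg fun t _ => mul_nonneg (hr0 t) (h0 n t)) this hq0.le).trans ?_
          rw [Real.mul_rpow (Real.rpow_nonneg hS _) (Real.rpow_nonneg hS2 _), ← Real.rpow_mul hS, ← Real.rpow_mul hS2, inv_mul_cancel₀ hq0.ne',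
            Real.rpow_one, sub_mul, inv_mul_cancel₀ hq0.ne', one_mul]
          exact mul_le_mul_of_nonneg_right (Real.rpow_le_rpow hS (hb T) (by linarith)) hS2
      _ = C ^ (q - 1) * ∑ t ∈ T, ((1 + |(t:ℝ)|) ^ 2)⁻¹ * ∑ n ∈ W, h n t ^ q := by
          rw [← Finset.mul_sum, Finset.sum_comm]
          congr 1
          exact Finset.sum_congr rfl fun t _ => by rw [Finset.mul_sum]
      _ ≤ C ^ (q - 1) * ∑ t ∈ T, ((1 + |(t:ℝ)|) ^ 2)⁻¹ * 1 := by
          apply mul_le_mul_of_nonneg_left _ (by positivity)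
          exact Finset.sum_le_sum fun t _ => mul_le_mul_of_nonneg_left (hs t) (hr0 t)
      _ ≤ _ := by
          apply mul_le_mul_of_nonneg_left _ (by positivity)
          simpa using hb T

lemma holder_shift (p₁ p₂ p₃ : ℝ≥0∞) (h₁ : 1 < p₁) (h₂ : 1 < p₂) (h₃ : 2/3 < p₃) (h₃' : p₃ < ∞)
    (hsum : 1/p₁ + 1/p₂ = 1/p₃) (V W : Finset ℤ) (a b : ℤ → ℂ) (ha : ∀ x, x ∉ V → a x = 0) (hb : ∀ x, x ∉ V → b x = 0)
    (ha1 : Uc p₁ V a) (hb1 : Uc p₂ V b) (s t : ℤ) : ∑ n ∈ W, (‖a (n - s)‖ * ‖b (n - t)‖) ^ p₃.toReal ≤ 1 := by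
  have h30 : p₃ ≠ 0 := (lt_of_le_of_lt (zero_le) h₃).ne'
  have hq0 : 0 < p₃.toReal := ENNReal.toReal_pos h30 h₃'.ne
  have sh : ∀ (p : ℝ≥0∞) (c : ℤ → ℂ) (r : ℤ), 1 < p → p ≠ ∞ → (∀ x, x ∉ V → c x = 0) → Uc p V c → ∑ n ∈ W, ‖c (n - r)‖ ^ p.toReal ≤ 1 := by
    intro p c r hp hpt hc hU
    have hp0 : 0 < p.toReal := ENNReal.toReal_pos (lt_trans zero_lt_one hp).ne' hpt
    refine (shift_sum (fun x => ‖c x‖ ^ p.toReal) V W (fun x => by positivity) (fun x hx => ?_) r).trans (hU.2 hpt)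
    rw [hc x hx, norm_zero, Real.zero_rpow hp0.ne']
  by_cases t1 : p₁ = ∞
  · have e : p₂ = p₃ := by
      rw [t1] at hsum; simpa using hsum
    have t2 : p₂ ≠ ∞ := by rw [e]; exact h₃'.ne
    refine (Finset.sum_le_sum fun n _ => ?_).trans (sh p₂ b t h₂ t2 hb hb1)
    rw [e]
    exact Real.rpow_le_rpow (by positivity) (mul_le_of_le_one_left (norm_nonneg _) (ha1.1 t1 _)) hq0.le
  by_cases t2 : p₂ = ∞
  · have e : p₁ = p₃ := by
      rw [t2] at hsum; simpa using hsum
    refine (Finset.sum_le_sum fun n _ => ?_).trans (sh p₁ a s h₁ t1 ha ha1)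
    rw [e]
    exact Real.rpow_le_rpow (by positivity) (mul_le_of_le_one_right (norm_nonneg _) (hb1.1 t2 _)) hq0.le
  have g1 : 0 < p₁.toReal := ENNReal.toReal_pos (lt_trans zero_lt_one h₁).ne' t1
  have g2 : 0 < p₂.toReal := ENNReal.toReal_pos (lt_trans zero_lt_one h₂).ne' t2
  have hst : 1 / p₁.toReal + 1 / p₂.toReal = 1 / p₃.toReal := by
    have := congrArg ENNReal.toReal hsum
    rw [ENNReal.toReal_add (by simp; intro h; simp [h] at h₁) (by simp; intro h; simp [h] at h₂)] at this
    simp only [one_div, ENNReal.toReal_inv] at this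
    simpa using this
  have hw : p₃.toReal / p₁.toReal + p₃.toReal / p₂.toReal = 1 := by
    have : p₃.toReal * (1 / p₁.toReal + 1 / p₂.toReal) = 1 := by rw [hst]; field_simp
    rw [← this]; ring
  have w1 : 0 < p₃.toReal / p₁.toReal := by positivity
  have w2 : 0 < p₃.toReal / p₂.toReal := by positivity
  calc _ ≤ ∑ n ∈ W, (p₃.toReal / p₁.toReal * ‖a (n - s)‖ ^ p₁.toReal + p₃.toReal / p₂.toReal * ‖b (n - t)‖ ^ p₂.toReal) := by
        refine Finset.sum_le_sum fun n _ => ?_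
        have := Real.geom_mean_le_arith_mean2_weighted w1.le w2.le (p₁ := ‖a (n - s)‖ ^ p₁.toReal) (p₂ := ‖b (n - t)‖ ^ p₂.toReal)
          (by positivity) (by positivity) hw
        refine le_trans (le_of_eq ?_) this
        rw [Real.mul_rpow (norm_nonneg _) (norm_nonneg _), ← Real.rpow_mul (norm_nonneg _), ← Real.rpow_mul (norm_nonneg _),
          mul_div_cancel₀ _ g1.ne', mul_div_cancel₀ _ g2.ne']
    _ = p₃.toReal / p₁.toReal * ∑ n ∈ W, ‖a (n - s)‖ ^ p₁.toReal + p₃.toReal / p₂.toReal * ∑ n ∈ W, ‖b (n - t)‖ ^ p₂.toReal := by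
        rw [Finset.sum_add_distrib, Finset.mul_sum, Finset.mul_sum]
    _ ≤ p₃.toReal / p₁.toReal * 1 + p₃.toReal / p₂.toReal * 1 :=
        add_le_add (mul_le_mul_of_nonneg_left (sh p₁ a s h₁ t1 ha ha1) w1.le) (mul_le_mul_of_nonneg_left (sh p₂ b t h₂ t2 hb hb1) w2.le)
    _ = 1 := by rw [mul_one, mul_one, hw]

lemma bhtZ_eq (α : ℤ) (V : Finset ℤ) (a b : ℤ → ℂ) (ha : ∀ x, x ∉ V → a x = 0) (n : ℤ) :
    bhtZ α a b n = (π:ℂ)⁻¹ * ∑ x ∈ V, ((n - x : ℤ) : ℂ)⁻¹ * (a x * b (n - α * (n - x))) := by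
  classical
  unfold bhtZ
  congr 1
  have e1 : (fun k : ℤ => ∑ᶠ (_ : k ≠ 0), a (n - k) * b (n - α * k) * (k:ℂ)⁻¹) = fun k : ℤ => a (n - k) * b (n - α * k) * (k:ℂ)⁻¹ := by
    ext k
    by_cases hk : k = 0
    · simp [hk]
    · simp [hk]
  rw [e1, finsum_eq_sum_of_support_subset (s := V.image fun x => n - x)]
  · rw [Finset.sum_image (by intro x _ y _ h; simpa using h)]
    refine Finset.sum_congr rfl fun x _ => ?_
    rw [sub_sub_cancel]; ring
  · intro k hk
    rw [Function.mem_support] at hk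
    rw [Finset.mem_coe, Finset.mem_image]
    refine ⟨n - k, ?_, by ring⟩
    by_contra h
    apply hk
    rw [ha _ h]; ring

lemma unit_bound (α : ℤ) (hα0 : α ≠ 0) (hα1 : α ≠ 1) (p₁ p₂ p₃ : ℝ≥0∞) (h₁ : 1 < p₁) (h₂ : 1 < p₂) (h₃ : 2/3 < p₃) (h₃' : p₃ < ∞)
    (hsum : 1/p₁ + 1/p₂ = 1/p₃) :
    ∃ D : ℝ, 0 < D ∧ ∀ (V : Finset ℤ) (a b : ℤ → ℂ),
      (∀ x, x ∉ V → a x = 0) → (∀ x, x ∉ V → b x = 0) → Uc p₁ V a → Uc p₂ V b →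
      ∑ z ∈ V, ‖bhtZ α a b z‖ ^ p₃.toReal ≤ D := by
  classical
  have h30 : p₃ ≠ 0 := (lt_of_le_of_lt (zero_le) h₃).ne'
  have hq0 : 0 < p₃.toReal := ENNReal.toReal_pos h30 h₃'.ne
  have hq23 : 2 / 3 < p₃.toReal := by
    have := (ENNReal.toReal_lt_toReal (by finiteness) h₃'.ne).2 h₃
    simpa using this
  obtain ⟨C, K, κ, A, hA, hGd, hlim, hκ⟩ := exists_form α hα0 hα1
  obtain ⟨D, hD, H⟩ := strong C p₁ p₂ p₃ h₁ h₂ h₃ h₃' hsum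
  obtain ⟨B, hB, hconv⟩ := conv_bound p₃.toReal hq23
  obtain ⟨q, hq⟩ : ∃ q, q = p₃.toReal := ⟨_, rfl⟩
  rw [← hq] at hq0
  refine ⟨2 ^ q * (2 ^ q * D + A ^ q * B), by positivity, fun V a b ha hb ha1 hb1 => ?_⟩
  -- the limiting form
  have m1 : ∑ n ∈ V, ‖∑ x ∈ V, κ (n - x) * (a x * b (n - α * (n - x)))‖ ^ q ≤ D := by
    have hJ : ∀ J, ∑ n ∈ V, ‖∑ x ∈ V, K J (n - x) * (a x * b (n - α * (n - x)))‖ ^ q ≤ D := by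
      intro J
      have := H _ (hGd J V) V a b ha hb ha1 hb1
      rw [hq]
      refine le_trans (le_of_eq (Finset.sum_congr rfl fun n hn => ?_)) this
      rw [LamT_Tz α (K J) V a b n hn]
    refine le_of_tendsto (x := atTop) ?_ (Filter.Eventually.of_forall hJ)
    refine tendsto_finsetSum _ fun n _ => ?_
    refine Tendsto.rpow_const (Tendsto.norm (tendsto_finsetSum _ fun x _ => (hlim _).mul_const _)) (Or.inr hq0.le)
  -- the error
  obtain ⟨Er, hEr⟩ : ∃ Er : ℤ → ℂ, Er = fun n => ∑ x ∈ V, (-(2 * π * I) * κ (n - x) - ((n - x : ℤ):ℂ)⁻¹) * (a x * b (n - α * (n - x))) := ⟨_, rfl⟩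
  have m2 : ∑ n ∈ V, ‖Er n‖ ^ q ≤ A ^ q * B := by
    obtain ⟨T, hT⟩ : ∃ T : Finset ℤ, T = (V ×ˢ V).image (fun z => z.1 - z.2) := ⟨_, rfl⟩
    have c1 := hconv V T (fun n t => ‖a (n - t)‖ * ‖b (n - α * t)‖) (fun n t => by positivity)
      (fun t => holder_shift p₁ p₂ p₃ h₁ h₂ h₃ h₃' hsum V V a b ha hb ha1 hb1 t (α * t))
    rw [← hq] at c1
    calc _ ≤ ∑ n ∈ V, A ^ q * (∑ t ∈ T, ((1 + |(t:ℝ)|) ^ 2)⁻¹ * (‖a (n - t)‖ * ‖b (n - α * t)‖)) ^ q := by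
          refine Finset.sum_le_sum fun n hn => ?_
          rw [← Real.mul_rpow hA.le (Finset.sum_nonneg fun t _ => by positivity)]
          apply Real.rpow_le_rpow (norm_nonneg _) _ hq0.le
          rw [hEr]
          calc _ ≤ ∑ x ∈ V, A * (((1 + |((n - x : ℤ):ℝ)|) ^ 2)⁻¹ * (‖a (n - (n - x))‖ * ‖b (n - α * (n - x))‖)) := by
                refine (norm_sum_le _ _).trans (Finset.sum_le_sum fun x _ => ?_)
                rw [norm_mul, norm_mul (a x), sub_sub_cancel, ← mul_assoc A]
                exact mul_le_mul_of_nonneg_right (hκ (n - x)) (mul_nonneg (norm_nonneg _) (norm_nonneg _))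
            _ = A * ∑ t ∈ V.image (fun x => n - x), ((1 + |(t:ℝ)|) ^ 2)⁻¹ * (‖a (n - t)‖ * ‖b (n - α * t)‖) := by
                rw [Finset.sum_image (by intro x _ y _ h; simpa using h), Finset.mul_sum]
            _ ≤ _ := by
                apply mul_le_mul_of_nonneg_left _ hA.le
                apply Finset.sum_le_sum_of_subset_of_nonneg
                · intro t ht
                  rw [Finset.mem_image] at ht
                  obtain ⟨x, hx, rfl⟩ := ht
                  rw [hT, Finset.mem_image]
                  exact ⟨(n, x), Finset.mem_product.2 ⟨hn, hx⟩, rfl⟩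
                · intro t _ _; positivity
      _ = A ^ q * ∑ n ∈ V, (∑ t ∈ T, ((1 + |(t:ℝ)|) ^ 2)⁻¹ * (‖a (n - t)‖ * ‖b (n - α * t)‖)) ^ q := by rw [Finset.mul_sum]
      _ ≤ _ := by gcongr
  have pt : ∀ n, ‖bhtZ α a b n‖ ^ q ≤ 2 ^ q * (2 ^ q * ‖∑ x ∈ V, κ (n - x) * (a x * b (n - α * (n - x)))‖ ^ q + ‖Er n‖ ^ q) := by
    intro n
    have e1 : bhtZ α a b n = -(2 * I) * ∑ x ∈ V, κ (n - x) * (a x * b (n - α * (n - x))) - (π:ℂ)⁻¹ * Er n := by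
      rw [bhtZ_eq α V a b ha n, hEr]
      beta_reduce
      have : (π:ℂ) ≠ 0 := by exact_mod_cast Real.pi_ne_zero
      simp only [sub_mul, Finset.sum_sub_distrib, mul_assoc, ← Finset.mul_sum, neg_mul, Finset.sum_neg_distrib]
      field_simp
      ring
    have e2 : ‖bhtZ α a b n‖ ≤ 2 * ‖∑ x ∈ V, κ (n - x) * (a x * b (n - α * (n - x)))‖ + ‖Er n‖ := by
      rw [e1]
      refine (norm_sub_le _ _).trans (add_le_add (le_of_eq ?_) ?_)
      · simp
      · rw [norm_mul, norm_inv, Complex.norm_real, Real.norm_of_nonneg Real.pi_pos.le]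
        exact mul_le_of_le_one_left (norm_nonneg _) (inv_le_one_of_one_le₀ (by linarith [Real.pi_gt_three]))
    obtain ⟨X, hX⟩ : ∃ X, X = 2 * ‖∑ x ∈ V, κ (n - x) * (a x * b (n - α * (n - x)))‖ := ⟨_, rfl⟩
    have hX0 : 0 ≤ X := by rw [hX]; positivity
    rw [← Real.mul_rpow (by norm_num) (norm_nonneg (∑ x ∈ V, κ (n - x) * (a x * b (n - α * (n - x))))), ← hX]
    rw [← hX] at e2
    calc ‖bhtZ α a b n‖ ^ q ≤ (2 * max X ‖Er n‖) ^ q := by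
          apply Real.rpow_le_rpow (norm_nonneg _) _ hq0.le
          linarith [le_max_left X ‖Er n‖, le_max_right X ‖Er n‖]
      _ = 2 ^ q * (max X ‖Er n‖) ^ q := Real.mul_rpow (by norm_num) (le_max_of_le_left hX0)
      _ ≤ _ := by
          apply mul_le_mul_of_nonneg_left _ (by positivity)
          have y1 : 0 ≤ X ^ q := Real.rpow_nonneg hX0 _
          have y2 : 0 ≤ ‖Er n‖ ^ q := Real.rpow_nonneg (norm_nonneg _) _
          rcases max_choice X ‖Er n‖ with h | h <;> rw [h] <;> linarith
  rw [← hq]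
  refine (Finset.sum_le_sum fun n _ => pt n).trans ?_
  rw [← Finset.mul_sum, Finset.sum_add_distrib, ← Finset.mul_sum]
  gcongr

lemma Uc_of_norm (p : ℝ≥0∞) (hp : 1 < p) (a : ℤ → ℂ) (h : eLpNorm a p Measure.count ≤ 1) (V : Finset ℤ) : Uc p V a := by
  constructor
  · intro ht x
    rw [ht, eLpNorm_exponent_top] at h
    have := (Measure.ae_count_iff.1 (ae_le_eLpNormEssSup (f := a) (μ := Measure.count)) x).trans h
    rw [← ofReal_norm, ENNReal.ofReal_le_one] at this
    exact this
  · intro ht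
    have hp0 : p ≠ 0 := (lt_trans zero_lt_one hp).ne'
    have hr : 0 < p.toReal := ENNReal.toReal_pos hp0 ht
    rw [eLpNorm_eq_lintegral_rpow_enorm_toReal hp0 ht, lintegral_count] at h
    have h2 : ∑' x, ‖a x‖ₑ ^ p.toReal ≤ 1 := by
      have := ENNReal.rpow_le_rpow h hr.le
      rwa [← ENNReal.rpow_mul, one_div, inv_mul_cancel₀ hr.ne', ENNReal.rpow_one, ENNReal.one_rpow] at this
    have h3 := (ENNReal.sum_le_tsum V).trans h2
    rw [← ENNReal.ofReal_le_one, ENNReal.ofReal_sum_of_nonneg (fun x _ => by positivity)]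
    refine le_trans (le_of_eq (Finset.sum_congr rfl fun x _ => ?_)) h3
    rw [← ofReal_norm, ENNReal.ofReal_rpow_of_nonneg (norm_nonneg _) hr.le]

lemma finite_norm (p : ℝ≥0∞) (hp : 1 < p) (a : ℤ → ℂ) (ha : (Function.support a).Finite) : eLpNorm a p Measure.count ≠ ∞ := by
  by_cases ht : p = ∞
  · rw [ht, eLpNorm_exponent_top]
    obtain ⟨V, hV⟩ : ∃ V : Finset ℤ, V = ha.toFinset := ⟨_, rfl⟩
    have : eLpNormEssSup a Measure.count ≤ ENNReal.ofReal (∑ x ∈ V, ‖a x‖) := by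
      refine essSup_le_of_ae_le _ ?_
      refine Filter.Eventually.of_forall fun x => ?_
      beta_reduce
      rw [← ofReal_norm]
      apply ENNReal.ofReal_le_ofReal
      by_cases hx : x ∈ V
      · exact Finset.single_le_sum (f := fun x => ‖a x‖) (fun x _ => norm_nonneg _) hx
      · have : a x = 0 := by by_contra h; exact hx (by rw [hV]; simpa using h)
        rw [this, norm_zero]; exact Finset.sum_nonneg fun x _ => norm_nonneg _
    exact (this.trans_lt ENNReal.ofReal_lt_top).ne
  · have hp0 : p ≠ 0 := (lt_trans zero_lt_one hp).ne'
    have hr : 0 < p.toReal := ENNReal.toReal_pos hp0 ht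
    rw [eLpNorm_eq_lintegral_rpow_enorm_toReal hp0 ht, lintegral_count, tsum_eq_sum (s := ha.toFinset)]
    · apply ENNReal.rpow_ne_top_of_nonneg (by positivity)
      rw [ENNReal.sum_ne_top]
      intro x _
      exact ENNReal.rpow_ne_top_of_nonneg hr.le enorm_ne_top
    · intro x hx
      have : a x = 0 := by by_contra h; exact hx (by simpa using h)
      simp [this, hr]

lemma final (α : ℤ) (hα0 : α ≠ 0) (hα1 : α ≠ 1) (p₁ p₂ p₃ : ℝ≥0∞) (h₁ : 1 < p₁) (h₂ : 1 < p₂) (h₃ : 2/3 < p₃) (h₃' : p₃ < ∞)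
    (hsum : 1/p₁ + 1/p₂ = 1/p₃) :
    ∃ C : ℝ, 0 < C ∧ ∀ a b : ℤ → ℂ, (Function.support a).Finite → (Function.support b).Finite →
      eLpNorm (bhtZ α a b) p₃ Measure.count ≤ ENNReal.ofReal C * (eLpNorm a p₁ Measure.count * eLpNorm b p₂ Measure.count) := by
  classical
  have h30 : p₃ ≠ 0 := (lt_of_le_of_lt (zero_le) h₃).ne'
  have hq0 : 0 < p₃.toReal := ENNReal.toReal_pos h30 h₃'.ne
  obtain ⟨D, hD, H⟩ := unit_bound α hα0 hα1 p₁ p₂ p₃ h₁ h₂ h₃ h₃' hsum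
  refine ⟨D ^ (1 / p₃.toReal), by positivity, fun a b ha hb => ?_⟩
  obtain ⟨V0, hV0⟩ : ∃ V0 : Finset ℤ, V0 = ha.toFinset ∪ hb.toFinset := ⟨_, rfl⟩
  have hsa : ∀ x, x ∉ V0 → a x = 0 := fun x hx => by
    by_contra h; exact hx (by rw [hV0]; simp [h])
  have hsb : ∀ x, x ∉ V0 → b x = 0 := fun x hx => by
    by_contra h; exact hx (by rw [hV0]; simp [h])
  by_cases hz : a = 0 ∨ b = 0
  · have : bhtZ α a b = 0 := by
      ext n
      rw [bhtZ_eq α V0 a b hsa n]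
      rcases hz with h | h <;> simp [h]
    rw [this, eLpNorm_zero]
    exact zero_le
  push Not at hz
  have fa := finite_norm p₁ h₁ a ha
  have fb := finite_norm p₂ h₂ b hb
  have pos : ∀ (p : ℝ≥0∞) (c : ℤ → ℂ), 1 < p → c ≠ 0 → eLpNorm c p Measure.count ≠ 0 := by
    intro p c hp hc h
    rw [eLpNorm_eq_zero_iff (by fun_prop) (lt_trans zero_lt_one hp).ne'] at h
    apply hc
    ext x
    exact Measure.ae_count_iff.1 h x
  have za := pos p₁ a h₁ hz.1
  have zb := pos p₂ b h₂ hz.2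
  obtain ⟨Na, hNa⟩ : ∃ N, N = (eLpNorm a p₁ Measure.count).toReal := ⟨_, rfl⟩
  obtain ⟨Nb, hNb⟩ : ∃ N, N = (eLpNorm b p₂ Measure.count).toReal := ⟨_, rfl⟩
  have na : 0 < Na := by rw [hNa]; exact ENNReal.toReal_pos za fa
  have nb : 0 < Nb := by rw [hNb]; exact ENNReal.toReal_pos zb fb
  have ea : eLpNorm a p₁ Measure.count = ENNReal.ofReal Na := by rw [hNa, ENNReal.ofReal_toReal fa]
  have eb : eLpNorm b p₂ Measure.count = ENNReal.ofReal Nb := by rw [hNb, ENNReal.ofReal_toReal fb]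
  have nrm : ∀ (p : ℝ≥0∞) (c : ℤ → ℂ) (N : ℝ), 0 < N → eLpNorm c p Measure.count = ENNReal.ofReal N →
      eLpNorm (((N⁻¹ : ℝ) : ℂ) • c) p Measure.count ≤ 1 := by
    intro p c N hN h
    rw [eLpNorm_const_smul, h, ← ofReal_norm, Complex.norm_real, Real.norm_of_nonneg (by positivity), ← ENNReal.ofReal_mul (by positivity),
      inv_mul_cancel₀ hN.ne', ENNReal.ofReal_one]
  obtain ⟨a', ha'⟩ : ∃ a' : ℤ → ℂ, a' = ((Na⁻¹ : ℝ) : ℂ) • a := ⟨_, rfl⟩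
  obtain ⟨b', hb'⟩ : ∃ b' : ℤ → ℂ, b' = ((Nb⁻¹ : ℝ) : ℂ) • b := ⟨_, rfl⟩
  have ua : ∀ V, Uc p₁ V a' := by rw [ha']; exact Uc_of_norm p₁ h₁ _ (nrm p₁ a Na na ea)
  have ub : ∀ V, Uc p₂ V b' := by rw [hb']; exact Uc_of_norm p₂ h₂ _ (nrm p₂ b Nb nb eb)
  have sa : ∀ x, x ∉ V0 → a' x = 0 := fun x hx => by rw [ha']; simp [hsa x hx]
  have sb : ∀ x, x ∉ V0 → b' x = 0 := fun x hx => by rw [hb']; simp [hsb x hx]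
  have e1 : bhtZ α a b = ((Na * Nb : ℝ) : ℂ) • bhtZ α a' b' := by
    ext n
    rw [Pi.smul_apply, smul_eq_mul, bhtZ_eq α V0 a b hsa n, bhtZ_eq α V0 a' b' sa n, mul_left_comm, Finset.mul_sum _ _ ((Na * Nb : ℝ) : ℂ)]
    congr 1
    refine Finset.sum_congr rfl fun x _ => ?_
    rw [ha', hb']
    have : (Na:ℂ) ≠ 0 := by exact_mod_cast na.ne'
    have : (Nb:ℂ) ≠ 0 := by exact_mod_cast nb.ne'
    simp only [Pi.smul_apply, smul_eq_mul]
    push_cast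
    field_simp
  have e2 : eLpNorm (bhtZ α a' b') p₃ Measure.count ≤ ENNReal.ofReal (D ^ (1 / p₃.toReal)) := by
    rw [eLpNorm_eq_lintegral_rpow_enorm_toReal h30 h₃'.ne, lintegral_count, ← ENNReal.ofReal_rpow_of_pos hD]
    apply ENNReal.rpow_le_rpow _ (by positivity)
    rw [ENNReal.tsum_eq_iSup_sum]
    refine iSup_le fun V => ?_
    have h5 := H (V ∪ V0) a' b' (fun x hx => sa x (by simp at hx; tauto)) (fun x hx => sb x (by simp at hx; tauto)) (ua _) (ub _)
    calc ∑ n ∈ V, ‖bhtZ α a' b' n‖ₑ ^ p₃.toReal = ENNReal.ofReal (∑ n ∈ V, ‖bhtZ α a' b' n‖ ^ p₃.toReal) := by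
          rw [ENNReal.ofReal_sum_of_nonneg (fun x _ => by positivity)]
          refine Finset.sum_congr rfl fun x _ => ?_
          rw [← ofReal_norm, ENNReal.ofReal_rpow_of_nonneg (norm_nonneg _) hq0.le]
      _ ≤ _ := by
          apply ENNReal.ofReal_le_ofReal
          exact (Finset.sum_le_sum_of_subset_of_nonneg Finset.subset_union_left fun x _ _ => by positivity).trans h5
  rw [e1, eLpNorm_const_smul, ea, eb, ← ENNReal.ofReal_mul na.le, mul_comm, ← ofReal_norm, Complex.norm_real,
    Real.norm_of_nonneg (by positivity)]
  gcongr
end BHT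

/-- Boundedness of the discrete bilinear Hilbert transforms:
`ℓ^{p₁} × ℓ^{p₂} → ℓ^{p₃}` for `1 < p₁,p₂ ≤ ∞`, `2/3 < p₃ < ∞`, `1/p₁ + 1/p₂ = 1/p₃`. -/
theorem stmt9 (α : ℤ) (hα0 : α ≠ 0) (hα1 : α ≠ 1) (p₁ p₂ p₃ : ℝ≥0∞)
    (h₁ : 1 < p₁) (h₂ : 1 < p₂) (h₃ : 2/3 < p₃) (h₃' : p₃ < ∞)
    (hsum : 1/p₁ + 1/p₂ = 1/p₃) :
    ∃ C : ℝ, 0 < C ∧ ∀ a b : ℤ → ℂ,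
      (Function.support a).Finite → (Function.support b).Finite →
      eLpNorm (bhtZ α a b) p₃ Measure.count ≤
        ENNReal.ofReal C * (eLpNorm a p₁ Measure.count * eLpNorm b p₂ Measure.count) := by
  exact BHT.final α hα0 hα1 p₁ p₂ p₃ h₁ h₂ h₃ h₃' hsum
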